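/- Theorem 0.4 (multi-parameter case, square function S̃): There exist constants 0 < c ≤ C < ∞ depending only on N₁,…,Nₙ such that for every f ∈ L¹(X): f belongs to H¹(X₁×…×Xₙ) if and only if ∫_X [E_ω(|S̃_{D(ω)} f(x)|²)]^{1/2} dx < ∞; moreover, for f ∈ H¹(X₁×…×Xₙ), c‖f‖_{H¹(X)} ≤ ∫_X [E_ω(|S̃_{D(ω)} f(x)|²)]^{1/2} dx ≤ C‖f‖_{H¹(X)}. -/

import Mathlib

open MeasureTheory Filter Topology
open scoped ENNReal

noncomputable section

namespace Treil

/-- The cube of sidelength `2^k` of the dyadic lattice `t + 𝒟₀` that contains `x`. -/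
def dcube {N : ℕ} (t : Fin N → ℝ) (k : ℤ) (x : Fin N → ℝ) : Set (Fin N → ℝ) :=
  {y | ∀ i, ⌊(y i - t i) / (2 : ℝ) ^ k⌋ = ⌊(x i - t i) / (2 : ℝ) ^ k⌋}

/-- The averaging operator `E_k` over the cubes of sidelength `2^k` of the (generalized)
dyadic lattice whose layer at scale `2^k` has offset `c k`. -/
def avg {N : ℕ} (c : ℤ → Fin N → ℝ) (k : ℤ) (f : (Fin N → ℝ) → ℝ) (x : Fin N → ℝ) : ℝ :=
  (∫ y in dcube (c k) k x, f y) / ((2 : ℝ) ^ k) ^ (N : ℕ)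

/-- The martingale difference `Δ_k = E_{k-1} - E_k`. -/
def mdiff {N : ℕ} (c : ℤ → Fin N → ℝ) (k : ℤ) (f : (Fin N → ℝ) → ℝ) (x : Fin N → ℝ) : ℝ :=
  avg c (k - 1) f x - avg c k f x

/-- The square of the dyadic square function, `|S_𝒟 f (x)|² = ∑_k |Δ_k f (x)|²`,
with values in `[0,∞]`. -/
def Ssq {N : ℕ} (c : ℤ → Fin N → ℝ) (f : (Fin N → ℝ) → ℝ) (x : Fin N → ℝ) : ℝ≥0∞ :=
  ∑' k : ℤ, ENNReal.ofReal ((mdiff c k f x) ^ 2)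

/-- The offset (at scale `2^k`) of the random dyadic lattice on `ℝ` built from the uniform
shift `u ∈ [0,1)` and the fair signs `ξ_j`, `j ≥ 1`, encoded as the binary digits of
`v ∈ [0,1)` (`ξ_j = -1` iff `⌊v 2^j⌋` is odd); the interval `I_0 = [u-1, u)` belongs to the
lattice, and `I_k` is obtained from `I_{k-1}` by adjoining the right neighbour if `ξ_k = +1`
and the left neighbour if `ξ_k = -1`. -/
def randOffset1 (u v : ℝ) (k : ℤ) : ℝ :=
  u - 1 - ∑ j ∈ Finset.range k.toNat, (if ⌊v * 2 ^ (j + 1)⌋ % 2 = 1 then (2 : ℝ) ^ j else 0)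

/-- The sample space for the random dyadic lattice in `ℝ^N`: each of the `N` independent
coordinate lattices is driven by a pair (uniform shift, digit-encoded fair signs). -/
abbrev RSpace (N : ℕ) := Fin N → ℝ × ℝ

/-- The probability measure of the random dyadic lattice in `ℝ^N`. -/
def randMeasure (N : ℕ) : Measure (RSpace N) :=
  Measure.pi fun _ =>
    (volume.restrict (Set.Ico (0 : ℝ) 1)).prod (volume.restrict (Set.Ico (0 : ℝ) 1))

/-- The per-scale offsets of the random dyadic lattice `𝒟(ω)` in `ℝ^N`. -/
def randOffset {N : ℕ} (ω : RSpace N) (k : ℤ) : Fin N → ℝ :=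
  fun i => randOffset1 (ω i).1 (ω i).2 k

/-- An (axis-parallel, half-open) cube in `ℝ^N`. -/
def IsPCube {N : ℕ} (Q : Set (Fin N → ℝ)) : Prop :=
  ∃ (a : Fin N → ℝ) (l : ℝ), 0 < l ∧ Q = Set.univ.pi fun i => Set.Ico (a i) (a i + l)

/-- An `H¹`-atom: supported in a cube `Q`, bounded by `|Q|⁻¹`, with zero mean. -/
def IsAtom {N : ℕ} (a : (Fin N → ℝ) → ℝ) : Prop :=
  ∃ Q : Set (Fin N → ℝ), IsPCube Q ∧ (∀ x, x ∉ Q → a x = 0) ∧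
    (∀ x, |a x| ≤ ((volume Q).toReal)⁻¹) ∧ (∫ x, a x) = 0

/-- The atomic `H¹(ℝ^N)` norm: the infimum of `∑ |λ_j|` over all decompositions
`f = ∑ λ_j a_j` converging in `L¹`, with atoms `a_j`. -/
def H1norm {N : ℕ} (f : (Fin N → ℝ) → ℝ) : ℝ≥0∞ :=
  ⨅ (lam : ℕ → ℝ) (a : ℕ → (Fin N → ℝ) → ℝ) (_ : ∀ j, IsAtom (a j))
    (_ : Tendsto (fun m => ∫ x, |f x - ∑ j ∈ Finset.range m, lam j * a j x|) atTop (𝓝 0)),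
    ∑' j, ENNReal.ofReal |lam j|
/-! ### Multi-parameter setting: `X = X₁ × ⋯ × Xₙ`, `X_j = ℝ^{N_j}` -/

variable (n : ℕ) (Nd : Fin n → ℕ)

/-- The product space `X = X₁ × X₂ × ⋯ × Xₙ`, `X_j = ℝ^{N_j}`. -/
abbrev X := Π j : Fin n, (Fin (Nd j) → ℝ)

/-- The averaging operator `E_𝐤 = E¹_{k₁} ⋯ Eⁿ_{kₙ}` over the "rectangles"
`R = Q₁ × ⋯ × Qₙ` of the product lattice with per-variable, per-scale offsets `c`. -/
def ravg (c : Π j : Fin n, ℤ → Fin (Nd j) → ℝ) (k : Fin n → ℤ) (f : X n Nd → ℝ)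
    (x : X n Nd) : ℝ :=
  (∫ y in Set.univ.pi fun j => dcube (c j (k j)) (k j) (x j), f y) /
    ∏ j, ((2 : ℝ) ^ (k j)) ^ (Nd j : ℕ)

/-- The multi-parameter martingale difference
`Δ_𝐤 = Δ¹_{k₁} ⋯ Δⁿ_{kₙ} = ∏_j (E^j_{k_j - 1} - E^j_{k_j})`, expanded by multilinearity. -/
def rmdiff (c : Π j : Fin n, ℤ → Fin (Nd j) → ℝ) (k : Fin n → ℤ) (f : X n Nd → ℝ)
    (x : X n Nd) : ℝ :=
  ∑ ε : Fin n → Bool,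
    (-1 : ℝ) ^ (Finset.univ.filter fun j => ε j = false).card *
      ravg n Nd c (fun j => k j - if ε j then 1 else 0) f x

/-- The square of the multi-parameter dyadic square function,
`|S_𝒟 f (x)|² = ∑_{R ∋ x} |Δ_R f (x)|² = ∑_{𝐤 ∈ ℤⁿ} |Δ_𝐤 f (x)|²`. -/
def rSsq (c : Π j : Fin n, ℤ → Fin (Nd j) → ℝ) (f : X n Nd → ℝ) (x : X n Nd) : ℝ≥0∞ :=
  ∑' k : Fin n → ℤ, ENNReal.ofReal ((rmdiff n Nd c k f x) ^ 2)

/-- The sample space of the random product dyadic lattice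
`𝒟(ω) = 𝒟₁(ω) × ⋯ × 𝒟ₙ(ω)`. -/
abbrev PSpace := Π j : Fin n, RSpace (Nd j)

instance randMeasure.instSigmaFinite (M : ℕ) : SigmaFinite (randMeasure M) := by
  unfold randMeasure; infer_instance

/-- The probability measure of the random product dyadic lattice (the `n` factors are
independent). -/
def prodRandMeasure : Measure (PSpace n Nd) := Measure.pi fun j => randMeasure (Nd j)

/-- The quantity `∫_X [𝔼_ω |S_{𝒟(ω)} f (x)|²]^{1/2} dx` for the multi-parameter random
dyadic square function. -/
def randProdSNorm (f : X n Nd → ℝ) : ℝ≥0∞ :=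
  ∫⁻ x, (∫⁻ ω, rSsq n Nd (fun j => randOffset (ω j)) f x ∂prodRandMeasure n Nd) ^ (1 / 2 : ℝ)

/-! ### The product (Chang–Fefferman) Hardy space `H¹(X₁ × ⋯ × Xₙ)` -/

/-- The upper half-space variables `((y₁,t₁),…,(yₙ,tₙ))`. -/
abbrev W := Π j : Fin n, ((Fin (Nd j) → ℝ) × ℝ)

/-- The Poisson kernel of the upper half-space `ℝ^{M+1}_+`. -/
def pk (M : ℕ) (y : Fin M → ℝ) (t : ℝ) : ℝ :=
  (Real.Gamma (((M : ℝ) + 1) / 2) / Real.pi ^ (((M : ℝ) + 1) / 2)) * t /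
    ((∑ i, y i ^ 2) + t ^ 2) ^ (((M : ℝ) + 1) / 2)

/-- The extension of `f` to `ℝ^{N₁+1}_+ × ⋯ × ℝ^{Nₙ+1}_+` obtained by applying the Poisson
(harmonic) extension in each variable. -/
def prodPoisson (f : X n Nd → ℝ) (p : W n Nd) : ℝ :=
  ∫ z, f z * ∏ j, pk (Nd j) ((p j).1 - z j) (p j).2

/-- The coordinate direction `i` in the `j`-th half-space factor (`i = N_j` is the
`t_j`-direction). -/
def dirW (j : Fin n) (i : Fin (Nd j + 1)) : W n Nd :=
  Pi.single j (if h : (i : ℕ) < Nd j then (Pi.single (⟨i, h⟩ : Fin (Nd j)) 1, 0) else (0, 1))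

/-- `|∇₁ ∇₂ ⋯ ∇ₙ u (p)|²`: the sum over all choices of one coordinate direction in each
half-space factor of the square of the corresponding mixed partial derivative. -/
def mixedGradSq (u : W n Nd → ℝ) (p : W n Nd) : ℝ :=
  ∑ d : Π j : Fin n, Fin (Nd j + 1),
    (iteratedFDeriv ℝ n u p fun j => dirW n Nd j (d j)) ^ 2

/-- The product cone `Γ_{x₁} × ⋯ × Γ_{xₙ}`, `Γ_{x_j} = {(y,t) : |y - x_j| < t}`. -/
def prodCone (x : X n Nd) : Set (W n Nd) :=
  {p | ∀ j, Real.sqrt (∑ i, ((p j).1 i - x j i) ^ 2) < (p j).2}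

/-- The square of the product Lusin square function `S⃗^L f`. -/
def lusinSq (f : X n Nd → ℝ) (x : X n Nd) : ℝ≥0∞ :=
  ∫⁻ p in prodCone n Nd x,
    ENNReal.ofReal (mixedGradSq n Nd (prodPoisson n Nd f) p *
      ∏ j, (p j).2 ^ (1 - (Nd j : ℝ)))

/-- The norm of the multi-parameter (product) Hardy space `H¹(X₁ × ⋯ × Xₙ)` of
Chang–Fefferman: `‖f‖ = ‖S⃗^L f‖_{L¹(X)}`. -/
def H1prodNorm (f : X n Nd → ℝ) : ℝ≥0∞ :=
  ∫⁻ x, (lusinSq n Nd f x) ^ (1 / 2 : ℝ)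
/-- The square of the multi-parameter square function `S̃_𝒟`,
`|S̃_𝒟 f (x)|² = ∑_{R ∋ x} (E_R |Δ_R f|²)(x)`. -/
def rStildeSq (n : ℕ) (Nd : Fin n → ℕ) (c : Π j : Fin n, ℤ → Fin (Nd j) → ℝ)
    (f : X n Nd → ℝ) (x : X n Nd) : ℝ≥0∞ :=
  ∑' k : Fin n → ℤ, ENNReal.ofReal (ravg n Nd c k (fun y => (rmdiff n Nd c k f y) ^ 2) x)

/-- The quantity `∫_X [𝔼_ω |S̃_{𝒟(ω)} f (x)|²]^{1/2} dx` for the multi-parameter random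
dyadic square function `S̃`. -/
def randProdStildeNorm (n : ℕ) (Nd : Fin n → ℕ) (f : X n Nd → ℝ) : ℝ≥0∞ :=
  ∫⁻ x, (∫⁻ ω, rStildeSq n Nd (fun j => randOffset (ω j)) f x ∂prodRandMeasure n Nd) ^
    (1 / 2 : ℝ)

/-! ### The Minkowski integral inequality in `L²` -/

theorem sqrt_sq_ennreal (a : ℝ≥0∞) : (a ^ 2) ^ (1 / 2 : ℝ) = a := by
  rw [← ENNReal.rpow_natCast, ← ENNReal.rpow_mul]; norm_num

theorem sq_sqrt_ennreal (a : ℝ≥0∞) : (a ^ (1 / 2 : ℝ)) ^ 2 = a := by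
  rw [← ENNReal.rpow_natCast, ← ENNReal.rpow_mul]; norm_num

theorem lintegral_mul_le_sqrt {α : Type*} [MeasurableSpace α] (μ : Measure α)
    {f g : α → ℝ≥0∞} (hf : AEMeasurable f μ) (hg : AEMeasurable g μ) :
    ∫⁻ a, f a * g a ∂μ ≤ (∫⁻ a, f a ^ 2 ∂μ) ^ (1 / 2 : ℝ) * (∫⁻ a, g a ^ 2 ∂μ) ^ (1 / 2 : ℝ) := by
  have := ENNReal.lintegral_mul_le_Lp_mul_Lq μ Real.HolderConjugate.two_two hf hg
  simpa using this

/-- Minkowski's integral inequality in `L²`. -/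
theorem minkowski_sq {α β : Type*} [MeasurableSpace α] [MeasurableSpace β] (μ : Measure α)
    (ν : Measure β) [SFinite μ] [SFinite ν] {g : α → β → ℝ≥0∞}
    (hg : Measurable (Function.uncurry g)) :
    (∫⁻ a, (∫⁻ b, g a b ∂ν) ^ 2 ∂μ) ^ (1 / 2 : ℝ) ≤
      ∫⁻ b, (∫⁻ a, g a b ^ 2 ∂μ) ^ (1 / 2 : ℝ) ∂ν := by
  have hga : ∀ a, Measurable (g a) := fun a => hg.comp measurable_prodMk_left
  have hgb : ∀ b, Measurable (fun a => g a b) := fun b => hg.comp measurable_prodMk_right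
  have hN : Measurable fun b => (∫⁻ a, g a b ^ 2 ∂μ) ^ (1 / 2 : ℝ) := by
    refine Measurable.pow_const ?_ _
    exact Measurable.lintegral_prod_left' (f := fun p : α × β => g p.1 p.2 ^ 2) (hg.pow_const 2)
  have h3 : Measurable fun p : (α × β) × β => g p.1.1 p.1.2 * g p.1.1 p.2 :=
    (hg.comp measurable_fst).mul (hg.comp
        ((measurable_fst.comp measurable_fst).prodMk measurable_snd))
  have key : ∫⁻ a, (∫⁻ b, g a b ∂ν) ^ 2 ∂μ ≤
      (∫⁻ b, (∫⁻ a, g a b ^ 2 ∂μ) ^ (1 / 2 : ℝ) ∂ν) ^ 2 := by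
    calc ∫⁻ a, (∫⁻ b, g a b ∂ν) ^ 2 ∂μ
        = ∫⁻ a, ∫⁻ b, ∫⁻ b', g a b * g a b' ∂ν ∂ν ∂μ := by
          refine lintegral_congr fun a => ?_
          rw [sq, ← lintegral_mul_const _ (hga a)]
          refine lintegral_congr fun b => ?_
          rw [lintegral_const_mul _ (hga a)]
      _ = ∫⁻ b, ∫⁻ a, ∫⁻ b', g a b * g a b' ∂ν ∂μ ∂ν := by
          rw [lintegral_lintegral_swap]
          exact (Measurable.lintegral_prod_right' h3).aemeasurable
      _ = ∫⁻ b, ∫⁻ b', ∫⁻ a, g a b * g a b' ∂μ ∂ν ∂ν := by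
          refine lintegral_congr fun b => ?_
          rw [lintegral_lintegral_swap]
          exact (((hgb b).comp measurable_fst).mul hg).aemeasurable
      _ ≤ ∫⁻ b, ∫⁻ b', (∫⁻ a, g a b ^ 2 ∂μ) ^ (1 / 2 : ℝ) * (∫⁻ a, g a b' ^ 2 ∂μ) ^ (1 / 2 : ℝ)
            ∂ν ∂ν := by
          refine lintegral_mono fun b => lintegral_mono fun b' => ?_
          exact lintegral_mul_le_sqrt μ (hgb b).aemeasurable (hgb b').aemeasurable
      _ = _ := by
          rw [sq, ← lintegral_mul_const _ hN]
          refine lintegral_congr fun b => ?_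
          rw [lintegral_const_mul _ hN]
  calc _ ≤ ((∫⁻ b, (∫⁻ a, g a b ^ 2 ∂μ) ^ (1 / 2 : ℝ) ∂ν) ^ 2) ^ (1 / 2 : ℝ) :=
        ENNReal.rpow_le_rpow key (by norm_num)
    _ = _ := sqrt_sq_ennreal _

/-- The triangle inequality in `ℓ²` for countable sums of functions with values in `[0,∞]`. -/
theorem minkowski_sq_tsum {ι κ : Type*} [Countable ι] [Countable κ] (g : ι → κ → ℝ≥0∞) :
    (∑' i, (∑' m, g i m) ^ 2) ^ (1 / 2 : ℝ) ≤ ∑' m, (∑' i, g i m ^ 2) ^ (1 / 2 : ℝ) := by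
  let _ : MeasurableSpace ι := ⊤
  let _ : MeasurableSpace κ := ⊤
  have : DiscreteMeasurableSpace ι := ⟨fun _ => trivial⟩
  have : DiscreteMeasurableSpace κ := ⟨fun _ => trivial⟩
  have := minkowski_sq (Measure.count : Measure ι) (Measure.count : Measure κ) (g := g)
    (measurable_of_countable _)
  simpa only [lintegral_count] using this

/-! ### The Hardy–Littlewood maximal function -/

/-- The average over the ball of radius `2^l` (up to the factor `2^N`). -/
def hlAvg {N : ℕ} (l : ℤ) (g : (Fin N → ℝ) → ℝ≥0∞) (x : Fin N → ℝ) : ℝ≥0∞ :=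
  (2 : ℝ≥0∞) ^ (-((l : ℝ) * N)) * ∫⁻ y in Metric.closedBall x (2 ^ l), g y

/-- The Hardy–Littlewood maximal function. -/
def hlMax {N : ℕ} (g : (Fin N → ℝ) → ℝ≥0∞) (x : Fin N → ℝ) : ℝ≥0∞ := ⨆ l : ℤ, hlAvg l g x

theorem measurable_hlAvg {N : ℕ} (l : ℤ) {g : (Fin N → ℝ) → ℝ≥0∞} (hg : Measurable g) :
    Measurable (hlAvg l g) := by
  unfold hlAvg
  refine Measurable.const_mul ?_ _
  have hs : MeasurableSet {p : (Fin N → ℝ) × (Fin N → ℝ) | dist p.2 p.1 ≤ 2 ^ l} :=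
    measurableSet_le (measurable_snd.dist measurable_fst) measurable_const
  have : (fun x : Fin N → ℝ => ∫⁻ y in Metric.closedBall x (2 ^ l), g y) =
      fun x => ∫⁻ y, {p : (Fin N → ℝ) × (Fin N → ℝ) | dist p.2 p.1 ≤ 2 ^ l}.indicator
        (fun p => g p.2) (x, y) := by
    ext x
    rw [← lintegral_indicator Metric.isClosed_closedBall.measurableSet]
    rfl
  rw [this]
  exact Measurable.lintegral_prod_right' ((hg.comp measurable_snd).indicator hs)

theorem measurable_hlMax {N : ℕ} {g : (Fin N → ℝ) → ℝ≥0∞} (hg : Measurable g) :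
    Measurable (hlMax g) := Measurable.iSup fun l => measurable_hlAvg l hg

theorem volume_closedBall_two_zpow {N : ℕ} (x : Fin N → ℝ) (l : ℤ) (a : ℝ) (ha : 0 ≤ a) :
    volume (Metric.closedBall x (a * 2 ^ l)) =
      ENNReal.ofReal ((2 * a) ^ N) * (2 : ℝ≥0∞) ^ ((l : ℝ) * N) := by
  rw [Real.volume_pi_closedBall _ (by positivity), Fintype.card_fin, ← mul_assoc, mul_pow,
    ENNReal.ofReal_mul (by positivity)]
  congr 1
  rw [← zpow_natCast, ← zpow_mul, ← Real.rpow_intCast,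
    ← ENNReal.ofReal_rpow_of_pos (by norm_num)]
  norm_num

theorem hlMax_weak_trunc {N : ℕ} {g : (Fin N → ℝ) → ℝ≥0∞} (lam : ℝ≥0∞)
    (m : ℤ) : lam * volume {x | ∃ l ≤ m, lam < hlAvg l g x} ≤
      ENNReal.ofReal (10 ^ N) * ∫⁻ y, g y := by
  set t : Set (Fin N → ℝ) := {x | ∃ l ≤ m, lam < hlAvg l g x} with ht
  have hch : ∀ x : Fin N → ℝ, ∃ l : ℤ, x ∈ t → l ≤ m ∧ lam < hlAvg l g x := by
    intro x
    by_cases hx : x ∈ t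
    · obtain ⟨l, h1, h2⟩ := hx
      exact ⟨l, fun _ => ⟨h1, h2⟩⟩
    · exact ⟨0, fun h => absurd h hx⟩
  choose k hk using hch
  obtain ⟨u, hut, hdis, hcov⟩ :=
    Vitali.exists_disjoint_subfamily_covering_enlargement_closedBall t (fun x => x)
      (fun x => (2 : ℝ) ^ (k x)) (2 ^ m)
      (fun a ha => zpow_le_zpow_right₀ (by norm_num) (hk a ha).1) 5 (by norm_num)
  have hcount : u.Countable := by
    refine hdis.countable_of_nonempty_interior fun x _ => ?_
    refine ⟨x, ?_⟩
    exact Metric.ball_subset_interior_closedBall (Metric.mem_ball_self (by positivity))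
  have hsub : t ⊆ ⋃ b ∈ u, Metric.closedBall b (5 * 2 ^ (k b)) := by
    intro x hx
    obtain ⟨b, hb, hs⟩ := hcov x hx
    exact Set.mem_biUnion hb (hs (Metric.mem_closedBall_self (by positivity)))
  have hb : ∀ b ∈ u, lam * volume (Metric.closedBall b (5 * 2 ^ (k b))) ≤
      ENNReal.ofReal (10 ^ N) * ∫⁻ y in Metric.closedBall b (2 ^ k b), g y := by
    intro b hb
    have h := (hk b (hut hb)).2.le
    rw [volume_closedBall_two_zpow _ _ _ (by norm_num), hlAvg] at *
    rw [mul_left_comm]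
    norm_num
    gcongr
    calc lam * 2 ^ ((k b : ℝ) * N) ≤ (2 ^ (-((k b : ℝ) * N)) *
        ∫⁻ y in Metric.closedBall b (2 ^ k b), g y)
          * 2 ^ ((k b : ℝ) * N) := by gcongr
      _ = (2 ^ (-((k b : ℝ) * N)) * 2 ^ ((k b : ℝ) * N)) *
          ∫⁻ y in Metric.closedBall b (2 ^ k b), g y := by
          ring
      _ = _ := by
          rw [← ENNReal.rpow_add _ _ (by norm_num) (by norm_num)]; simp
  calc lam * volume t ≤ lam * volume (⋃ b ∈ u, Metric.closedBall b (5 * 2 ^ (k b))) := by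
        gcongr
    _ ≤ lam * ∑' b : u, volume (Metric.closedBall b.1 (5 * 2 ^ (k b))) := by
        gcongr
        exact measure_biUnion_le _ hcount _
    _ = ∑' b : u, lam * volume (Metric.closedBall b.1 (5 * 2 ^ (k b))) := by
        rw [ENNReal.tsum_mul_left]
    _ ≤ ∑' b : u, ENNReal.ofReal (10 ^ N) * ∫⁻ y in Metric.closedBall b.1 (2 ^ k b), g y :=
        ENNReal.tsum_le_tsum fun b => hb b.1 b.2
    _ = ENNReal.ofReal (10 ^ N) * ∫⁻ y in ⋃ b ∈ u, Metric.closedBall b (2 ^ k b), g y := by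
        rw [ENNReal.tsum_mul_left, lintegral_biUnion hcount
          (fun b _ => Metric.isClosed_closedBall.measurableSet) hdis]
    _ ≤ _ := by
        gcongr
        exact Measure.restrict_le_self

theorem hlMax_weak {N : ℕ} {g : (Fin N → ℝ) → ℝ≥0∞} (lam : ℝ≥0∞) :
    lam * volume {x | lam < hlMax g x} ≤ ENNReal.ofReal (10 ^ N) * ∫⁻ y, g y := by
  have h : {x | lam < hlMax g x} = ⋃ m : ℕ, {x | ∃ l ≤ (m : ℤ), lam < hlAvg l g x} := by
    ext x
    simp only [hlMax, lt_iSup_iff, Set.mem_ofPred_eq, Set.mem_iUnion]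
    constructor
    · rintro ⟨l, hl⟩
      exact ⟨l.toNat, l, Int.self_le_toNat l, hl⟩
    · rintro ⟨_, l, _, hl⟩
      exact ⟨l, hl⟩
  rw [h, Monotone.measure_iUnion, ENNReal.mul_iSup]
  · exact iSup_le fun m => hlMax_weak_trunc lam m
  · intro a b hab x
    rintro ⟨l, h1, h2⟩
    exact ⟨l, h1.trans (by exact_mod_cast hab), h2⟩

theorem hlAvg_one_le {N : ℕ} (l : ℤ) (c : ℝ≥0∞) (x : Fin N → ℝ) :
    hlAvg l (fun _ => c) x = ENNReal.ofReal (2 ^ N) * c := by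
  have := volume_closedBall_two_zpow x l 1 (by norm_num)
  rw [one_mul] at this
  rw [hlAvg, lintegral_const, Measure.restrict_apply_univ, this]
  calc _ = (2 ^ (-((l : ℝ) * N)) * 2 ^ ((l : ℝ) * N)) *
      (ENNReal.ofReal ((2 * 1) ^ N) * c) := by ring
    _ = _ := by rw [← ENNReal.rpow_add _ _ (by norm_num) (by norm_num)]; simp

theorem hlMax_le_trunc {N : ℕ} {g : (Fin N → ℝ) → ℝ≥0∞} (hg : Measurable g) (c : ℝ≥0∞)
    (x : Fin N → ℝ) :
    hlMax g x ≤ hlMax ({y | c < g y}.indicator g) x + ENNReal.ofReal (2 ^ N) * c := by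
  refine iSup_le fun l => ?_
  have hm : Measurable ({y | c < g y}.indicator g) :=
    hg.indicator (measurableSet_lt measurable_const hg)
  calc hlAvg l g x ≤ hlAvg l ({y | c < g y}.indicator g) x + hlAvg l (fun _ => c) x := by
        rw [hlAvg, hlAvg, hlAvg, ← mul_add, ← lintegral_add_left hm]
        gcongr with y
        by_cases h : c < g y
        · simp [h]
        · simp [h, not_lt.mp h]
    _ ≤ _ := by
        rw [hlAvg_one_le]
        gcongr
        exact le_iSup (fun l => hlAvg l ({y | c < g y}.indicator g) x) l

theorem two_zpow_strictMono_ennreal : StrictMono fun j : ℤ => (2 : ℝ≥0∞) ^ j := by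
  intro i j h
  simp only [← ENNReal.rpow_intCast]
  exact ENNReal.rpow_lt_rpow_of_exponent_lt (by norm_num) (by norm_num) (by exact_mod_cast h)

theorem rpow_le_tsum_levels {s : ℝ} (hs : 0 < s) (a : ℝ≥0∞) :
    a ^ s ≤ 2 ^ s * ∑' j : ℤ, if (2 : ℝ≥0∞) ^ j < a then ((2 : ℝ≥0∞) ^ j) ^ s else 0 := by
  rcases eq_or_ne a 0 with rfl | h0
  · simp [hs]
  rcases eq_or_ne a ⊤ with rfl | ht
  · have h1 : (⊤ : ℝ≥0∞) ≤ ∑' j : ℤ, if (2 : ℝ≥0∞) ^ j < ⊤ then ((2 : ℝ≥0∞) ^ j) ^ s else 0 := by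
      calc (⊤ : ℝ≥0∞) = ∑' _ : ℕ, 1 := (ENNReal.tsum_const_eq_top_of_ne_zero one_ne_zero).symm
        _ ≤ ∑' i : ℕ, if (2 : ℝ≥0∞) ^ (i : ℤ) < ⊤ then ((2 : ℝ≥0∞) ^ (i : ℤ)) ^ s else 0 := by
          refine ENNReal.tsum_le_tsum fun i => ?_
          rw [if_pos (by simp [zpow_natCast])]
          exact ENNReal.one_le_rpow (by rw [zpow_natCast]; exact one_le_pow₀ (by norm_num)) hs
        _ ≤ _ := ENNReal.tsum_comp_le_tsum_of_injective
          (f := fun i : ℕ => (i : ℤ)) Nat.cast_injective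
          (fun j : ℤ => if (2 : ℝ≥0∞) ^ j < ⊤ then ((2 : ℝ≥0∞) ^ j) ^ s else 0)
    rw [top_le_iff.1 h1, ENNReal.mul_top (by simp)]
    exact le_top
  · obtain ⟨J, h1, h2⟩ := ENNReal.exists_mem_Ioc_zpow h0 ht (y := 2) (by norm_num) (by norm_num)
    calc a ^ s ≤ ((2 : ℝ≥0∞) ^ (J + 1)) ^ s := by gcongr
      _ = 2 ^ s * (if (2 : ℝ≥0∞) ^ J < a then ((2 : ℝ≥0∞) ^ J) ^ s else 0) := by
        rw [if_pos h1, ENNReal.zpow_add (by norm_num) (by norm_num), zpow_one,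
          ENNReal.mul_rpow_of_nonneg _ _ hs.le, mul_comm]
      _ ≤ _ := by
        gcongr
        exact ENNReal.le_tsum (f := fun j : ℤ => if (2 : ℝ≥0∞) ^ j < a
            then ((2 : ℝ≥0∞) ^ j) ^ s else 0) J

theorem tsum_levels_le {s : ℝ} (hs : 0 < s) (a : ℝ≥0∞) :
    (∑' j : ℤ, if (2 : ℝ≥0∞) ^ j < a then ((2 : ℝ≥0∞) ^ j) ^ s else 0) ≤
      (1 - 2 ^ (-s))⁻¹ * a ^ s := by
  rcases eq_or_ne a 0 with rfl | h0
  · simp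
  rcases eq_or_ne a ⊤ with rfl | ht
  · rw [ENNReal.top_rpow_of_pos hs, ENNReal.mul_top]
    · exact le_top
    · exact ENNReal.inv_ne_zero.2 (ne_top_of_le_ne_top ENNReal.one_ne_top tsub_le_self)
  · obtain ⟨J, h1, h2⟩ := ENNReal.exists_mem_Ioc_zpow h0 ht (y := 2) (by norm_num) (by norm_num)
    have hinj : Function.Injective fun i : ℕ => J - (i : ℤ) := fun i j h => by
      simpa using h
    have hsupp : Function.support
        (fun j : ℤ => if (2 : ℝ≥0∞) ^ j < a then ((2 : ℝ≥0∞) ^ j) ^ s else 0) ⊆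
        Set.range fun i : ℕ => J - (i : ℤ) := by
      intro j hj
      have hja : (2 : ℝ≥0∞) ^ j < a := by
        by_contra h
        simp [h] at hj
      have : j < J + 1 := two_zpow_strictMono_ennreal.lt_iff_lt.1 (hja.trans_le h2)
      exact ⟨(J - j).toNat, by simp only; omega⟩
    rw [← hinj.tsum_eq hsupp]
    calc (∑' i : ℕ, if (2 : ℝ≥0∞) ^ (J - (i : ℤ)) < a then ((2 : ℝ≥0∞) ^ (J - (i : ℤ))) ^ s else 0)
        ≤ ∑' i : ℕ, (2 ^ (-s)) ^ i * a ^ s := by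
          refine ENNReal.tsum_le_tsum fun i => ?_
          refine (ite_le_sup _ _ _).trans (sup_le ?_ bot_le)
          calc ((2 : ℝ≥0∞) ^ (J - (i : ℤ))) ^ s = (2 ^ (-s)) ^ i * ((2 : ℝ≥0∞) ^ J) ^ s := by
                rw [sub_eq_add_neg, ENNReal.zpow_add (by norm_num) (by norm_num),
                  ENNReal.mul_rpow_of_nonneg _ _ hs.le, mul_comm]
                congr 1
                rw [← ENNReal.rpow_intCast, ← ENNReal.rpow_natCast, ← ENNReal.rpow_mul,
                  ← ENNReal.rpow_mul]
                push_cast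
                ring_nf
            _ ≤ _ := by gcongr
      _ = _ := by rw [ENNReal.tsum_mul_right, ENNReal.tsum_geometric]

/-- The Hardy–Littlewood maximal theorem. -/
theorem hlMax_strong (N : ℕ) {s : ℝ} (hs : 1 < s) :
    ∃ C : ℝ≥0∞, C ≠ ⊤ ∧ ∀ g : (Fin N → ℝ) → ℝ≥0∞, Measurable g →
      ∫⁻ x, hlMax g x ^ s ≤ C * ∫⁻ x, g x ^ s := by
  have hs0 : 0 < s := by linarith
  have hs1 : 0 < s - 1 := by linarith
  set D : ℝ≥0∞ := (1 - 2 ^ (-(s - 1)))⁻¹ with hD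
  have hDt : D ≠ ⊤ := by
    rw [hD]
    refine ENNReal.inv_ne_top.2 (tsub_pos_of_lt ?_).ne'
    exact ENNReal.rpow_lt_one_of_one_lt_of_neg (by norm_num) (by linarith)
  set B : ℝ≥0∞ := (2 : ℝ≥0∞) ^ (N + 1 : ℤ) with hB
  have hBt : B ≠ ⊤ := by
    rw [hB]; exact (ENNReal.zpow_lt_top (by norm_num) (by norm_num) _).ne
  have hB0 : B ≠ 0 := by
    rw [hB]; exact (ENNReal.zpow_pos (by norm_num) (by norm_num) _).ne'
  refine ⟨2 ^ s * (2 * ENNReal.ofReal (10 ^ N) * (B ^ (s - 1) * D)), ?_, fun g hg => ?_⟩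
  · have h1 : (2 : ℝ≥0∞) ^ s ≠ ⊤ := ENNReal.rpow_ne_top_of_nonneg hs0.le (by norm_num)
    have h2 : B ^ (s - 1) ≠ ⊤ := ENNReal.rpow_ne_top_of_nonneg hs1.le hBt
    exact ENNReal.mul_ne_top h1 (ENNReal.mul_ne_top (ENNReal.mul_ne_top (by norm_num)
      ENNReal.ofReal_ne_top) (ENNReal.mul_ne_top h2 hDt))
  have hM := measurable_hlMax hg
  have hlev : ∀ j : ℤ, (2 : ℝ≥0∞) ^ j * volume {x | (2 : ℝ≥0∞) ^ j < hlMax g x} ≤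
      2 * ENNReal.ofReal (10 ^ N) * ∫⁻ y, ({y | (2 : ℝ≥0∞) ^ j < B * g y}.indicator g) y := by
    intro j
    have e1 : ENNReal.ofReal (2 ^ N) * (2 : ℝ≥0∞) ^ (j - 1 - N) = (2 : ℝ≥0∞) ^ (j - 1) := by
      rw [ENNReal.zpow_sub (by norm_num) (by norm_num), zpow_natCast]
      rw [ENNReal.ofReal_pow (by norm_num)]
      norm_num
      rw [mul_left_comm, ENNReal.mul_inv_cancel (by simp) (by simp), mul_one]
    have e2 : (2 : ℝ≥0∞) * (2 : ℝ≥0∞) ^ (j - 1) = (2 : ℝ≥0∞) ^ j := by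
      have := ENNReal.zpow_add (x := 2) (by norm_num) (by norm_num) 1 (j - 1)
      rw [zpow_one, add_sub_cancel] at this
      exact this.symm
    have hset : {y | (2 : ℝ≥0∞) ^ (j - 1 - N) < g y} = {y | (2 : ℝ≥0∞) ^ j < B * g y} := by
      ext y
      have : (2 : ℝ≥0∞) ^ j = B * (2 : ℝ≥0∞) ^ (j - 1 - N) := by
        rw [hB, ← ENNReal.zpow_add (by norm_num) (by norm_num)]
        congr 1; ring
      rw [Set.mem_ofPred_eq, Set.mem_ofPred_eq, this, ENNReal.mul_lt_mul_iff_right hB0 hBt]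
    have hsub : {x | (2 : ℝ≥0∞) ^ j < hlMax g x} ⊆
        {x | (2 : ℝ≥0∞) ^ (j - 1) < hlMax ({y | (2 : ℝ≥0∞) ^ j < B * g y}.indicator g) x} := by
      intro x hx
      by_contra h
      have h1 := hlMax_le_trunc hg ((2 : ℝ≥0∞) ^ (j - 1 - N)) x
      rw [e1, hset] at h1
      have h2 : hlMax g x ≤ (2 : ℝ≥0∞) ^ j := by
        have h3 : (2 : ℝ≥0∞) ^ (j - 1) + (2 : ℝ≥0∞) ^ (j - 1) = (2 : ℝ≥0∞) ^ j := by
          rw [← two_mul, e2]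
        exact h1.trans ((add_le_add (not_lt.1 h) le_rfl).trans h3.le)
      exact absurd hx (not_lt.2 h2)
    calc (2 : ℝ≥0∞) ^ j * volume {x | (2 : ℝ≥0∞) ^ j < hlMax g x}
        ≤ (2 * (2 : ℝ≥0∞) ^ (j - 1)) * volume
          {x | (2 : ℝ≥0∞) ^ (j - 1) < hlMax ({y | (2 : ℝ≥0∞) ^ j < B * g y}.indicator g) x} := by
          rw [e2]; gcongr
      _ ≤ _ := by
        rw [mul_assoc, mul_assoc]
        have h4 := hlMax_weak (g := {y | (2 : ℝ≥0∞) ^ j < B * g y}.indicator g)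
            ((2 : ℝ≥0∞) ^ (j - 1))
        exact mul_le_mul_right h4 _
  have hpow : ∀ j : ℤ, ((2 : ℝ≥0∞) ^ j) ^ s = ((2 : ℝ≥0∞) ^ j) ^ (s - 1) * (2 : ℝ≥0∞) ^ j := by
    intro j
    have := ENNReal.rpow_add (x := (2 : ℝ≥0∞) ^ j) (s - 1) 1
      (ENNReal.zpow_pos (by norm_num) (by norm_num) _).ne'
      (ENNReal.zpow_lt_top (by norm_num) (by norm_num) _).ne
    rw [ENNReal.rpow_one] at this
    rw [← this]; ring_nf
  have hmset : ∀ j : ℤ, MeasurableSet {y | (2 : ℝ≥0∞) ^ j < B * g y} := fun j =>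
    measurableSet_lt measurable_const (hg.const_mul B)
  have hmset' : ∀ j : ℤ, MeasurableSet {y | (2 : ℝ≥0∞) ^ j < hlMax g y} := fun j =>
    measurableSet_lt measurable_const hM
  calc ∫⁻ x, hlMax g x ^ s
      ≤ ∫⁻ x, 2 ^ s * ∑' j : ℤ, if (2 : ℝ≥0∞) ^ j < hlMax g x then ((2 : ℝ≥0∞) ^ j) ^ s else 0 :=
        lintegral_mono fun x => rpow_le_tsum_levels hs0 _
    _ = 2 ^ s * ∑' j : ℤ, ((2 : ℝ≥0∞) ^ j) ^ s * volume {x | (2 : ℝ≥0∞) ^ j < hlMax g x} := by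
        rw [lintegral_const_mul _ (Measurable.tsum fun j =>
          Measurable.ite (hmset' j) measurable_const measurable_const), lintegral_tsum
          fun j => (Measurable.ite (hmset' j) measurable_const measurable_const).aemeasurable]
        congr 1
        refine tsum_congr fun j => ?_
        rw [← lintegral_indicator_const (hmset' j)]
        refine lintegral_congr fun x => ?_
        simp [Set.indicator_apply]
    _ ≤ 2 ^ s * ∑' j : ℤ, ((2 : ℝ≥0∞) ^ j) ^ (s - 1) * (2 * ENNReal.ofReal (10 ^ N) *
          ∫⁻ y, ({y | (2 : ℝ≥0∞) ^ j < B * g y}.indicator g) y) := by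
        refine mul_le_mul_right (ENNReal.tsum_le_tsum fun j => ?_) _
        rw [hpow, mul_assoc]
        exact mul_le_mul_right (hlev j) _
    _ = 2 ^ s * (2 * ENNReal.ofReal (10 ^ N) * ∫⁻ y, g y *
          ∑' j : ℤ, if (2 : ℝ≥0∞) ^ j < B * g y then ((2 : ℝ≥0∞) ^ j) ^ (s - 1) else 0) := by
        congr 1
        simp_rw [mul_left_comm _ (2 * ENNReal.ofReal (10 ^ N))]
        rw [ENNReal.tsum_mul_left]
        congr 1
        simp_rw [← ENNReal.tsum_mul_left]
        rw [lintegral_tsum fun j : ℤ => (show Measurable fun y => g y *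
            if (2 : ℝ≥0∞) ^ j < B * g y then
          ((2 : ℝ≥0∞) ^ j) ^ (s - 1) else 0 from hg.mul (Measurable.ite (hmset j)
            measurable_const measurable_const)).aemeasurable]
        refine tsum_congr fun j => ?_
        rw [← lintegral_const_mul _ (hg.indicator (hmset j))]
        refine lintegral_congr fun y => ?_
        by_cases h : (2 : ℝ≥0∞) ^ j < B * g y
        · simp only [Set.indicator_apply, Set.mem_ofPred_eq, h, if_true]
          exact mul_comm _ _
        · simp [h]
    _ ≤ 2 ^ s * (2 * ENNReal.ofReal (10 ^ N) * ∫⁻ y, B ^ (s - 1) * D * g y ^ s) := by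
        refine mul_le_mul_right (mul_le_mul_right (lintegral_mono fun y => ?_) _) _
        calc g y * _ ≤ g y * (D * (B * g y) ^ (s - 1)) :=
              mul_le_mul_right (tsum_levels_le hs1 _) _
          _ = B ^ (s - 1) * D * (g y ^ (s - 1) * g y) := by
              rw [ENNReal.mul_rpow_of_nonneg _ _ hs1.le]; ring
          _ = _ := by
              congr 1
              have := ENNReal.rpow_add_of_nonneg (x := g y) (s - 1) 1 (by linarith) (by norm_num)
              rw [ENNReal.rpow_one, sub_add_cancel] at this
              exact this.symm
    _ = _ := by
        rw [lintegral_const_mul _ (hg.pow_const s)]; ring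

/-! ### The kernels `2^{-lN} (1 + ‖x‖ / 2^l)^{-a}` -/

theorem rpow_neg_anti {x y : ℝ≥0∞} (h : x ≤ y) {a : ℝ} (ha : 0 ≤ a) : y ^ (-a) ≤ x ^ (-a) := by
  rw [ENNReal.rpow_neg, ENNReal.rpow_neg]
  exact ENNReal.inv_le_inv.2 (ENNReal.rpow_le_rpow h ha)

/-- The kernel `2^{-lN} (1 + ‖x‖ / 2^l)^{-a}`. -/
def kr (N : ℕ) (a : ℝ) (l : ℤ) (x : Fin N → ℝ) : ℝ≥0∞ :=
  2 ^ (-((l : ℝ) * N)) * ENNReal.ofReal (1 + ‖x‖ / 2 ^ l) ^ (-a)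

theorem measurable_kr (N : ℕ) (a : ℝ) (l : ℤ) : Measurable (kr N a l) := by
  unfold kr
  fun_prop

theorem one_le_ofReal_one_add {N : ℕ} (l : ℤ) (x : Fin N → ℝ) :
    1 ≤ ENNReal.ofReal (1 + ‖x‖ / 2 ^ l) :=
  ENNReal.one_le_ofReal.2 (le_add_of_nonneg_right (by positivity))

theorem kr_neg {N : ℕ} (a : ℝ) (l : ℤ) (x : Fin N → ℝ) : kr N a l (-x) = kr N a l x := by
  simp [kr]

theorem kr_sub_comm {N : ℕ} (a : ℝ) (l : ℤ) (x y : Fin N → ℝ) :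
    kr N a l (x - y) = kr N a l (y - x) := by rw [← kr_neg, neg_sub]

theorem two_rpow_add (a b : ℝ) : (2 : ℝ≥0∞) ^ (a + b) = 2 ^ a * 2 ^ b :=
  ENNReal.rpow_add a b (by norm_num) (by norm_num)

theorem two_rpow_ne_top (a : ℝ) : (2 : ℝ≥0∞) ^ a ≠ ⊤ :=
  ENNReal.rpow_ne_top_of_ne_zero (by norm_num) (by norm_num)

theorem kr_shift {N : ℕ} {a : ℝ} (ha : 0 ≤ a) {l : ℤ} {x y : Fin N → ℝ}
    (h : ‖x - y‖ ≤ 2 ^ l) : kr N a l x ≤ 2 ^ a * kr N a l y := by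
  unfold kr
  rw [mul_left_comm]
  refine mul_le_mul_right ?_ _
  have h1 : ENNReal.ofReal (1 + ‖y‖ / 2 ^ l) ≤ 2 * ENNReal.ofReal (1 + ‖x‖ / 2 ^ l) := by
    rw [← ENNReal.ofReal_ofNat 2, ← ENNReal.ofReal_mul (by norm_num)]
    apply ENNReal.ofReal_le_ofReal
    have h2 : ‖y‖ ≤ ‖x‖ + 2 ^ l := by
      have := norm_sub_norm_le y x
      rw [norm_sub_rev] at this
      linarith
    have h3 : ‖y‖ / 2 ^ l ≤ ‖x‖ / 2 ^ l + 1 := by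
      rw [← div_self (show (2 : ℝ) ^ l ≠ 0 by positivity), ← add_div]
      gcongr
    have : 0 ≤ ‖x‖ / 2 ^ l := by positivity
    linarith
  calc ENNReal.ofReal (1 + ‖x‖ / 2 ^ l) ^ (-a)
      = 2 ^ a * (2 * ENNReal.ofReal (1 + ‖x‖ / 2 ^ l)) ^ (-a) := by
        rw [ENNReal.mul_rpow_of_ne_top (by norm_num) ENNReal.ofReal_ne_top, ← mul_assoc,
          ← two_rpow_add]
        simp
    _ ≤ _ := mul_le_mul_right (rpow_neg_anti h1 ha) _

theorem kr_rpow {N : ℕ} (a r : ℝ) (hr : 0 ≤ r) (l : ℤ) (x : Fin N → ℝ) :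
    kr N a l x ^ r = 2 ^ ((l : ℝ) * N * (1 - r)) * kr N (a * r) l x := by
  unfold kr
  rw [ENNReal.mul_rpow_of_nonneg _ _ hr, ← mul_assoc, ← two_rpow_add, ← ENNReal.rpow_mul,
    ← ENNReal.rpow_mul]
  ring_nf

theorem kr_le_tsum {N : ℕ} {a : ℝ} (ha : 0 ≤ a) (l : ℤ) (x : Fin N → ℝ) :
    kr N a l x ≤ 2 ^ a * ∑' m : ℕ, 2 ^ (-((a - N) * m)) * (2 ^ (-(((l + m : ℤ) : ℝ) * N)) *
      (Metric.closedBall (0 : Fin N → ℝ) (2 ^ (l + m))).indicator 1 x) := by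
  classical
  have hex : ∃ m : ℕ, ‖x‖ ≤ 2 ^ (l + m) := by
    obtain ⟨m, hm⟩ := pow_unbounded_of_one_lt (‖x‖ / 2 ^ l) (one_lt_two (α := ℝ))
    refine ⟨m, ?_⟩
    rw [zpow_add₀ (by norm_num), zpow_natCast, mul_comm]
    exact ((div_lt_iff₀ (by positivity)).1 hm).le
  set m := Nat.find hex with hm
  have h1 : ‖x‖ ≤ 2 ^ (l + m) := Nat.find_spec hex
  have h2 : (2 : ℝ≥0∞) ^ ((m : ℝ) - 1) ≤ ENNReal.ofReal (1 + ‖x‖ / 2 ^ l) := by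
    rcases Nat.eq_zero_or_pos m with h0 | hpos
    · refine le_trans ?_ (one_le_ofReal_one_add l x)
      rw [h0]
      exact ENNReal.rpow_le_one_of_one_le_of_neg (by norm_num) (by norm_num)
    · have h3 : ¬ ‖x‖ ≤ 2 ^ (l + (m - 1 : ℕ)) := Nat.find_min hex (Nat.sub_lt hpos one_pos)
      rw [← ENNReal.ofReal_ofNat 2, ENNReal.ofReal_rpow_of_pos (by norm_num)]
      apply ENNReal.ofReal_le_ofReal
      have h4 : (2 : ℝ) ^ (m - 1) ≤ ‖x‖ / 2 ^ l := by
        rw [le_div_iff₀ (by positivity), mul_comm, ← zpow_natCast, ← zpow_add₀ (by norm_num)]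
        exact (not_le.1 h3).le
      have h5 : (2 : ℝ) ^ ((m : ℝ) - 1) = 2 ^ (m - 1) := by
        rw [← Real.rpow_natCast, Nat.cast_sub hpos]; simp
      rw [h5]
      linarith
  have hind : (Metric.closedBall (0 : Fin N → ℝ) (2 ^ (l + m))).indicator
      (1 : (Fin N → ℝ) → ℝ≥0∞) x = 1 := by
    rw [Set.indicator_of_mem (by simpa using h1)]; rfl
  calc kr N a l x ≤ 2 ^ (-((l : ℝ) * N)) * (2 ^ ((m : ℝ) - 1)) ^ (-a) :=
        mul_le_mul_right (rpow_neg_anti h2 ha) _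
    _ = 2 ^ a * (2 ^ (-((a - N) * m)) * (2 ^ (-(((l + m : ℤ) : ℝ) * N)) *
      (Metric.closedBall (0 : Fin N → ℝ) (2 ^ (l + m))).indicator 1 x)) := by
        rw [hind, mul_one, ← ENNReal.rpow_mul, ← two_rpow_add, ← two_rpow_add, ← two_rpow_add]
        push_cast
        ring_nf
    _ ≤ _ := mul_le_mul_right (ENNReal.le_tsum (f := fun m : ℕ => (2 : ℝ≥0∞) ^ (-((a - N) * m)) *
        (2 ^ (-(((l + m : ℤ) : ℝ) * N)) *
        (Metric.closedBall (0 : Fin N → ℝ) (2 ^ (l + m))).indicator 1 x)) m) _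

/-- The constant in the pointwise bound of convolution with `kr N a l`. -/
def krConst (N : ℕ) (a : ℝ) : ℝ≥0∞ := 2 ^ a * (1 - 2 ^ (-(a - N)))⁻¹

theorem krConst_ne_top {N : ℕ} {a : ℝ} (ha : N < a) : krConst N a ≠ ⊤ := by
  refine ENNReal.mul_ne_top (two_rpow_ne_top _) (ENNReal.inv_ne_top.2 (tsub_pos_of_lt ?_).ne')
  exact ENNReal.rpow_lt_one_of_one_lt_of_neg (by norm_num) (by linarith)

theorem lintegral_kr_mul_le {N : ℕ} {a : ℝ} (ha : N < a) (l : ℤ) {g : (Fin N → ℝ) → ℝ≥0∞}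
    (hg : Measurable g) (x : Fin N → ℝ) :
    ∫⁻ y, kr N a l (x - y) * g y ≤ krConst N a * hlMax g x := by
  have hN : (0 : ℝ) ≤ N := by positivity
  have hms : ∀ m : ℕ, MeasurableSet (Metric.closedBall x ((2 : ℝ) ^ (l + m))) := fun m =>
    Metric.isClosed_closedBall.measurableSet
  have hi : ∀ (m : ℕ) (y : Fin N → ℝ),
      (Metric.closedBall (0 : Fin N → ℝ) (2 ^ (l + m))).indicator
          (1 : (Fin N → ℝ) → ℝ≥0∞) (x - y) * g y =
      (Metric.closedBall x ((2 : ℝ) ^ (l + m))).indicator g y := by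
    intro m y
    have : x - y ∈ Metric.closedBall (0 : Fin N → ℝ) (2 ^ (l + m)) ↔
        y ∈ Metric.closedBall x ((2 : ℝ) ^ (l + m)) := by
      rw [mem_closedBall_zero_iff, Metric.mem_closedBall, dist_comm, dist_eq_norm]
    by_cases h : y ∈ Metric.closedBall x ((2 : ℝ) ^ (l + m))
    · rw [Set.indicator_of_mem h, Set.indicator_of_mem (this.2 h)]; simp
    · rw [Set.indicator_of_notMem h, Set.indicator_of_notMem (mt this.1 h)]; simp
  calc ∫⁻ y, kr N a l (x - y) * g y
      ≤ ∫⁻ y, 2 ^ a * ∑' m : ℕ, 2 ^ (-((a - N) * m)) * (2 ^ (-(((l + m : ℤ) : ℝ) * N)) *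
        (Metric.closedBall x ((2 : ℝ) ^ (l + m))).indicator g y) := by
        refine lintegral_mono fun y => ?_
        refine (mul_le_mul_left (kr_le_tsum (by linarith) l (x - y)) _).trans (le_of_eq ?_)
        rw [mul_assoc, ← ENNReal.tsum_mul_right]
        simp_rw [mul_assoc, hi]
    _ = 2 ^ a * ∑' m : ℕ, 2 ^ (-((a - N) * m)) * hlAvg (l + m) g x := by
        rw [lintegral_const_mul _ (Measurable.tsum fun m =>
          ((hg.indicator (hms m)).const_mul _).const_mul _), lintegral_tsum
          fun m => (((hg.indicator (hms m)).const_mul _).const_mul _).aemeasurable]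
        congr 1
        refine tsum_congr fun m => ?_
        rw [lintegral_const_mul _ ((hg.indicator (hms m)).const_mul _),
          lintegral_const_mul _ (hg.indicator (hms m)), lintegral_indicator (hms m), hlAvg]
    _ ≤ 2 ^ a * ∑' m : ℕ, (2 ^ (-(a - N))) ^ m * hlMax g x := by
        refine mul_le_mul_right (ENNReal.tsum_le_tsum fun m => ?_) _
        refine mul_le_mul' (le_of_eq ?_) (le_iSup (fun l => hlAvg l g x) _)
        rw [← ENNReal.rpow_natCast, ← ENNReal.rpow_mul]
        ring_nf
    _ = _ := by rw [ENNReal.tsum_mul_right, ENNReal.tsum_geometric, krConst, mul_assoc]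

theorem lintegral_kr_le {N : ℕ} {a : ℝ} (ha : N < a) (l : ℤ) (y : Fin N → ℝ) :
    ∫⁻ x, kr N a l (x - y) ≤ krConst N a * ENNReal.ofReal (2 ^ N) := by
  have h := lintegral_kr_mul_le ha l (g := fun _ => 1) measurable_const y
  simp only [mul_one] at h
  simp_rw [kr_sub_comm a l _ y]
  refine h.trans (mul_le_mul_right (iSup_le fun l => ?_) _)
  rw [hlAvg_one_le, mul_one]

/-! ### A vector-valued inequality for families of averaging operators -/

theorem lintegral_mul_rpow_le {α : Type*} [MeasurableSpace α] (ν : Measure α) {q : ℝ} (hq : 1 < q)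
    {K h g : α → ℝ≥0∞} (hK : Measurable K) (hh : Measurable h) (hg : Measurable g)
    (hhg : ∀ y, h y ^ q ≤ g y) (hgt : ∀ᵐ y ∂ν, g y ≠ ⊤) :
    (∫⁻ y, K y * h y ∂ν) ^ q ≤ (∫⁻ y, K y * (h y ^ q * g y ^ (-(1 / 2 : ℝ))) ∂ν) *
      (∫⁻ y, K y * g y ^ (1 / (2 * (q - 1))) ∂ν) ^ (q - 1) := by
  have hq0 : 0 < q := by linarith
  have hq1 : 0 < q - 1 := by linarith
  have hpq : q.HolderConjugate (q / (q - 1)) := Real.HolderConjugate.conjExponent hq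
  set μ := ν.withDensity K with hμ
  have conv : ∀ φ : α → ℝ≥0∞, Measurable φ → ∫⁻ y, K y * φ y ∂ν = ∫⁻ y, φ y ∂μ := by
    intro φ hφ
    rw [hμ, lintegral_withDensity_eq_lintegral_mul _ hK hφ]
    rfl
  rw [conv _ hh, conv (fun y => h y ^ q * g y ^ (-(1 / 2 : ℝ)))
    ((hh.pow_const q).mul (hg.pow_const _)), conv _ (hg.pow_const _)]
  have hae : ∀ᵐ y ∂μ, h y ≤ (h y * g y ^ (-(1 / (2 * q)))) * g y ^ (1 / (2 * q)) := by
    filter_upwards [(withDensity_absolutelyContinuous ν K).ae_le hgt] with y hy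
    rcases eq_or_ne (g y) 0 with h0 | h0
    · have := hhg y
      rw [h0, nonpos_iff_eq_zero, ENNReal.rpow_eq_zero_iff_of_pos hq0] at this
      simp [this]
    · rw [mul_assoc, ← ENNReal.rpow_add _ _ h0 hy]
      simp
  have hol := ENNReal.lintegral_mul_le_Lp_mul_Lq μ hpq
    (f := fun y => h y * g y ^ (-(1 / (2 * q)))) (g := fun y => g y ^ (1 / (2 * q)))
    (hh.mul (hg.pow_const _)).aemeasurable (hg.pow_const _).aemeasurable
  have e1 : ∀ y, (h y * g y ^ (-(1 / (2 * q)))) ^ q = h y ^ q * g y ^ (-(1 / 2 : ℝ)) := by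
    intro y
    rw [ENNReal.mul_rpow_of_nonneg _ _ hq0.le, ← ENNReal.rpow_mul]
    congr 2
    field_simp
  have e2 : ∀ y, (g y ^ (1 / (2 * q))) ^ (q / (q - 1)) = g y ^ (1 / (2 * (q - 1))) := by
    intro y
    rw [← ENNReal.rpow_mul]
    congr 1
    field_simp
  simp only [e1, e2] at hol
  calc (∫⁻ y, h y ∂μ) ^ q ≤ ((∫⁻ y, h y ^ q * g y ^ (-(1 / 2 : ℝ)) ∂μ) ^ (1 / q) *
        (∫⁻ y, g y ^ (1 / (2 * (q - 1))) ∂μ) ^ (1 / (q / (q - 1)))) ^ q :=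
        ENNReal.rpow_le_rpow ((lintegral_mono_ae hae).trans hol) hq0.le
    _ = _ := by
        rw [ENNReal.mul_rpow_of_nonneg _ _ hq0.le, ← ENNReal.rpow_mul, ← ENNReal.rpow_mul]
        congr 2
        · rw [one_div_mul_cancel hq0.ne', ENNReal.rpow_one]
        · field_simp

/-- A vector-valued `L¹(ℓ^q)`-type inequality for operators dominated by the maximal function. -/
theorem vector_maximal (N : ℕ) {q : ℝ} (hq : 2 < q) {A : ℝ≥0∞} (hA : A ≠ ⊤) :
    ∃ C : ℝ≥0∞, C ≠ ⊤ ∧ ∀ (ι : Type) [Countable ι]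
      (K : ι → (Fin N → ℝ) → (Fin N → ℝ) → ℝ≥0∞) (h : ι → (Fin N → ℝ) → ℝ≥0∞),
      (∀ i, Measurable (Function.uncurry (K i))) →
      (∀ i g x, Measurable g → ∫⁻ y, K i x y * g y ≤ A * hlMax g x) →
      (∀ i y, ∫⁻ x, K i x y ≤ A) → (∀ i, Measurable (h i)) →
      ∫⁻ x, (∑' i, (∫⁻ y, K i x y * h i y) ^ q) ^ (1 / 2 : ℝ) ≤
        C * ∫⁻ x, (∑' i, h i x ^ q) ^ (1 / 2 : ℝ) := by
  obtain ⟨B, hB, hmax⟩ := hlMax_strong N (s := q - 1) (by linarith)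
  refine ⟨A ^ (1 / 2 : ℝ) * (A ^ (q - 1) * B) ^ (1 / 2 : ℝ) + 1, ?_, ?_⟩
  · refine ENNReal.add_ne_top.2 ⟨ENNReal.mul_ne_top ?_ ?_, ENNReal.one_ne_top⟩
    · exact ENNReal.rpow_ne_top_of_nonneg (by norm_num) hA
    · exact ENNReal.rpow_ne_top_of_nonneg (by norm_num)
        (ENNReal.mul_ne_top (ENNReal.rpow_ne_top_of_nonneg (by linarith) hA) hB)
  intro ι _ K h hK hmx hinteg hh
  set g : (Fin N → ℝ) → ℝ≥0∞ := fun x => ∑' i, h i x ^ q with hg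
  have hgm : Measurable g := Measurable.tsum fun i => (hh i).pow_const q
  rcases eq_or_ne (∫⁻ x, g x ^ (1 / 2 : ℝ)) ⊤ with htop | hfin
  · rw [htop, ENNReal.mul_top (by simp)]
    exact le_top
  have hgt : ∀ᵐ y, g y ≠ ⊤ := by
    filter_upwards [ae_lt_top (hgm.pow_const _) hfin] with y hy h0
    simp [h0] at hy
  have hKx : ∀ i x, Measurable (K i x) := fun i x => (hK i).comp measurable_prodMk_left
  set G : (Fin N → ℝ) → ℝ≥0∞ := fun y => g y ^ (1 / (2 * (q - 1))) with hG
  have hGm : Measurable G := hgm.pow_const _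
  set φ : ι → (Fin N → ℝ) → ℝ≥0∞ := fun i y => h i y ^ q * g y ^ (-(1 / 2 : ℝ)) with hφ
  have hφm : ∀ i, Measurable (φ i) := fun i => ((hh i).pow_const q).mul (hgm.pow_const _)
  have hKφ : ∀ i, Measurable fun x => ∫⁻ y, K i x y * φ i y := fun i =>
    Measurable.lintegral_prod_right' (f := fun p : (Fin N → ℝ) × (Fin N → ℝ) =>
      K i p.1 p.2 * φ i p.2) ((hK i).mul ((hφm i).comp measurable_snd))
  have hMG := measurable_hlMax hGm
  have hpt : ∀ x, (∑' i, (∫⁻ y, K i x y * h i y) ^ q) ^ (1 / 2 : ℝ) ≤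
      (∑' i, ∫⁻ y, K i x y * φ i y) ^ (1 / 2 : ℝ) *
        ((A * hlMax G x) ^ (q - 1)) ^ (1 / 2 : ℝ) := by
    intro x
    rw [← ENNReal.mul_rpow_of_nonneg _ _ (by norm_num), ← ENNReal.tsum_mul_right]
    refine ENNReal.rpow_le_rpow (ENNReal.tsum_le_tsum fun i => ?_) (by norm_num)
    refine (lintegral_mul_rpow_le volume (by linarith) (hKx i x) (hh i) hgm
      (fun y => ENNReal.le_tsum i) hgt).trans ?_
    exact mul_le_mul_right (ENNReal.rpow_le_rpow (hmx i G x hGm) (by linarith)) _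
  have hone : ∫⁻ x, ∑' i, ∫⁻ y, K i x y * φ i y ≤ A * ∫⁻ x, g x ^ (1 / 2 : ℝ) := by
    rw [lintegral_tsum fun i => (hKφ i).aemeasurable]
    calc ∑' i, ∫⁻ x, ∫⁻ y, K i x y * φ i y ≤ ∑' i, ∫⁻ y, A * φ i y := by
          refine ENNReal.tsum_le_tsum fun i => ?_
          rw [lintegral_lintegral_swap
            ((hK i).mul ((hφm i).comp measurable_snd)).aemeasurable]
          refine lintegral_mono fun y => ?_
          rw [lintegral_mul_const (f := fun x => K i x y) _
            ((hK i).comp measurable_prodMk_right)]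
          exact mul_le_mul_left (hinteg i y) _
      _ = ∫⁻ y, A * ∑' i, φ i y := by
          rw [← lintegral_tsum fun i => ((hφm i).const_mul A).aemeasurable]
          simp_rw [ENNReal.tsum_mul_left]
      _ ≤ ∫⁻ y, A * g y ^ (1 / 2 : ℝ) := by
          refine lintegral_mono_ae ?_
          filter_upwards [hgt] with y hy
          refine mul_le_mul_right ?_ _
          simp only [hφ]
          rw [ENNReal.tsum_mul_right]
          change g y * _ ≤ _
          rcases eq_or_ne (g y) 0 with h0 | h0
          · simp [h0]
          · have := ENNReal.rpow_add 1 (-(1 / 2 : ℝ)) h0 hy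
            rw [ENNReal.rpow_one] at this
            rw [← this]
            norm_num
      _ = _ := lintegral_const_mul _ (hgm.pow_const _)
  have htwo : ∫⁻ x, (A * hlMax G x) ^ (q - 1) ≤ A ^ (q - 1) * B * ∫⁻ x, g x ^ (1 / 2 : ℝ) := by
    simp_rw [ENNReal.mul_rpow_of_nonneg _ _ (show 0 ≤ q - 1 by linarith)]
    rw [lintegral_const_mul _ (hMG.pow_const _), mul_assoc]
    refine mul_le_mul_right ((hmax G hGm).trans (le_of_eq ?_)) _
    congr 1
    refine lintegral_congr fun x => ?_
    rw [hG, ← ENNReal.rpow_mul]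
    congr 1
    have : q - 1 ≠ 0 := by linarith
    field_simp
  calc _ ≤ ∫⁻ x, (∑' i, ∫⁻ y, K i x y * φ i y) ^ (1 / 2 : ℝ) *
        ((A * hlMax G x) ^ (q - 1)) ^ (1 / 2 : ℝ) := lintegral_mono hpt
    _ ≤ (∫⁻ x, ((∑' i, ∫⁻ y, K i x y * φ i y) ^ (1 / 2 : ℝ)) ^ 2) ^ (1 / 2 : ℝ) *
        (∫⁻ x, (((A * hlMax G x) ^ (q - 1)) ^ (1 / 2 : ℝ)) ^ 2) ^ (1 / 2 : ℝ) :=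
        lintegral_mul_le_sqrt _ ((Measurable.tsum hKφ).pow_const _).aemeasurable
          (((hMG.const_mul A).pow_const _).pow_const _).aemeasurable
    _ ≤ (A * ∫⁻ x, g x ^ (1 / 2 : ℝ)) ^ (1 / 2 : ℝ) *
        (A ^ (q - 1) * B * ∫⁻ x, g x ^ (1 / 2 : ℝ)) ^ (1 / 2 : ℝ) := by
        simp_rw [sq_sqrt_ennreal]
        exact mul_le_mul' (ENNReal.rpow_le_rpow hone (by norm_num))
          (ENNReal.rpow_le_rpow htwo (by norm_num))
    _ = A ^ (1 / 2 : ℝ) * (A ^ (q - 1) * B) ^ (1 / 2 : ℝ) * ∫⁻ x, g x ^ (1 / 2 : ℝ) := by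
        rw [ENNReal.mul_rpow_of_nonneg _ _ (by norm_num),
          ENNReal.mul_rpow_of_nonneg (A ^ (q - 1) * B) _ (by norm_num)]
        rw [mul_mul_mul_comm, ← sq, sq_sqrt_ennreal]
    _ ≤ _ := mul_le_mul_left le_self_add _

/-! ### Dyadic cubes -/

theorem mem_dcube_self {N : ℕ} (c : Fin N → ℝ) (l : ℤ) (x : Fin N → ℝ) : x ∈ dcube c l x :=
  fun _ => rfl

theorem mem_dcube_comm {N : ℕ} {c : Fin N → ℝ} {l : ℤ} {x y : Fin N → ℝ} :
    y ∈ dcube c l x ↔ x ∈ dcube c l y :=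
  ⟨fun h i => (h i).symm, fun h i => (h i).symm⟩

theorem dcube_eq_of_mem {N : ℕ} {c : Fin N → ℝ} {l : ℤ} {x y : Fin N → ℝ}
    (h : y ∈ dcube c l x) : dcube c l y = dcube c l x := by
  ext z
  exact forall_congr' fun i => by rw [h i]

theorem dcube_eq_pi {N : ℕ} (c : Fin N → ℝ) (l : ℤ) (x : Fin N → ℝ) :
    dcube c l x = Set.univ.pi fun i =>
      Set.Ico (c i + 2 ^ l * (⌊(x i - c i) / 2 ^ l⌋ : ℝ))
        (c i + 2 ^ l * (⌊(x i - c i) / 2 ^ l⌋ : ℝ) + 2 ^ l) := by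
  have h2 : (0 : ℝ) < 2 ^ l := by positivity
  ext y
  simp only [dcube, Set.mem_ofPred_eq, Set.mem_univ_pi, Set.mem_Ico]
  refine forall_congr' fun i => ?_
  rw [Int.floor_eq_iff, le_div_iff₀ h2, div_lt_iff₀ h2]
  constructor <;> rintro ⟨h, h'⟩ <;> constructor <;> linarith

theorem measurableSet_dcube {N : ℕ} (c : Fin N → ℝ) (l : ℤ) (x : Fin N → ℝ) :
    MeasurableSet (dcube c l x) := by
  rw [dcube_eq_pi]
  exact MeasurableSet.univ_pi fun i => measurableSet_Ico

theorem ofReal_two_zpow_pow (N : ℕ) (l : ℤ) :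
    ENNReal.ofReal ((2 : ℝ) ^ l) ^ N = 2 ^ ((l : ℝ) * N) := by
  rw [← Real.rpow_intCast, ← ENNReal.ofReal_rpow_of_pos (by norm_num), ← ENNReal.rpow_natCast,
    ← ENNReal.rpow_mul]
  norm_num

theorem volume_dcube {N : ℕ} (c : Fin N → ℝ) (l : ℤ) (x : Fin N → ℝ) :
    volume (dcube c l x) = 2 ^ ((l : ℝ) * N) := by
  rw [dcube_eq_pi, volume_pi_pi]
  simp [ofReal_two_zpow_pow]

theorem norm_sub_le_of_mem_dcube {N : ℕ} {c : Fin N → ℝ} {l : ℤ} {x y : Fin N → ℝ}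
    (h : y ∈ dcube c l x) : ‖y - x‖ ≤ 2 ^ l := by
  have h2 : (0 : ℝ) < 2 ^ l := by positivity
  rw [pi_norm_le_iff_of_nonneg h2.le]
  intro i
  have hx := mem_dcube_self c l x
  rw [dcube_eq_pi] at h hx
  have h1 := h i trivial
  have h3 := hx i trivial
  simp only [Set.mem_Ico] at h1 h3
  rw [Pi.sub_apply, Real.norm_eq_abs, abs_le]
  constructor <;> linarith

/-- The function `β` is constant on the cubes of sidelength `2^l` with offset `c`. -/
def DConst {N : ℕ} {α : Type*} (c : Fin N → ℝ) (l : ℤ) (β : (Fin N → ℝ) → α) : Prop :=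
  ∀ x y, y ∈ dcube c l x → β y = β x

/-! ### `ℓ²`-valued bounds for convolutions of functions constant on cubes -/

theorem lintegral_kr_mul_le_rpow {N : ℕ} {a r : ℝ} (ha : 0 ≤ a) (hr : 0 < r) (hr1 : r < 1)
    (l : ℤ) (e : ℕ) (c : Fin N → ℝ) {β : (Fin N → ℝ) → ℝ≥0∞} (hβ : Measurable β)
    (hc : DConst c l β) (x : Fin N → ℝ) :
    ∫⁻ y, kr N a (l + e) (x - y) * β y ≤ 2 ^ (a * (1 - r)) * 2 ^ (e * N * ((1 - r) / r)) *
      (∫⁻ y, kr N (a * r) (l + e) (x - y) * β y ^ r) ^ (1 / r) := by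
  set b : (Fin N → ℝ) → ℝ≥0∞ := fun y => kr N a (l + e) (x - y) * β y with hb
  have hkm : ∀ a, Measurable fun y => kr N a (l + e) (x - y) := fun a =>
    (measurable_kr N a (l + e)).comp (measurable_const.sub measurable_id)
  have hbm : Measurable b := (hkm a).mul hβ
  set I := ∫⁻ y, b y ^ r with hI
  have hle : (2 : ℝ) ^ l ≤ 2 ^ (l + e) := zpow_le_zpow_right₀ (by norm_num) (by omega)
  have hloc : ∀ y, b y ^ r ≤ 2 ^ (a * r) * 2 ^ (-((l : ℝ) * N)) * I := by
    intro y
    have h1 : ∀ y' ∈ dcube c l y, b y ^ r ≤ 2 ^ (a * r) * b y' ^ r := by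
      intro y' hy'
      rw [ENNReal.rpow_mul, ← ENNReal.mul_rpow_of_nonneg _ _ hr.le]
      refine ENNReal.rpow_le_rpow ?_ hr.le
      simp only [hb]
      rw [hc y y' hy', ← mul_assoc]
      refine mul_le_mul_left (kr_shift ha ?_) _
      rw [sub_sub_sub_cancel_left]
      exact (norm_sub_le_of_mem_dcube hy').trans hle
    have h2 : b y ^ r * 2 ^ ((l : ℝ) * N) ≤ 2 ^ (a * r) * I := by
      calc b y ^ r * 2 ^ ((l : ℝ) * N) = ∫⁻ _ in dcube c l y, b y ^ r := by
            rw [setLIntegral_const, volume_dcube]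
        _ ≤ ∫⁻ y' in dcube c l y, 2 ^ (a * r) * b y' ^ r :=
            setLIntegral_mono' (measurableSet_dcube c l y) h1
        _ ≤ ∫⁻ y', 2 ^ (a * r) * b y' ^ r := setLIntegral_le_lintegral _ _
        _ = _ := lintegral_const_mul _ (hbm.pow_const r)
    calc b y ^ r = (b y ^ r * 2 ^ ((l : ℝ) * N)) * 2 ^ (-((l : ℝ) * N)) := by
          rw [mul_assoc, ← two_rpow_add]; simp
      _ ≤ 2 ^ (a * r) * I * 2 ^ (-((l : ℝ) * N)) := mul_le_mul_left h2 _
      _ = _ := by ring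
  have hIJ : I = 2 ^ (((l + e : ℤ) : ℝ) * N * (1 - r)) *
      ∫⁻ y, kr N (a * r) (l + e) (x - y) * β y ^ r := by
    rw [hI, ← lintegral_const_mul' _ _ (two_rpow_ne_top _)]
    refine lintegral_congr fun y => ?_
    rw [hb, ENNReal.mul_rpow_of_nonneg _ _ hr.le, kr_rpow _ _ hr.le, mul_assoc]
  have h1r : 0 ≤ (1 - r) / r := div_nonneg (by linarith) hr.le
  calc ∫⁻ y, b y ≤ ∫⁻ y, b y ^ r * (2 ^ (a * r) * 2 ^ (-((l : ℝ) * N)) * I) ^ ((1 - r) / r) := by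
        refine lintegral_mono fun y => ?_
        calc b y = b y ^ r * b y ^ (1 - r) := by
              rw [← ENNReal.rpow_add_of_nonneg _ _ hr.le (by linarith)]; simp
          _ ≤ _ := by
              refine mul_le_mul_right ?_ _
              calc b y ^ (1 - r) = (b y ^ r) ^ ((1 - r) / r) := by
                    rw [← ENNReal.rpow_mul]; congr 1; field_simp
                _ ≤ _ := ENNReal.rpow_le_rpow (hloc y) h1r
    _ = I * (2 ^ (a * r) * 2 ^ (-((l : ℝ) * N)) * I) ^ ((1 - r) / r) := by
        rw [lintegral_mul_const _ (hbm.pow_const r)]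
    _ = (2 ^ (a * r) * 2 ^ (-((l : ℝ) * N))) ^ ((1 - r) / r) * I ^ (1 / r) := by
        rw [ENNReal.mul_rpow_of_nonneg _ _ h1r, mul_left_comm]
        congr 1
        have : I ^ (1 / r) = I ^ (1 + (1 - r) / r) := by congr 1; field_simp; ring
        rw [this, ENNReal.rpow_add_of_nonneg _ _ zero_le_one h1r, ENNReal.rpow_one]
    _ = _ := by
        rw [hIJ, ← two_rpow_add, ENNReal.mul_rpow_of_nonneg _ _ (by positivity),
          ← ENNReal.rpow_mul, ← ENNReal.rpow_mul, ← mul_assoc, ← two_rpow_add, ← two_rpow_add]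
        congr 2
        push_cast
        field_simp
        ring

/-- The `L¹(ℓ²)` bound for convolutions at scale `2^{l+e}` of functions constant on cubes of
sidelength `2^l`. -/
theorem lintegral_conv_le {N : ℕ} (hN : 0 < N) : ∃ C : ℝ≥0∞, C ≠ ⊤ ∧ ∀ (ι : Type) [Countable ι]
    (c : ι → Fin N → ℝ) (l : ι → ℤ) (e : ℕ) (β : ι → (Fin N → ℝ) → ℝ≥0∞),
    (∀ i, Measurable (β i)) → (∀ i, DConst (c i) (l i) (β i)) →
    ∫⁻ x, (∑' i, (∫⁻ y, kr N (N + 1) (l i + e) (x - y) * β i y) ^ 2) ^ (1 / 2 : ℝ) ≤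
      C * 2 ^ ((e : ℝ) / 4) * ∫⁻ x, (∑' i, β i x ^ 2) ^ (1 / 2 : ℝ) := by
  have hN' : (1 : ℝ) ≤ N := by exact_mod_cast hN
  set r : ℝ := 4 * N / (4 * N + 1) with hr
  have hr0 : 0 < r := by positivity
  have hr1 : r < 1 := by rw [hr, div_lt_one (by positivity)]; linarith
  have hrr : (1 - r) / r = 1 / (4 * N) := by rw [hr]; field_simp; ring
  set a : ℝ := (N + 1) * r with ha
  have haN : (N : ℝ) < a := by
    rw [ha, hr, ← mul_div_assoc, lt_div_iff₀ (by positivity)]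
    nlinarith
  set A : ℝ≥0∞ := krConst N a * (1 + ENNReal.ofReal (2 ^ N)) with hA
  have hAt : A ≠ ⊤ := ENNReal.mul_ne_top (krConst_ne_top haN) (by simp)
  have hq : 2 < 2 / r := by rw [lt_div_iff₀ hr0]; linarith
  obtain ⟨C, hC, hvm⟩ := vector_maximal N hq hAt
  refine ⟨2 ^ (((N : ℝ) + 1) * (1 - r)) * C, ENNReal.mul_ne_top (two_rpow_ne_top _) hC, ?_⟩
  intro ι _ c l e β hβ hc
  have h := hvm ι (fun i x y => kr N a (l i + e) (x - y)) (fun i y => β i y ^ r)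
    (fun i => (measurable_kr N a (l i + e)).comp (measurable_fst.sub measurable_snd))
    (fun i g x hg => (lintegral_kr_mul_le haN _ hg x).trans
      (mul_le_mul_left (le_mul_of_one_le_right' le_self_add) _))
    (fun i y => (lintegral_kr_le haN _ y).trans (mul_le_mul_right le_add_self _))
    (fun i => (hβ i).pow_const r)
  have e1 : ∀ b : ℝ≥0∞, (b ^ r) ^ (2 / r) = b ^ 2 := fun b => by
    rw [← ENNReal.rpow_mul, mul_div_cancel₀ _ hr0.ne', ENNReal.rpow_ofNat]
  simp only [e1] at h
  set D : ℝ≥0∞ := 2 ^ (((N : ℝ) + 1) * (1 - r)) * 2 ^ ((e : ℝ) / 4) with hD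
  have hpt : ∀ x, (∑' i, (∫⁻ y, kr N (N + 1) (l i + e) (x - y) * β i y) ^ 2) ^ (1 / 2 : ℝ) ≤
      D * (∑' i, (∫⁻ y, kr N a (l i + e) (x - y) * β i y ^ r) ^ (2 / r)) ^ (1 / 2 : ℝ) := by
    intro x
    calc _ ≤ (∑' i, D ^ 2 * (∫⁻ y, kr N a (l i + e) (x - y) * β i y ^ r) ^
          (2 / r)) ^ (1 / 2 : ℝ) := by
          refine ENNReal.rpow_le_rpow (ENNReal.tsum_le_tsum fun i => ?_) (by norm_num)
          have h1 := lintegral_kr_mul_le_rpow (a := N + 1) (by positivity) hr0 hr1 (l i) e (c i)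
            (hβ i) (hc i) x
          have h2 : (e : ℝ) * N * ((1 - r) / r) = e / 4 := by rw [hrr]; field_simp
          rw [h2] at h1
          calc _ ≤ _ := pow_le_pow_left' h1 2
            _ = _ := by
              rw [mul_pow, ← ENNReal.rpow_natCast (_ ^ (1 / r)), ← ENNReal.rpow_mul]
              congr 2
              push_cast
              ring
      _ = _ := by
          rw [ENNReal.tsum_mul_left, ENNReal.mul_rpow_of_nonneg _ _ (by norm_num),
            sqrt_sq_ennreal]
  calc _ ≤ _ := lintegral_mono hpt
    _ ≤ D * (C * ∫⁻ x, (∑' i, β i x ^ 2) ^ (1 / 2 : ℝ)) := by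
        rw [lintegral_const_mul' _ _ (ENNReal.mul_ne_top (two_rpow_ne_top _) (two_rpow_ne_top _))]
        exact mul_le_mul_right h _
    _ = _ := by rw [hD]; ring

/-! ### A domination inequality for nested lattices -/

/-- The layers of the generalized lattice with offsets `c` are nested. -/
def Nested {N : ℕ} (c : ℤ → Fin N → ℝ) : Prop :=
  ∀ k l, k ≤ l → ∀ x, dcube (c k) k x ⊆ dcube (c l) l x

theorem DConst.mono {N : ℕ} {α : Type*} {c : ℤ → Fin N → ℝ} (hc : Nested c) {k l : ℤ}
    (hkl : k ≤ l) {β : (Fin N → ℝ) → α} (h : DConst (c l) l β) : DConst (c k) k β :=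
  fun x y hy => h x y (hc k l hkl x hy)

theorem measurableSet_mem_dcube {N : ℕ} (c : Fin N → ℝ) (l : ℤ) :
    MeasurableSet {p : (Fin N → ℝ) × (Fin N → ℝ) | p.2 ∈ dcube c l p.1} := by
  have : {p : (Fin N → ℝ) × (Fin N → ℝ) | p.2 ∈ dcube c l p.1} =
      ⋂ i, {p | ⌊(p.2 i - c i) / (2 : ℝ) ^ l⌋ = ⌊(p.1 i - c i) / (2 : ℝ) ^ l⌋} := by
    ext p
    simp [dcube]
  rw [this]
  exact MeasurableSet.iInter fun i => measurableSet_eq_fun (by fun_prop) (by fun_prop)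

theorem two_mul_le_sq_add_sq_ennreal (u v : ℝ≥0∞) : 2 * (u * v) ≤ u ^ 2 + v ^ 2 := by
  rcases eq_or_ne u ⊤ with rfl | hu
  · simp
  rcases eq_or_ne v ⊤ with rfl | hv
  · simp
  lift u to NNReal using hu
  lift v to NNReal using hv
  have := two_mul_le_add_sq u v
  rw [mul_assoc] at this
  exact_mod_cast this

theorem mul_rpow_neg_half_add_le {d s' : ℝ≥0∞} (h : d + s' ≠ ⊤) :
    d * (d + s') ^ (-(1 / 2 : ℝ)) + 2 * s' ^ (1 / 2 : ℝ) ≤ 2 * (d + s') ^ (1 / 2 : ℝ) := by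
  set s := d + s' with hs
  rcases eq_or_ne s 0 with h0 | h0
  · have h1 : d = 0 ∧ s' = 0 := by simpa [hs] using h0
    simp [h1.1, h1.2]
  set u := s ^ (1 / 2 : ℝ) with hu
  set v := s' ^ (1 / 2 : ℝ) with hv
  have hu0 : u ≠ 0 := by simp [hu, h0, h]
  have hut : u ≠ ⊤ := ENNReal.rpow_ne_top_of_nonneg (by norm_num) h
  have hu2 : u ^ 2 = d + v ^ 2 := by rw [hu, hv, sq_sqrt_ennreal, sq_sqrt_ennreal]
  rw [ENNReal.rpow_neg, ← hu]
  have h1 : u * (d * u⁻¹ + 2 * v) ≤ u * (2 * u) := by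
    calc u * (d * u⁻¹ + 2 * v) = d * (u * u⁻¹) + 2 * (u * v) := by ring
      _ ≤ d + (u ^ 2 + v ^ 2) := by
        rw [ENNReal.mul_inv_cancel hu0 hut, mul_one]
        exact add_le_add le_rfl (two_mul_le_sq_add_sq_ennreal u v)
      _ = u * (2 * u) := by
        have : u * (2 * u) = u ^ 2 + u ^ 2 := by ring
        rw [this]
        nth_rewrite 3 [hu2]
        ring
  exact (ENNReal.mul_le_mul_iff_right hu0 hut).1 h1

theorem tsum_mul_rpow_neg_half_le (d s : ℤ → ℝ≥0∞) (S : ℝ≥0∞) (hS : S ≠ ⊤)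
    (hs : ∀ k, s k = d k + s (k + 1)) (hsS : ∀ k, s k ≤ S) :
    ∑' k, d k * s k ^ (-(1 / 2 : ℝ)) ≤ 2 * S ^ (1 / 2 : ℝ) := by
  have hfin : ∀ (b : ℤ) (m : ℕ), ∑ j ∈ Finset.range m, d (b - j) * s (b - j) ^ (-(1 / 2 : ℝ)) +
      2 * s (b + 1) ^ (1 / 2 : ℝ) ≤ 2 * s (b + 1 - m) ^ (1 / 2 : ℝ) := by
    intro b m
    induction m with
    | zero => simp
    | succ m ih =>
      rw [Finset.sum_range_succ, add_right_comm]
      refine (add_le_add ih le_rfl).trans ?_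
      have h1 := mul_rpow_neg_half_add_le (d := d (b - m)) (s' := s (b - m + 1))
        (by rw [← hs]; exact ne_top_of_le_ne_top hS (hsS _))
      rw [← hs, add_comm] at h1
      have e1 : b + 1 - m = b - m + 1 := by ring
      have e2 : b + 1 - (m + 1 : ℕ) = b - m := by push_cast; ring
      rw [e1, e2]
      exact h1
  rw [ENNReal.tsum_eq_iSup_sum]
  refine iSup_le fun T => ?_
  obtain ⟨b, hb⟩ := T.bddAbove
  obtain ⟨a, ha⟩ := T.bddBelow
  have hsub : T ⊆ (Finset.range (b - a + 1).toNat).image fun j : ℕ => b - (j : ℤ) := by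
    intro k hk
    have h1 := hb hk
    have h2 := ha hk
    rw [Finset.mem_image]
    exact ⟨(b - k).toNat, by rw [Finset.mem_range]; omega, by omega⟩
  calc ∑ k ∈ T, d k * s k ^ (-(1 / 2 : ℝ)) ≤ _ := Finset.sum_le_sum_of_subset hsub
    _ = ∑ j ∈ Finset.range (b - a + 1).toNat, d (b - j) * s (b - j) ^ (-(1 / 2 : ℝ)) :=
      Finset.sum_image fun i _ j _ h => by simpa using h
    _ ≤ _ := le_self_add.trans (hfin b _)
    _ ≤ _ := mul_le_mul_right (ENNReal.rpow_le_rpow (hsS _) (by norm_num)) _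

theorem lintegral_mul_le_of_dconst {N : ℕ} {c : Fin N → ℝ} {k : ℤ} {lam : ℝ≥0∞}
    {W Φ : (Fin N → ℝ) → ℝ≥0∞} (hW : Measurable W) (hΦ : Measurable Φ) (hc : DConst c k Φ)
    (havg : ∀ x, ∫⁻ y in dcube c k x, W y ≤ lam * 2 ^ ((k : ℝ) * N)) :
    ∫⁻ x, W x * Φ x ≤ lam * ∫⁻ x, Φ x := by
  have hvol : ∀ x, Φ x = 2 ^ (-((k : ℝ) * N)) * ∫⁻ y in dcube c k x, Φ y := by
    intro x
    have : ∫⁻ y in dcube c k x, Φ y = ∫⁻ _ in dcube c k x, Φ x :=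
      setLIntegral_congr_fun (measurableSet_dcube c k x) fun y hy => hc x y hy
    rw [this, setLIntegral_const, volume_dcube, mul_left_comm, ← two_rpow_add]
    simp
  set J : (Fin N → ℝ) × (Fin N → ℝ) → ℝ≥0∞ :=
    {p : (Fin N → ℝ) × (Fin N → ℝ) | p.2 ∈ dcube c k p.1}.indicator 1 with h1
  have h1m : Measurable J := measurable_one.indicator (measurableSet_mem_dcube c k)
  have hset : ∀ (g : (Fin N → ℝ) → ℝ≥0∞) x, ∫⁻ y in dcube c k x, g y = ∫⁻ y, J (x, y) * g y := by
    intro g x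
    rw [← lintegral_indicator (measurableSet_dcube c k x)]
    refine lintegral_congr fun y => ?_
    by_cases h : y ∈ dcube c k x <;> simp [h1, h]
  have hsymm : ∀ x y, J (x, y) = J (y, x) := by
    intro x y
    by_cases h : y ∈ dcube c k x
    · simp [h1, h, mem_dcube_comm.1 h]
    · simp [h1, h, mt mem_dcube_comm.1 h]
  have hm : Measurable fun p : (Fin N → ℝ) × (Fin N → ℝ) => W p.1 * (J p * Φ p.2) := by fun_prop
  calc ∫⁻ x, W x * Φ x = ∫⁻ x, 2 ^ (-((k : ℝ) * N)) * ∫⁻ y, W x * (J (x, y) * Φ y) := by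
        refine lintegral_congr fun x => ?_
        rw [lintegral_const_mul _ (by fun_prop), ← hset Φ x, mul_left_comm, ← hvol x]
    _ = 2 ^ (-((k : ℝ) * N)) * ∫⁻ y, ∫⁻ x, W x * (J (x, y) * Φ y) := by
        rw [lintegral_const_mul' _ _ (two_rpow_ne_top _), lintegral_lintegral_swap hm.aemeasurable]
    _ = 2 ^ (-((k : ℝ) * N)) * ∫⁻ y, (∫⁻ x in dcube c k y, W x) * Φ y := by
        congr 1
        refine lintegral_congr fun y => ?_
        rw [hset W y, ← lintegral_mul_const _ (by fun_prop)]
        refine lintegral_congr fun x => ?_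
        rw [hsymm x y]
        ring
    _ ≤ 2 ^ (-((k : ℝ) * N)) * ∫⁻ y, (lam * 2 ^ ((k : ℝ) * N)) * Φ y :=
        mul_le_mul_right (lintegral_mono fun y => mul_le_mul_left (havg y) _) _
    _ = _ := by
        rw [lintegral_const_mul _ hΦ, ← mul_assoc, mul_left_comm, ← two_rpow_add]
        simp

/-- Weights with small averages on the cubes where the other factor is constant. -/
theorem lintegral_sqrt_tsum_mul_le {N : ℕ} {c : ℤ → Fin N → ℝ} (hc : Nested c) {ι : Type*}
    [Countable ι] (k : ι → ℤ) (W D : ι → (Fin N → ℝ) → ℝ≥0∞) (lam : ℝ≥0∞)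
    (hW : ∀ i, Measurable (W i)) (hD : ∀ i, Measurable (D i))
    (hDc : ∀ i, DConst (c (k i)) (k i) (D i))
    (havg : ∀ i x, ∫⁻ y in dcube (c (k i)) (k i) x, W i y ≤ lam * 2 ^ ((k i : ℝ) * N)) :
    ∫⁻ x, (∑' i, W i x * D i x) ^ (1 / 2 : ℝ) ≤
      (2 * lam) ^ (1 / 2 : ℝ) * ∫⁻ x, (∑' i, D i x) ^ (1 / 2 : ℝ) := by
  set S : (Fin N → ℝ) → ℝ≥0∞ := fun x => ∑' i, D i x with hS
  have hSm : Measurable S := Measurable.tsum hD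
  rcases eq_or_ne lam 0 with rfl | hlam
  · have h0 : ∀ i, W i =ᵐ[volume] 0 := by
      intro i
      have h2 := lintegral_mul_le_of_dconst (hW i) (Φ := fun _ => 1) measurable_const
        (fun _ _ _ => rfl) (havg i)
      simp only [mul_one, zero_mul, nonpos_iff_eq_zero] at h2
      exact (lintegral_eq_zero_iff (hW i)).1 h2
    have h3 : (fun x => (∑' i, W i x * D i x) ^ (1 / 2 : ℝ)) =ᵐ[volume] 0 := by
      filter_upwards [ae_all_iff.2 h0] with x hx
      simp [hx]
    rw [lintegral_congr_ae h3]
    simp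
  rcases eq_or_ne (∫⁻ x, S x ^ (1 / 2 : ℝ)) ⊤ with htop | hfin
  · rw [htop, ENNReal.mul_top (by simp [hlam])]
    exact le_top
  have hSt : ∀ᵐ y, S y ≠ ⊤ := by
    filter_upwards [ae_lt_top (hSm.pow_const _) hfin] with y hy h0
    simp [h0] at hy
  set s : ℤ → (Fin N → ℝ) → ℝ≥0∞ := fun l x => ∑' i, if l ≤ k i then D i x else 0 with hs
  have hsm : ∀ l, Measurable (s l) := fun l => Measurable.tsum fun i =>
    Measurable.ite (MeasurableSet.const _) (hD i) measurable_const
  have hsc : ∀ l, DConst (c l) l (s l) := by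
    intro l x y hy
    refine tsum_congr fun i => ?_
    by_cases h : l ≤ k i
    · simp only [h, if_true]
      exact (hDc i).mono hc h x y hy
    · simp [h]
  have hsS : ∀ l x, s l x ≤ S x := fun l x => ENNReal.tsum_le_tsum fun i => by
    by_cases h : l ≤ k i <;> simp [h]
  have hDs : ∀ i x, D i x ≤ s (k i) x := fun i x => by
    have := ENNReal.le_tsum (f := fun i' => if k i ≤ k i' then D i' x else 0) i
    simpa using this
  set V : ι → (Fin N → ℝ) → ℝ≥0∞ := fun i x => D i x * s (k i) x ^ (-(1 / 2 : ℝ)) with hV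
  have hVm : ∀ i, Measurable (V i) := fun i => (hD i).mul ((hsm _).pow_const _)
  have hVc : ∀ i, DConst (c (k i)) (k i) (V i) := fun i x y hy => by
    simp only [hV]
    rw [hDc i x y hy, hsc _ x y hy]
  have hpt : ∀ᵐ x, (∑' i, W i x * D i x) ^ (1 / 2 : ℝ) ≤
      (∑' i, W i x * V i x) ^ (1 / 2 : ℝ) * (S x ^ (1 / 2 : ℝ)) ^ (1 / 2 : ℝ) := by
    filter_upwards [hSt] with x hx
    rw [← ENNReal.mul_rpow_of_nonneg _ _ (by norm_num), ← ENNReal.tsum_mul_right]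
    refine ENNReal.rpow_le_rpow (ENNReal.tsum_le_tsum fun i => ?_) (by norm_num)
    rw [mul_assoc]
    refine mul_le_mul_right ?_ _
    rcases eq_or_ne (s (k i) x) 0 with h0 | h0
    · have := hDs i x
      rw [h0, nonpos_iff_eq_zero] at this
      simp [this]
    · have ht : s (k i) x ≠ ⊤ := ne_top_of_le_ne_top hx (hsS _ _)
      calc D i x = D i x * (s (k i) x ^ (-(1 / 2 : ℝ)) * s (k i) x ^ (1 / 2 : ℝ)) := by
            rw [← ENNReal.rpow_add _ _ h0 ht]; simp
        _ = V i x * s (k i) x ^ (1 / 2 : ℝ) := by rw [hV, mul_assoc]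
        _ ≤ _ := mul_le_mul_right (ENNReal.rpow_le_rpow (hsS _ _) (by norm_num)) _
  have hsumV : ∀ᵐ x, ∑' i, V i x ≤ 2 * S x ^ (1 / 2 : ℝ) := by
    filter_upwards [hSt] with x hx
    have h1 := tsum_mul_rpow_neg_half_le (fun l => ∑' i, if l = k i then D i x else 0)
      (fun l => s l x) (S x) hx ?_ fun l => hsS l x
    · refine le_trans (le_of_eq ?_) h1
      simp_rw [← ENNReal.tsum_mul_right]
      rw [ENNReal.tsum_comm]
      refine tsum_congr fun i => ?_
      rw [tsum_eq_single (k i)]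
      · simp [hV]
      · intro l hl
        simp [hl]
    · intro l
      rw [hs, ← ENNReal.tsum_add]
      refine tsum_congr fun i => ?_
      rcases lt_trichotomy l (k i) with h | h | h
      · simp [h.le, h.ne, Int.add_one_le_iff.2 h]
      · simp [h]
      · simp [not_le.2 h, h.ne', show ¬ l + 1 ≤ k i by omega]
  have hone : ∫⁻ x, ∑' i, W i x * V i x ≤ 2 * lam * ∫⁻ x, S x ^ (1 / 2 : ℝ) := by
    rw [lintegral_tsum fun i =>
      (show Measurable fun x => W i x * V i x from (hW i).mul (hVm i)).aemeasurable]
    calc _ ≤ ∑' i, lam * ∫⁻ x, V i x := ENNReal.tsum_le_tsum fun i =>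
          lintegral_mul_le_of_dconst (hW i) (hVm i) (hVc i) (havg i)
      _ = lam * ∫⁻ x, ∑' i, V i x := by
          rw [ENNReal.tsum_mul_left, lintegral_tsum fun i => (hVm i).aemeasurable]
      _ ≤ lam * ∫⁻ x, 2 * S x ^ (1 / 2 : ℝ) := mul_le_mul_right (lintegral_mono_ae hsumV) _
      _ = _ := by rw [lintegral_const_mul _ (hSm.pow_const _)]; ring
  calc _ ≤ ∫⁻ x, (∑' i, W i x * V i x) ^ (1 / 2 : ℝ) * (S x ^ (1 / 2 : ℝ)) ^ (1 / 2 : ℝ) :=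
        lintegral_mono_ae hpt
    _ ≤ (∫⁻ x, ((∑' i, W i x * V i x) ^ (1 / 2 : ℝ)) ^ 2) ^ (1 / 2 : ℝ) *
        (∫⁻ x, ((S x ^ (1 / 2 : ℝ)) ^ (1 / 2 : ℝ)) ^ 2) ^ (1 / 2 : ℝ) :=
        lintegral_mul_le_sqrt _ ((Measurable.tsum fun i =>
          show Measurable fun x => W i x * V i x from (hW i).mul (hVm i)).pow_const _).aemeasurable
          ((hSm.pow_const _).pow_const _).aemeasurable
    _ ≤ (2 * lam * ∫⁻ x, S x ^ (1 / 2 : ℝ)) ^ (1 / 2 : ℝ) *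
        (∫⁻ x, S x ^ (1 / 2 : ℝ)) ^ (1 / 2 : ℝ) := by
        simp_rw [sq_sqrt_ennreal]
        exact mul_le_mul_left (ENNReal.rpow_le_rpow hone (by norm_num)) _
    _ = _ := by
        rw [ENNReal.mul_rpow_of_nonneg _ _ (by norm_num), mul_assoc, ← sq, sq_sqrt_ennreal]

/-! ### The boundary weights of a dyadic lattice -/

/-- A one-periodic weight which decays away from the integers at scale `τ`. -/
def wphi (τ u : ℝ) : ℝ := τ / (τ + |u - round u|)

theorem measurable_wphi (τ : ℝ) : Measurable (wphi τ) := by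
  have h : Measurable fun u : ℝ => |u - round u| := by
    simp_rw [abs_sub_round_eq_min]
    exact measurable_fract.min (measurable_const.sub measurable_fract)
  exact measurable_const.div (measurable_const.add h)

theorem wphi_add_one (τ u : ℝ) : wphi τ (u + 1) = wphi τ u := by
  simp [wphi, round_add_one]

theorem wphi_nonneg {τ : ℝ} (hτ : 0 < τ) (u : ℝ) : 0 ≤ wphi τ u := by
  unfold wphi; positivity

theorem wphi_le_one {τ : ℝ} (hτ : 0 < τ) (u : ℝ) : wphi τ u ≤ 1 := by
  unfold wphi
  rw [div_le_one (by positivity)]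
  linarith [abs_nonneg (u - round u)]

theorem integral_sq_div_add_sq {τ : ℝ} (hτ : 0 < τ) :
    ∫ u in (0 : ℝ)..1, (τ / (τ + u)) ^ 2 ≤ τ := by
  have h1 : ∫ u in (0 : ℝ)..1, (τ / (τ + u)) ^ 2 = -(τ ^ 2 / (τ + 1)) - -(τ ^ 2 / (τ + 0)) := by
    apply intervalIntegral.integral_eq_sub_of_hasDerivAt (f := fun u => -(τ ^ 2 / (τ + u)))
    · intro u hu
      rw [Set.uIcc_of_le zero_le_one] at hu
      have h2 : τ + u ≠ 0 := by linarith [hu.1]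
      have h3 : HasDerivAt (fun u => -(τ ^ 2 / (τ + u)))
          (-((0 * (τ + u) - τ ^ 2 * 1) / (τ + u) ^ 2)) u :=
        ((hasDerivAt_const u (τ ^ 2)).div ((hasDerivAt_id u).const_add τ) h2).neg
      refine h3.congr_deriv ?_
      rw [div_pow]
      ring
    · apply ContinuousOn.intervalIntegrable
      rw [Set.uIcc_of_le zero_le_one]
      refine (continuousOn_const.div (by fun_prop) fun u hu => ?_).pow 2
      have := hu.1
      positivity
  rw [h1]
  have : τ ^ 2 / (τ + 0) = τ := by field_simp; ring
  rw [this]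
  have : 0 ≤ τ ^ 2 / (τ + 1) := by positivity
  linarith

theorem wphi_periodic_scaled (τ : ℝ) {T : ℝ} (hT : 0 < T) :
    Function.Periodic (fun v => wphi τ (v / T) ^ 2) T := by
  intro v
  simp only
  rw [add_div, div_self hT.ne', wphi_add_one]

theorem intervalIntegrable_wphi_sq {τ : ℝ} (hτ : 0 < τ) (T a b : ℝ) :
    IntervalIntegrable (fun v => wphi τ (v / T) ^ 2) volume a b := by
  have hm : Measurable fun v : ℝ => wphi τ (v / T) ^ 2 :=
    ((measurable_wphi τ).comp (measurable_id.div_const T)).pow_const 2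
  rw [intervalIntegrable_iff]
  refine Measure.integrableOn_of_bounded (M := 1) (by simp) hm.aestronglyMeasurable ?_
  filter_upwards with v
  rw [Real.norm_of_nonneg (by positivity)]
  have h1 := wphi_le_one hτ (v / T)
  have h2 := wphi_nonneg hτ (v / T)
  nlinarith

theorem integral_wphi_sq_le {τ : ℝ} (hτ : 0 < τ) {T : ℝ} (hT : 0 < T) (a : ℝ) :
    ∫ v in a..(a + T), wphi τ (v / T) ^ 2 ≤ 2 * τ * T := by
  rw [(wphi_periodic_scaled τ hT).intervalIntegral_add_eq a 0, zero_add,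
    intervalIntegral.integral_comp_div (fun u => wphi τ u ^ 2) hT.ne', zero_div, div_self hT.ne',
    smul_eq_mul, mul_comm]
  refine mul_le_mul_of_nonneg_right ?_ hT.le
  have hc : ∀ u ∈ Set.Icc (0 : ℝ) 1, 0 ≤ u → τ + u ≠ 0 := fun u _ h => by positivity
  have hi1 : IntervalIntegrable (fun u => (τ / (τ + u)) ^ 2) volume 0 1 := by
    apply ContinuousOn.intervalIntegrable
    rw [Set.uIcc_of_le zero_le_one]
    refine (continuousOn_const.div (by fun_prop) fun u hu => ?_).pow 2
    have := hu.1
    positivity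
  have hi2 : IntervalIntegrable (fun u => (τ / (τ + (1 - u))) ^ 2) volume 0 1 := by
    apply ContinuousOn.intervalIntegrable
    rw [Set.uIcc_of_le zero_le_one]
    refine (continuousOn_const.div (by fun_prop) fun u hu => ?_).pow 2
    have := hu.2
    have : 0 ≤ 1 - u := by linarith
    positivity
  have hi0 : IntervalIntegrable (fun u => wphi τ u ^ 2) volume 0 1 := by
    simpa using intervalIntegrable_wphi_sq hτ 1 0 1
  calc ∫ u in (0 : ℝ)..1, wphi τ u ^ 2
      ≤ ∫ u in (0 : ℝ)..1, ((τ / (τ + u)) ^ 2 + (τ / (τ + (1 - u))) ^ 2) := by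
        refine intervalIntegral.integral_mono_on_of_le_Ioo zero_le_one hi0 (hi1.add hi2) ?_
        intro u hu
        have hf : Int.fract u = u := Int.fract_eq_self.2 ⟨hu.1.le, hu.2⟩
        unfold wphi
        rw [abs_sub_round_eq_min, hf]
        rcases min_choice u (1 - u) with h | h <;> rw [h]
        · exact le_add_of_nonneg_right (by positivity)
        · exact le_add_of_nonneg_left (by positivity)
    _ = (∫ u in (0 : ℝ)..1, (τ / (τ + u)) ^ 2) + ∫ u in (0 : ℝ)..1, (τ / (τ + (1 - u))) ^ 2 :=
        intervalIntegral.integral_add hi1 hi2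
    _ ≤ τ + τ := by
        rw [intervalIntegral.integral_comp_sub_left (fun u => (τ / (τ + u)) ^ 2) 1]
        simp only [sub_self, sub_zero]
        exact add_le_add (integral_sq_div_add_sq hτ) (integral_sq_div_add_sq hτ)
    _ = 2 * τ := by ring

theorem lintegral_wphi_sq_le {τ : ℝ} (hτ : 0 < τ) {T : ℝ} (hT : 0 < T) (a : ℝ) :
    ∫⁻ v in Set.Ioc a (a + T), ENNReal.ofReal (wphi τ (v / T)) ^ 2 ≤
      ENNReal.ofReal (2 * τ * T) := by
  have h1 := integral_wphi_sq_le hτ hT a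
  rw [intervalIntegral.integral_of_le (by linarith)] at h1
  have h2 := (intervalIntegrable_wphi_sq hτ T a (a + T)).1
  calc _ = ∫⁻ v in Set.Ioc a (a + T), ENNReal.ofReal (wphi τ (v / T) ^ 2) :=
        lintegral_congr fun v => (ENNReal.ofReal_pow (wphi_nonneg hτ _) 2).symm
    _ = ENNReal.ofReal (∫ v in Set.Ioc a (a + T), wphi τ (v / T) ^ 2) :=
        (ofReal_integral_eq_lintegral_ofReal h2 (ae_of_all _ fun v => by positivity)).symm
    _ ≤ _ := ENNReal.ofReal_le_ofReal h1

theorem lintegral_Ioc_nat_eq_sum (g : ℝ → ℝ≥0∞) (a : ℝ) {T : ℝ} (hT : 0 ≤ T) (m : ℕ) :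
    ∫⁻ v in Set.Ioc a (a + m * T), g v =
      ∑ j ∈ Finset.range m, ∫⁻ v in Set.Ioc (a + j * T) (a + j * T + T), g v := by
  induction m with
  | zero => simp
  | succ m ih =>
    rw [Finset.sum_range_succ, ← ih, ← lintegral_union measurableSet_Ioc, Set.Ioc_union_Ioc_eq_Ioc]
    · congr 3
      push_cast
      ring
    · have : 0 ≤ m * T := by positivity
      linarith
    · linarith
    · rw [Set.disjoint_left]
      intro v h1 h2
      exact absurd h1.2 (not_le.2 h2.1)

theorem lintegral_comp_sub_left_Ico (g : ℝ → ℝ≥0∞) (x a b : ℝ) :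
    ∫⁻ u in Set.Ico a b, g (x - u) = ∫⁻ v in Set.Ioc (x - b) (x - a), g v := by
  rw [← lintegral_indicator measurableSet_Ico, ← lintegral_indicator measurableSet_Ioc,
    ← lintegral_sub_left_eq_self ((Set.Ioc (x - b) (x - a)).indicator g) x]
  refine lintegral_congr fun u => ?_
  by_cases h : u ∈ Set.Ico a b
  · rw [Set.indicator_of_mem h, Set.indicator_of_mem (Set.mem_Ioc.2
      ⟨by linarith [h.2], by linarith [h.1]⟩)]
  · rw [Set.indicator_of_notMem h, Set.indicator_of_notMem fun h' =>
      h ⟨by linarith [h'.2], by linarith [h'.1]⟩]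

/-! ### Random offsets -/

/-- The sum of the first `l` binary digits of `v`, in reversed order. -/
def bitSum (l : ℕ) (v : ℝ) : ℝ :=
  ∑ j ∈ Finset.range l, (if ⌊v * 2 ^ (j + 1)⌋ % 2 = 1 then (2 : ℝ) ^ j else 0)

theorem randOffset1_eq (u v : ℝ) (k : ℤ) : randOffset1 u v k = u - 1 - bitSum k.toNat v := rfl

theorem measurable_bitSum (l : ℕ) : Measurable (bitSum l) := by
  refine Finset.measurable_fun_sum _ fun j _ => ?_
  refine Measurable.ite ?_ measurable_const measurable_const
  have : Measurable fun v : ℝ => ⌊v * 2 ^ (j + 1)⌋ % 2 :=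
    (measurable_of_countable fun m : ℤ => m % 2).comp (Int.measurable_floor.comp (by fun_prop))
  exact this (measurableSet_singleton 1)

theorem bitSum_succ (l : ℕ) {v : ℝ} (hv : v ∈ Set.Ico (0 : ℝ) 1) (b : ℕ) (hb : b < 2) :
    bitSum (l + 1) ((v + b) / 2) = b + 2 * bitSum l v := by
  unfold bitSum
  rw [Finset.sum_range_succ', Finset.mul_sum, add_comm]
  have hfl : ⌊v⌋ = 0 := Int.floor_eq_zero_iff.2 hv
  congr 1
  · have : (v + b) / 2 * 2 ^ (0 + 1) = v + (b : ℤ) := by push_cast; ring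
    rw [this, Int.floor_add_intCast, hfl]
    interval_cases b <;> simp
  · refine Finset.sum_congr rfl fun j _ => ?_
    have : (v + b) / 2 * 2 ^ (j + 1 + 1) = v * 2 ^ (j + 1) + ((2 * (b * 2 ^ j) : ℤ) : ℝ) := by
      push_cast; ring
    rw [this, Int.floor_add_intCast]
    have h2 : (⌊v * 2 ^ (j + 1)⌋ + 2 * ((b : ℤ) * 2 ^ j)) % 2 = ⌊v * 2 ^ (j + 1)⌋ % 2 := by omega
    rw [h2]
    split_ifs <;> ring

theorem lintegral_Ico_halves (g : ℝ → ℝ≥0∞) :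
    ∫⁻ v in Set.Ico (0 : ℝ) 1, g v =
      2⁻¹ * ((∫⁻ v in Set.Ico (0 : ℝ) 1, g ((v + (0 : ℕ)) / 2)) +
        ∫⁻ v in Set.Ico (0 : ℝ) 1, g ((v + (1 : ℕ)) / 2)) := by
  have key : ∀ b : ℕ, 2⁻¹ * ∫⁻ v in Set.Ico (0 : ℝ) 1, g ((v + b) / 2) =
      ∫⁻ v in Set.Ico ((b : ℝ) / 2) ((b + 1) / 2), g v := by
    intro b
    rw [← lintegral_indicator measurableSet_Ico, ← lintegral_indicator measurableSet_Ico]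
    have h1 : ∫⁻ v, (Set.Ico ((b : ℝ) / 2) ((b + 1) / 2)).indicator g ((2 : ℝ)⁻¹ • v) =
        2 * ∫⁻ v, (Set.Ico ((b : ℝ) / 2) ((b + 1) / 2)).indicator g v := by
      have h5 := (Homeomorph.smulOfNeZero (2 : ℝ)⁻¹ (by norm_num)).measurableEmbedding.lintegral_map
        (μ := (volume : Measure ℝ)) ((Set.Ico ((b : ℝ) / 2) ((b + 1) / 2)).indicator g)
      have h4 := Measure.map_addHaar_smul (volume : Measure ℝ) (r := (2 : ℝ)⁻¹) (by norm_num)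
      refine h5.symm.trans ?_
      refine (congrArg (fun m => ∫⁻ v, (Set.Ico ((b : ℝ) / 2) ((b + 1) / 2)).indicator g v ∂m)
        h4).trans ?_
      simp only [lintegral_smul_measure]
      norm_num
    have h2 := lintegral_add_right_eq_self (μ := (volume : Measure ℝ))
      (fun v => (Set.Ico ((b : ℝ) / 2) ((b + 1) / 2)).indicator g ((2 : ℝ)⁻¹ • v)) (b : ℝ)
    have h3 : ∫⁻ v, (Set.Ico (0 : ℝ) 1).indicator (fun v => g ((v + b) / 2)) v =
        ∫⁻ v, (Set.Ico ((b : ℝ) / 2) ((b + 1) / 2)).indicator g ((2 : ℝ)⁻¹ • (v + b)) := by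
      refine lintegral_congr fun v => ?_
      have e : (2 : ℝ)⁻¹ • (v + b) = (v + b) / 2 := by rw [smul_eq_mul]; ring
      rw [e]
      by_cases h : v ∈ Set.Ico (0 : ℝ) 1
      · rw [Set.indicator_of_mem h, Set.indicator_of_mem
          (Set.mem_Ico.2 ⟨by linarith [h.1], by linarith [h.2]⟩)]
      · rw [Set.indicator_of_notMem h, Set.indicator_of_notMem fun h' =>
          h ⟨by linarith [h'.1], by linarith [h'.2]⟩]
    rw [h3, h2, h1]
    rw [← mul_assoc, ENNReal.inv_mul_cancel (by norm_num) (by norm_num), one_mul]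
  rw [mul_add, key, key, ← lintegral_union measurableSet_Ico]
  · norm_num
  · rw [Set.disjoint_left]
    intro v h1 h2
    have h3 := h1.2
    have h4 := h2.1
    norm_num at h3 h4
    linarith

theorem lintegral_bitSum (l : ℕ) (G : ℝ → ℝ≥0∞) :
    ∫⁻ v in Set.Ico (0 : ℝ) 1, G (bitSum l v) =
      2⁻¹ ^ l * ∑ a ∈ Finset.range (2 ^ l), G a := by
  induction l generalizing G with
  | zero => simp [bitSum]
  | succ l ih =>
    rw [lintegral_Ico_halves]
    have h : ∀ b : ℕ, b < 2 → ∫⁻ v in Set.Ico (0 : ℝ) 1, G (bitSum (l + 1) ((v + b) / 2)) =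
        2⁻¹ ^ l * ∑ a ∈ Finset.range (2 ^ l), G (b + 2 * a) := by
      intro b hb
      rw [← ih fun s => G (b + 2 * s)]
      refine setLIntegral_congr_fun measurableSet_Ico fun v hv => ?_
      rw [bitSum_succ l hv b hb]
    rw [h 0 (by norm_num), h 1 (by norm_num), ← mul_add, ← mul_assoc, ← Finset.sum_add_distrib,
      pow_succ' 2⁻¹ l, pow_succ 2 l, mul_comm (2 ^ l) 2]
    congr 1
    have : ∀ m : ℕ, ∑ a ∈ Finset.range (2 * m), G a =
        ∑ a ∈ Finset.range m, (G ((0 : ℕ) + 2 * a) + G ((1 : ℕ) + 2 * a)) := by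
      intro m
      induction m with
      | zero => simp
      | succ m ih =>
        rw [show 2 * (m + 1) = 2 * m + 1 + 1 by ring, Finset.sum_range_succ,
          Finset.sum_range_succ, Finset.sum_range_succ, ih, add_assoc]
        congr 2 <;> (push_cast; ring_nf)
    rw [this]

/-- The random offset at scale `2^l` is equidistributed modulo `2^l`. -/
theorem lintegral_randOffset1_le (l : ℤ) {g : ℝ → ℝ≥0∞} {B : ℝ≥0∞}
    (hB : ∀ a, ∫⁻ v in Set.Ioc a (a + (2 : ℝ) ^ l), g v ≤ B) (x : ℝ) :
    ∫⁻ v in Set.Ico (0 : ℝ) 1, ∫⁻ u in Set.Ico (0 : ℝ) 1, g (x - randOffset1 u v l) ≤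
      2 ^ (-(l : ℝ)) * B := by
  have h1 : ∀ v, ∫⁻ u in Set.Ico (0 : ℝ) 1, g (x - randOffset1 u v l) =
      ∫⁻ s in Set.Ioc (x + bitSum l.toNat v) (x + bitSum l.toNat v + 1), g s := by
    intro v
    have : ∀ u, x - randOffset1 u v l = (x + 1 + bitSum l.toNat v) - u := fun u => by
      rw [randOffset1_eq]; ring
    simp_rw [this]
    rw [lintegral_comp_sub_left_Ico]
    congr 3 <;> ring
  simp_rw [h1]
  rw [lintegral_bitSum l.toNat fun s => ∫⁻ s in Set.Ioc (x + s) (x + s + 1), g s]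
  rcases le_total 0 l with hl | hl
  · obtain ⟨m, rfl⟩ := Int.eq_ofNat_of_zero_le hl
    have h2 := lintegral_Ioc_nat_eq_sum g x (zero_le_one) (2 ^ m)
    simp only [mul_one] at h2
    rw [Int.toNat_natCast, ← h2]
    have h3 := hB x
    rw [zpow_natCast] at h3
    push_cast
    rw [ENNReal.rpow_neg, ENNReal.rpow_natCast, ENNReal.inv_pow]
    exact mul_le_mul_right h3 _
  · obtain ⟨m, hm⟩ := Int.eq_ofNat_of_zero_le (neg_nonneg.2 hl)
    obtain rfl : l = -m := by omega
    have h0 : (-(m : ℤ)).toNat = 0 := by simp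
    rw [h0]
    simp only [pow_zero, Finset.sum_range_one, Nat.cast_zero, add_zero, one_mul]
    have h2 := lintegral_Ioc_nat_eq_sum g x (T := (2 : ℝ) ^ (-(m : ℤ))) (by positivity) (2 ^ m)
    have h3 : ((2 ^ m : ℕ) : ℝ) * (2 : ℝ) ^ (-(m : ℤ)) = 1 := by
      push_cast
      rw [zpow_neg, zpow_natCast, mul_inv_cancel₀ (by positivity)]
    rw [h3] at h2
    rw [h2]
    refine (Finset.sum_le_sum fun j _ => hB _).trans ?_
    rw [Finset.sum_const, Finset.card_range, nsmul_eq_mul]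
    push_cast
    rw [neg_neg, ENNReal.rpow_natCast]

theorem nested_of_step {N : ℕ} {c : ℤ → Fin N → ℝ}
    (h : ∀ k i, ∃ m : ℤ, c (k + 1) i = c k i + 2 ^ k * m) : Nested c := by
  have h1 : ∀ k x, dcube (c k) k x ⊆ dcube (c (k + 1)) (k + 1) x := by
    intro k x y hy i
    obtain ⟨m, hm⟩ := h k i
    have h2 : (2 : ℝ) ^ k ≠ 0 := by positivity
    have key : ∀ z : Fin N → ℝ, ⌊(z i - c (k + 1) i) / (2 : ℝ) ^ (k + 1)⌋ =
        (⌊(z i - c k i) / (2 : ℝ) ^ k⌋ - m) / 2 := by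
      intro z
      have : (z i - c (k + 1) i) / (2 : ℝ) ^ (k + 1) =
          ((z i - c k i) / (2 : ℝ) ^ k - (m : ℝ)) / ((2 : ℕ) : ℝ) := by
        rw [hm, zpow_add_one₀ (by norm_num)]
        push_cast
        field_simp
        ring
      rw [this, Int.floor_div_natCast, Int.floor_sub_intCast]
      rfl
    rw [key, key, hy i]
  intro k l hkl x
  obtain ⟨m, rfl⟩ := Int.le.dest hkl
  induction m with
  | zero => simp
  | succ m ih =>
    refine (ih (by omega)).trans ?_
    have := h1 (k + m) x
    push_cast
    rw [← add_assoc]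
    exact this

theorem nested_randOffset {N : ℕ} (ω : RSpace N) : Nested (randOffset ω) := by
  refine nested_of_step fun k i => ?_
  simp only [randOffset, randOffset1_eq]
  rcases lt_or_ge k 0 with hk | hk
  · exact ⟨0, by rw [show k.toNat = 0 by omega, show (k + 1).toNat = 0 by omega]; simp⟩
  · obtain ⟨m, rfl⟩ := Int.eq_ofNat_of_zero_le hk
    rw [show ((m : ℤ) + 1).toNat = m + 1 by omega, Int.toNat_natCast]
    refine ⟨if ⌊(ω i).2 * 2 ^ (m + 1)⌋ % 2 = 1 then -1 else 0, ?_⟩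
    rw [bitSum, Finset.sum_range_succ, ← bitSum]
    split_ifs
    · simp
      ring
    · simp

/-- The weight of the boundary of the lattice of sidelength `2^l` at scale `2^i`. -/
def gw {N : ℕ} (c : Fin N → ℝ) (l i : ℤ) (x : Fin N → ℝ) : ℝ≥0∞ :=
  ∑ a, ENNReal.ofReal (wphi (2 ^ (i - l)) ((x a - c a) / 2 ^ l))

/-- The weight which bounds the interaction of the martingale difference of order `k` with a
smooth cancellative kernel at scale `2^i`. -/
def wt {N : ℕ} (c : ℤ → Fin N → ℝ) (k i : ℤ) (x : Fin N → ℝ) : ℝ≥0∞ :=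
  if k < i then 2 ^ ((k : ℝ) - i) else gw (c k) k i x + gw (c (k - 1)) (k - 1) i x

theorem measurable_gw_comp {N : ℕ} {α : Type*} [MeasurableSpace α] (l i : ℤ)
    {c x : α → Fin N → ℝ} (hc : Measurable c) (hx : Measurable x) :
    Measurable fun p => gw (c p) l i (x p) := by
  refine Finset.measurable_fun_sum _ fun a _ => ENNReal.measurable_ofReal.comp ?_
  refine (measurable_wphi _).comp (Measurable.div_const ?_ _)
  exact ((measurable_pi_apply a).comp hx).sub ((measurable_pi_apply a).comp hc)

theorem measurable_wt_comp {N : ℕ} {α : Type*} [MeasurableSpace α] (k i : ℤ)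
    {c : α → ℤ → Fin N → ℝ} {x : α → Fin N → ℝ} (hc : ∀ l, Measurable fun p => c p l)
    (hx : Measurable x) : Measurable fun p => wt (c p) k i (x p) := by
  unfold wt
  split_ifs
  · exact measurable_const
  · exact (measurable_gw_comp k i (hc k) hx).add (measurable_gw_comp (k - 1) i (hc (k - 1)) hx)

theorem measurable_gw {N : ℕ} (c : Fin N → ℝ) (l i : ℤ) : Measurable (gw c l i) :=
  measurable_gw_comp l i measurable_const measurable_id

theorem measurable_wt {N : ℕ} (c : ℤ → Fin N → ℝ) (k i : ℤ) : Measurable (wt c k i) :=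
  measurable_wt_comp k i (fun _ => measurable_const) measurable_id

theorem sq_sum_le_card_mul_sum_sq_ennreal {N : ℕ} (f : Fin N → ℝ≥0∞) :
    (∑ a, f a) ^ 2 ≤ N * ∑ a, f a ^ 2 := by
  have h := ENNReal.rpow_sum_le_const_mul_sum_rpow (Finset.univ) f (p := 2) (by norm_num)
  norm_num at h
  exact_mod_cast h

theorem gw_sq_le {N : ℕ} (c : Fin N → ℝ) (l i : ℤ) (x : Fin N → ℝ) :
    gw c l i x ^ 2 ≤ N * ∑ a, ENNReal.ofReal (wphi (2 ^ (i - l)) ((x a - c a) / 2 ^ l)) ^ 2 :=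
  sq_sum_le_card_mul_sum_sq_ennreal _

theorem ofReal_two_zpow (l : ℤ) : ENNReal.ofReal ((2 : ℝ) ^ l) = 2 ^ (l : ℝ) := by
  have := ofReal_two_zpow_pow 1 l
  simpa using this

theorem lintegral_gw_sq_le {N : ℕ} (c : Fin N → ℝ) (l i : ℤ) (x : Fin N → ℝ) :
    ∫⁻ y in dcube c l x, gw c l i y ^ 2 ≤
      2 * N ^ 2 * 2 ^ ((i : ℝ) - l) * 2 ^ ((l : ℝ) * N) := by
  have hτ : (0 : ℝ) < 2 ^ (i - l) := by positivity
  have hT : (0 : ℝ) < 2 ^ l := by positivity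
  have hone : ∀ a, ∫⁻ y in dcube c l x,
      ENNReal.ofReal (wphi (2 ^ (i - l)) ((y a - c a) / 2 ^ l)) ^ 2 ≤
        2 * 2 ^ ((i : ℝ) - l) * 2 ^ ((l : ℝ) * N) := by
    intro a
    have hg : Measurable fun s : ℝ => ENNReal.ofReal (wphi (2 ^ (i - l)) ((s - c a) / 2 ^ l)) ^ 2 :=
      (ENNReal.measurable_ofReal.comp ((measurable_wphi _).comp (by fun_prop))).pow_const _
    rw [dcube_eq_pi, volume_pi, Measure.restrict_pi_pi]
    set s : Fin N → Set ℝ := fun i => Set.Ico (c i + 2 ^ l * (⌊(x i - c i) / 2 ^ l⌋ : ℝ))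
        (c i + 2 ^ l * (⌊(x i - c i) / 2 ^ l⌋ : ℝ) + 2 ^ l) with hs
    have h1 := lintegral_map (μ := Measure.pi fun i => (volume : Measure ℝ).restrict (s i))
      hg (measurable_pi_apply a)
    refine h1.symm.trans_le ?_
    rw [Measure.pi_map_eval, lintegral_smul_measure]
    have h2 : ∀ b, (volume.restrict (s b)) Set.univ = 2 ^ (l : ℝ) := by
      intro b
      rw [Measure.restrict_apply_univ, hs]
      simp [ofReal_two_zpow]
    have h3 : ∫⁻ v in s a, ENNReal.ofReal (wphi (2 ^ (i - l)) ((v - c a) / 2 ^ l)) ^ 2 ≤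
        2 * 2 ^ ((i : ℝ) - l) * 2 ^ (l : ℝ) := by
      have h4 := lintegral_wphi_sq_le hτ hT (2 ^ l * (⌊(x a - c a) / 2 ^ l⌋ : ℝ))
      have h5 : ENNReal.ofReal (2 * 2 ^ (i - l) * 2 ^ l) =
          2 * 2 ^ ((i : ℝ) - l) * 2 ^ (l : ℝ) := by
        rw [ENNReal.ofReal_mul (by positivity), ENNReal.ofReal_mul (by norm_num), ofReal_two_zpow,
          ofReal_two_zpow]
        simp
      rw [h5] at h4
      refine le_trans (le_of_eq ?_) h4
      rw [hs, restrict_Ico_eq_restrict_Ioc, ← lintegral_indicator measurableSet_Ioc,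
        ← lintegral_indicator measurableSet_Ioc]
      rw [← lintegral_add_right_eq_self _ (c a)]
      refine lintegral_congr fun v => ?_
      by_cases h : v ∈ Set.Ioc (2 ^ l * (⌊(x a - c a) / 2 ^ l⌋ : ℝ))
          (2 ^ l * (⌊(x a - c a) / 2 ^ l⌋ : ℝ) + 2 ^ l)
      · rw [Set.indicator_of_mem h, Set.indicator_of_mem
          (Set.mem_Ioc.2 ⟨by linarith [h.1], by linarith [h.2]⟩), add_sub_cancel_right]
      · rw [Set.indicator_of_notMem h, Set.indicator_of_notMem fun h' =>
          h ⟨by linarith [h'.1], by linarith [h'.2]⟩]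
    simp_rw [h2]
    rw [Finset.prod_const, Finset.card_erase_of_mem (Finset.mem_univ a), Finset.card_univ,
      Fintype.card_fin, smul_eq_mul]
    refine (mul_le_mul_right h3 _).trans (le_of_eq ?_)
    obtain ⟨M, rfl⟩ : ∃ M, N = M + 1 := ⟨N - 1, by have := a.pos; omega⟩
    rw [Nat.add_sub_cancel, ENNReal.rpow_mul, ENNReal.rpow_natCast, pow_succ]
    ring
  calc ∫⁻ y in dcube c l x, gw c l i y ^ 2
      ≤ ∫⁻ y in dcube c l x,
        N * ∑ a, ENNReal.ofReal (wphi (2 ^ (i - l)) ((y a - c a) / 2 ^ l)) ^ 2 :=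
        lintegral_mono fun y => gw_sq_le c l i y
    _ = N * ∑ a, ∫⁻ y in dcube c l x,
        ENNReal.ofReal (wphi (2 ^ (i - l)) ((y a - c a) / 2 ^ l)) ^ 2 := by
        rw [lintegral_const_mul' _ _ (by simp), lintegral_finsetSum]
        intro a _
        exact (ENNReal.measurable_ofReal.comp
          ((measurable_wphi _).comp (by fun_prop))).pow_const _
    _ ≤ N * ∑ a : Fin N, 2 * 2 ^ ((i : ℝ) - l) * 2 ^ ((l : ℝ) * N) :=
        mul_le_mul_right (Finset.sum_le_sum fun a _ => hone a) _
    _ = _ := by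
        rw [Finset.sum_const, Finset.card_univ, Fintype.card_fin, nsmul_eq_mul]
        ring

theorem isProbabilityMeasure_restrict_Ico :
    IsProbabilityMeasure ((volume : Measure ℝ).restrict (Set.Ico (0 : ℝ) 1)) :=
  ⟨by simp⟩

instance randMeasure.instIsProbabilityMeasure (M : ℕ) : IsProbabilityMeasure (randMeasure M) := by
  have := isProbabilityMeasure_restrict_Ico
  unfold randMeasure
  infer_instance

theorem measurable_randOffset1 (l : ℤ) :
    Measurable fun p : ℝ × ℝ => randOffset1 p.1 p.2 l := by
  simp_rw [randOffset1_eq]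
  exact (measurable_fst.sub_const 1).sub ((measurable_bitSum _).comp measurable_snd)

theorem measurable_randOffset {N : ℕ} (l : ℤ) :
    Measurable fun ω : RSpace N => randOffset ω l :=
  measurable_pi_lambda _ fun a => (measurable_randOffset1 l).comp (measurable_pi_apply a)

theorem lintegral_gw_randOffset_sq_le {N : ℕ} (l i : ℤ) (x : Fin N → ℝ) :
    ∫⁻ ω, gw (randOffset ω l) l i x ^ 2 ∂randMeasure N ≤ 2 * N ^ 2 * 2 ^ ((i : ℝ) - l) := by
  have hτ : (0 : ℝ) < 2 ^ (i - l) := by positivity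
  have hT : (0 : ℝ) < 2 ^ l := by positivity
  have := isProbabilityMeasure_restrict_Ico
  have hm : ∀ a, Measurable fun p : ℝ × ℝ =>
      ENNReal.ofReal (wphi (2 ^ (i - l)) ((x a - randOffset1 p.1 p.2 l) / 2 ^ l)) ^ 2 := fun a =>
    (ENNReal.measurable_ofReal.comp ((measurable_wphi _).comp
      ((measurable_const.sub (measurable_randOffset1 l)).div_const _))).pow_const _
  have hone : ∀ a, ∫⁻ ω, ENNReal.ofReal
      (wphi (2 ^ (i - l)) ((x a - randOffset ω l a) / 2 ^ l)) ^ 2 ∂randMeasure N ≤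
        2 * 2 ^ ((i : ℝ) - l) := by
    intro a
    have h1 := (measurePreserving_eval (fun _ : Fin N => (volume.restrict (Set.Ico (0 : ℝ) 1)).prod
      (volume.restrict (Set.Ico (0 : ℝ) 1))) a).lintegral_comp (hm a)
    refine (show _ = _ from h1).trans_le ?_
    rw [lintegral_prod_symm' _ (hm a)]
    have h2 := lintegral_randOffset1_le l (g := fun v => ENNReal.ofReal
      (wphi (2 ^ (i - l)) (v / 2 ^ l)) ^ 2) (lintegral_wphi_sq_le hτ hT) (x a)
    refine h2.trans (le_of_eq ?_)
    rw [ENNReal.ofReal_mul (by positivity), ENNReal.ofReal_mul (by norm_num), ofReal_two_zpow,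
      ofReal_two_zpow, mul_comm, mul_assoc, ← two_rpow_add]
    simp
  calc _ ≤ ∫⁻ ω, N * ∑ a, ENNReal.ofReal
        (wphi (2 ^ (i - l)) ((x a - randOffset ω l a) / 2 ^ l)) ^ 2 ∂randMeasure N :=
        lintegral_mono fun ω => gw_sq_le _ l i x
    _ = N * ∑ a, ∫⁻ ω, ENNReal.ofReal
        (wphi (2 ^ (i - l)) ((x a - randOffset ω l a) / 2 ^ l)) ^ 2 ∂randMeasure N := by
        rw [lintegral_const_mul' _ _ (by simp), lintegral_finsetSum]
        intro a _
        exact (hm a).comp (measurable_pi_apply a)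
    _ ≤ N * ∑ a : Fin N, 2 * 2 ^ ((i : ℝ) - l) :=
        mul_le_mul_right (Finset.sum_le_sum fun a _ => hone a) _
    _ = _ := by
        rw [Finset.sum_const, Finset.card_univ, Fintype.card_fin, nsmul_eq_mul]
        ring

theorem lintegral_wt_randOffset_sq_le {N : ℕ} (hN : 0 < N) (k i : ℤ) (x : Fin N → ℝ) :
    ∫⁻ ω, wt (randOffset ω) k i x ^ 2 ∂randMeasure N ≤ 12 * N ^ 2 * 2 ^ (-(|k - i| : ℝ)) := by
  have hN1 : (1 : ℝ≥0∞) ≤ N := by exact_mod_cast hN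
  unfold wt
  split_ifs with h
  · rw [lintegral_const, measure_univ, mul_one]
    have h1 : (k : ℝ) < i := by exact_mod_cast h
    rw [abs_of_neg (by linarith), neg_neg]
    calc ((2 : ℝ≥0∞) ^ ((k : ℝ) - i)) ^ 2 ≤ 2 ^ ((k : ℝ) - i) := by
          rw [← ENNReal.rpow_natCast, ← ENNReal.rpow_mul]
          refine ENNReal.rpow_le_rpow_of_exponent_le (by norm_num) ?_
          push_cast
          linarith
      _ = 1 * 2 ^ ((k : ℝ) - i) := by rw [one_mul]
      _ ≤ _ := by
          refine mul_le_mul_left ?_ _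
          calc (1 : ℝ≥0∞) = 1 * 1 ^ 2 := by norm_num
            _ ≤ 12 * N ^ 2 := mul_le_mul' (by norm_num) (pow_le_pow_left' hN1 2)
  · have h1 : (i : ℝ) ≤ k := by exact_mod_cast not_lt.1 h
    rw [abs_of_nonneg (by linarith), neg_sub]
    calc _ ≤ ∫⁻ ω, (2 * gw (randOffset ω k) k i x ^ 2 +
          2 * gw (randOffset ω (k - 1)) (k - 1) i x ^ 2) ∂randMeasure N := by
          refine lintegral_mono fun ω => ?_
          have h2 := sq_sum_le_card_mul_sum_sq_ennreal
            ![gw (randOffset ω k) k i x, gw (randOffset ω (k - 1)) (k - 1) i x]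
          simp only [Fin.sum_univ_two, Matrix.cons_val_zero, Matrix.cons_val_one] at h2
          refine h2.trans (le_of_eq ?_)
          push_cast
          ring
      _ = 2 * (∫⁻ ω, gw (randOffset ω k) k i x ^ 2 ∂randMeasure N) +
          2 * ∫⁻ ω, gw (randOffset ω (k - 1)) (k - 1) i x ^ 2 ∂randMeasure N := by
          have hm : ∀ l, Measurable fun ω : RSpace N => gw (randOffset ω l) l i x ^ 2 := fun l =>
            (measurable_gw_comp l i (measurable_randOffset l) measurable_const).pow_const _
          rw [lintegral_add_left ((hm k).const_mul _), lintegral_const_mul _ (hm k),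
            lintegral_const_mul _ (hm (k - 1))]
      _ ≤ 2 * (2 * N ^ 2 * 2 ^ ((i : ℝ) - k)) + 2 * (2 * N ^ 2 * 2 ^ ((i : ℝ) - (k - 1 : ℤ))) :=
          add_le_add (mul_le_mul_right (lintegral_gw_randOffset_sq_le k i x) _)
            (mul_le_mul_right (lintegral_gw_randOffset_sq_le (k - 1) i x) _)
      _ = _ := by
          have : (i : ℝ) - (k - 1 : ℤ) = 1 + (i - k) := by push_cast; ring
          rw [this, two_rpow_add, ENNReal.rpow_one]
          ring

/-! ### The one-variable estimate on the lattice side -/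

/-- The corner of the cube of sidelength `2^l` that contains `x`. -/
def corner {N : ℕ} (c : Fin N → ℝ) (l : ℤ) (x : Fin N → ℝ) : Fin N → ℝ :=
  fun a => c a + 2 ^ l * (⌊(x a - c a) / 2 ^ l⌋ : ℝ)

theorem measurable_corner {N : ℕ} (c : Fin N → ℝ) (l : ℤ) : Measurable (corner c l) := by
  unfold corner
  fun_prop

theorem corner_mem_dcube {N : ℕ} (c : Fin N → ℝ) (l : ℤ) (x : Fin N → ℝ) :
    corner c l x ∈ dcube c l x := by
  intro a
  have h2 : (2 : ℝ) ^ l ≠ 0 := by positivity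
  rw [corner, add_sub_cancel_left, mul_div_cancel_left₀ _ h2, Int.floor_intCast]

theorem corner_eq_of_mem {N : ℕ} {c : Fin N → ℝ} {l : ℤ} {x y : Fin N → ℝ}
    (h : y ∈ dcube c l x) : corner c l y = corner c l x := by
  funext a
  rw [corner, corner, h a]

theorem lintegral_kr_mul_shift {N : ℕ} {a : ℝ} (ha : 0 ≤ a) {l : ℤ} {x x' : Fin N → ℝ}
    (h : ‖x - x'‖ ≤ 2 ^ l) (β : (Fin N → ℝ) → ℝ≥0∞) :
    ∫⁻ y, kr N a l (x - y) * β y ≤ 2 ^ a * ∫⁻ y, kr N a l (x' - y) * β y := by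
  rw [← lintegral_const_mul' _ _ (two_rpow_ne_top _)]
  refine lintegral_mono fun y => ?_
  rw [← mul_assoc]
  exact mul_le_mul_left (kr_shift ha (by rwa [sub_sub_sub_cancel_right])) _

theorem measurable_lintegral_kr_mul {N : ℕ} (a : ℝ) (l : ℤ) {β : (Fin N → ℝ) → ℝ≥0∞}
    (hβ : Measurable β) : Measurable fun x => ∫⁻ y, kr N a l (x - y) * β y := by
  refine Measurable.lintegral_prod_right' (f := fun p : (Fin N → ℝ) × (Fin N → ℝ) =>
    kr N a l (p.1 - p.2) * β p.2) ?_
  exact ((measurable_kr N a l).comp (measurable_fst.sub measurable_snd)).mul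
    (hβ.comp measurable_snd)

theorem lintegral_gw_conv_le {N : ℕ} (hN : 0 < N) : ∃ C : ℝ≥0∞, C ≠ ⊤ ∧
    ∀ (c : ℤ → Fin N → ℝ), Nested c → ∀ (ι : Type) [Countable ι] (k l i : ι → ℤ) (m : ℝ)
      (β : ι → (Fin N → ℝ) → ℝ≥0∞), (∀ p, Measurable (β p)) →
      (∀ p, DConst (c (k p)) (k p) (β p)) → (∀ p, l p ≤ k p) → (∀ p, (i p : ℝ) - l p = m) →
      ∫⁻ x, (∑' p, (gw (c (l p)) (l p) (i p) x *
        ∫⁻ y, kr N (N + 1) (k p) (x - y) * β p y) ^ 2) ^ (1 / 2 : ℝ) ≤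
        C * 2 ^ (m / 2) * ∫⁻ x, (∑' p, β p x ^ 2) ^ (1 / 2 : ℝ) := by
  obtain ⟨C, hC, hstep⟩ := lintegral_conv_le hN
  refine ⟨(2 * (2 * N ^ 2)) ^ (1 / 2 : ℝ) * 2 ^ ((N : ℝ) + 1) * (2 ^ ((N : ℝ) + 1) * C), ?_, ?_⟩
  · refine ENNReal.mul_ne_top (ENNReal.mul_ne_top ?_ (two_rpow_ne_top _))
      (ENNReal.mul_ne_top (two_rpow_ne_top _) hC)
    refine ENNReal.rpow_ne_top_of_nonneg (by norm_num) ?_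
    exact ENNReal.mul_ne_top (by norm_num) (ENNReal.mul_ne_top (by norm_num) (by simp))
  intro c hc ι _ k l i m β hβ hβc hlk him
  have ha : (0 : ℝ) ≤ N + 1 := by positivity
  set A : ι → (Fin N → ℝ) → ℝ≥0∞ := fun p x => ∫⁻ y, kr N (N + 1) (k p) (x - y) * β p y with hA
  have hAm : ∀ p, Measurable (A p) := fun p => measurable_lintegral_kr_mul _ _ (hβ p)
  set D : ι → (Fin N → ℝ) → ℝ≥0∞ := fun p x => A p (corner (c (l p)) (l p) x) ^ 2 with hD
  have hnorm : ∀ p x, ‖corner (c (l p)) (l p) x - x‖ ≤ 2 ^ k p := fun p x =>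
    (norm_sub_le_of_mem_dcube (corner_mem_dcube _ _ _)).trans
      (zpow_le_zpow_right₀ (by norm_num) (hlk p))
  have h1 : ∀ p x, A p x ≤ 2 ^ ((N : ℝ) + 1) * A p (corner (c (l p)) (l p) x) := fun p x =>
    lintegral_kr_mul_shift ha (by rw [norm_sub_rev]; exact hnorm p x) _
  have h2 : ∀ p x, A p (corner (c (l p)) (l p) x) ≤ 2 ^ ((N : ℝ) + 1) * A p x := fun p x =>
    lintegral_kr_mul_shift ha (hnorm p x) _
  have hlen := lintegral_sqrt_tsum_mul_le hc l
    (fun p x => gw (c (l p)) (l p) (i p) x ^ 2) D (2 * N ^ 2 * 2 ^ m)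
    (fun p => (measurable_gw _ _ _).pow_const _)
    (fun p => ((hAm p).comp (measurable_corner _ _)).pow_const _)
    (fun p x y hy => by simp only [hD]; rw [corner_eq_of_mem hy])
    (fun p x => by rw [← him p]; exact lintegral_gw_sq_le _ _ _ _)
  have hst := hstep ι (fun p => c (k p)) k 0 β hβ hβc
  simp only [Nat.cast_zero, add_zero, zero_div, ENNReal.rpow_zero, mul_one] at hst
  have hsq : ∀ (B : ℝ≥0∞) (f g : ι → ℝ≥0∞), (∀ p, f p ≤ B * g p) →
      (∑' p, f p ^ 2) ^ (1 / 2 : ℝ) ≤ B * (∑' p, g p ^ 2) ^ (1 / 2 : ℝ) := by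
    intro B f g h
    calc (∑' p, f p ^ 2) ^ (1 / 2 : ℝ) ≤ (B ^ 2 * ∑' p, g p ^ 2) ^ (1 / 2 : ℝ) := by
          rw [← ENNReal.tsum_mul_left]
          refine ENNReal.rpow_le_rpow (ENNReal.tsum_le_tsum fun p => ?_) (by norm_num)
          rw [← mul_pow]
          exact pow_le_pow_left' (h p) 2
      _ = _ := by rw [ENNReal.mul_rpow_of_nonneg _ _ (by norm_num), sqrt_sq_ennreal]
  calc _ ≤ ∫⁻ x, 2 ^ ((N : ℝ) + 1) *
        (∑' p, (gw (c (l p)) (l p) (i p) x * A p (corner (c (l p)) (l p) x)) 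
              ^ 2) ^ (1 / 2 : ℝ) := by
        refine lintegral_mono fun x => hsq _ _ _ fun p => ?_
        rw [mul_left_comm]
        exact mul_le_mul_right (h1 p x) _
    _ = 2 ^ ((N : ℝ) + 1) *
        ∫⁻ x, (∑' p, gw (c (l p)) (l p) (i p) x ^ 2 * D p x) ^ (1 / 2 : ℝ) := by
        rw [lintegral_const_mul' _ _ (two_rpow_ne_top _)]
        simp_rw [mul_pow]
        rfl
    _ ≤ 2 ^ ((N : ℝ) + 1) * ((2 * (2 * N ^ 2 * 2 ^ m)) ^ (1 / 2 : ℝ) *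
        ∫⁻ x, (∑' p, D p x) ^ (1 / 2 : ℝ)) := mul_le_mul_right hlen _
    _ ≤ 2 ^ ((N : ℝ) + 1) * ((2 * (2 * N ^ 2 * 2 ^ m)) ^ (1 / 2 : ℝ) *
        (2 ^ ((N : ℝ) + 1) * (C * ∫⁻ x, (∑' p, β p x ^ 2) ^ (1 / 2 : ℝ)))) := by
        refine mul_le_mul_right (mul_le_mul_right ?_ _) _
        refine le_trans ?_ (mul_le_mul_right hst _)
        rw [← lintegral_const_mul' _ _ (two_rpow_ne_top _)]
        exact lintegral_mono fun x => hsq _ _ _ fun p => h2 p x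
    _ = _ := by
        rw [← mul_assoc 2 (2 * (N : ℝ≥0∞) ^ 2) (2 ^ m),
          ENNReal.mul_rpow_of_nonneg _ _ (by norm_num : (0 : ℝ) ≤ 1 / 2), ← ENNReal.rpow_mul 2 m,
          mul_one_div]
        ring

theorem sqrt_tsum_add_sq_le {ι : Type*} (f g : ι → ℝ≥0∞) :
    (∑' p, (f p + g p) ^ 2) ^ (1 / 2 : ℝ) ≤
      2 * ((∑' p, f p ^ 2) ^ (1 / 2 : ℝ) + (∑' p, g p ^ 2) ^ (1 / 2 : ℝ)) := by
  have h : ∀ p, (f p + g p) ^ 2 ≤ 2 * (f p ^ 2 + g p ^ 2) := fun p => by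
    have h2 := sq_sum_le_card_mul_sum_sq_ennreal ![f p, g p]
    simpa [Fin.sum_univ_two] using h2
  calc (∑' p, (f p + g p) ^ 2) ^ (1 / 2 : ℝ)
      ≤ (2 * (∑' p, f p ^ 2 + ∑' p, g p ^ 2)) ^ (1 / 2 : ℝ) := by
        rw [← ENNReal.tsum_add, ← ENNReal.tsum_mul_left]
        exact ENNReal.rpow_le_rpow (ENNReal.tsum_le_tsum h) (by norm_num)
    _ ≤ (2 ^ 2 * (∑' p, f p ^ 2 + ∑' p, g p ^ 2)) ^ (1 / 2 : ℝ) :=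
        ENNReal.rpow_le_rpow (mul_le_mul_left (by norm_num) _) (by norm_num)
    _ = 2 * (∑' p, f p ^ 2 + ∑' p, g p ^ 2) ^ (1 / 2 : ℝ) := by
        rw [ENNReal.mul_rpow_of_nonneg _ _ (by norm_num), sqrt_sq_ennreal]
    _ ≤ _ := mul_le_mul_right
        (ENNReal.rpow_add_le_add_rpow _ _ (by norm_num) (by norm_num)) _

theorem lintegral_wt_conv_le {N : ℕ} (hN : 0 < N) : ∃ C : ℝ≥0∞, C ≠ ⊤ ∧
    ∀ (c : ℤ → Fin N → ℝ), Nested c → ∀ (ι : Type) [Countable ι] (k : ι → ℤ) (m : ℤ)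
      (β : ι → (Fin N → ℝ) → ℝ≥0∞), (∀ p, Measurable (β p)) →
      (∀ p, DConst (c (k p)) (k p) (β p)) →
      ∫⁻ x, (∑' p, (∫⁻ y, kr N (N + 1) (max (k p) (k p - m)) (x - y) *
        wt c (k p) (k p - m) x * β p y) ^ 2) ^ (1 / 2 : ℝ) ≤
        C * 2 ^ (-(|m| : ℝ) / 4) * ∫⁻ x, (∑' p, β p x ^ 2) ^ (1 / 2 : ℝ) := by
  obtain ⟨C, hC, hstep⟩ := lintegral_conv_le hN
  obtain ⟨C', hC', hgw⟩ := lintegral_gw_conv_le hN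
  refine ⟨C + 8 * C', by simp [hC, ENNReal.mul_ne_top, hC'], ?_⟩
  intro c hc ι _ k m β hβ hβc
  rcases lt_or_ge m 0 with hm | hm
  · obtain ⟨e, he⟩ := Int.eq_ofNat_of_zero_le (neg_nonneg.2 hm.le)
    have hst := hstep ι (fun p => c (k p)) k e β hβ hβc
    have hmr : (m : ℝ) = -(e : ℝ) := by
      have : m = -(e : ℤ) := by omega
      rw [this]
      push_cast
      ring
    have h1 : ∀ p x, ∫⁻ y, kr N (N + 1) (max (k p) (k p - m)) (x - y) *
        wt c (k p) (k p - m) x * β p y = 2 ^ (m : ℝ) *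
          ∫⁻ y, kr N (N + 1) (k p + e) (x - y) * β p y := by
      intro p x
      rw [← lintegral_const_mul' _ _ (two_rpow_ne_top _)]
      refine lintegral_congr fun y => ?_
      have h2 : wt c (k p) (k p - m) x = 2 ^ (m : ℝ) := by
        rw [wt, if_pos (by omega)]
        congr 1
        push_cast
        ring
      rw [h2, max_eq_right (by omega), show k p - m = k p + e by omega]
      ring
    simp_rw [h1, mul_pow, ENNReal.tsum_mul_left,
      ENNReal.mul_rpow_of_nonneg _ _ (show (0 : ℝ) ≤ 1 / 2 by norm_num), sqrt_sq_ennreal]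
    rw [lintegral_const_mul' _ _ (two_rpow_ne_top _)]
    refine (mul_le_mul_right hst _).trans ?_
    rw [← mul_assoc, mul_left_comm, ← two_rpow_add]
    refine mul_le_mul_left (mul_le_mul' le_self_add ?_) _
    refine ENNReal.rpow_le_rpow_of_exponent_le (by norm_num) ?_
    rw [hmr, abs_neg, abs_of_nonneg (by positivity)]
    have : (0 : ℝ) ≤ e := by positivity
    linarith
  · have hmr : (0 : ℝ) ≤ m := by exact_mod_cast hm
    have h1 : ∀ p x, ∫⁻ y, kr N (N + 1) (max (k p) (k p - m)) (x - y) *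
        wt c (k p) (k p - m) x * β p y =
        gw (c (k p)) (k p) (k p - m) x * (∫⁻ y, kr N (N + 1) (k p) (x - y) * β p y) +
        gw (c (k p - 1)) (k p - 1) (k p - m) x *
          (∫⁻ y, kr N (N + 1) (k p) (x - y) * β p y) := by
      intro p x
      have hmk : Measurable fun y => kr N (N + 1) (k p) (x - y) * β p y :=
        ((measurable_kr N _ _).comp (measurable_const.sub measurable_id)).mul (hβ p)
      rw [← add_mul, ← lintegral_const_mul _ hmk]
      refine lintegral_congr fun y => ?_
      rw [wt, if_neg (by omega), max_eq_left (by omega)]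
      ring
    simp_rw [h1]
    have hA := hgw c hc ι k k (fun p => k p - m) (-m) β hβ hβc (fun p => le_rfl)
      (fun p => by push_cast; ring)
    have hB := hgw c hc ι k (fun p => k p - 1) (fun p => k p - m) (1 - m) β hβ hβc
      (fun p => by simp) (fun p => by push_cast; ring)
    have hmeas : ∀ l : ι → ℤ, Measurable fun x => (∑' p, (gw (c (l p)) (l p) (k p - m) x *
        ∫⁻ y, kr N (N + 1) (k p) (x - y) * β p y) ^ 2) ^ (1 / 2 : ℝ) := fun l =>
      (Measurable.tsum fun p => ((measurable_gw _ _ _).mul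
        (measurable_lintegral_kr_mul _ _ (hβ p))).pow_const 2).pow_const _
    refine (lintegral_mono fun x => sqrt_tsum_add_sq_le _ _).trans ?_
    rw [lintegral_const_mul' _ _ (by norm_num), lintegral_add_left (hmeas k)]
    refine (mul_le_mul_right (add_le_add hA hB) _).trans ?_
    rw [← add_mul, ← mul_assoc, ← mul_add, mul_left_comm]
    refine mul_le_mul_left ?_ _
    have hm1 : (2 : ℝ≥0∞) ^ (-(m : ℝ) / 2) ≤ 2 ^ (-(|m| : ℝ) / 4) := by
      refine ENNReal.rpow_le_rpow_of_exponent_le (by norm_num) ?_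
      rw [abs_of_nonneg hmr]
      linarith
    have hm2 : (2 : ℝ≥0∞) ^ ((1 - (m : ℝ)) / 2) ≤ 2 * 2 ^ (-(|m| : ℝ) / 4) := by
      have : (2 : ℝ≥0∞) * 2 ^ (-(|m| : ℝ) / 4) = 2 ^ (1 + -(|m| : ℝ) / 4) := by
        rw [two_rpow_add, ENNReal.rpow_one]
      rw [this]
      refine ENNReal.rpow_le_rpow_of_exponent_le (by norm_num) ?_
      rw [abs_of_nonneg hmr]
      linarith
    calc C' * (2 * ((2 : ℝ≥0∞) ^ (-(m : ℝ) / 2) + 2 ^ ((1 - (m : ℝ)) / 2)))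
        ≤ C' * (2 * (2 ^ (-(|m| : ℝ) / 4) + 2 * 2 ^ (-(|m| : ℝ) / 4))) :=
          mul_le_mul_right (mul_le_mul_right (add_le_add hm1 hm2) _) _
      _ = 6 * C' * 2 ^ (-(|m| : ℝ) / 4) := by ring
      _ ≤ _ := mul_le_mul_left ((mul_le_mul_left (by norm_num) _).trans le_add_self) _

/-! ### Iterating one-variable estimates over the factors of a product -/

section Iterate

variable {n : ℕ} {Nd : Fin n → ℕ} {ι : Type}

/-- The partial operator with the product kernel `∏_{j ∈ s} τ_j`, acting in the variables
`x_j`, `j ∈ s`. -/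
def partialOp (τ : ∀ j : Fin n, ι → (Fin (Nd j) → ℝ) → (Fin (Nd j) → ℝ) → ℝ≥0∞)
    (s : Finset (Fin n)) (β : ι → X n Nd → ℝ≥0∞) (p : ι) (x : X n Nd) : ℝ≥0∞ :=
  (∫⋯∫⁻_s, fun z => (∏ j ∈ s, τ j p (x j) (z j)) * β p z ∂fun _ => volume) x

variable {τ : ∀ j : Fin n, ι → (Fin (Nd j) → ℝ) → (Fin (Nd j) → ℝ) → ℝ≥0∞}

theorem measurable_partialOp (hτ : ∀ j p, Measurable (Function.uncurry (τ j p)))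
    (s : Finset (Fin n)) {β : ι → X n Nd → ℝ≥0∞} (hβ : ∀ p, Measurable (β p)) (p : ι) :
    Measurable (partialOp τ s β p) := by
  unfold partialOp lmarginal
  have hm : Measurable fun q : X n Nd × (∀ i : s, Fin (Nd i) → ℝ) =>
      Function.updateFinset q.1 s q.2 := measurable_updateFinset'
  refine Measurable.lintegral_prod_right'
    (f := fun q : X n Nd × (∀ i : s, Fin (Nd i) → ℝ) =>
      (∏ j ∈ s, τ j p (q.1 j) (Function.updateFinset q.1 s q.2 j)) *
        β p (Function.updateFinset q.1 s q.2)) ?_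
  refine Measurable.mul (Finset.measurable_fun_prod _ fun j _ => ?_) ((hβ p).comp hm)
  exact (hτ j p).comp (((measurable_pi_apply j).comp measurable_fst).prodMk
    ((measurable_pi_apply j).comp hm))

theorem updateFinset_update_comm {j : Fin n} {s : Finset (Fin n)} (hj : j ∉ s) (x : X n Nd)
    (y : Fin (Nd j) → ℝ) (w : ∀ i : s, Fin (Nd i) → ℝ) :
    Function.updateFinset (Function.update x j y) s w =
      Function.update (Function.updateFinset x s w) j y := by
  funext i
  rcases eq_or_ne i j with rfl | hij
  · simp [Function.updateFinset, hj]
  · by_cases hi : i ∈ s <;> simp [Function.updateFinset, hi, hij]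

theorem partialOp_insert (hτ : ∀ j p, Measurable (Function.uncurry (τ j p)))
    {j : Fin n} {s : Finset (Fin n)} (hj : j ∉ s) {β : ι → X n Nd → ℝ≥0∞}
    (hβ : ∀ p, Measurable (β p)) (p : ι) (x : X n Nd) :
    partialOp τ (insert j s) β p x =
      ∫⁻ y, τ j p (x j) y * partialOp τ s β p (Function.update x j y) := by
  have hm : ∀ s : Finset (Fin n),
      Measurable fun z : X n Nd => (∏ j ∈ s, τ j p (x j) (z j)) * β p z := fun s =>
    (Finset.measurable_fun_prod _ fun i _ =>
      (hτ i p).comp (measurable_const.prodMk (measurable_pi_apply i))).mul (hβ p)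
  rw [partialOp, lmarginal_insert _ (hm _) hj]
  refine lintegral_congr fun y => ?_
  have hm2 : Measurable fun w : ∀ i : s, Fin (Nd i) → ℝ =>
      (∏ i ∈ s, τ i p (Function.update x j y i)
        (Function.updateFinset (Function.update x j y) s w i)) *
        β p (Function.updateFinset (Function.update x j y) s w) := by
    refine Measurable.mul (Finset.measurable_fun_prod _ fun i _ => ?_)
      ((hβ p).comp measurable_updateFinset)
    have hu : Measurable fun w : ∀ i : s, Fin (Nd i) → ℝ =>
        Function.updateFinset (Function.update x j y) s w i :=
      measurable_pi_iff.1 (measurable_updateFinset (s := s) (x := Function.update x j y)) i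
    exact (hτ i p).comp (measurable_const.prodMk hu)
  rw [partialOp, lmarginal, lmarginal, ← lintegral_const_mul _ hm2]
  refine lintegral_congr fun w => ?_
  rw [Finset.prod_insert hj, mul_assoc, updateFinset_update_comm hj, Function.update_self]
  congr 2
  refine Finset.prod_congr rfl fun i hi => ?_
  rw [Function.update_of_ne (by rintro rfl; exact hj hi) _ x]

variable {cc : ∀ j : Fin n, ι → Fin (Nd j) → ℝ} {ll : Fin n → ι → ℤ}

theorem dconst_partialOp {s : Finset (Fin n)} {β : ι → X n Nd → ℝ≥0∞}
    (hd : ∀ j p x, DConst (cc j p) (ll j p) fun y => β p (Function.update x j y))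
    {j : Fin n} (hj : j ∉ s) (p : ι) (x : X n Nd) :
    DConst (cc j p) (ll j p) fun y => partialOp τ s β p (Function.update x j y) := by
  intro y y' h
  simp only [partialOp, lmarginal]
  refine lintegral_congr fun w => ?_
  rw [updateFinset_update_comm hj, updateFinset_update_comm hj,
    show β p _ = β p _ from hd j p _ y y' h]
  congr 1
  refine Finset.prod_congr rfl fun i hi => ?_
  have hij : i ≠ j := by rintro rfl; exact hj hi
  simp only [Function.update_of_ne hij]

/-- If each one-variable kernel `τ_j` is bounded on `L¹(ℓ²)` for functions that are constant on
the cubes of given lattices, then so is the product kernel. -/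
theorem lintegral_iterate_le [Countable ι]
    (hτ : ∀ j p, Measurable (Function.uncurry (τ j p))) (C : Fin n → ℝ≥0∞)
    (hstep : ∀ j, ∀ β : ι → (Fin (Nd j) → ℝ) → ℝ≥0∞, (∀ p, Measurable (β p)) →
      (∀ p, DConst (cc j p) (ll j p) (β p)) →
      ∫⁻ x, (∑' p, (∫⁻ y, τ j p x y * β p y) ^ 2) ^ (1 / 2 : ℝ) ≤
        C j * ∫⁻ x, (∑' p, β p x ^ 2) ^ (1 / 2 : ℝ))
    {β : ι → X n Nd → ℝ≥0∞} (hβ : ∀ p, Measurable (β p))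
    (hd : ∀ j p x, DConst (cc j p) (ll j p) fun y => β p (Function.update x j y)) :
    ∫⁻ x : X n Nd, (∑' p, (∫⁻ z : X n Nd, (∏ j, τ j p (x j) (z j)) * β p z) ^ 2) ^ (1 / 2 : ℝ) ≤
      (∏ j, C j) * ∫⁻ x, (∑' p, β p x ^ 2) ^ (1 / 2 : ℝ) := by
  have key : ∀ s : Finset (Fin n),
      ∫⁻ x, (∑' p, partialOp τ s β p x ^ 2) ^ (1 / 2 : ℝ) ≤
        (∏ j ∈ s, C j) * ∫⁻ x, (∑' p, β p x ^ 2) ^ (1 / 2 : ℝ) := by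
    intro s
    induction s using Finset.induction_on with
    | empty => simp [partialOp]
    | insert j s hj ih =>
      have hmS : ∀ s, Measurable fun x => (∑' p, partialOp τ s β p x ^ 2) ^ (1 / 2 : ℝ) :=
        fun s => (Measurable.tsum fun p =>
          (measurable_partialOp hτ s hβ p).pow_const 2).pow_const _
      have h1 : ∫⁻ x, (∑' p, partialOp τ (insert j s) β p x ^ 2) ^ (1 / 2 : ℝ) ≤
          ∫⁻ x, C j * (∑' p, partialOp τ s β p x ^ 2) ^ (1 / 2 : ℝ) := by
        refine lintegral_le_of_lmarginal_le (μ := fun _ => volume) {j} (hmS _)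
          ((hmS s).const_mul _) fun x => ?_
        simp only [lmarginal_singleton]
        have hmx : Measurable fun y =>
            (∑' p, partialOp τ s β p (Function.update x j y) ^ 2) ^ (1 / 2 : ℝ) :=
          (hmS s).comp (measurable_update x)
        rw [lintegral_const_mul _ hmx]
        refine le_trans (le_of_eq ?_) (hstep j (fun p y => partialOp τ s β p
          (Function.update x j y)) (fun p => (measurable_partialOp hτ s hβ p).comp
          (measurable_update x)) fun p => dconst_partialOp hd hj p x)
        refine lintegral_congr fun y => ?_
        congr 1
        refine tsum_congr fun p => ?_
        rw [partialOp_insert hτ hj hβ]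
        simp only [Function.update_self, Function.update_idem]
      rw [lintegral_const_mul _ (hmS s)] at h1
      rw [Finset.prod_insert hj, mul_assoc]
      exact h1.trans (mul_le_mul_right ih _)
  have := key Finset.univ
  simpa only [partialOp, lmarginal_univ, volume_pi] using this

end Iterate

/-! ### Size and smoothness of the Poisson kernel -/

/-- The Poisson kernel as a function on `ℝ^N × ℝ`. -/
def poisson (N : ℕ) (p : (Fin N → ℝ) × ℝ) : ℝ := pk N p.1 p.2

theorem sum_sq_add_sq_pos {N : ℕ} {p : (Fin N → ℝ) × ℝ} (hp : p ≠ 0) :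
    0 < (∑ i, p.1 i ^ 2) + p.2 ^ 2 := by
  have h0 : 0 ≤ ∑ i, p.1 i ^ 2 := Finset.sum_nonneg fun i _ => sq_nonneg _
  by_contra! h
  have h1 : ∑ i, p.1 i ^ 2 = 0 := le_antisymm (by nlinarith [sq_nonneg p.2]) h0
  have h2 : p.2 = 0 := by
    have := sq_nonneg p.2
    have : p.2 ^ 2 = 0 := by linarith
    simpa using this
  refine hp (Prod.ext (funext fun i => ?_) h2)
  have := (Finset.sum_eq_zero_iff_of_nonneg fun i _ => sq_nonneg (p.1 i)).1 h1 i
    (Finset.mem_univ i)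
  simpa using this

theorem contDiffAt_poisson {N : ℕ} {p : (Fin N → ℝ) × ℝ} (hp : p ≠ 0) (m : ℕ∞) :
    ContDiffAt ℝ m (poisson N) p := by
  have h := sum_sq_add_sq_pos hp
  unfold poisson pk
  refine ContDiffAt.div (by fun_prop) ?_ (Real.rpow_pos_of_pos h _).ne'
  refine ContDiffAt.rpow_const_of_ne ?_ h.ne'
  refine ContDiffAt.add (ContDiffAt.sum fun i _ => ?_) (by fun_prop)
  exact ((contDiff_apply ℝ ℝ i).contDiffAt.comp p contDiffAt_fst).pow 2

theorem poisson_smul {N : ℕ} {r : ℝ} (hr : 0 < r) (p : (Fin N → ℝ) × ℝ) :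
    poisson N (r • p) = (r ^ N)⁻¹ * poisson N p := by
  unfold poisson pk
  have h1 : (∑ i, (r • p).1 i ^ 2) + (r • p).2 ^ 2 =
      r ^ 2 * ((∑ i, p.1 i ^ 2) + p.2 ^ 2) := by
    simp [mul_pow, Finset.mul_sum, mul_add]
  have h0 : 0 ≤ (∑ i, p.1 i ^ 2) + p.2 ^ 2 :=
    add_nonneg (Finset.sum_nonneg fun i _ => sq_nonneg _) (sq_nonneg _)
  have h2 : (r ^ 2) ^ (((N : ℝ) + 1) / 2) = r ^ N * r := by
    rw [← Real.rpow_natCast r 2, ← Real.rpow_mul hr.le,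
      show ((2 : ℕ) : ℝ) * (((N : ℝ) + 1) / 2) = ((N + 1 : ℕ) : ℝ) by push_cast; ring,
      Real.rpow_natCast, pow_succ]
  rw [h1, Real.mul_rpow (by positivity) h0, h2]
  simp only [Prod.smul_snd, smul_eq_mul]
  have : r ^ N ≠ 0 := by positivity
  field_simp

theorem iteratedFDeriv_poisson_smul {N : ℕ} {r : ℝ} (hr : 0 < r) (m : ℕ)
    {p : (Fin N → ℝ) × ℝ} (hp : p ≠ 0) :
    r ^ (N + m) • iteratedFDeriv ℝ m (poisson N) (r • p) = iteratedFDeriv ℝ m (poisson N) p := by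
  have h1 := (ContinuousLinearEquiv.smulLeft (R₁ := ℝ) (M₁ := (Fin N → ℝ) × ℝ)
    (Units.mk0 r hr.ne')).iteratedFDerivWithin_comp_right (poisson N) uniqueDiffOn_univ
    (x := p) (Set.mem_univ _) m
  simp only [Set.preimage_univ, iteratedFDerivWithin_univ] at h1
  have h2 : (poisson N ∘ (ContinuousLinearEquiv.smulLeft (R₁ := ℝ) (M₁ := (Fin N → ℝ) × ℝ)
    (Units.mk0 r hr.ne'))) = fun p => (r ^ N)⁻¹ • poisson N p := by
    funext p
    exact poisson_smul hr p
  rw [h2, iteratedFDeriv_const_smul_apply' (contDiffAt_poisson hp m)] at h1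
  have h3 : (iteratedFDeriv ℝ m (poisson N) (r • p)).compContinuousLinearMap (fun _ =>
      ((ContinuousLinearEquiv.smulLeft (R₁ := ℝ) (M₁ := (Fin N → ℝ) × ℝ)
        (Units.mk0 r hr.ne') : _ ≃L[ℝ] _) : _ →L[ℝ] _)) =
      r ^ m • iteratedFDeriv ℝ m (poisson N) (r • p) := by
    ext v
    have := (iteratedFDeriv ℝ m (poisson N) (r • p)).map_smul_univ (fun _ => r) v
    simpa using this
  have h4 : (r ^ N)⁻¹ • iteratedFDeriv ℝ m (poisson N) p =
      r ^ m • iteratedFDeriv ℝ m (poisson N) (r • p) := h1.trans h3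
  rw [pow_add, mul_smul, ← h4, smul_smul, mul_inv_cancel₀ (by positivity), one_smul]

theorem exists_norm_iteratedFDeriv_poisson_le (N m : ℕ) : ∃ C : ℝ, 0 < C ∧
    ∀ p : (Fin N → ℝ) × ℝ, p ≠ 0 →
      ‖iteratedFDeriv ℝ m (poisson N) p‖ ≤ C * (‖p‖ ^ (N + m))⁻¹ := by
  have hc : ContinuousOn (fun p => ‖iteratedFDeriv ℝ m (poisson N) p‖)
      (Metric.sphere (0 : (Fin N → ℝ) × ℝ) 1) := by
    intro p hp
    have hp0 : p ≠ 0 := by rintro rfl; simp at hp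
    exact ((contDiffAt_poisson hp0 m).continuousAt_iteratedFDeriv le_rfl).norm.continuousWithinAt
  obtain ⟨C, hC⟩ := (isCompact_sphere (0 : (Fin N → ℝ) × ℝ) 1).bddAbove_image hc
  refine ⟨max C 1, by positivity, fun p hp => ?_⟩
  have hp' : 0 < ‖p‖ := norm_pos_iff.2 hp
  have hs : ‖p‖⁻¹ • p ∈ Metric.sphere (0 : (Fin N → ℝ) × ℝ) 1 := by
    simp [norm_smul, hp'.ne']
  have h1 := hC (Set.mem_image_of_mem _ hs)
  rw [← iteratedFDeriv_poisson_smul (inv_pos.2 hp') m hp, norm_smul, norm_pow, norm_inv,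
    norm_norm, inv_pow, mul_comm]
  exact mul_le_mul_of_nonneg_right (h1.trans (le_max_left _ _)) (by positivity)

/-- The coordinate directions of `ℝ^N × ℝ`. -/
def pdir (N : ℕ) (d : Fin (N + 1)) : (Fin N → ℝ) × ℝ :=
  if h : (d : ℕ) < N then (Pi.single (⟨d, h⟩ : Fin N) 1, 0) else (0, 1)

theorem norm_pdir_le (N : ℕ) (d : Fin (N + 1)) : ‖pdir N d‖ ≤ 1 := by
  unfold pdir
  split_ifs with h
  · have : ‖(Pi.single (⟨d, h⟩ : Fin N) (1 : ℝ) : Fin N → ℝ)‖ ≤ 1 := by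
      rw [pi_norm_le_iff_of_nonneg zero_le_one]
      intro i
      by_cases hi : i = ⟨d, h⟩ <;> simp [hi]
    simpa [Prod.norm_def] using this
  · simp [Prod.norm_def]

/-- The partial derivatives of the Poisson kernel. -/
def dpk (N : ℕ) (d : Fin (N + 1)) (p : (Fin N → ℝ) × ℝ) : ℝ :=
  fderiv ℝ (poisson N) p (pdir N d)

theorem contDiffAt_dpk {N : ℕ} (d : Fin (N + 1)) {p : (Fin N → ℝ) × ℝ} (hp : p ≠ 0) (m : ℕ∞) :
    ContDiffAt ℝ m (dpk N d) p := by
  unfold dpk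
  exact ((contDiffAt_poisson hp (m + 1)).fderiv_right (m := m) (by simp)).clm_apply
    contDiffAt_const

theorem norm_sq_le_sum_sq {N : ℕ} (p : (Fin N → ℝ) × ℝ) :
    ‖p‖ ^ 2 ≤ (∑ i, p.1 i ^ 2) + p.2 ^ 2 := by
  have h0 : 0 ≤ ∑ i, p.1 i ^ 2 := Finset.sum_nonneg fun i _ => sq_nonneg _
  have h : ‖p‖ ≤ Real.sqrt ((∑ i, p.1 i ^ 2) + p.2 ^ 2) := by
    refine max_le ((pi_norm_le_iff_of_nonneg (Real.sqrt_nonneg _)).2 fun i => ?_) ?_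
    · refine Real.abs_le_sqrt ?_
      have := Finset.single_le_sum (f := fun i => p.1 i ^ 2) (fun i _ => sq_nonneg _)
        (Finset.mem_univ i)
      nlinarith [sq_nonneg p.2]
    · exact Real.abs_le_sqrt (by linarith)
  exact (Real.le_sqrt (norm_nonneg _) (by positivity)).1 h

theorem exists_abs_poisson_le (N : ℕ) : ∃ C : ℝ, 0 < C ∧ ∀ p : (Fin N → ℝ) × ℝ, p ≠ 0 →
    |poisson N p| ≤ C * |p.2| * (‖p‖ ^ (N + 1))⁻¹ := by
  refine ⟨Real.Gamma (((N : ℝ) + 1) / 2) / Real.pi ^ (((N : ℝ) + 1) / 2), ?_, fun p hp => ?_⟩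
  · have := Real.Gamma_pos_of_pos (show 0 < ((N : ℝ) + 1) / 2 by positivity)
    positivity
  have hp' : 0 < ‖p‖ := norm_pos_iff.2 hp
  have h1 : ‖p‖ ^ (N + 1) ≤ ((∑ i, p.1 i ^ 2) + p.2 ^ 2) ^ (((N : ℝ) + 1) / 2) := by
    refine le_trans (le_of_eq ?_) (Real.rpow_le_rpow (sq_nonneg ‖p‖) (norm_sq_le_sum_sq p)
      (by positivity))
    rw [← Real.rpow_natCast ‖p‖ 2, ← Real.rpow_mul hp'.le,
      show ((2 : ℕ) : ℝ) * (((N : ℝ) + 1) / 2) = ((N + 1 : ℕ) : ℝ) by push_cast; ring,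
      Real.rpow_natCast]
  have hG := Real.Gamma_pos_of_pos (show 0 < ((N : ℝ) + 1) / 2 by positivity)
  have hG' : 0 < Real.Gamma (((N : ℝ) + 1) / 2) / Real.pi ^ (((N : ℝ) + 1) / 2) := by positivity
  unfold poisson pk
  rw [abs_div, abs_mul, abs_of_pos hG', div_eq_mul_inv]
  refine mul_le_mul_of_nonneg_left ?_ (by positivity)
  rw [abs_of_pos ((by positivity : 0 < ‖p‖ ^ (N + 1)).trans_le h1)]
  exact inv_anti₀ (by positivity) h1

theorem exists_abs_dpk_le (N : ℕ) : ∃ C : ℝ, 0 < C ∧ ∀ d, ∀ p : (Fin N → ℝ) × ℝ, p ≠ 0 →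
    |dpk N d p| ≤ C * (‖p‖ ^ (N + 1))⁻¹ := by
  obtain ⟨C, hC0, hC⟩ := exists_norm_iteratedFDeriv_poisson_le N 1
  refine ⟨C, hC0, fun d p hp => ?_⟩
  refine le_trans ?_ (hC p hp)
  rw [norm_iteratedFDeriv_one]
  exact (fderiv ℝ (poisson N) p).unit_le_opNorm _ (norm_pdir_le N d)

theorem exists_norm_fderiv_dpk_le (N : ℕ) : ∃ C : ℝ, 0 < C ∧ ∀ d, ∀ p : (Fin N → ℝ) × ℝ,
    p ≠ 0 → ‖fderiv ℝ (dpk N d) p‖ ≤ C * (‖p‖ ^ (N + 2))⁻¹ := by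
  obtain ⟨C, hC0, hC⟩ := exists_norm_iteratedFDeriv_poisson_le N 2
  refine ⟨C, hC0, fun d p hp => ?_⟩
  refine le_trans ?_ (hC p hp)
  have hd : DifferentiableAt ℝ (fderiv ℝ (poisson N)) p :=
    ((contDiffAt_poisson hp 2).fderiv_right (m := 1) (by norm_num)).differentiableAt (by simp)
  rw [← norm_iteratedFDeriv_fderiv, norm_iteratedFDeriv_one]
  refine ContinuousLinearMap.opNorm_le_bound _ (norm_nonneg _) fun v => ?_
  have h1 : fderiv ℝ (dpk N d) p v = fderiv ℝ (fderiv ℝ (poisson N)) p v (pdir N d) := by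
    unfold dpk
    rw [fderiv_clm_apply hd (differentiableAt_const _)]
    simp
  rw [h1]
  exact (ContinuousLinearMap.unit_le_opNorm _ _ (norm_pdir_le N d)).trans
    (ContinuousLinearMap.le_opNorm _ _)

/-! ### The Poisson kernel is harmonic -/

section Harmonic

variable {N : ℕ}

theorem hasDerivAt_sum_sq_line (p v : (Fin N → ℝ) × ℝ) :
    HasDerivAt (fun τ : ℝ => (∑ i, (p + τ • v).1 i ^ 2) + (p + τ • v).2 ^ 2)
      (2 * ((∑ i, p.1 i * v.1 i) + p.2 * v.2)) 0 := by
  have h1 : ∀ a b : ℝ, HasDerivAt (fun τ : ℝ => (a + τ * b) ^ 2) (2 * (a * b)) 0 := by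
    intro a b
    have := (((hasDerivAt_id (0 : ℝ)).mul_const b).const_add a).pow 2
    refine this.congr_deriv ?_
    simp
    ring
  have h2 := (HasDerivAt.fun_sum fun i (_ : i ∈ Finset.univ) => h1 (p.1 i) (v.1 i)).add
    (h1 p.2 v.2)
  refine h2.congr_deriv ?_
  rw [mul_add, Finset.mul_sum]

theorem hasDerivAt_rpow_line {p : (Fin N → ℝ) × ℝ} (hp : p ≠ 0) (v : (Fin N → ℝ) × ℝ)
    (e : ℝ) :
    HasDerivAt (fun τ : ℝ => ((∑ i, (p + τ • v).1 i ^ 2) + (p + τ • v).2 ^ 2) ^ e)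
      (2 * ((∑ i, p.1 i * v.1 i) + p.2 * v.2) * e *
        ((∑ i, p.1 i ^ 2) + p.2 ^ 2) ^ (e - 1)) 0 := by
  have h := (hasDerivAt_sum_sq_line p v).rpow_const (p := e) (Or.inl (by
    simpa using (sum_sq_add_sq_pos hp).ne'))
  simpa using h

theorem hasDerivAt_snd_line (p v : (Fin N → ℝ) × ℝ) :
    HasDerivAt (fun τ : ℝ => (p + τ • v).2) v.2 0 := by
  have := ((hasDerivAt_id (0 : ℝ)).mul_const v.2).const_add p.2
  simpa using this

theorem hasDerivAt_inner_line (p v : (Fin N → ℝ) × ℝ) :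
    HasDerivAt (fun τ : ℝ => (∑ i, (p + τ • v).1 i * v.1 i) + (p + τ • v).2 * v.2)
      ((∑ i, v.1 i ^ 2) + v.2 ^ 2) 0 := by
  have h1 : ∀ a b : ℝ, HasDerivAt (fun τ : ℝ => (a + τ * b) * b) (b ^ 2) 0 := by
    intro a b
    have := (((hasDerivAt_id (0 : ℝ)).mul_const b).const_add a).mul_const b
    refine this.congr_deriv (by ring)
  exact (HasDerivAt.fun_sum fun i (_ : i ∈ Finset.univ) => h1 (p.1 i) (v.1 i)).add (h1 p.2 v.2)

/-- The normalising constant of the Poisson kernel. -/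
def pkConst (N : ℕ) : ℝ := Real.Gamma (((N : ℝ) + 1) / 2) / Real.pi ^ (((N : ℝ) + 1) / 2)

theorem poisson_eq (p : (Fin N → ℝ) × ℝ) : poisson N p =
    pkConst N * (p.2 * ((∑ i, p.1 i ^ 2) + p.2 ^ 2) ^ (-(((N : ℝ) + 1) / 2))) := by
  have h0 : 0 ≤ (∑ i, p.1 i ^ 2) + p.2 ^ 2 :=
    add_nonneg (Finset.sum_nonneg fun i _ => sq_nonneg _) (sq_nonneg _)
  rw [poisson, pk, Real.rpow_neg h0, pkConst]
  ring

theorem fderiv_poisson_apply {p : (Fin N → ℝ) × ℝ} (hp : p ≠ 0) (v : (Fin N → ℝ) × ℝ) :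
    fderiv ℝ (poisson N) p v = pkConst N *
      (v.2 * ((∑ i, p.1 i ^ 2) + p.2 ^ 2) ^ (-(((N : ℝ) + 1) / 2)) -
        ((N : ℝ) + 1) * (p.2 * ((∑ i, p.1 i * v.1 i) + p.2 * v.2) *
          ((∑ i, p.1 i ^ 2) + p.2 ^ 2) ^ (-(((N : ℝ) + 1) / 2) - 1))) := by
  have hd : DifferentiableAt ℝ (poisson N) p :=
    (contDiffAt_poisson hp 1).differentiableAt (by simp)
  rw [← hd.lineDeriv_eq_fderiv]
  have h := ((hasDerivAt_snd_line p v).mul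
    (hasDerivAt_rpow_line hp v (-(((N : ℝ) + 1) / 2)))).const_mul (pkConst N)
  have h2 : HasLineDerivAt ℝ (poisson N) _ p v := h.congr_of_eventuallyEq
    (Eventually.of_forall fun τ => poisson_eq _)
  rw [h2.lineDeriv]
  simp only [zero_smul, add_zero]
  ring

theorem line_ne_zero_eventually {p : (Fin N → ℝ) × ℝ} (hp : p ≠ 0) (v : (Fin N → ℝ) × ℝ) :
    ∀ᶠ τ : ℝ in 𝓝 0, p + τ • v ≠ 0 := by
  have : ContinuousAt (fun τ : ℝ => p + τ • v) 0 := by fun_prop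
  exact this.eventually_ne (by simpa using hp)

theorem fderiv_fderiv_poisson_apply {p : (Fin N → ℝ) × ℝ} (hp : p ≠ 0)
    (v : (Fin N → ℝ) × ℝ) :
    fderiv ℝ (fun q => fderiv ℝ (poisson N) q v) p v = -(pkConst N * ((N : ℝ) + 1)) *
      ((2 * v.2 * ((∑ i, p.1 i * v.1 i) + p.2 * v.2) + p.2 * ((∑ i, v.1 i ^ 2) + v.2 ^ 2)) *
          ((∑ i, p.1 i ^ 2) + p.2 ^ 2) ^ (-(((N : ℝ) + 1) / 2) - 1) -
        ((N : ℝ) + 3) * p.2 * ((∑ i, p.1 i * v.1 i) + p.2 * v.2) ^ 2 *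
          ((∑ i, p.1 i ^ 2) + p.2 ^ 2) ^ (-(((N : ℝ) + 1) / 2) - 1 - 1)) := by
  have hd : DifferentiableAt ℝ (fun q => fderiv ℝ (poisson N) q v) p :=
    (((contDiffAt_poisson hp 2).fderiv_right (m := 1) (by norm_num)).clm_apply
      contDiffAt_const).differentiableAt (by simp)
  rw [← hd.lineDeriv_eq_fderiv]
  have h := (((hasDerivAt_rpow_line hp v (-(((N : ℝ) + 1) / 2))).const_mul v.2).sub
    ((((hasDerivAt_snd_line p v).mul (hasDerivAt_inner_line p v)).mul
      (hasDerivAt_rpow_line hp v (-(((N : ℝ) + 1) / 2) - 1))).const_mul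
        ((N : ℝ) + 1))).const_mul (pkConst N)
  have h2 : HasLineDerivAt ℝ (fun q => fderiv ℝ (poisson N) q v) _ p v :=
    h.congr_of_eventuallyEq
      ((line_ne_zero_eventually hp v).mono fun τ hτ => fderiv_poisson_apply hτ v)
  rw [h2.lineDeriv]
  simp only [Pi.mul_apply, zero_smul, add_zero]
  ring

theorem pdir_castSucc (a : Fin N) : pdir N a.castSucc = (Pi.single a 1, 0) := by
  simp [pdir]

theorem pdir_last : pdir N (Fin.last N) = (0, 1) := by
  simp [pdir]

/-- The second partial derivatives of the Poisson kernel. -/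
def ddpk (N : ℕ) (d : Fin (N + 1)) (p : (Fin N → ℝ) × ℝ) : ℝ :=
  fderiv ℝ (dpk N d) p (pdir N d)

theorem sum_ddpk {p : (Fin N → ℝ) × ℝ} (hp : p ≠ 0) : ∑ d, ddpk N d p = 0 := by
  have h0 := sum_sq_add_sq_pos hp
  unfold ddpk dpk
  simp_rw [fderiv_fderiv_poisson_apply hp, ← Finset.mul_sum]
  rw [Fin.sum_univ_castSucc]
  simp only [pdir_castSucc, pdir_last]
  have h1 : ∀ a : Fin N, ∑ i, p.1 i * (Pi.single a (1 : ℝ) : Fin N → ℝ) i = p.1 a := by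
    intro a
    simp [Pi.single_apply]
  have h2 : ∀ a : Fin N, ∑ i, (Pi.single a (1 : ℝ) : Fin N → ℝ) i ^ 2 = 1 := by
    intro a
    simp [Pi.single_apply]
  simp only [h1, h2]
  simp only [Pi.zero_apply, mul_zero, zero_mul, Finset.sum_const_zero, zero_add, add_zero,
    zero_pow two_ne_zero, one_pow, mul_one, Finset.sum_sub_distrib, ← Finset.sum_mul,
    ← Finset.mul_sum, Finset.sum_const, Finset.card_univ, Fintype.card_fin, nsmul_eq_mul]
  set ρ := (∑ i, p.1 i ^ 2) + p.2 ^ 2 with hρ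
  have h3 : ρ ^ (-(((N : ℝ) + 1) / 2) - 1) = ρ ^ (-(((N : ℝ) + 1) / 2) - 1 - 1) * ρ := by
    conv_lhs => rw [show (-(((N : ℝ) + 1) / 2) - 1) = (-(((N : ℝ) + 1) / 2) - 1 - 1) + 1 by ring]
    rw [Real.rpow_add_one h0.ne']
  rw [h3, hρ]
  ring
end Harmonic

/-! ### Integrals of the Poisson kernel and its derivatives -/

section PoissonIntegrals

variable {N : ℕ}

/-- An integrable majorant for the Poisson kernel at heights at least `s`. -/
def maj (N : ℕ) (s : ℝ) (z : Fin N → ℝ) : ℝ := ((s + ‖z‖) ^ (N + 1))⁻¹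

theorem maj_nonneg {s : ℝ} (hs : 0 < s) (z : Fin N → ℝ) : 0 ≤ maj N s z := by
  unfold maj; positivity

theorem maj_le {s : ℝ} (hs : 0 < s) (z : Fin N → ℝ) : maj N s z ≤ (s ^ (N + 1))⁻¹ := by
  unfold maj
  gcongr
  linarith [norm_nonneg z]

@[fun_prop]
theorem measurable_maj (s : ℝ) : Measurable (maj N s) := by
  unfold maj; fun_prop

theorem integrable_maj {s : ℝ} (hs : 0 < s) : Integrable (maj N s) := by
  have h1 := integrable_one_add_norm (μ := (volume : Measure (Fin N → ℝ))) (r := (N + 1 : ℕ))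
    (by simp)
  refine (h1.const_mul ((min s 1 ^ (N + 1))⁻¹)).mono' (measurable_maj s).aestronglyMeasurable
    (Eventually.of_forall fun z => ?_)
  have hz := norm_nonneg z
  have hm : 0 < min s 1 := lt_min hs one_pos
  rw [Real.norm_of_nonneg (maj_nonneg hs z), Real.rpow_neg (by positivity), Real.rpow_natCast,
    ← mul_inv, ← mul_pow]
  unfold maj
  gcongr
  have h2 := min_le_left s 1
  have h3 := min_le_right s 1
  nlinarith

theorem mk_ne_zero {t : ℝ} (ht : 0 < t) (z : Fin N → ℝ) : (z, t) ≠ (0 : (Fin N → ℝ) × ℝ) := by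
  intro h
  exact ht.ne' (congrArg Prod.snd h)

theorem inv_norm_pow_le_maj {s t : ℝ} (hs : 0 < s) (hst : s ≤ t) (z : Fin N → ℝ) :
    (‖(z, t)‖ ^ (N + 1))⁻¹ ≤ 2 ^ (N + 1) * maj N s z := by
  have hz := norm_nonneg z
  unfold maj
  rw [← div_eq_mul_inv, le_div_iff₀ (by positivity), ← div_eq_inv_mul, ← div_pow]
  have h1 : ‖z‖ ≤ ‖(z, t)‖ := norm_fst_le (z, t)
  have h2 : t ≤ ‖(z, t)‖ := (le_abs_self t).trans (norm_snd_le (z, t))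
  gcongr
  rw [div_le_iff₀ (by linarith)]
  linarith

theorem exists_poisson_bounds (N : ℕ) : ∃ C : ℝ, 0 < C ∧ ∀ (s t : ℝ) (z : Fin N → ℝ), 0 < s →
    s ≤ t → |poisson N (z, t)| ≤ C * t * maj N s z ∧
      ∀ d, |dpk N d (z, t)| ≤ C * maj N s z ∧ |ddpk N d (z, t)| ≤ C * s⁻¹ * maj N s z := by
  obtain ⟨C1, hC1, h1⟩ := exists_abs_poisson_le N
  obtain ⟨C2, hC2, h2⟩ := exists_abs_dpk_le N
  obtain ⟨C3, hC3, h3⟩ := exists_norm_fderiv_dpk_le N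
  refine ⟨(C1 + C2 + C3) * 2 ^ (N + 1), by positivity, fun s t z hs hst => ?_⟩
  have hp := mk_ne_zero (hs.trans_le hst) z
  have ht := hs.trans_le hst
  have hm := inv_norm_pow_le_maj hs hst z
  have hm0 := maj_nonneg hs z
  refine ⟨?_, fun d => ⟨?_, ?_⟩⟩
  · refine (h1 _ hp).trans ?_
    rw [abs_of_pos ht]
    calc C1 * t * (‖(z, t)‖ ^ (N + 1))⁻¹ ≤ (C1 + C2 + C3) * t * (2 ^ (N + 1) * maj N s z) := by
          gcongr; linarith
      _ = _ := by ring
  · refine (h2 d _ hp).trans ?_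
    calc C2 * (‖(z, t)‖ ^ (N + 1))⁻¹ ≤ (C1 + C2 + C3) * (2 ^ (N + 1) * maj N s z) := by
          gcongr; linarith
      _ = _ := by ring
  · have h4 : |ddpk N d (z, t)| ≤ ‖fderiv ℝ (dpk N d) (z, t)‖ :=
      (fderiv ℝ (dpk N d) (z, t)).unit_le_opNorm _ (norm_pdir_le N d)
    refine (h4.trans (h3 d _ hp)).trans ?_
    have h5 : s ≤ ‖(z, t)‖ := hst.trans ((le_abs_self t).trans (norm_snd_le (z, t)))
    calc C3 * (‖(z, t)‖ ^ (N + 2))⁻¹ = C3 * (‖(z, t)‖⁻¹ * (‖(z, t)‖ ^ (N + 1))⁻¹) := by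
          rw [pow_succ _ (N + 1), mul_inv]; ring
      _ ≤ (C1 + C2 + C3) * (s⁻¹ * (2 ^ (N + 1) * maj N s z)) := by
          gcongr; linarith
      _ = _ := by ring

@[fun_prop]
theorem measurable_poisson : Measurable (poisson N) := by
  unfold poisson pk; fun_prop

@[fun_prop]
theorem measurable_dpk (d : Fin (N + 1)) : Measurable (dpk N d) :=
  measurable_fderiv_apply_const ℝ _ _

@[fun_prop]
theorem measurable_ddpk (d : Fin (N + 1)) : Measurable (ddpk N d) :=
  measurable_fderiv_apply_const ℝ _ _

theorem integrable_poisson {t : ℝ} (ht : 0 < t) : Integrable fun z => poisson N (z, t) := by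
  obtain ⟨C, hC0, hC⟩ := exists_poisson_bounds N
  exact ((integrable_maj ht).const_mul (C * t)).mono'
    (by fun_prop : Measurable fun z => poisson N (z, t)).aestronglyMeasurable
    (Eventually.of_forall fun z => (hC t t z ht le_rfl).1)

theorem integrable_dpk {t : ℝ} (ht : 0 < t) (d : Fin (N + 1)) :
    Integrable fun z => dpk N d (z, t) := by
  obtain ⟨C, hC0, hC⟩ := exists_poisson_bounds N
  exact ((integrable_maj ht).const_mul C).mono'
    (by fun_prop : Measurable fun z => dpk N d (z, t)).aestronglyMeasurable
    (Eventually.of_forall fun z => ((hC t t z ht le_rfl).2 d).1)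

theorem poisson_pos {t : ℝ} (ht : 0 < t) (z : Fin N → ℝ) : 0 < poisson N (z, t) := by
  have := Real.Gamma_pos_of_pos (show 0 < ((N : ℝ) + 1) / 2 by positivity)
  have := sum_sq_add_sq_pos (mk_ne_zero ht z)
  simp only at this
  unfold poisson pk
  simp only
  positivity

theorem poisson_scale {t : ℝ} (ht : 0 < t) (z : Fin N → ℝ) :
    poisson N (t • z, t) = (t ^ N)⁻¹ * poisson N (z, 1) := by
  rw [← poisson_smul ht]; simp

theorem dpk_smul {r : ℝ} (hr : 0 < r) {p : (Fin N → ℝ) × ℝ} (hp : p ≠ 0) (d : Fin (N + 1)) :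
    dpk N d (r • p) = (r ^ (N + 1))⁻¹ * dpk N d p := by
  have h := iteratedFDeriv_poisson_smul hr 1 hp
  have h2 := congrArg (fun A => A fun _ => pdir N d) h
  simp only [smul_apply, iteratedFDeriv_one_apply, smul_eq_mul] at h2
  unfold dpk
  rw [← h2]
  field_simp

theorem dpk_scale {t : ℝ} (ht : 0 < t) (z : Fin N → ℝ) (d : Fin (N + 1)) :
    t * dpk N d (t • z, t) = (t ^ N)⁻¹ * dpk N d (z, 1) := by
  have := dpk_smul ht (mk_ne_zero one_pos z) d
  rw [Prod.smul_mk, smul_eq_mul, mul_one] at this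
  rw [this]
  field_simp
  ring

/-- The mass of the Poisson kernel. -/
def poissonMass (N : ℕ) : ℝ := ∫ z, poisson N (z, 1)

theorem poissonMass_pos : 0 < poissonMass N := by
  unfold poissonMass
  rw [integral_pos_iff_support_of_nonneg (fun z => (poisson_pos one_pos z).le)
    (integrable_poisson one_pos)]
  rw [show Function.support (fun z => poisson N (z, 1)) = Set.univ from
    Set.eq_univ_of_forall fun z => (poisson_pos one_pos z).ne']
  exact (Measure.measure_univ_pos).2 (NeZero.ne _)

theorem integral_poisson {t : ℝ} (ht : 0 < t) : ∫ z, poisson N (z, t) = poissonMass N := by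
  have h := Measure.integral_comp_smul volume (fun z => poisson N (z, t)) t
  simp only [poisson_scale ht, integral_const_mul] at h
  rw [Module.finrank_fin_fun, abs_of_pos (by positivity), smul_eq_mul] at h
  exact (mul_left_cancel₀ (by positivity) h).symm

theorem hasDerivAt_poisson_snd {t : ℝ} (ht : 0 < t) (z : Fin N → ℝ) :
    HasDerivAt (fun s => poisson N (z, s)) (dpk N (Fin.last N) (z, t)) t := by
  have hd : DifferentiableAt ℝ (poisson N) (z, t) :=
    (contDiffAt_poisson (mk_ne_zero ht z) 1).differentiableAt (by simp)
  have h2 : HasDerivAt (fun s : ℝ => (z, s)) ((0 : Fin N → ℝ), (1 : ℝ)) t :=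
    (hasDerivAt_const t z).prodMk (hasDerivAt_id t)
  rw [dpk, pdir_last]
  exact hd.hasFDerivAt.comp_hasDerivAt t h2

theorem hasDerivAt_dpk_snd {t : ℝ} (ht : 0 < t) (z : Fin N → ℝ) :
    HasDerivAt (fun s => dpk N (Fin.last N) (z, s)) (ddpk N (Fin.last N) (z, t)) t := by
  have hd : DifferentiableAt ℝ (dpk N (Fin.last N)) (z, t) :=
    (contDiffAt_dpk _ (mk_ne_zero ht z) 1).differentiableAt (by simp)
  have h2 : HasDerivAt (fun s : ℝ => (z, s)) ((0 : Fin N → ℝ), (1 : ℝ)) t :=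
    (hasDerivAt_const t z).prodMk (hasDerivAt_id t)
  rw [ddpk, pdir_last]
  exact hd.hasFDerivAt.comp_hasDerivAt t h2

theorem hasLineDerivAt_fst {F : (Fin N → ℝ) × ℝ → ℝ} {t : ℝ} {z : Fin N → ℝ}
    (hd : DifferentiableAt ℝ F (z, t)) (b : Fin N) :
    HasLineDerivAt ℝ (fun w => F (w, t)) (fderiv ℝ F (z, t) (pdir N b.castSucc)) z
      (Pi.single b 1) := by
  have h := hd.hasFDerivAt.hasLineDerivAt (pdir N b.castSucc)
  rw [pdir_castSucc] at h ⊢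
  unfold HasLineDerivAt at h ⊢
  simpa using h

theorem integral_lineDeriv_eq_zero {g g' : (Fin N → ℝ) → ℝ} {v : Fin N → ℝ}
    (h : ∀ z, HasLineDerivAt ℝ g (g' z) z v) (hg : Integrable g) (hg' : Integrable g') :
    ∫ z, g' z = 0 := by
  have := integral_bilinear_hasLineDerivAt_right_eq_neg_left_of_integrable
    (μ := (volume : Measure (Fin N → ℝ))) (f := fun _ => (1 : ℝ)) (f' := fun _ => (0 : ℝ))
    (g := g) (g' := g') (v := v) (B := ContinuousLinearMap.mul ℝ ℝ)
    (by simp) (by simpa using hg') (by simpa using hg)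
    (fun x _ => hasDerivAt_const _ _) (fun x _ => h x)
  simpa using this

theorem integral_dpk {t : ℝ} (ht : 0 < t) (d : Fin (N + 1)) : ∫ z, dpk N d (z, t) = 0 := by
  induction d using Fin.lastCases with
  | cast b =>
    exact integral_lineDeriv_eq_zero (fun z => hasLineDerivAt_fst
      ((contDiffAt_poisson (mk_ne_zero ht z) 1).differentiableAt (by simp)) b)
      (integrable_poisson ht) (integrable_dpk ht _)
  | last =>
    obtain ⟨C, hC0, hC⟩ := exists_poisson_bounds N
    have h := (hasDerivAt_integral_of_dominated_loc_of_deriv_le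
        (μ := (volume : Measure (Fin N → ℝ)))
      (F := fun s z => poisson N (z, s)) (F' := fun s z => dpk N (Fin.last N) (z, s))
      (bound := fun z => C * maj N (t / 2) z) (Ioi_mem_nhds (half_lt_self ht))
      (Eventually.of_forall fun s =>
        (by fun_prop : Measurable fun z => poisson N (z, s)).aestronglyMeasurable)
      (integrable_poisson ht)
      (by fun_prop : Measurable fun z => dpk N (Fin.last N) (z, t)).aestronglyMeasurable
      (Eventually.of_forall fun z s hs =>
        ((hC (t / 2) s z (half_pos ht) (le_of_lt hs)).2 _).1)
      ((integrable_maj (half_pos ht)).const_mul C)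
      (Eventually.of_forall fun z s hs =>
        hasDerivAt_poisson_snd ((half_pos ht).trans hs) z)).2
    refine h.unique ((hasDerivAt_const t (poissonMass N)).congr_of_eventuallyEq ?_)
    filter_upwards [Ioi_mem_nhds ht] with s hs using integral_poisson hs

end PoissonIntegrals

/-! ### Green's identity for pairs of Poisson kernels -/

section Green

variable {N : ℕ}

theorem contDiffAt_ddpk (d : Fin (N + 1)) {p : (Fin N → ℝ) × ℝ} (hp : p ≠ 0) (m : ℕ∞) :
    ContDiffAt ℝ m (ddpk N d) p := by
  unfold ddpk
  exact ((contDiffAt_dpk d hp (m + 1)).fderiv_right (m := m) (by simp)).clm_apply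
    contDiffAt_const

theorem continuousAt_snd_of_contDiffAt {F : (Fin N → ℝ) × ℝ → ℝ}
    (hF : ∀ p, p ≠ 0 → ContDiffAt ℝ ((0 : ℕ∞) : WithTop ℕ∞) F p) {t : ℝ} (ht : 0 < t)
    (z : Fin N → ℝ) :
    ContinuousAt (fun s => F (z, s)) t :=
  ContinuousAt.comp (f := fun s : ℝ => (z, s)) (hF (z, t) (mk_ne_zero ht z)).continuousAt
    (by fun_prop)

theorem hasLineDerivAt_comp_sub {g : (Fin N → ℝ) → ℝ} {g' : ℝ} {z a v : Fin N → ℝ}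
    (h : HasLineDerivAt ℝ g g' (z - a) v) : HasLineDerivAt ℝ (fun w => g (w - a)) g' z v := by
  unfold HasLineDerivAt at h ⊢
  simpa only [add_sub_right_comm] using h

theorem HasLineDerivAt.mul' {g h : (Fin N → ℝ) → ℝ} {g' h' : ℝ} {z v : Fin N → ℝ}
    (hg : HasLineDerivAt ℝ g g' z v) (hh : HasLineDerivAt ℝ h h' z v) :
    HasLineDerivAt ℝ (fun w => g w * h w) (g' * h z + g z * h') z v := by
  unfold HasLineDerivAt at hg hh ⊢
  refine (hg.mul hh).congr_deriv ?_
  simp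

theorem HasLineDerivAt.add' {g h : (Fin N → ℝ) → ℝ} {g' h' : ℝ} {z v : Fin N → ℝ}
    (hg : HasLineDerivAt ℝ g g' z v) (hh : HasLineDerivAt ℝ h h' z v) :
    HasLineDerivAt ℝ (fun w => g w + h w) (g' + h') z v := by
  unfold HasLineDerivAt at hg hh ⊢
  exact hg.add hh

theorem ae_snd_mem_Ioc (ε T : ℝ) :
    ∀ᵐ p ∂((volume : Measure (Fin N → ℝ)).prod (volume.restrict (Set.Ioc ε T))),
      p.2 ∈ Set.Ioc ε T :=
  Measure.quasiMeasurePreserving_snd.ae (ae_restrict_mem measurableSet_Ioc)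

theorem integrable_prod_of_le_maj {ε T C : ℝ} (hε : 0 < ε) {a : Fin N → ℝ}
    {F : (Fin N → ℝ) × ℝ → ℝ} (hF : Measurable F)
    (h : ∀ z t, t ∈ Set.Ioc ε T → |F (z, t)| ≤ C * maj N ε (z - a)) :
    Integrable F ((volume : Measure (Fin N → ℝ)).prod (volume.restrict (Set.Ioc ε T))) := by
  have h1 : Integrable (fun p : (Fin N → ℝ) × ℝ => C * maj N ε (p.1 - a) * 1)
      ((volume : Measure (Fin N → ℝ)).prod (volume.restrict (Set.Ioc ε T))) :=
    (((integrable_maj hε).comp_sub_right a).const_mul C).mul_prod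
      (ν := volume.restrict (Set.Ioc ε T)) (g := fun _ => (1 : ℝ)) (by fun_prop)
  refine h1.mono' hF.aestronglyMeasurable ?_
  filter_upwards [ae_snd_mem_Ioc (N := N) ε T] with p hp
  rw [mul_one]
  exact h p.1 p.2 hp

/-- The second derivative in the direction `d` of the product of two translated Poisson
kernels. -/
def qdd (d : Fin (N + 1)) (a b : Fin N → ℝ) (p : (Fin N → ℝ) × ℝ) : ℝ :=
  ddpk N d (p.1 - a, p.2) * poisson N (p.1 - b, p.2) +
    2 * (dpk N d (p.1 - a, p.2) * dpk N d (p.1 - b, p.2)) +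
    poisson N (p.1 - a, p.2) * ddpk N d (p.1 - b, p.2)

/-- The first derivative in the direction `d` of the product of two translated Poisson
kernels. -/
def qd (d : Fin (N + 1)) (a b : Fin N → ℝ) (p : (Fin N → ℝ) × ℝ) : ℝ :=
  dpk N d (p.1 - a, p.2) * poisson N (p.1 - b, p.2) +
    poisson N (p.1 - a, p.2) * dpk N d (p.1 - b, p.2)

theorem measurable_qdd (d : Fin (N + 1)) (a b : Fin N → ℝ) : Measurable (qdd d a b) := by
  unfold qdd; fun_prop

theorem measurable_qd (d : Fin (N + 1)) (a b : Fin N → ℝ) : Measurable (qd d a b) := by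
  unfold qd; fun_prop

theorem exists_q_bounds (N : ℕ) {ε : ℝ} (hε : 0 < ε) (T : ℝ) : ∃ C : ℝ, 0 < C ∧
    ∀ (a b z : Fin N → ℝ) (t : ℝ), t ∈ Set.Icc ε T →
      |poisson N (z - a, t) * poisson N (z - b, t)| ≤ C * maj N ε (z - a) ∧
      ∀ d, |qd d a b (z, t)| ≤ C * maj N ε (z - a) ∧
        |qdd d a b (z, t)| ≤ C * maj N ε (z - a) ∧
        |dpk N d (z - a, t) * dpk N d (z - b, t)| ≤ C * maj N ε (z - a) := by
  obtain ⟨C, hC0, hC⟩ := exists_poisson_bounds N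
  have key : ∀ (z : Fin N → ℝ) (t : ℝ), t ∈ Set.Icc ε T →
      |poisson N (z, t)| ≤ C * (1 + |T| + ε⁻¹) * maj N ε z ∧
      ∀ d, |dpk N d (z, t)| ≤ C * (1 + |T| + ε⁻¹) * maj N ε z ∧
        |ddpk N d (z, t)| ≤ C * (1 + |T| + ε⁻¹) * maj N ε z := by
    intro z t ht
    obtain ⟨h1, h2⟩ := hC ε t z hε ht.1
    have hm := maj_nonneg hε z
    have h3 := le_abs_self T
    have h4 := ht.2
    have h5 := abs_nonneg T
    have h6 : 0 < ε⁻¹ := by positivity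
    refine ⟨h1.trans ?_, fun d => ⟨(h2 d).1.trans ?_, (h2 d).2.trans ?_⟩⟩
    · gcongr; linarith
    · rw [mul_assoc]
      have : maj N ε z ≤ (1 + |T| + ε⁻¹) * maj N ε z := le_mul_of_one_le_left hm (by linarith)
      gcongr
    · gcongr; linarith
  have h5 := abs_nonneg T
  have h6 : 0 < ε⁻¹ := by positivity
  set D := C * (1 + |T| + ε⁻¹) with hD
  have hD0 : 0 < D := by positivity
  have hmul : ∀ {u v A B : ℝ} , 0 ≤ A → |u| ≤ D * A → |v| ≤ D * B → B ≤ (ε ^ (N + 1))⁻¹ →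
      |u * v| ≤ D * D * (ε ^ (N + 1))⁻¹ * A := by
    intro u v A B hA hu hv hB
    rw [abs_mul]
    calc |u| * |v| ≤ (D * A) * (D * (ε ^ (N + 1))⁻¹) := by
          refine mul_le_mul hu (hv.trans (by gcongr)) (abs_nonneg _) (by positivity)
      _ = _ := by ring
  refine ⟨4 * (D * D * (ε ^ (N + 1))⁻¹), by positivity, fun a b z t ht => ?_⟩
  obtain ⟨p1, d1⟩ := key (z - a) t ht
  obtain ⟨p2, d2⟩ := key (z - b) t ht
  have hm := maj_nonneg hε (z - a)
  have hb := maj_le hε (z - b)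
  have hX : 0 ≤ D * D * (ε ^ (N + 1))⁻¹ * maj N ε (z - a) := by positivity
  refine ⟨(hmul hm p1 p2 hb).trans (by linarith), fun d => ⟨?_, ?_, ?_⟩⟩
  · have e1 := hmul hm (d1 d).1 p2 hb
    have e2 := hmul hm p1 (d2 d).1 hb
    refine (abs_add_le _ _).trans ?_
    simp only
    linarith
  · have e1 := hmul hm (d1 d).2 p2 hb
    have e2 := hmul hm p1 (d2 d).2 hb
    have e3 := hmul hm (d1 d).1 (d2 d).1 hb
    refine (abs_add_le _ _).trans ((add_le_add_left (abs_add_le _ _) _).trans ?_)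
    rw [abs_mul 2, abs_two]
    simp only
    linarith
  · exact (hmul hm (d1 d).1 (d2 d).1 hb).trans (by linarith)

theorem integral_qdd_castSucc {t : ℝ} (ht : 0 < t) (b' : Fin N) (a b : Fin N → ℝ) :
    ∫ z, qdd b'.castSucc a b (z, t) = 0 := by
  obtain ⟨C, hC0, hC⟩ := exists_q_bounds N ht t
  have hm : Integrable fun z => C * maj N t (z - a) :=
    ((integrable_maj ht).comp_sub_right a).const_mul C
  refine integral_lineDeriv_eq_zero (g := fun z => qd b'.castSucc a b (z, t))
    (v := Pi.single b' 1) (fun z => ?_) ?_ ?_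
  · have e : ∀ c, HasLineDerivAt ℝ (fun w => poisson N (w - c, t))
        (dpk N b'.castSucc (z - c, t)) z (Pi.single b' 1) := fun c =>
      hasLineDerivAt_comp_sub (g := fun w => poisson N (w, t)) (hasLineDerivAt_fst
        ((contDiffAt_poisson (mk_ne_zero ht _) 1).differentiableAt (by simp)) b')
    have e2 : ∀ c, HasLineDerivAt ℝ (fun w => dpk N b'.castSucc (w - c, t))
        (ddpk N b'.castSucc (z - c, t)) z (Pi.single b' 1) := fun c =>
      hasLineDerivAt_comp_sub (g := fun w => dpk N b'.castSucc (w, t)) (hasLineDerivAt_fst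
        ((contDiffAt_dpk _ (mk_ne_zero ht _) 1).differentiableAt (by simp)) b')
    refine HasDerivAt.congr_deriv (HasLineDerivAt.add' (HasLineDerivAt.mul' (e2 a) (e b))
      (HasLineDerivAt.mul' (e a) (e2 b))) ?_
    simp only [qdd]
    ring
  · exact hm.mono' ((measurable_qd _ a b).comp (by fun_prop)).aestronglyMeasurable
      (Eventually.of_forall fun z => ((hC a b z t ⟨le_rfl, le_rfl⟩).2 _).1)
  · exact hm.mono' ((measurable_qdd _ a b).comp (by fun_prop)).aestronglyMeasurable
      (Eventually.of_forall fun z => ((hC a b z t ⟨le_rfl, le_rfl⟩).2 _).2.1)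

/-- The boundary density in Green's identity. -/
def bdry (a b z : Fin N → ℝ) (t : ℝ) : ℝ :=
  poisson N (z - a, t) * poisson N (z - b, t) - t * qd (Fin.last N) a b (z, t)

theorem integral_qdd_last {ε T : ℝ} (hε : 0 < ε) (hT : ε ≤ T) (a b z : Fin N → ℝ) :
    ∫ t in Set.Ioc ε T, t * qdd (Fin.last N) a b (z, t) = bdry a b z ε - bdry a b z T := by
  rw [← intervalIntegral.integral_of_le hT]
  have hpos : ∀ t ∈ Set.uIcc ε T, 0 < t := fun t ht => by
    rw [Set.uIcc_of_le hT] at ht; exact hε.trans_le ht.1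
  have h := intervalIntegral.integral_eq_sub_of_hasDerivAt (a := ε) (b := T)
    (f := fun t => -bdry a b z t) (f' := fun t => t * qdd (Fin.last N) a b (z, t))
    (fun t ht => ?_) ?_
  · rw [h]; ring
  · have h0 := hpos t ht
    have e1 := fun c => hasDerivAt_poisson_snd h0 (z - c)
    have e2 := fun c => hasDerivAt_dpk_snd h0 (z - c)
    refine (((e1 a).mul (e1 b)).sub ((hasDerivAt_id t).mul
      (((e2 a).mul (e1 b)).add ((e1 a).mul (e2 b))))).neg.congr_deriv ?_
    simp only [Pi.mul_apply, Pi.add_apply, id, qdd]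
    ring
  · refine ContinuousOn.intervalIntegrable fun t ht => ContinuousAt.continuousWithinAt ?_
    have h0 := hpos t ht
    have c1 := fun c => continuousAt_snd_of_contDiffAt (fun p hp => contDiffAt_poisson hp 0) h0
      (z - c)
    have c2 := fun c => continuousAt_snd_of_contDiffAt
      (fun p hp => contDiffAt_dpk (Fin.last N) hp 0) h0 (z - c)
    have c3 := fun c => continuousAt_snd_of_contDiffAt
      (fun p hp => contDiffAt_ddpk (Fin.last N) hp 0) h0 (z - c)
    exact continuousAt_id.mul ((((c3 a).mul (c1 b)).add
      (continuousAt_const.mul ((c2 a).mul (c2 b)))).add ((c1 a).mul (c3 b)))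

theorem integrable_bdry {t : ℝ} (ht : 0 < t) (a b : Fin N → ℝ) :
    Integrable fun z => bdry a b z t := by
  obtain ⟨C, hC0, hC⟩ := exists_q_bounds N ht t
  have hm : Integrable fun z => C * maj N t (z - a) :=
    ((integrable_maj ht).comp_sub_right a).const_mul C
  refine Integrable.sub (hm.mono'
    (by fun_prop : Measurable fun z => poisson N (z - a, t) * poisson N (z - b, t)).aestronglyMeasurable
    (Eventually.of_forall fun z => (hC a b z t ⟨le_rfl, le_rfl⟩).1)) (Integrable.const_mul
      (hm.mono' ((measurable_qd _ a b).comp (by fun_prop)).aestronglyMeasurable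
      (Eventually.of_forall fun z => ((hC a b z t ⟨le_rfl, le_rfl⟩).2 _).1)) t)

theorem integral_green {ε T : ℝ} (hε : 0 < ε) (hT : ε ≤ T) (a b : Fin N → ℝ) :
    ∫ p, p.2 * ∑ d, dpk N d (p.1 - a, p.2) * dpk N d (p.1 - b, p.2)
        ∂((volume : Measure (Fin N → ℝ)).prod (volume.restrict (Set.Ioc ε T))) =
      2⁻¹ * ((∫ z, bdry a b z ε) - ∫ z, bdry a b z T) := by
  obtain ⟨C, hC0, hC⟩ := exists_q_bounds N hε T
  have hinteg : ∀ d, Integrable (fun p => p.2 * qdd d a b p)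
      ((volume : Measure (Fin N → ℝ)).prod (volume.restrict (Set.Ioc ε T))) := fun d => by
    refine integrable_prod_of_le_maj (C := T * C) (a := a) hε
      (measurable_snd.mul (measurable_qdd d a b)) fun z t ht => ?_
    rw [abs_mul, abs_of_pos (hε.trans ht.1), mul_assoc]
    exact mul_le_mul ht.2 ((hC a b z t ⟨ht.1.le, ht.2⟩).2 d).2.1 (abs_nonneg _)
      (hε.le.trans hT)
  have h1 : ∫ p, p.2 * ∑ d, dpk N d (p.1 - a, p.2) * dpk N d (p.1 - b, p.2)
        ∂((volume : Measure (Fin N → ℝ)).prod (volume.restrict (Set.Ioc ε T))) =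
      ∫ p, 2⁻¹ * ∑ d, p.2 * qdd d a b p
        ∂((volume : Measure (Fin N → ℝ)).prod (volume.restrict (Set.Ioc ε T))) := by
    refine integral_congr_ae ?_
    filter_upwards [ae_snd_mem_Ioc (N := N) ε T] with p hp
    have h0 : 0 < p.2 := hε.trans hp.1
    have e1 := sum_ddpk (mk_ne_zero h0 (p.1 - a))
    have e2 := sum_ddpk (mk_ne_zero h0 (p.1 - b))
    rw [← Finset.mul_sum]
    simp only [qdd, Finset.sum_add_distrib, ← Finset.mul_sum, ← Finset.sum_mul, e1, e2]
    ring
  rw [h1, integral_const_mul, integral_finsetSum _ fun d _ => hinteg d, Fin.sum_univ_castSucc,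
    integral_prod _ (hinteg _)]
  simp only [integral_qdd_last hε hT]
  rw [integral_sub (integrable_bdry hε a b) (integrable_bdry (hε.trans_le hT) a b),
    Finset.sum_eq_zero, zero_add]
  intro b' _
  rw [integral_prod_symm _ (hinteg _)]
  refine integral_eq_zero_of_ae ?_
  filter_upwards [ae_restrict_mem measurableSet_Ioc] with t ht
  simp only [integral_const_mul]
  rw [integral_qdd_castSucc (hε.trans ht.1), mul_zero]
  rfl

end Green

/-! ### The one-variable reproducing formula -/

section Calderon

variable {N : ℕ}

/-- The profile of the boundary term in Green's identity. -/
def greenProfile (N : ℕ) (p : (Fin N → ℝ) × (Fin N → ℝ)) : ℝ :=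
  poisson N (p.1, 1) * poisson N (p.2, 1) -
    (dpk N (Fin.last N) (p.1, 1) * poisson N (p.2, 1) +
      poisson N (p.1, 1) * dpk N (Fin.last N) (p.2, 1))

/-- The kernel of the boundary operator in Green's identity. -/
def greenKernel (N : ℕ) (u : Fin N → ℝ) : ℝ := ∫ v, greenProfile N (v, v + u)

theorem integrable_greenProfile :
    Integrable (greenProfile N) ((volume : Measure (Fin N → ℝ)).prod volume) := by
  have h1 := integrable_poisson (N := N) one_pos
  have h2 := integrable_dpk (N := N) one_pos (Fin.last N)
  exact (h1.mul_prod h1).sub ((h2.mul_prod h1).add (h1.mul_prod h2))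

theorem integral_greenProfile :
    ∫ p, greenProfile N p ∂((volume : Measure (Fin N → ℝ)).prod volume) = poissonMass N ^ 2 := by
  have h1 := integrable_poisson (N := N) one_pos
  have h2 := integrable_dpk (N := N) one_pos (Fin.last N)
  unfold greenProfile
  refine (integral_sub (h1.mul_prod h1) ((h2.mul_prod h1).add (h1.mul_prod h2))).trans ?_
  simp only [Pi.add_apply]
  rw [integral_add (h2.mul_prod h1) (h1.mul_prod h2)]
  rw [integral_prod_mul (fun z => poisson N (z, 1)) (fun z => poisson N (z, 1)),
    integral_prod_mul (fun z => dpk N (Fin.last N) (z, 1)) (fun z => poisson N (z, 1)),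
    integral_prod_mul (fun z => poisson N (z, 1)) (fun z => dpk N (Fin.last N) (z, 1)),
    integral_dpk one_pos, integral_poisson one_pos]
  ring

theorem integrable_greenProfile_shear :
    Integrable (fun p : (Fin N → ℝ) × (Fin N → ℝ) => greenProfile N (p.1, p.1 + p.2))
      (volume.prod volume) :=
  (measurePreserving_prod_add (volume : Measure (Fin N → ℝ)) volume).integrable_comp_of_integrable
    integrable_greenProfile

theorem integrable_greenKernel : Integrable (greenKernel N) :=
  integrable_greenProfile_shear.integral_prod_right

theorem integral_greenKernel : ∫ u, greenKernel N u = poissonMass N ^ 2 := by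
  unfold greenKernel
  have h := measurePreserving_prod_add (volume : Measure (Fin N → ℝ)) volume
  have h1 : AEStronglyMeasurable (greenProfile N) (Measure.map
      (fun z : (Fin N → ℝ) × (Fin N → ℝ) => (z.1, z.1 + z.2)) (volume.prod volume)) := by
    rw [h.map_eq]
    exact integrable_greenProfile.aestronglyMeasurable
  have h2 := integral_map h.measurable.aemeasurable h1
  rw [h.map_eq, integral_greenProfile] at h2
  rw [h2]
  exact (integral_prod_symm _ integrable_greenProfile_shear).symm

theorem integral_bdry {t : ℝ} (ht : 0 < t) (a b : Fin N → ℝ) :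
    ∫ z, bdry a b z t = (t ^ N)⁻¹ * greenKernel N (t⁻¹ • (a - b)) := by
  have h := Measure.integral_comp_smul volume (fun z => bdry a b (z + a) t) t
  rw [integral_add_right_eq_self (fun z => bdry a b z t) a] at h
  rw [Module.finrank_fin_fun, abs_of_pos (by positivity), smul_eq_mul] at h
  have e : ∀ v, bdry a b (t • v + a) t =
      (t ^ N)⁻¹ * ((t ^ N)⁻¹ * greenProfile N (v, v + t⁻¹ • (a - b))) := by
    intro v
    have e1 : t • v + a - a = t • v := by simp
    have e2 : t • v + a - b = t • (v + t⁻¹ • (a - b)) := by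
      rw [smul_add, smul_smul, mul_inv_cancel₀ ht.ne', one_smul]; abel
    unfold bdry qd greenProfile
    simp only [e1, e2]
    rw [mul_add, ← mul_assoc, mul_left_comm t (poisson N _), dpk_scale ht, dpk_scale ht,
      poisson_scale ht, poisson_scale ht]
    ring
  simp only [e, integral_const_mul] at h
  exact (mul_left_cancel₀ (by positivity) h).symm

theorem integral_mul_greenKernel {t : ℝ} (ht : 0 < t) (h : (Fin N → ℝ) → ℝ) (w : Fin N → ℝ) :
    ∫ x, h x * ((t ^ N)⁻¹ * greenKernel N (t⁻¹ • (w - x))) =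
      ∫ u, h (w - t • u) * greenKernel N u := by
  have e := Measure.integral_comp_inv_smul volume (fun u => h (w - t • u) * greenKernel N u) t
  rw [← integral_sub_left_eq_self _ volume w] at e
  rw [Module.finrank_fin_fun, abs_of_pos (by positivity), smul_eq_mul] at e
  simp only [smul_inv_smul₀ ht.ne', sub_sub_cancel] at e
  rw [show (fun x => h x * ((t ^ N)⁻¹ * greenKernel N (t⁻¹ • (w - x)))) =
    fun x => (t ^ N)⁻¹ * (h x * greenKernel N (t⁻¹ • (w - x))) by ext x; ring,
    integral_const_mul, e]
  field_simp

/-- The measure `dz dt` on a truncated upper half space. -/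
def slabMeasure (N m : ℕ) : Measure ((Fin N → ℝ) × ℝ) :=
  (volume : Measure (Fin N → ℝ)).prod (volume.restrict (Set.Ioc ((m : ℝ) + 1)⁻¹ ((m : ℝ) + 1)))

instance (N m : ℕ) : SigmaFinite (slabMeasure N m) := by
  unfold slabMeasure; infer_instance

/-- The truncated reproducing operator. -/
def calA (N m : ℕ) (h : (Fin N → ℝ) → ℝ) (w : Fin N → ℝ) : ℝ :=
  ∫ p, p.2 * ∑ d, dpk N d (p.1 - w, p.2) * (∫ x, h x * dpk N d (p.1 - x, p.2)) ∂slabMeasure N m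

theorem truncation_pos (m : ℕ) : (0 : ℝ) < ((m : ℝ) + 1)⁻¹ := by positivity

theorem truncation_le (m : ℕ) : ((m : ℝ) + 1)⁻¹ ≤ (m : ℝ) + 1 := by
  have : (1 : ℝ) ≤ (m : ℝ) + 1 := by simp
  exact (inv_le_one_of_one_le₀ this).trans this

theorem calA_eq (m : ℕ) {h : (Fin N → ℝ) → ℝ} (hm : Measurable h) (hi : Integrable h)
    {M : ℝ} (hM : ∀ x, |h x| ≤ M) (w : Fin N → ℝ) :
    calA N m h w = 2⁻¹ * ((∫ u, h (w - ((m : ℝ) + 1)⁻¹ • u) * greenKernel N u) -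
      ∫ u, h (w - ((m : ℝ) + 1) • u) * greenKernel N u) := by
  have hε := truncation_pos m
  have hT := truncation_le m
  have hT0 : (0 : ℝ) < (m : ℝ) + 1 := by positivity
  obtain ⟨C, hC0, hC⟩ := exists_q_bounds N hε ((m : ℝ) + 1)
  have hmaj : Integrable (fun p : (Fin N → ℝ) × ℝ =>
      (((m : ℝ) + 1) * ((N + 1 : ℕ) * C)) * maj N ((m : ℝ) + 1)⁻¹ (p.1 - w)) (slabMeasure N m) := by
    refine integrable_prod_of_le_maj (C := (((m : ℝ) + 1) * ((N + 1 : ℕ) * C))) (a := w) hε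
      (by fun_prop) fun z t _ => ?_
    rw [abs_of_nonneg]
    have := maj_nonneg hε (z - w)
    positivity
  have hinteg : Integrable (fun q : (Fin N → ℝ) × ((Fin N → ℝ) × ℝ) =>
      h q.1 * (q.2.2 * ∑ d, dpk N d (q.2.1 - w, q.2.2) * dpk N d (q.2.1 - q.1, q.2.2)))
      (volume.prod (slabMeasure N m)) := by
    refine (hi.norm.mul_prod hmaj).mono' (by fun_prop : Measurable _).aestronglyMeasurable ?_
    have hae : ∀ᵐ q ∂((volume : Measure (Fin N → ℝ)).prod (slabMeasure N m)),
        q.2.2 ∈ Set.Ioc ((m : ℝ) + 1)⁻¹ ((m : ℝ) + 1) :=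
      Measure.quasiMeasurePreserving_snd.ae (ae_snd_mem_Ioc _ _)
    filter_upwards [hae] with q hq
    rw [norm_mul, norm_mul, Real.norm_of_nonneg (hε.trans hq.1).le, mul_assoc ((m : ℝ) + 1)]
    refine mul_le_mul_of_nonneg_left (mul_le_mul hq.2 ?_ (norm_nonneg _) hT0.le) (norm_nonneg _)
    refine (norm_sum_le_of_le _ fun d _ =>
      ((hC w q.1 q.2.1 q.2.2 ⟨hq.1.le, hq.2⟩).2 d).2.2).trans ?_
    simp [mul_assoc]
  have e1 : calA N m h w = ∫ p, (∫ x, h x * (p.2 * ∑ d, dpk N d (p.1 - w, p.2) *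
      dpk N d (p.1 - x, p.2))) ∂slabMeasure N m := by
    unfold calA
    refine integral_congr_ae ?_
    filter_upwards [ae_snd_mem_Ioc (N := N) ((m : ℝ) + 1)⁻¹ ((m : ℝ) + 1)] with p hp
    have hp0 := hε.trans hp.1
    obtain ⟨C', hC0', hC'⟩ := exists_poisson_bounds N
    have hb : ∀ d, Integrable fun x => h x * dpk N d (p.1 - x, p.2) := fun d =>
      hi.mul_bdd (c := C' * (p.2 ^ (N + 1))⁻¹)
        (by fun_prop : Measurable fun x => dpk N d (p.1 - x, p.2)).aestronglyMeasurable
        (Eventually.of_forall fun x => (((hC' p.2 p.2 (p.1 - x) hp0 le_rfl).2 d).1).trans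
          (mul_le_mul_of_nonneg_left (maj_le hp0 _) hC0'.le))
    simp only [← integral_const_mul]
    rw [← integral_finsetSum _ fun d _ => (hb d).const_mul _, ← integral_const_mul]
    refine integral_congr_ae (Eventually.of_forall fun x => ?_)
    simp only [Finset.mul_sum]
    refine Finset.sum_congr rfl fun d _ => ?_
    ring
  rw [e1, ← integral_prod_symm (fun q : (Fin N → ℝ) × ((Fin N → ℝ) × ℝ) =>
      h q.1 * (q.2.2 * ∑ d, dpk N d (q.2.1 - w, q.2.2) * dpk N d (q.2.1 - q.1, q.2.2))) hinteg,
    integral_prod _ hinteg]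
  have e2 : ∀ x, ∫ p : (Fin N → ℝ) × ℝ, h x * (p.2 * ∑ d, dpk N d (p.1 - w, p.2) *
      dpk N d (p.1 - x, p.2)) ∂slabMeasure N m = 2⁻¹ *
      (h x * (((((m : ℝ) + 1)⁻¹) ^ N)⁻¹ * greenKernel N ((((m : ℝ) + 1)⁻¹)⁻¹ • (w - x))) -
      h x * ((((m : ℝ) + 1) ^ N)⁻¹ * greenKernel N (((m : ℝ) + 1)⁻¹ • (w - x)))) := by
    intro x
    rw [integral_const_mul, slabMeasure, integral_green hε hT, integral_bdry hε, integral_bdry hT0]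
    ring
  have hg : ∀ s : ℝ, s ≠ 0 → ∀ r : ℝ,
      Integrable fun x => h x * (r * greenKernel N (s • (w - x))) := fun s hs r =>
    (((integrable_greenKernel.comp_smul hs).comp_sub_left w).const_mul r).bdd_mul (c := M)
      hm.aestronglyMeasurable (Eventually.of_forall hM)
  refine (integral_congr_ae (Eventually.of_forall e2)).trans ?_
  rw [integral_const_mul, integral_sub (hg _ (inv_pos.2 hε).ne' _) (hg _ (inv_pos.2 hT0).ne' _),
    integral_mul_greenKernel hε, integral_mul_greenKernel hT0]

/-- The constant of the reproducing formula. -/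
def calConst (N : ℕ) : ℝ := 2⁻¹ * poissonMass N ^ 2

theorem calConst_pos : 0 < calConst N := by
  have := poissonMass_pos (N := N)
  unfold calConst; positivity

theorem abs_calA_le (m : ℕ) {h : (Fin N → ℝ) → ℝ} (hm : Measurable h) (hi : Integrable h)
    {M : ℝ} (hM : ∀ x, |h x| ≤ M) (w : Fin N → ℝ) :
    |calA N m h w| ≤ M * ∫ u, |greenKernel N u| := by
  have hb : ∀ s : ℝ, |∫ u, h (w - s • u) * greenKernel N u| ≤ M * ∫ u, |greenKernel N u| := by
    intro s
    rw [← integral_const_mul]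
    refine norm_integral_le_of_norm_le (G := ℝ) (integrable_greenKernel.norm.const_mul M)
      (Eventually.of_forall fun u => ?_)
    rw [norm_mul]
    exact mul_le_mul_of_nonneg_right (hM _) (norm_nonneg _)
  rw [calA_eq m hm hi hM, abs_mul, abs_of_pos (by norm_num : (0 : ℝ) < 2⁻¹)]
  have := (abs_sub _ _).trans (add_le_add (hb ((m : ℝ) + 1)⁻¹) (hb ((m : ℝ) + 1)))
  linarith

theorem tendsto_calA (hN : 0 < N) {h : (Fin N → ℝ) → ℝ} (hm : Measurable h) (hi : Integrable h)
    {M : ℝ} (hM : ∀ x, |h x| ≤ M) {R : ℝ} (hR : ∀ x, R < ‖x‖ → h x = 0) {w : Fin N → ℝ}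
    (hw : ContinuousAt h w) :
    Tendsto (fun m => calA N m h w) atTop (𝓝 (calConst N * h w)) := by
  have hT : Tendsto (fun m : ℕ => (m : ℝ) + 1) atTop atTop :=
    tendsto_atTop_add_const_right _ _ tendsto_natCast_atTop_atTop
  have hE : Tendsto (fun m : ℕ => ((m : ℝ) + 1)⁻¹) atTop (𝓝 0) := tendsto_inv_atTop_zero.comp hT
  have hdom : ∀ s : ℕ → ℝ, ∀ F : (Fin N → ℝ) → ℝ,
      (∀ᵐ u : Fin N → ℝ, Tendsto (fun m => h (w - s m • u)) atTop (𝓝 (F u))) →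
      Tendsto (fun m => ∫ u, h (w - s m • u) * greenKernel N u) atTop
        (𝓝 (∫ u, F u * greenKernel N u)) := by
    intro s F hF
    refine tendsto_integral_of_dominated_convergence (fun u => M * |greenKernel N u|)
      (fun m => ?_) (integrable_greenKernel.norm.const_mul M) (fun m => ?_) ?_
    · exact ((hm.comp (by fun_prop)).aestronglyMeasurable).mul
        integrable_greenKernel.aestronglyMeasurable
    · refine Eventually.of_forall fun u => ?_
      rw [norm_mul]
      exact mul_le_mul_of_nonneg_right (hM _) (norm_nonneg _)
    · filter_upwards [hF] with u hu using hu.mul_const _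
  have h1 := hdom (fun m => ((m : ℝ) + 1)⁻¹) (fun _ => h w) (Eventually.of_forall fun u => by
    have : Tendsto (fun m : ℕ => w - ((m : ℝ) + 1)⁻¹ • u) atTop (𝓝 w) := by
      simpa using tendsto_const_nhds.sub (hE.smul_const u)
    exact hw.tendsto.comp this)
  have h2 := hdom (fun m => (m : ℝ) + 1) (fun _ => 0) (by
    have : Nonempty (Fin N) := ⟨⟨0, hN⟩⟩
    filter_upwards [(Measure.ae_ne volume (0 : Fin N → ℝ))] with u hu
    have hu0 : 0 < ‖u‖ := norm_pos_iff.2 hu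
    refine tendsto_const_nhds.congr' ?_
    filter_upwards [hT.eventually_gt_atTop ((R + ‖w‖) / ‖u‖)] with m hm'
    refine (hR _ ?_).symm
    rw [div_lt_iff₀ hu0] at hm'
    have e1 : ‖((m : ℝ) + 1) • u‖ = ((m : ℝ) + 1) * ‖u‖ := by
      rw [norm_smul, Real.norm_of_nonneg (by positivity)]
    have e2 := norm_sub_norm_le (((m : ℝ) + 1) • u) w
    rw [norm_sub_rev] at e2
    linarith)
  have h3 := (h1.sub h2).const_mul 2⁻¹
  simp only [calA_eq _ hm hi hM]
  rw [integral_const_mul, integral_greenKernel] at h3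
  simp only [zero_mul, integral_zero, sub_zero] at h3
  unfold calConst
  rwa [show 2⁻¹ * poissonMass N ^ 2 * h w = 2⁻¹ * (h w * poissonMass N ^ 2) by ring]

end Calderon

/-! ### Martingale differences of the Poisson kernel -/

section Kappa

variable {N : ℕ}

/-- The differentiated Poisson kernel `t ∂P(z - w, t)` as a function of `w`. -/
def pker (N : ℕ) (d : Fin (N + 1)) (z : Fin N → ℝ) (t : ℝ) (w : Fin N → ℝ) : ℝ :=
  t * dpk N d (z - w, t)

theorem measurable_pker (d : Fin (N + 1)) (z : Fin N → ℝ) (t : ℝ) :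
    Measurable (pker N d z t) := by
  unfold pker; fun_prop

theorem integrable_pker {t : ℝ} (ht : 0 < t) (d : Fin (N + 1)) (z : Fin N → ℝ) :
    Integrable (pker N d z t) :=
  ((integrable_dpk ht d).comp_sub_left z).const_mul t

theorem integral_pker {t : ℝ} (ht : 0 < t) (d : Fin (N + 1)) (z : Fin N → ℝ) :
    ∫ w, pker N d z t w = 0 := by
  unfold pker
  rw [integral_const_mul, integral_sub_left_eq_self (fun w => dpk N d (w, t)) volume z,
    integral_dpk ht, mul_zero]

theorem maj_anti {s s' : ℝ} (hs : 0 < s) (h : s ≤ s') {x x' : Fin N → ℝ} (hx : ‖x‖ ≤ ‖x'‖) :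
    maj N s' x' ≤ maj N s x := by
  unfold maj
  have := norm_nonneg x
  gcongr

theorem maj_le_of_add_le {s s' A : ℝ} (hs : 0 < s) (hs' : 0 < s')
    {x x' : Fin N → ℝ} (h : s' + ‖x'‖ ≤ A * (s + ‖x‖)) :
    maj N s x ≤ A ^ (N + 1) * maj N s' x' := by
  have h1 := norm_nonneg x
  have h2 := norm_nonneg x'
  unfold maj
  rw [← div_eq_mul_inv, le_div_iff₀ (by positivity), ← div_eq_inv_mul,
    div_le_iff₀ (by positivity), ← mul_pow]
  exact pow_le_pow_left₀ (by positivity) h _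

theorem exists_abs_pker_le (N : ℕ) : ∃ C : ℝ, 0 < C ∧ ∀ d (z w : Fin N → ℝ) (t : ℝ), 0 < t →
    |pker N d z t w| ≤ C * (t * maj N t (z - w)) := by
  obtain ⟨C, hC0, hC⟩ := exists_poisson_bounds N
  refine ⟨C, hC0, fun d z w t ht => ?_⟩
  unfold pker
  rw [abs_mul, abs_of_pos ht]
  calc t * |dpk N d (z - w, t)| ≤ t * (C * maj N t (z - w)) := by
        gcongr; exact ((hC t t _ ht le_rfl).2 d).1
    _ = _ := by ring

theorem exists_abs_pker_sub_le (N : ℕ) : ∃ C : ℝ, 0 < C ∧ ∀ d (z w y : Fin N → ℝ) (t : ℝ), 0 < t →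
    ‖w - y‖ ≤ t → |pker N d z t w - pker N d z t y| ≤ C * maj N t (z - y) * ‖w - y‖ := by
  obtain ⟨C, hC0, hC⟩ := exists_norm_fderiv_dpk_le N
  refine ⟨C * (2 ^ (N + 1) * 2 ^ (N + 1)), by positivity, fun d z w y t ht hwy => ?_⟩
  have hbd : ∀ ξ ∈ Metric.closedBall y ‖w - y‖, ‖fderiv ℝ (dpk N d) (z - ξ, t)‖ ≤
      t⁻¹ * (C * (2 ^ (N + 1) * 2 ^ (N + 1)) * maj N t (z - y)) := by
    intro ξ hξ
    rw [mem_closedBall_iff_norm] at hξ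
    have e1 := inv_norm_pow_le_maj ht le_rfl (z - ξ)
    have e2 : maj N t (z - ξ) ≤ 2 ^ (N + 1) * maj N t (z - y) := by
      refine maj_le_of_add_le ht ht ?_
      have : ‖z - y‖ ≤ ‖z - ξ‖ + ‖ξ - y‖ := norm_sub_le_norm_sub_add_norm_sub _ _ _
      linarith [norm_nonneg (z - ξ)]
    have e3 : t ≤ ‖(z - ξ, t)‖ := (le_abs_self t).trans (norm_snd_le (z - ξ, t))
    calc ‖fderiv ℝ (dpk N d) (z - ξ, t)‖ ≤ C * (‖(z - ξ, t)‖ ^ (N + 2))⁻¹ :=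
          hC d _ (mk_ne_zero ht _)
      _ = C * (‖(z - ξ, t)‖⁻¹ * (‖(z - ξ, t)‖ ^ (N + 1))⁻¹) := by
          rw [pow_succ _ (N + 1), mul_inv]; ring
      _ ≤ C * (t⁻¹ * (2 ^ (N + 1) * (2 ^ (N + 1) * maj N t (z - y)))) := by
          gcongr; exact e1.trans (by gcongr)
      _ = _ := by ring
  have hder : ∀ ξ ∈ Metric.closedBall y ‖w - y‖,
      HasFDerivWithinAt (pker N d z t) (t • ((fderiv ℝ (dpk N d) (z - ξ, t)).comp
        ((-ContinuousLinearMap.id ℝ (Fin N → ℝ)).prod 0))) (Metric.closedBall y ‖w - y‖) ξ := by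
    intro ξ _
    have hd : DifferentiableAt ℝ (dpk N d) (z - ξ, t) :=
      (contDiffAt_dpk _ (mk_ne_zero ht _) 1).differentiableAt (by simp)
    have h1 : HasFDerivAt (fun ξ : Fin N → ℝ => (z - ξ, t))
        ((-ContinuousLinearMap.id ℝ (Fin N → ℝ)).prod 0) ξ :=
      ((hasFDerivAt_id ξ).const_sub z).prodMk (hasFDerivAt_const t ξ)
    exact ((hd.hasFDerivAt.comp ξ h1).const_mul t).hasFDerivWithinAt
  refine ((convex_closedBall y ‖w - y‖).norm_image_sub_le_of_norm_hasFDerivWithin_le hder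
    (C := C * (2 ^ (N + 1) * 2 ^ (N + 1)) * maj N t (z - y)) (fun ξ hξ => ?_)
    (Metric.mem_closedBall_self (norm_nonneg _)) (mem_closedBall_iff_norm.2 le_rfl))
  rw [norm_smul, Real.norm_of_nonneg ht.le]
  have h1 : ‖((-ContinuousLinearMap.id ℝ (Fin N → ℝ)).prod (0 : (Fin N → ℝ) →L[ℝ] ℝ))‖ ≤ 1 := by
    refine ContinuousLinearMap.opNorm_le_bound _ zero_le_one fun v => ?_
    simp [Prod.norm_def]
  calc t * ‖(fderiv ℝ (dpk N d) (z - ξ, t)).comp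
        ((-ContinuousLinearMap.id ℝ (Fin N → ℝ)).prod 0)‖ ≤
      t * (‖fderiv ℝ (dpk N d) (z - ξ, t)‖ * 1) := by
        gcongr
        exact (ContinuousLinearMap.opNorm_comp_le _ _).trans (by gcongr)
    _ ≤ t * (t⁻¹ * (C * (2 ^ (N + 1) * 2 ^ (N + 1)) * maj N t (z - y))) := by
        rw [mul_one]; gcongr; exact hbd ξ hξ
    _ = _ := by field_simp

theorem measureReal_dcube (c : Fin N → ℝ) (l : ℤ) (x : Fin N → ℝ) :
    volume.real (dcube c l x) = ((2 : ℝ) ^ l) ^ N := by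
  rw [measureReal_def, volume_dcube, ← ofReal_two_zpow_pow, ← ENNReal.ofReal_pow (by positivity),
    ENNReal.toReal_ofReal (by positivity)]

theorem volume_dcube_lt_top (c : Fin N → ℝ) (l : ℤ) (x : Fin N → ℝ) :
    volume (dcube c l x) < ⊤ := by
  rw [volume_dcube]; exact (two_rpow_ne_top _).lt_top

theorem abs_avg_le (c : ℤ → Fin N → ℝ) (l : ℤ) {f : (Fin N → ℝ) → ℝ} {y : Fin N → ℝ} {B : ℝ}
    (hB : ∀ w ∈ dcube (c l) l y, |f w| ≤ B) : |avg c l f y| ≤ B := by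
  have h := norm_setIntegral_le_of_norm_le_const (f := f) (volume_dcube_lt_top (c l) l y) hB
  rw [measureReal_dcube] at h
  unfold avg
  rw [abs_div, abs_of_pos (by positivity : (0 : ℝ) < ((2 : ℝ) ^ l) ^ N),
      div_le_iff₀ (by positivity)]
  exact h

theorem avg_sub_const (c : ℤ → Fin N → ℝ) (l : ℤ) {f : (Fin N → ℝ) → ℝ} (hf : Integrable f)
    (y : Fin N → ℝ) (b : ℝ) : avg c l (fun w => f w - b) y = avg c l f y - b := by
  have hc : IntegrableOn (fun _ : Fin N → ℝ => b) (dcube (c l) l y) :=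
    integrableOn_const (volume_dcube_lt_top _ _ _).ne
  unfold avg
  rw [integral_sub hf.integrableOn hc, setIntegral_const, measureReal_dcube, smul_eq_mul, sub_div,
    mul_div_cancel_left₀ _ (by positivity)]

/-- Real-valued version of `gw`. -/
def gwR (c : Fin N → ℝ) (l i : ℤ) (x : Fin N → ℝ) : ℝ :=
  ∑ a, wphi (2 ^ (i - l)) ((x a - c a) / 2 ^ l)

theorem gw_eq_ofReal (c : Fin N → ℝ) (l i : ℤ) (x : Fin N → ℝ) :
    gw c l i x = ENNReal.ofReal (gwR c l i x) :=
  (ENNReal.ofReal_sum_of_nonneg fun _ _ => wphi_nonneg (by positivity) _).symm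

theorem gwR_nonneg (c : Fin N → ℝ) (l i : ℤ) (x : Fin N → ℝ) : 0 ≤ gwR c l i x :=
  Finset.sum_nonneg fun _ _ => wphi_nonneg (by positivity) _

theorem dist_round_le {u v : ℝ} (h : ⌊v⌋ ≠ ⌊u⌋) : |u - round u| ≤ |v - u| := by
  rcases lt_or_gt_of_ne h with h | h
  · refine (round_le u ⌊u⌋).trans ?_
    have h1 := Int.floor_le u
    have h2 : v < ⌊u⌋ := Int.floor_lt.1 h
    rw [abs_of_nonneg (by linarith), abs_of_neg (by linarith)]
    linarith
  · refine (round_le u ⌊v⌋).trans ?_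
    have h1 := Int.floor_le v
    have h2 : u < ⌊v⌋ := Int.floor_lt.1 h
    rw [abs_of_neg (by linarith), abs_of_nonneg (by linarith)]
    linarith

theorem wphi_le_of_near {τ τ' u u' : ℝ} (hτ : 0 < τ) (hτ' : 0 < τ') (h : τ' ≤ 2 * τ)
    (hu : |u - u'| ≤ 2 * τ) : wphi τ' u ≤ 6 * wphi τ u' := by
  have e1 : |u' - round u'| ≤ |u - round u| + |u - u'| := by
    refine (round_le u' (round u)).trans ?_
    rw [show u' - (round u : ℝ) = (u - round u) - (u - u') by ring]
    exact abs_sub _ _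
  have h0 := abs_nonneg (u' - round u')
  have h1 := abs_nonneg (u - round u)
  unfold wphi
  rw [← mul_div_assoc, div_le_div_iff₀ (by positivity) (by positivity)]
  nlinarith [mul_nonneg hτ.le h1, mul_nonneg hτ.le h0]

theorem exists_tail_le (N : ℕ) : ∃ C : ℝ, 0 < C ∧ ∀ d (z : Fin N → ℝ) (t ρ : ℝ), 0 < t → 0 ≤ ρ →
    ∀ A : Set (Fin N → ℝ), MeasurableSet A → (∀ w ∈ A, ρ ≤ ‖z - w‖) →
      ∫ w in A, |pker N d z t w| ≤ C * (t / (t + ρ)) := by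
  obtain ⟨C, hC0, hC⟩ := exists_abs_pker_le N
  have hmass : ∀ σ : ℝ, 0 < σ → ∫ v : Fin N → ℝ, σ * maj N σ v = ∫ v : Fin N → ℝ, maj N 1 v := by
    intro σ hσ
    have h := Measure.integral_comp_smul volume (fun v : Fin N → ℝ => σ * maj N σ v) σ
    have e : ∀ v : Fin N → ℝ, σ * maj N σ (σ • v) = (σ ^ N)⁻¹ * maj N 1 v := by
      intro v
      unfold maj
      rw [norm_smul, Real.norm_of_nonneg hσ.le, show σ + σ * ‖v‖ = σ * (1 + ‖v‖) by ring, mul_pow]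
      have := norm_nonneg v
      field_simp
      ring
    simp only [e] at h
    rw [integral_const_mul, Module.finrank_fin_fun, abs_of_pos (by positivity), smul_eq_mul] at h
    exact (mul_left_cancel₀ (by positivity) h).symm
  have hm0 : 0 ≤ ∫ v : Fin N → ℝ, maj N 1 v := integral_nonneg fun v => maj_nonneg one_pos v
  refine ⟨C * 2 ^ (N + 1) * ((∫ v : Fin N → ℝ, maj N 1 v) + 1), by positivity,
    fun d z t ρ ht hρ A hA hAρ => ?_⟩
  have hσ : 0 < t + ρ := by linarith
  have hi : Integrable fun w => C * 2 ^ (N + 1) * (t / (t + ρ)) *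
      ((t + ρ) * maj N (t + ρ) (z - w)) :=
    (((integrable_maj hσ).comp_sub_left z).const_mul _).const_mul _
  calc ∫ w in A, |pker N d z t w| ≤
      ∫ w in A, C * 2 ^ (N + 1) * (t / (t + ρ)) * ((t + ρ) * maj N (t + ρ) (z - w)) := by
        refine setIntegral_mono_on (integrable_pker ht d z).abs.integrableOn hi.integrableOn hA
          fun w hw => ?_
        have h1 : maj N t (z - w) ≤ 2 ^ (N + 1) * maj N (t + ρ) (z - w) :=
          maj_le_of_add_le ht hσ (by linarith [hAρ w hw])
        calc |pker N d z t w| ≤ C * (t * maj N t (z - w)) := hC d z w t ht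
          _ ≤ C * (t * (2 ^ (N + 1) * maj N (t + ρ) (z - w))) := by gcongr
          _ = _ := by field_simp
    _ ≤ ∫ w, C * 2 ^ (N + 1) * (t / (t + ρ)) * ((t + ρ) * maj N (t + ρ) (z - w)) := by
        refine setIntegral_le_integral hi (Eventually.of_forall fun w => ?_)
        have := maj_nonneg hσ (z - w)
        simp only [Pi.zero_apply]
        positivity
    _ = C * 2 ^ (N + 1) * (t / (t + ρ)) * ∫ v : Fin N → ℝ, maj N 1 v := by
        rw [integral_const_mul,
          integral_sub_left_eq_self (fun w => (t + ρ) * maj N (t + ρ) w) volume z, hmass _ hσ]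
    _ ≤ _ := by
        have : 0 ≤ C * 2 ^ (N + 1) * (t / (t + ρ)) := by positivity
        nlinarith

end Kappa

section Kappa

variable {N : ℕ}

theorem exists_abs_setIntegral_pker_le (N : ℕ) (hN : 0 < N) : ∃ C : ℝ, 0 < C ∧
    ∀ d (c : Fin N → ℝ) (l : ℤ) (y z : Fin N → ℝ) (t : ℝ), 0 < t → ∃ a : Fin N,
      |∫ w in dcube c l y, pker N d z t w| ≤
        C * wphi (t / 2 ^ l) ((z a - c a) / 2 ^ l) := by
  obtain ⟨C, hC0, hC⟩ := exists_tail_le N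
  refine ⟨C, hC0, fun d c l y z t ht => ?_⟩
  have h2 : (0 : ℝ) < 2 ^ l := by positivity
  have : Nonempty (Fin N) := ⟨⟨0, hN⟩⟩
  obtain ⟨a, -, ha⟩ := Finset.exists_min_image (Finset.univ : Finset (Fin N))
    (fun a => |(z a - c a) / 2 ^ l - round ((z a - c a) / 2 ^ l)|) Finset.univ_nonempty
  refine ⟨a, ?_⟩
  set δ := |(z a - c a) / 2 ^ l - round ((z a - c a) / 2 ^ l)| with hδ
  have hδ0 : 0 ≤ δ := abs_nonneg _
  have hsep : ∀ w, z ∉ dcube c l w → 2 ^ l * δ ≤ ‖z - w‖ := by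
    intro w hw
    simp only [dcube, Set.mem_ofPred_eq, not_forall] at hw
    obtain ⟨b, hb⟩ := hw
    have h1 := (ha b (Finset.mem_univ b)).trans (dist_round_le (Ne.symm hb))
    have h3 : |(w b - c b) / 2 ^ l - (z b - c b) / 2 ^ l| = |(z - w) b| / 2 ^ l := by
      rw [← sub_div, abs_div, abs_of_pos h2, abs_sub_comm]
      congr 2
      simp only [Pi.sub_apply]; ring
    rw [h3, le_div_iff₀ h2] at h1
    have h4 := norm_le_pi_norm (z - w) b
    rw [Real.norm_eq_abs] at h4
    linarith
  have hfin : C * (t / (t + 2 ^ l * δ)) = C * wphi (t / 2 ^ l) ((z a - c a) / 2 ^ l) := by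
    unfold wphi
    rw [← hδ]
    field_simp
  rw [← hfin]
  by_cases hz : z ∈ dcube c l y
  · have h1 := integral_add_compl (measurableSet_dcube c l y) (integrable_pker ht d z)
    rw [integral_pker ht] at h1
    rw [eq_neg_of_add_eq_zero_left h1, abs_neg]
    refine (abs_integral_le_integral_abs).trans (hC d z t _ ht (by positivity) _
      (measurableSet_dcube c l y).compl fun w hw => hsep w fun hzw => hw ?_)
    rw [← dcube_eq_of_mem hz, mem_dcube_comm] 
    exact hzw
  · refine (abs_integral_le_integral_abs).trans (hC d z t _ ht (by positivity) _
      (measurableSet_dcube c l y) fun w hw => hsep w fun hzw => hz ?_)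
    rw [← dcube_eq_of_mem hw]
    exact hzw

theorem exists_abs_avg_pker_le (N : ℕ) (hN : 0 < N) : ∃ C : ℝ, 0 < C ∧
    ∀ d (c : ℤ → Fin N → ℝ) (l i : ℤ) (x y z : Fin N → ℝ) (t : ℝ), i ≤ l + 1 → 2 ^ i ≤ t →
      t ≤ 2 * 2 ^ i → ‖x - z‖ ≤ t →
      |avg c l (pker N d z t) y| ≤ C * (2 ^ l * maj N (2 ^ l) (y - x)) * gwR (c l) l i x := by
  obtain ⟨C1, hC1, h1⟩ := exists_abs_setIntegral_pker_le N hN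
  obtain ⟨C2, hC2, h2⟩ := exists_abs_pker_le N
  refine ⟨6 * C1 * 7 ^ (N + 1) + 6 * C2 * 6 ^ (N + 1), by positivity,
    fun d c l i x y z t hil hit hti hxz => ?_⟩
  set s : ℝ := 2 ^ l with hs
  have hs0 : 0 < s := by positivity
  have hi0 : (0 : ℝ) < 2 ^ i := by positivity
  have ht : 0 < t := hi0.trans_le hit
  have hτ : (2 : ℝ) ^ (i - l) = 2 ^ i / s := zpow_sub₀ two_ne_zero i l
  have his : (2 : ℝ) ^ i ≤ 2 * s := by
    have := zpow_le_zpow_right₀ (one_le_two : (1 : ℝ) ≤ 2) hil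
    rwa [zpow_add_one₀ two_ne_zero, mul_comm] at this
  have ht4 : t ≤ 4 * s := by linarith
  have hτ0 : 0 < (2 : ℝ) ^ i / s := by positivity
  have hm := maj_nonneg hs0 (y - x)
  have hg0 := gwR_nonneg (c l) l i x
  by_cases hnear : ‖z - y‖ ≤ 2 * s
  · obtain ⟨a, ha⟩ := h1 d (c l) l y z t ht
    have e1 : wphi (t / s) ((z a - c l a) / s) ≤ 6 * wphi (2 ^ i / s) ((x a - c l a) / s) := by
      refine wphi_le_of_near hτ0 (by positivity) ?_ ?_
      · rw [← mul_div_assoc]; gcongr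
      · rw [← sub_div, abs_div, abs_of_pos hs0, ← mul_div_assoc]
        gcongr
        have h4 := norm_le_pi_norm (x - z) a
        simp only [Pi.sub_apply] at h4
        rw [Real.norm_eq_abs, abs_sub_comm] at h4
        rw [show z a - c l a - (x a - c l a) = z a - x a by ring]
        linarith
    have e2 : wphi (2 ^ i / s) ((x a - c l a) / s) ≤ gwR (c l) l i x := by
      unfold gwR
      rw [hτ]
      exact Finset.single_le_sum (f := fun a => wphi (2 ^ i / s) ((x a - c l a) / s))
        (fun _ _ => wphi_nonneg hτ0 _) (Finset.mem_univ a)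
    have e3 : (s ^ N)⁻¹ ≤ 7 ^ (N + 1) * (s * maj N s (y - x)) := by
      have : ‖y - x‖ ≤ ‖z - y‖ + ‖x - z‖ := by
        have := norm_sub_le_norm_sub_add_norm_sub x z y
        rwa [norm_sub_rev, add_comm] at this
      have h5 : maj N s (0 : Fin N → ℝ) ≤ 7 ^ (N + 1) * maj N s (y - x) :=
        maj_le_of_add_le hs0 hs0 (by rw [norm_zero, add_zero]; linarith)
      calc (s ^ N)⁻¹ = s * maj N s (0 : Fin N → ℝ) := by
            unfold maj; rw [norm_zero, add_zero]; field_simp; ring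
        _ ≤ s * (7 ^ (N + 1) * maj N s (y - x)) := by gcongr
        _ = _ := by ring
    unfold avg
    rw [abs_div, abs_of_pos (by positivity : (0 : ℝ) < (2 ^ l) ^ N), ← hs, div_eq_mul_inv]
    calc |∫ w in dcube (c l) l y, pker N d z t w| * (s ^ N)⁻¹ ≤
        (C1 * (6 * gwR (c l) l i x)) * (7 ^ (N + 1) * (s * maj N s (y - x))) := by
          gcongr
          exact ha.trans (by gcongr; exact e1.trans (by gcongr))
      _ = 6 * C1 * 7 ^ (N + 1) * (s * maj N s (y - x)) * gwR (c l) l i x := by ring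
      _ ≤ _ := by gcongr; exact le_add_of_nonneg_right (by positivity)
  · push Not at hnear
    have e4 : 2 ^ i / s ≤ 3 * gwR (c l) l i x := by
      let a : Fin N := ⟨0, hN⟩
      have e5 : wphi (2 ^ i / s) ((x a - c l a) / s) ≤ gwR (c l) l i x := by
        unfold gwR
        rw [hτ]
        exact Finset.single_le_sum (f := fun a => wphi (2 ^ i / s) ((x a - c l a) / s))
          (fun _ _ => wphi_nonneg hτ0 _) (Finset.mem_univ a)
      refine le_trans ?_ (mul_le_mul_of_nonneg_left e5 (by norm_num))
      have e6 : 2 ^ i / s ≤ 2 := by rw [div_le_iff₀ hs0]; exact his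
      have e7 := abs_sub_round ((x a - c l a) / s)
      have e8 := abs_nonneg ((x a - c l a) / s - round ((x a - c l a) / s))
      unfold wphi
      rw [← mul_div_assoc, le_div_iff₀ (by positivity)]
      nlinarith
    have hbd : ∀ w ∈ dcube (c l) l y, |pker N d z t w| ≤
        (6 * C2 * 6 ^ (N + 1)) * (s * maj N s (y - x)) * gwR (c l) l i x := by
      intro w hw
      have f1 : ‖w - y‖ ≤ s := norm_sub_le_of_mem_dcube hw
      have f2 : ‖z - y‖ ≤ ‖z - w‖ + ‖w - y‖ := norm_sub_le_norm_sub_add_norm_sub z w y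
      have f3 : ‖y - x‖ ≤ ‖z - y‖ + ‖x - z‖ := by
        have := norm_sub_le_norm_sub_add_norm_sub x z y
        rwa [norm_sub_rev, add_comm] at this
      have f4 : maj N t (z - w) ≤ 6 ^ (N + 1) * maj N s (y - x) :=
        maj_le_of_add_le ht hs0 (by linarith)
      calc |pker N d z t w| ≤ C2 * (t * maj N t (z - w)) := h2 d z w t ht
        _ ≤ C2 * (t * (6 ^ (N + 1) * maj N s (y - x))) := by gcongr
        _ = C2 * 6 ^ (N + 1) * (s * maj N s (y - x)) * (t / s) := by field_simp
        _ ≤ C2 * 6 ^ (N + 1) * (s * maj N s (y - x)) * (6 * gwR (c l) l i x) := by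
            gcongr
            calc t / s ≤ 2 * (2 ^ i / s) := by rw [← mul_div_assoc]; gcongr
              _ ≤ _ := by linarith
        _ = _ := by ring
    refine (abs_avg_le c l hbd).trans ?_
    gcongr
    exact le_add_of_nonneg_left (by positivity)

theorem kr_eq_ofReal (l : ℤ) (x : Fin N → ℝ) :
    kr N (N + 1) l x = ENNReal.ofReal (2 ^ l * maj N (2 ^ l) x) := by
  have h2 : (0 : ℝ) < 2 ^ l := by positivity
  have hx := norm_nonneg x
  unfold kr maj
  rw [show (2 : ℝ) ^ l * ((2 ^ l + ‖x‖) ^ (N + 1))⁻¹ =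
      ((2 ^ l) ^ N)⁻¹ * (1 + ‖x‖ / 2 ^ l) ^ (-((N : ℝ) + 1)) by
    rw [Real.rpow_neg (by positivity), show (N : ℝ) + 1 = ((N + 1 : ℕ) : ℝ) by push_cast; ring,
      Real.rpow_natCast, show (2 : ℝ) ^ l + ‖x‖ = 2 ^ l * (1 + ‖x‖ / 2 ^ l) by field_simp,
      mul_pow]
    field_simp
    ring]
  rw [ENNReal.ofReal_mul (by positivity), ENNReal.ofReal_rpow_of_pos (by positivity),
    ENNReal.ofReal_inv_of_pos (by positivity), ENNReal.ofReal_pow (by positivity),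
    ofReal_two_zpow_pow, ENNReal.rpow_neg]

/-- Pointwise bound for the martingale differences of the differentiated Poisson kernel. -/
theorem exists_mdiff_pker_le (N : ℕ) (hN : 0 < N) : ∃ C : ℝ≥0∞, C ≠ ⊤ ∧
    ∀ d (c : ℤ → Fin N → ℝ) (k i : ℤ) (x y z : Fin N → ℝ) (t : ℝ), 2 ^ i ≤ t →
      t ≤ 2 * 2 ^ i → ‖x - z‖ ≤ t →
      ENNReal.ofReal |mdiff c k (pker N d z t) y| ≤
        C * (kr N (N + 1) (max k i) (x - y) * wt c k i x) := by
  obtain ⟨C1, hC1, h1⟩ := exists_abs_avg_pker_le N hN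
  obtain ⟨C2, hC2, h2⟩ := exists_abs_pker_sub_le N
  refine ⟨ENNReal.ofReal (2 ^ (N + 1) * C1 + 2 * C2 * 2 ^ (N + 1)), ENNReal.ofReal_ne_top,
    fun d c k i x y z t hit hti hxz => ?_⟩
  have hi0 : (0 : ℝ) < 2 ^ i := by positivity
  have ht : 0 < t := hi0.trans_le hit
  rw [kr_sub_comm, kr_eq_ofReal]
  rcases lt_or_ge k i with hki | hki
  · rw [max_eq_right hki.le, wt, if_pos hki,
      show (2 : ℝ≥0∞) ^ ((k : ℝ) - i) = ENNReal.ofReal (2 ^ (k - i)) by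
        rw [ofReal_two_zpow]; push_cast; rfl,
      ← ENNReal.ofReal_mul (by have := maj_nonneg hi0 (y - x); positivity),
      ← ENNReal.ofReal_mul (by positivity)]
    refine ENNReal.ofReal_le_ofReal ?_
    have hk2 : (2 : ℝ) ^ k ≤ t := (zpow_le_zpow_right₀ one_le_two hki.le).trans hit
    have hm : maj N t (z - y) ≤ 2 ^ (N + 1) * maj N (2 ^ i) (y - x) := by
      have f3 : ‖y - x‖ ≤ ‖z - y‖ + ‖x - z‖ := by
        have := norm_sub_le_norm_sub_add_norm_sub x z y
        rwa [norm_sub_rev, add_comm] at this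
      exact maj_le_of_add_le ht hi0 (by linarith [norm_nonneg (z - y)])
    have hm0 := maj_nonneg hi0 (y - x)
    have hl : ∀ l, l ≤ k → |avg c l (pker N d z t) y - pker N d z t y| ≤
        C2 * (2 ^ (N + 1) * maj N (2 ^ i) (y - x)) * 2 ^ k := by
      intro l hl
      rw [← avg_sub_const c l (integrable_pker ht d z)]
      refine abs_avg_le c l fun w hw => ?_
      have f1 : ‖w - y‖ ≤ 2 ^ k :=
        (norm_sub_le_of_mem_dcube hw).trans (zpow_le_zpow_right₀ one_le_two hl)
      refine (h2 d z w y t ht (f1.trans hk2)).trans ?_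
      gcongr
    have h3 := (abs_sub _ _).trans (add_le_add (hl (k - 1) (by omega)) (hl k le_rfl))
    rw [sub_sub_sub_cancel_right] at h3
    refine h3.trans ?_
    rw [zpow_sub₀ two_ne_zero]
    calc C2 * (2 ^ (N + 1) * maj N (2 ^ i) (y - x)) * 2 ^ k +
        C2 * (2 ^ (N + 1) * maj N (2 ^ i) (y - x)) * 2 ^ k =
        (2 * C2 * 2 ^ (N + 1)) * (2 ^ i * maj N (2 ^ i) (y - x) * (2 ^ k / 2 ^ i)) := by
          field_simp; ring
      _ ≤ _ := by gcongr; exact le_add_of_nonneg_left (by positivity)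
  · have hk0 : (0 : ℝ) < 2 ^ k := by positivity
    have hm0 := maj_nonneg hk0 (y - x)
    have hg1 := gwR_nonneg (c k) k i x
    have hg2 := gwR_nonneg (c (k - 1)) (k - 1) i x
    rw [max_eq_left hki, wt, if_neg (not_lt.2 hki), gw_eq_ofReal, gw_eq_ofReal,
      ← ENNReal.ofReal_add hg1 hg2, ← ENNReal.ofReal_mul (by positivity),
      ← ENNReal.ofReal_mul (by positivity)]
    refine ENNReal.ofReal_le_ofReal ?_
    have e1 := h1 d c k i x y z t (by omega) hit hti hxz
    have e2 := h1 d c (k - 1) i x y z t (by omega) hit hti hxz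
    have e3 : (2 : ℝ) ^ (k - 1) * maj N (2 ^ (k - 1)) (y - x) ≤
        2 ^ (N + 1) * (2 ^ k * maj N (2 ^ k) (y - x)) := by
      have f0 : (2 : ℝ) ^ (k - 1) ≤ 2 ^ k := zpow_le_zpow_right₀ one_le_two (by omega)
      have f1 : maj N (2 ^ (k - 1)) (y - x) ≤ 2 ^ (N + 1) * maj N (2 ^ k) (y - x) := by
        refine maj_le_of_add_le (by positivity) hk0 ?_
        rw [zpow_sub_one₀ two_ne_zero]
        linarith [norm_nonneg (y - x)]
      have f2 := maj_nonneg (show (0 : ℝ) < 2 ^ (k - 1) by positivity) (y - x)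
      calc (2 : ℝ) ^ (k - 1) * maj N (2 ^ (k - 1)) (y - x) ≤
          2 ^ k * (2 ^ (N + 1) * maj N (2 ^ k) (y - x)) := by gcongr
        _ = _ := by ring
    have e4 : (2 : ℝ) ^ k * maj N (2 ^ k) (y - x) ≤
        2 ^ (N + 1) * (2 ^ k * maj N (2 ^ k) (y - x)) :=
      le_mul_of_one_le_left (by positivity) (one_le_pow₀ one_le_two)
    unfold mdiff
    refine (abs_sub _ _).trans ((add_le_add e2 e1).trans ?_)
    calc C1 * (2 ^ (k - 1) * maj N (2 ^ (k - 1)) (y - x)) * gwR (c (k - 1)) (k - 1) i x +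
        C1 * (2 ^ k * maj N (2 ^ k) (y - x)) * gwR (c k) k i x ≤
        C1 * (2 ^ (N + 1) * (2 ^ k * maj N (2 ^ k) (y - x))) * gwR (c (k - 1)) (k - 1) i x +
        C1 * (2 ^ (N + 1) * (2 ^ k * maj N (2 ^ k) (y - x))) * gwR (c k) k i x := by gcongr
      _ = 2 ^ (N + 1) * C1 * (2 ^ k * maj N (2 ^ k) (y - x) *
          (gwR (c k) k i x + gwR (c (k - 1)) (k - 1) i x)) := by ring
      _ ≤ _ := by gcongr; exact le_add_of_nonneg_right (by positivity)

end Kappa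

/-! ### The mixed derivatives of the product Poisson extension -/
section Mixed

variable {n : ℕ} {Nd : Fin n → ℕ}

/-- The product Poisson kernel. -/
def prodPk (p : W n Nd) : ℝ := ∏ j, poisson (Nd j) (p j)

/-- The boundary point of the product of half-spaces below `z`. -/
def bdryPt (z : X n Nd) : W n Nd := fun j => (z j, 0)

theorem continuous_bdryPt : Continuous (bdryPt : X n Nd → W n Nd) := by
  unfold bdryPt; fun_prop

theorem ne_zero_of_snd_pos {N : ℕ} {p : (Fin N → ℝ) × ℝ} (h : 0 < p.2) : p ≠ 0 := by
  rintro rfl; exact h.ne' rfl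

theorem contDiffAt_poisson_eval {p : W n Nd} (hp : ∀ j, 0 < (p j).2) (j : Fin n) (m : ℕ∞) :
    ContDiffAt ℝ m (fun q : W n Nd => poisson (Nd j) (q j)) p :=
  ContDiffAt.comp (g := poisson (Nd j)) (f := fun q : W n Nd => q j) p
    (contDiffAt_poisson (ne_zero_of_snd_pos (hp j)) m)
    (ContinuousLinearMap.proj (R := ℝ) (φ := fun j => (Fin (Nd j) → ℝ) × ℝ) j).contDiff.contDiffAt

theorem contDiffAt_prodPk {p : W n Nd} (hp : ∀ j, 0 < (p j).2) (m : ℕ∞) :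
    ContDiffAt ℝ m (prodPk : W n Nd → ℝ) p := by
  unfold prodPk
  exact contDiffAt_prod fun j _ => contDiffAt_poisson_eval hp j m

theorem isOpen_halfSpace : IsOpen {p : W n Nd | ∀ j, 0 < (p j).2} := by
  simp only [Set.ofPred_forall]
  exact isOpen_iInter_of_finite fun j => isOpen_lt (by fun_prop) (by fun_prop)

theorem exists_norm_iteratedFDeriv_poisson_eval_le (j : Fin n) (m : ℕ) {ε : ℝ} (hε : 0 < ε) :
    ∃ B : ℝ, 0 ≤ B ∧ ∀ p : W n Nd, (∀ j, ε ≤ (p j).2) →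
      ‖iteratedFDeriv ℝ m (fun q : W n Nd => poisson (Nd j) (q j)) p‖ ≤ B := by
  obtain ⟨C, hC, h⟩ := exists_norm_iteratedFDeriv_poisson_le (Nd j) m
  let π : W n Nd →L[ℝ] ((Fin (Nd j) → ℝ) × ℝ) := ContinuousLinearMap.proj j
  refine ⟨C * (ε ^ (Nd j + m))⁻¹ * ∏ _i : Fin m, ‖π‖, by positivity, fun p hp => ?_⟩
  let s : Set ((Fin (Nd j) → ℝ) × ℝ) := {q | 0 < q.2}
  have hs : IsOpen s := isOpen_lt (by fun_prop) (by fun_prop)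
  have hps : π p ∈ s := hε.trans_le (hp j)
  have hs' : IsOpen (π ⁻¹' s) := hs.preimage π.continuous
  have h1 := π.iteratedFDerivWithin_comp_right (f := poisson (Nd j)) (s := s)
    (n := ((m : ℕ∞) : WithTop ℕ∞))
    (fun q hq => (contDiffAt_poisson (ne_zero_of_snd_pos hq) m).contDiffWithinAt)
    hs.uniqueDiffOn hs'.uniqueDiffOn hps (i := m) le_rfl
  rw [iteratedFDerivWithin_of_isOpen m hs' hps, iteratedFDerivWithin_of_isOpen m hs hps] at h1
  have h2 : (fun q : W n Nd => poisson (Nd j) (q j)) = poisson (Nd j) ∘ π := rfl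
  rw [h2, h1]
  refine (ContinuousMultilinearMap.norm_compContinuousLinearMap_le _ _).trans ?_
  gcongr
  refine (h _ (ne_zero_of_snd_pos hps)).trans ?_
  gcongr
  calc ε ≤ (p j).2 := hp j
    _ ≤ ‖(p j).2‖ := Real.le_norm_self _
    _ ≤ ‖p j‖ := norm_snd_le _

theorem exists_norm_iteratedFDeriv_prodPk_le (m : ℕ) {ε : ℝ} (hε : 0 < ε) :
    ∃ B : ℝ, 0 ≤ B ∧ ∀ p : W n Nd, (∀ j, ε ≤ (p j).2) →
      ‖iteratedFDeriv ℝ m (prodPk : W n Nd → ℝ) p‖ ≤ B := by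
  choose B hB0 hB using fun (j : Fin n) (k : ℕ) =>
    exists_norm_iteratedFDeriv_poisson_eval_le (Nd := Nd) j k hε
  refine ⟨∑ p ∈ (Finset.univ : Finset (Fin n)).sym m, (p : Multiset (Fin n)).countPerms *
    ∏ j, B j (Multiset.count j (p : Multiset (Fin n))), ?_, fun p hp => ?_⟩
  · exact Finset.sum_nonneg fun p _ => mul_nonneg (by positivity)
      (Finset.prod_nonneg fun j _ => hB0 _ _)
  · have hp0 : p ∈ {p : W n Nd | ∀ j, 0 < (p j).2} := fun j => hε.trans_le (hp j)
    have hU := isOpen_halfSpace (n := n) (Nd := Nd)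
    rw [← iteratedFDerivWithin_of_isOpen m hU hp0]
    have h1 := norm_iteratedFDerivWithin_prod_le (𝕜 := ℝ) (u := Finset.univ)
      (f := fun j (q : W n Nd) => poisson (Nd j) (q j))
      (s := {p : W n Nd | ∀ j, 0 < (p j).2}) (N := ((m : ℕ∞) : WithTop ℕ∞))
      (fun j _ q hq => (contDiffAt_poisson_eval hq j m).contDiffWithinAt)
      hU.uniqueDiffOn hp0 (n := m) le_rfl
    refine h1.trans (Finset.sum_le_sum fun q _ => ?_)
    gcongr with j
    rw [iteratedFDerivWithin_of_isOpen _ hU hp0]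
    exact hB j _ p hp

theorem continuous_iteratedFDeriv_prodPk_sub (m : ℕ) {p : W n Nd} (hp : ∀ j, 0 < (p j).2) :
    Continuous fun z : X n Nd => iteratedFDeriv ℝ m prodPk (p - bdryPt z) := by
  refine continuous_iff_continuousAt.2 fun z => ?_
  have h1 : ContinuousAt (iteratedFDeriv ℝ m (prodPk : W n Nd → ℝ)) (p - bdryPt z) :=
    ((contDiffAt_prodPk (p := p - bdryPt z) (by simpa [bdryPt] using hp) m).continuousAt_iteratedFDeriv
      (by exact_mod_cast le_rfl))
  exact h1.comp (f := fun z : X n Nd => p - bdryPt z)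
    (continuous_const.sub continuous_bdryPt).continuousAt

theorem prodPoisson_eq (f : X n Nd → ℝ) (p : W n Nd) :
    prodPoisson n Nd f p = ∫ z, f z • prodPk (p - bdryPt z) := by
  simp only [prodPoisson, prodPk, poisson, bdryPt, Pi.sub_apply, Prod.fst_sub, Prod.snd_sub,
    sub_zero, smul_eq_mul]

theorem integrable_smul_iteratedFDeriv_prodPk {f : X n Nd → ℝ} (hf : Integrable f) (m : ℕ)
    {p : W n Nd} (hp : ∀ j, 0 < (p j).2) :
    Integrable fun z => f z • iteratedFDeriv ℝ m prodPk (p - bdryPt z) := by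
  obtain ⟨ε, hε, hεp⟩ : ∃ ε : ℝ, 0 < ε ∧ ∀ j, ε ≤ (p j).2 := by
    have := (Set.finite_range fun j => (p j).2).bddBelow
    rcases isEmpty_or_nonempty (Fin n) with h | h
    · exact ⟨1, one_pos, fun j => h.elim j⟩
    · obtain ⟨j, -, hj⟩ := Finset.exists_min_image (Finset.univ : Finset (Fin n))
        (fun j => (p j).2) Finset.univ_nonempty
      exact ⟨(p j).2, hp j, fun i => hj i (Finset.mem_univ i)⟩
  obtain ⟨B, hB0, hB⟩ := exists_norm_iteratedFDeriv_prodPk_le (n := n) (Nd := Nd) m hε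
  refine hf.smul_bdd B (continuous_iteratedFDeriv_prodPk_sub m hp).aestronglyMeasurable
    (ae_of_all _ fun z => hB _ fun j => ?_)
  simpa [bdryPt] using hεp j

theorem iteratedFDeriv_prodPoisson {f : X n Nd → ℝ} (hf : Integrable f) (m : ℕ) :
    ∀ {p : W n Nd}, (∀ j, 0 < (p j).2) →
      iteratedFDeriv ℝ m (prodPoisson n Nd f) p =
        ∫ z, f z • iteratedFDeriv ℝ m prodPk (p - bdryPt z) := by
  induction m with
  | zero =>
    intro p hp
    rw [iteratedFDeriv_zero_eq_comp, iteratedFDeriv_zero_eq_comp, Function.comp_apply,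
      prodPoisson_eq, ← LinearIsometryEquiv.coe_toContinuousLinearEquiv,
          ← ContinuousLinearEquiv.integral_comp_comm]
    simp only [map_smul, Function.comp_apply]
  | succ m ih =>
    intro p hp
    have hmem : {p : W n Nd | ∀ j, 0 < (p j).2} ∈ 𝓝 p := isOpen_halfSpace.mem_nhds hp
    obtain ⟨ε, hε, hεp⟩ : ∃ ε : ℝ, 0 < ε ∧ ∀ j, ε < (p j).2 := by
      rcases isEmpty_or_nonempty (Fin n) with h | h
      · exact ⟨1, one_pos, fun j => h.elim j⟩
      · obtain ⟨j, -, hj⟩ := Finset.exists_min_image (Finset.univ : Finset (Fin n))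
          (fun j => (p j).2) Finset.univ_nonempty
        exact ⟨(p j).2 / 2, half_pos (hp j), fun i =>
          (half_lt_self (hp j)).trans_le (hj i (Finset.mem_univ i))⟩
    have hs : {q : W n Nd | ∀ j, ε < (q j).2} ∈ 𝓝 p := by
      refine IsOpen.mem_nhds ?_ hεp
      simp only [Set.ofPred_forall]
      exact isOpen_iInter_of_finite fun j => isOpen_lt (by fun_prop) (by fun_prop)
    obtain ⟨B, hB0, hB⟩ := exists_norm_iteratedFDeriv_prodPk_le (n := n) (Nd := Nd) (m + 1) hε
    have hdiff : ∀ q : W n Nd, (∀ j, 0 < (q j).2) →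
        DifferentiableAt ℝ (iteratedFDeriv ℝ m (prodPk : W n Nd → ℝ)) q := fun q hq =>
      (contDiffAt_prodPk hq (m + 1 : ℕ)).differentiableAt_iteratedFDeriv
        (by exact_mod_cast Nat.lt_succ_self m)
    have hmain : HasFDerivAt (fun q : W n Nd => ∫ z, f z • iteratedFDeriv ℝ m prodPk (q - bdryPt z))
        (∫ z, f z • fderiv ℝ (iteratedFDeriv ℝ m prodPk) (p - bdryPt z)) p := by
      refine hasFDerivAt_integral_of_dominated_of_fderiv_le (𝕜 := ℝ)
        (F' := fun q z => f z • fderiv ℝ (iteratedFDeriv ℝ m prodPk) (q - bdryPt z))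
        (bound := fun z => ‖f z‖ * B) hs ?_
        (integrable_smul_iteratedFDeriv_prodPk hf m hp) ?_ ?_ (hf.norm.mul_const B) ?_
      · filter_upwards [hmem] with q hq
        exact (integrable_smul_iteratedFDeriv_prodPk hf m hq).aestronglyMeasurable
      · have : SecondCountableTopologyEither (X n Nd) (W n Nd →L[ℝ] W n Nd [×m]→L[ℝ] ℝ) :=
          ⟨Or.inl inferInstance⟩
        refine hf.aestronglyMeasurable.smul (Continuous.aestronglyMeasurable ?_)
        have h1 := continuous_iteratedFDeriv_prodPk_sub (m + 1) hp
        simp only [iteratedFDeriv_succ_eq_comp_left, Function.comp_apply] at h1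
        exact (LinearIsometryEquiv.comp_continuous_iff _).1 h1
      · refine ae_of_all _ fun z q hq => ?_
        rw [norm_smul, norm_fderiv_iteratedFDeriv]
        gcongr
        exact hB _ fun j => by simpa [bdryPt] using (hq j).le
      · refine ae_of_all _ fun z q hq => ?_
        have h1 := (hdiff (q - bdryPt z) (by
          intro j; simpa [bdryPt] using hε.trans (hq j))).hasFDerivAt
        exact (((hasFDerivAt_comp_sub (bdryPt z)).2 h1).const_smul (f z))
    have hev : iteratedFDeriv ℝ m (prodPoisson n Nd f) =ᶠ[𝓝 p]
        fun q : W n Nd => ∫ z, f z • iteratedFDeriv ℝ m prodPk (q - bdryPt z) := by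
      filter_upwards [hmem] with q hq using ih hq
    rw [iteratedFDeriv_succ_eq_comp_left, iteratedFDeriv_succ_eq_comp_left, Function.comp_apply,
      hev.fderiv_eq, hmain.fderiv]
    refine (ContinuousLinearEquiv.integral_comp_comm (𝕜 := ℝ) (μ := (volume : Measure (X n Nd)))
      (E := W n Nd →L[ℝ] W n Nd [×m]→L[ℝ] ℝ) (F := W n Nd [×(m + 1)]→L[ℝ] ℝ)
      (continuousMultilinearCurryLeftEquiv ℝ (fun _ : Fin (m + 1) => W n Nd) ℝ).symm.toContinuousLinearEquiv _).symm.trans ?_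
    simp only [map_smul, Function.comp_apply]
    rfl

theorem iteratedFDeriv_prodPk_apply (d : Π j, Fin (Nd j + 1)) (k : ℕ) :
    ∀ (e : Fin k → Fin n), Function.Injective e → ∀ q : W n Nd, (∀ j, 0 < (q j).2) →
      iteratedFDeriv ℝ k prodPk q (fun i => dirW n Nd (e i) (d (e i))) =
        ∏ j, if j ∈ Set.range e then dpk (Nd j) (d j) (q j) else poisson (Nd j) (q j) := by
  classical
  induction k with
  | zero =>
    intro e _ q _
    simp [prodPk]
  | succ k ih =>
    intro e he q hq
    have hdiff : DifferentiableAt ℝ (iteratedFDeriv ℝ k (prodPk : W n Nd → ℝ)) q :=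
      (contDiffAt_prodPk hq (k + 1 : ℕ)).differentiableAt_iteratedFDeriv
        (by exact_mod_cast Nat.lt_succ_self k)
    rw [iteratedFDeriv_succ_apply_left, ← fderiv_continuousMultilinear_apply_const_apply hdiff]
    set e' : Fin k → Fin n := Fin.tail e with he'
    have he'i : Function.Injective e' := he.comp (Fin.succ_injective k)
    have h0 : e 0 ∉ Set.range e' := by
      rintro ⟨i, hi⟩
      exact Fin.succ_ne_zero i (he hi)
    have hev : (fun y => (iteratedFDeriv ℝ k (prodPk : W n Nd → ℝ) y)
        (Fin.tail fun i => dirW n Nd (e i) (d (e i)))) =ᶠ[𝓝 q] fun y => ∏ j,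
          if j ∈ Set.range e' then dpk (Nd j) (d j) (y j) else poisson (Nd j) (y j) := by
      filter_upwards [isOpen_halfSpace.mem_nhds hq] with y hy
      exact ih e' he'i y hy
    have hd1 : DifferentiableAt ℝ (fun y => (iteratedFDeriv ℝ k (prodPk : W n Nd → ℝ) y)
        (Fin.tail fun i => dirW n Nd (e i) (d (e i)))) q :=
      hdiff.continuousMultilinear_apply_const _
    have hd2 := hd1.congr_of_eventuallyEq hev.symm
    rw [hev.fderiv_eq]
    have hl := hd2.hasFDerivAt.hasLineDerivAt (dirW n Nd (e 0) (d (e 0)))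
    have hdir : dirW n Nd (e 0) (d (e 0)) = Pi.single (e 0) (pdir (Nd (e 0)) (d (e 0))) := rfl
    refine hl.unique ?_
    unfold HasLineDerivAt
    have hp0 : HasDerivAt (fun s : ℝ => poisson (Nd (e 0)) (q (e 0) + s • pdir (Nd (e 0))
        (d (e 0))))
        (dpk (Nd (e 0)) (d (e 0)) (q (e 0))) 0 :=
      (((contDiffAt_poisson (ne_zero_of_snd_pos (hq (e 0))) 1).differentiableAt
        one_ne_zero).hasFDerivAt.hasLineDerivAt _)
    have hprod := hp0.mul_const (∏ j ∈ Finset.univ.erase (e 0),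
      if j ∈ Set.range e' then dpk (Nd j) (d j) (q j) else poisson (Nd j) (q j))
    have hR : (∏ j, if j ∈ Set.range e then dpk (Nd j) (d j) (q j) else poisson (Nd j) (q j)) =
        dpk (Nd (e 0)) (d (e 0)) (q (e 0)) * ∏ j ∈ Finset.univ.erase (e 0),
      (if j ∈ Set.range e' then dpk (Nd j) (d j) (q j) else poisson (Nd j) (q j)) := by
      rw [← Finset.mul_prod_erase _ _ (Finset.mem_univ (e 0)), if_pos ⟨0, rfl⟩]
      congr 1
      refine Finset.prod_congr rfl fun j hj => ?_
      have hj' := Finset.ne_of_mem_erase hj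
      have : j ∈ Set.range e ↔ j ∈ Set.range e' := by
        constructor
        · rintro ⟨i, rfl⟩
          obtain ⟨i', rfl⟩ := Fin.exists_succ_eq.2 (show i ≠ 0 by rintro rfl; exact hj' rfl)
          exact ⟨i', rfl⟩
        · rintro ⟨i, rfl⟩; exact ⟨i.succ, rfl⟩
      simp only [this]
    rw [hR]
    refine hprod.congr_of_eventuallyEq (Eventually.of_forall fun s => ?_)
    dsimp only
    rw [← Finset.mul_prod_erase _ _ (Finset.mem_univ (e 0)), if_neg h0, hdir]
    congr 1
    · simp
    · refine Finset.prod_congr rfl fun j hj => ?_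
      have hj' := Finset.ne_of_mem_erase hj
      simp [hj']

theorem iteratedFDeriv_prodPk_dirW (d : Π j, Fin (Nd j + 1)) {q : W n Nd}
    (hq : ∀ j, 0 < (q j).2) :
    iteratedFDeriv ℝ n prodPk q (fun j => dirW n Nd j (d j)) =
      ∏ j, dpk (Nd j) (d j) (q j) := by
  have := iteratedFDeriv_prodPk_apply d n id Function.injective_id q hq
  simpa using this

/-- The normalized mixed derivative of the Poisson extension, in the directions `d`. -/
def mixedF (f : X n Nd → ℝ) (d : Π j, Fin (Nd j + 1)) (p : W n Nd) : ℝ :=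
  ∫ w, f w * ∏ j, pker (Nd j) (d j) (p j).1 (p j).2 (w j)

theorem mixedGradSq_prodPoisson_mul {f : X n Nd → ℝ} (hf : Integrable f) {p : W n Nd}
    (hp : ∀ j, 0 < (p j).2) :
    mixedGradSq n Nd (prodPoisson n Nd f) p * ∏ j, (p j).2 ^ (1 - (Nd j : ℝ)) =
      (∑ d, mixedF f d p ^ 2) * ∏ j, (p j).2 ^ (-1 - (Nd j : ℝ)) := by
  have h1 : ∀ d, mixedF f d p = (∏ j, (p j).2) *
      iteratedFDeriv ℝ n (prodPoisson n Nd f) p fun j => dirW n Nd j (d j) := by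
    intro d
    rw [iteratedFDeriv_prodPoisson hf n hp]
    rw [ContinuousMultilinearMap.integral_apply
      (integrable_smul_iteratedFDeriv_prodPk hf n hp), ← integral_const_mul]
    refine integral_congr_ae (ae_of_all _ fun w => ?_)
    have h2 : ∀ j, 0 < ((p - bdryPt w) j).2 := by intro j; simpa [bdryPt] using hp j
    simp only [smul_apply, smul_eq_mul]
    rw [iteratedFDeriv_prodPk_dirW d h2]
    simp only [pker, Finset.prod_mul_distrib, bdryPt, Pi.sub_apply]
    have h3 : ∀ j, p j - (w j, (0 : ℝ)) = ((p j).1 - w j, (p j).2) := fun j =>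
      Prod.ext rfl (sub_zero _)
    simp only [h3]
    ring
  unfold mixedGradSq
  simp only [h1, mul_pow, ← Finset.mul_sum]
  rw [mul_comm (_ ^ 2), mul_assoc, ← Finset.prod_pow, ← Finset.prod_mul_distrib]
  congr 1
  refine Finset.prod_congr rfl fun j _ => ?_
  rw [← Real.rpow_natCast, ← Real.rpow_add (hp j)]
  congr 1
  push_cast; ring

theorem lusinSq_eq {f : X n Nd → ℝ} (hf : Integrable f) (x : X n Nd) :
    lusinSq n Nd f x = ∫⁻ p in prodCone n Nd x,
      ENNReal.ofReal ((∑ d, mixedF f d p ^ 2) * ∏ j, (p j).2 ^ (-1 - (Nd j : ℝ))) := by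
  unfold lusinSq
  refine setLIntegral_congr_fun ?_ fun p hp => ?_
  · unfold prodCone
    simp only [Set.ofPred_forall]
    exact (MeasurableSet.iInter fun j => measurableSet_lt (by fun_prop) (by fun_prop))
  · rw [mixedGradSq_prodPoisson_mul hf fun j => (Real.sqrt_nonneg _).trans_lt (hp j)]

end Mixed

/-! ### The kernels of the averaging operators and of the martingale differences -/
section Haar

/-- The kernel of the averaging operator `E_k`. -/
def avgKer {N : ℕ} (c : ℤ → Fin N → ℝ) (k : ℤ) (y w : Fin N → ℝ) : ℝ :=
  (dcube (c k) k y).indicator (fun _ => (((2 : ℝ) ^ k) ^ N)⁻¹) w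

/-- The kernel of the martingale difference `Δ_k`. -/
def haar {N : ℕ} (c : ℤ → Fin N → ℝ) (k : ℤ) (y w : Fin N → ℝ) : ℝ :=
  avgKer c (k - 1) y w - avgKer c k y w

variable {N : ℕ} (c : ℤ → Fin N → ℝ) (k : ℤ)

theorem avgKer_comm (y w : Fin N → ℝ) : avgKer c k y w = avgKer c k w y := by
  unfold avgKer
  by_cases h : w ∈ dcube (c k) k y
  · rw [Set.indicator_of_mem h, Set.indicator_of_mem (mem_dcube_comm.1 h)]
  · rw [Set.indicator_of_notMem h, Set.indicator_of_notMem fun h' => h (mem_dcube_comm.1 h')]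

theorem haar_comm (y w : Fin N → ℝ) : haar c k y w = haar c k w y := by
  simp only [haar, avgKer_comm c _ y w]

theorem measurable_avgKer (y : Fin N → ℝ) : Measurable (avgKer c k y) :=
  measurable_const.indicator (measurableSet_dcube _ _ _)

theorem measurable_haar (y : Fin N → ℝ) : Measurable (haar c k y) :=
  (measurable_avgKer c _ y).sub (measurable_avgKer c _ y)

theorem integrable_avgKer (y : Fin N → ℝ) : Integrable (avgKer c k y) :=
  (integrable_indicator_iff (measurableSet_dcube _ _ _)).2
    (integrableOn_const (volume_dcube_lt_top _ _ _).ne)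

theorem integrable_haar (y : Fin N → ℝ) : Integrable (haar c k y) :=
  (integrable_avgKer c _ y).sub (integrable_avgKer c _ y)

theorem avgKer_nonneg (y w : Fin N → ℝ) : 0 ≤ avgKer c k y w :=
  Set.indicator_nonneg (fun _ _ => by positivity) w

theorem avgKer_le (y w : Fin N → ℝ) : avgKer c k y w ≤ (((2 : ℝ) ^ k) ^ N)⁻¹ :=
  Set.indicator_le_self' (fun _ _ => by positivity) w

theorem abs_haar_le (y w : Fin N → ℝ) :
    |haar c k y w| ≤ (((2 : ℝ) ^ (k - 1)) ^ N)⁻¹ + (((2 : ℝ) ^ k) ^ N)⁻¹ := by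
  refine (abs_sub _ _).trans (add_le_add ?_ ?_) <;>
  · rw [abs_of_nonneg (avgKer_nonneg c _ y w)]
    exact avgKer_le c _ y w

theorem haar_eq_zero (y w : Fin N → ℝ) (h : ‖y‖ + (2 : ℝ) ^ k < ‖w‖) : haar c k y w = 0 := by
  have key : ∀ l ≤ k, avgKer c l y w = 0 := by
    intro l hl
    refine Set.indicator_of_notMem (fun hw => ?_) _
    have h1 := norm_sub_le_of_mem_dcube hw
    have h2 : (2 : ℝ) ^ l ≤ 2 ^ k := zpow_le_zpow_right₀ one_le_two hl
    have h3 := norm_sub_norm_le w y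
    have h4 := norm_sub_rev w y
    linarith
  rw [haar, key _ (by lia), key _ le_rfl, sub_zero]

theorem ae_continuousAt_haar (y : Fin N → ℝ) : ∀ᵐ w, ContinuousAt (haar c k y) w := by
  have key : ∀ l, ∀ᵐ w, ContinuousAt (avgKer c l y) w := by
    intro l
    have h1 : Convex ℝ (dcube (c l) l y) := by
      rw [dcube_eq_pi]
      exact convex_pi fun i _ => convex_Ico _ _
    have h2 := h1.addHaar_frontier volume
    filter_upwards [measure_eq_zero_iff_ae_notMem.1 h2] with w hw
    have h3 : ∀ {s : Set (Fin N → ℝ)}, w ∈ s → w ∉ frontier s → s ∈ 𝓝 w := fun hs hw => by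
      rw [← mem_interior_iff_mem_nhds]
      rw [← self_sdiff_frontier]
      exact ⟨hs, hw⟩
    by_cases h : w ∈ dcube (c l) l y
    · refine (continuousAt_const (y := (((2 : ℝ) ^ l) ^ N)⁻¹)).congr ?_
      filter_upwards [h3 h hw] with v hv
      exact (Set.indicator_of_mem hv fun _ => (((2 : ℝ) ^ l) ^ N)⁻¹).symm
    · refine (continuousAt_const (y := (0 : ℝ))).congr ?_
      filter_upwards [h3 h (frontier_compl (dcube (c l) l y) ▸ hw)] with v hv
      exact (Set.indicator_of_notMem hv fun _ => (((2 : ℝ) ^ l) ^ N)⁻¹).symm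
  filter_upwards [key (k - 1), key k] with w h1 h2 using h1.sub h2

theorem integral_avgKer_mul (K : (Fin N → ℝ) → ℝ) (y : Fin N → ℝ) :
    ∫ w, avgKer c k y w * K w = avg c k K y := by
  unfold avgKer avg
  rw [← integral_indicator (measurableSet_dcube _ _ _), div_eq_inv_mul, ← integral_const_mul]
  refine integral_congr_ae (ae_of_all _ fun w => ?_)
  simp only [Set.indicator]
  split_ifs <;> simp

theorem integral_haar_mul {K : (Fin N → ℝ) → ℝ} (hK : Integrable K) (y : Fin N → ℝ) :
    ∫ w, haar c k y w * K w = mdiff c k K y := by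
  have hi : ∀ l, Integrable fun w => avgKer c l y w * K w := fun l =>
    hK.bdd_mul (c := (((2 : ℝ) ^ l) ^ N)⁻¹) (measurable_avgKer c l y).aestronglyMeasurable
      (ae_of_all _ fun w => by
        rw [Real.norm_eq_abs, abs_of_nonneg (avgKer_nonneg c _ y w)]
        exact avgKer_le c l y w)
  simp only [haar, sub_mul]
  rw [integral_sub (hi _) (hi _), integral_avgKer_mul, integral_avgKer_mul, mdiff]

end Haar

section ProductHaar

variable {n : ℕ} {Nd : Fin n → ℕ} (c : Π j : Fin n, ℤ → Fin (Nd j) → ℝ)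

theorem integrable_mul_prod_of_bdd {f : X n Nd → ℝ} (hf : Integrable f)
    {g : Π j, (Fin (Nd j) → ℝ) → ℝ} {B : Fin n → ℝ} (hg : ∀ j, Measurable (g j))
    (hB : ∀ j w, |g j w| ≤ B j) : Integrable fun w : X n Nd => f w * ∏ j, g j (w j) := by
  refine hf.mul_bdd (c := ∏ j, B j) ?_ (ae_of_all _ fun w => ?_)
  · exact (Finset.measurable_fun_prod _ fun j _ =>
      (hg j).comp (measurable_pi_apply j)).aestronglyMeasurable
  · rw [Real.norm_eq_abs, Finset.abs_prod]
    exact Finset.prod_le_prod (fun j _ => abs_nonneg _) fun j _ => hB j _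

theorem ravg_eq_integral (k : Fin n → ℤ) (f : X n Nd → ℝ) (y : X n Nd) :
    ravg n Nd c k f y = ∫ w, f w * ∏ j, avgKer (c j) (k j) (y j) (w j) := by
  unfold ravg
  have hm : MeasurableSet (Set.univ.pi fun j => dcube (c j (k j)) (k j) (y j)) :=
    MeasurableSet.univ_pi fun j => measurableSet_dcube _ _ _
  rw [← integral_indicator hm, div_eq_mul_inv, ← integral_mul_const]
  refine integral_congr_ae (ae_of_all _ fun w => ?_)
  dsimp only
  by_cases h : w ∈ Set.univ.pi fun j => dcube (c j (k j)) (k j) (y j)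
  · rw [Set.indicator_of_mem h, ← Finset.prod_inv_distrib]
    congr 1
    refine Finset.prod_congr rfl fun j _ => ?_
    rw [avgKer, Set.indicator_of_mem (h j (Set.mem_univ j))]
  · rw [Set.indicator_of_notMem h, zero_mul]
    simp only [Set.mem_univ_pi, not_forall] at h
    obtain ⟨j, hj⟩ := h
    rw [Finset.prod_eq_zero (Finset.mem_univ j), mul_zero]
    rw [avgKer, Set.indicator_of_notMem hj]

theorem rmdiff_eq_integral (k : Fin n → ℤ) {f : X n Nd → ℝ} (hf : Integrable f) (y : X n Nd) :
    rmdiff n Nd c k f y = ∫ w, f w * ∏ j, haar (c j) (k j) (y j) (w j) := by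
  have h1 : ∀ w : X n Nd, ∏ j, haar (c j) (k j) (y j) (w j) = ∑ ε : Fin n → Bool,
      (-1 : ℝ) ^ (Finset.univ.filter fun j => ε j = false).card *
        ∏ j, avgKer (c j) (k j - if ε j then 1 else 0) (y j) (w j) := by
    intro w
    have h2 : ∀ j, haar (c j) (k j) (y j) (w j) = ∑ b : Bool,
        (if b = false then -1 else 1) *
          avgKer (c j) (k j - if b then 1 else 0) (y j) (w j) := by
      intro j
      simp [haar, sub_eq_add_neg]
    simp only [h2]
    rw [Finset.prod_univ_sum, Fintype.piFinset_univ]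
    refine Finset.sum_congr rfl fun ε _ => ?_
    rw [Finset.prod_mul_distrib, Finset.prod_ite]
    simp
  simp only [h1, Finset.mul_sum]
  rw [integral_finsetSum]
  · unfold rmdiff
    refine Finset.sum_congr rfl fun ε _ => ?_
    rw [ravg_eq_integral, ← integral_const_mul]
    refine integral_congr_ae (ae_of_all _ fun w => ?_)
    dsimp only
    ring
  · intro ε _
    have := (integrable_mul_prod_of_bdd hf
      (g := fun j => avgKer (c j) (k j - if ε j then 1 else 0) (y j))
      (fun j => measurable_avgKer _ _ _) (fun j w => by
        rw [abs_of_nonneg (avgKer_nonneg _ _ _ w)]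
        exact avgKer_le (c j) _ (y j) w)).const_mul
        ((-1 : ℝ) ^ (Finset.univ.filter fun j => ε j = false).card)
    refine this.congr (ae_of_all _ fun w => ?_)
    dsimp only
    ring

end ProductHaar

/-! ### Reproducing the martingale differences from the Poisson extension -/
section Reproducing

variable {N : ℕ}

theorem exists_abs_pker_le_pow (N : ℕ) : ∃ C : ℝ, 0 < C ∧ ∀ d (z w : Fin N → ℝ) (t : ℝ), 0 < t →
    |pker N d z t w| ≤ C * (t ^ N)⁻¹ := by
  obtain ⟨C, hC0, hC⟩ := exists_abs_pker_le N
  refine ⟨C, hC0, fun d z w t ht => (hC d z w t ht).trans ?_⟩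
  have h1 := maj_le ht (z - w)
  calc C * (t * maj N t (z - w)) ≤ C * (t * (t ^ (N + 1))⁻¹) := by gcongr
    _ = C * (t ^ N)⁻¹ := by rw [pow_succ]; field_simp

theorem measurable_pker_uncurry (d : Fin (N + 1)) :
    Measurable fun q : ((Fin N → ℝ) × ℝ) × (Fin N → ℝ) => pker N d q.1.1 q.1.2 q.2 := by
  unfold pker; fun_prop

/-- The coefficient in the reproducing formula. -/
def pcoef (N : ℕ) (h : (Fin N → ℝ) → ℝ) (d : Fin (N + 1)) (p : (Fin N → ℝ) × ℝ) : ℝ :=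
  ∫ x, h x * pker N d p.1 p.2 x

theorem measurable_pcoef {h : (Fin N → ℝ) → ℝ} (hm : Measurable h) (d : Fin (N + 1)) :
    Measurable (pcoef N h d) := by
  have h1 : Measurable fun q : ((Fin N → ℝ) × ℝ) × (Fin N → ℝ) =>
      h q.2 * pker N d q.1.1 q.1.2 q.2 :=
    (hm.comp measurable_snd).mul (measurable_pker_uncurry d)
  exact h1.stronglyMeasurable.integral_prod_right.measurable

theorem integrable_pcoef (m : ℕ) {h : (Fin N → ℝ) → ℝ} (hm : Measurable h) (hi : Integrable h)
    {R : ℝ} (hR : ∀ x, R < ‖x‖ → h x = 0) (d : Fin (N + 1)) :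
    Integrable (pcoef N h d) (slabMeasure N m) := by
  obtain ⟨C, hC0, hC⟩ := exists_abs_pker_le N
  set ε : ℝ := ((m : ℝ) + 1)⁻¹ with hεdef
  have hε : 0 < ε := truncation_pos m
  refine integrable_prod_of_le_maj (a := 0) (C := (∫ x, |h x|) * (C * (((m : ℝ) + 1) *
    (1 + |R| / ε) ^ (N + 1)))) hε (measurable_pcoef hm d) fun z t ht => ?_
  have ht0 : 0 < t := hε.trans ht.1
  unfold pcoef
  rw [← Real.norm_eq_abs, mul_assoc, ← integral_mul_const]
  refine norm_integral_le_of_norm_le (G := ℝ) (hi.abs.mul_const _) (ae_of_all _ fun x => ?_)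
  rw [Real.norm_eq_abs, abs_mul]
  dsimp only
  rcases lt_or_ge R ‖x‖ with hx | hx
  · simp [hR x hx]
  refine mul_le_mul_of_nonneg_left ((hC d z x t ht0).trans ?_) (abs_nonneg _)
  rw [mul_assoc C, mul_assoc ((m : ℝ) + 1)]
  refine mul_le_mul_of_nonneg_left (mul_le_mul ht.2 ?_ (maj_nonneg ht0 _) (by positivity)) hC0.le
  refine (maj_anti hε ht.1.le le_rfl).trans (maj_le_of_add_le hε hε ?_)
  have h1 : ‖z - 0‖ ≤ ‖z - x‖ + |R| := by
    rw [sub_zero]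
    calc ‖z‖ = ‖(z - x) + x‖ := by simp
      _ ≤ ‖z - x‖ + ‖x‖ := norm_add_le _ _
      _ ≤ _ := by gcongr; exact hx.trans (le_abs_self R)
  have h2 := norm_nonneg (z - x)
  have h3 : 0 ≤ |R| / ε * ‖z - x‖ := by positivity
  have h4 : |R| / ε * ε = |R| := div_mul_cancel₀ _ hε.ne'
  nlinarith

/-- The integrand of the reproducing formula. -/
def calG (N : ℕ) (h : (Fin N → ℝ) → ℝ) (w : Fin N → ℝ) (p : (Fin N → ℝ) × ℝ) : ℝ :=
  p.2⁻¹ * ∑ d, pker N d p.1 p.2 w * pcoef N h d p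

theorem measurable_calG {h : (Fin N → ℝ) → ℝ} (hm : Measurable h) :
    Measurable fun q : (Fin N → ℝ) × ((Fin N → ℝ) × ℝ) => calG N h q.1 q.2 := by
  unfold calG
  refine Measurable.mul (by fun_prop) (Finset.measurable_fun_sum _ fun d _ => ?_)
  exact ((measurable_pker_uncurry d).comp measurable_swap).mul
    ((measurable_pcoef hm d).comp measurable_snd)

theorem calA_eq_integral_calG (m : ℕ) (h : (Fin N → ℝ) → ℝ) (w : Fin N → ℝ) :
    calA N m h w = ∫ p, calG N h w p ∂slabMeasure N m := by
  unfold calA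
  refine integral_congr_ae ?_
  filter_upwards [ae_snd_mem_Ioc (N := N) ((m : ℝ) + 1)⁻¹ ((m : ℝ) + 1)] with p hp
  have hp0 : p.2 ≠ 0 := ((truncation_pos m).trans hp.1).ne'
  unfold calG
  simp only [Finset.mul_sum]
  refine Finset.sum_congr rfl fun d _ => ?_
  have h1 : pcoef N h d p = p.2 * ∫ x, h x * dpk N d (p.1 - x, p.2) := by
    unfold pcoef pker
    rw [← integral_const_mul]
    refine integral_congr_ae (ae_of_all _ fun x => ?_)
    dsimp only; ring
  rw [h1]
  unfold pker
  field_simp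

theorem exists_abs_calG_le (m : ℕ) {h : (Fin N → ℝ) → ℝ} (hm : Measurable h) (hi : Integrable h)
    {R : ℝ} (hR : ∀ x, R < ‖x‖ → h x = 0) :
    ∃ g : (Fin N → ℝ) × ℝ → ℝ, Integrable g (slabMeasure N m) ∧
      ∀ w, ∀ p, p.2 ∈ Set.Ioc ((m : ℝ) + 1)⁻¹ ((m : ℝ) + 1) → |calG N h w p| ≤ g p := by
  obtain ⟨C, hC0, hC⟩ := exists_abs_pker_le_pow N
  refine ⟨fun p => ((m : ℝ) + 1) * ∑ d, C * ((m : ℝ) + 1) ^ N * |pcoef N h d p|,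
    (integrable_finsetSum _ fun d _ =>
      (integrable_pcoef m hm hi hR d).abs.const_mul _).const_mul _, fun w p hp => ?_⟩
  have hp0 : 0 < p.2 := (truncation_pos m).trans hp.1
  have hp1 : p.2⁻¹ ≤ (m : ℝ) + 1 := by
    have := inv_anti₀ (truncation_pos m) hp.1.le
    rwa [inv_inv] at this
  unfold calG
  rw [abs_mul, abs_of_pos (inv_pos.2 hp0)]
  refine mul_le_mul hp1 ((Finset.abs_sum_le_sum_abs _ _).trans (Finset.sum_le_sum fun d _ => ?_))
    (abs_nonneg _) (by positivity)
  rw [abs_mul]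
  refine mul_le_mul_of_nonneg_right ((hC d p.1 w p.2 hp0).trans ?_) (abs_nonneg _)
  rw [← inv_pow]
  gcongr

variable {n : ℕ} {Nd : Fin n → ℕ}

theorem pi_slabMeasure_le (m : ℕ) :
    Measure.pi (fun j => slabMeasure (Nd j) m) ≤
      (volume : Measure (W n Nd)).restrict {p | ∀ j, 0 < (p j).2} := by
  have h1 : ∀ j, slabMeasure (Nd j) m = (volume : Measure ((Fin (Nd j) → ℝ) × ℝ)).restrict
      (Set.univ ×ˢ Set.Ioc ((m : ℝ) + 1)⁻¹ ((m : ℝ) + 1)) := by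
    intro j
    rw [Measure.volume_eq_prod, ← Measure.prod_restrict, Measure.restrict_univ, slabMeasure]
  simp only [h1]
  rw [← Measure.restrict_pi_pi, ← volume_pi]
  refine Measure.restrict_mono (fun p hp j => ?_) le_rfl
  exact (truncation_pos m).trans (hp j (Set.mem_univ j)).2.1

theorem ae_pi_slabMeasure (m : ℕ) :
    ∀ᵐ p ∂(Measure.pi fun j => slabMeasure (Nd j) m), ∀ j, 
      (p j).2 ∈ Set.Ioc ((m : ℝ) + 1)⁻¹ ((m : ℝ) + 1) := by
  refine ae_all_iff.2 fun j => ?_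
  exact (Measure.quasiMeasurePreserving_eval (fun j => slabMeasure (Nd j) m) j).ae
    (ae_snd_mem_Ioc (N := Nd j) _ _)

end Reproducing

section ReproducingProduct

variable {n : ℕ} {Nd : Fin n → ℕ}

theorem measurable_mixedF {f : X n Nd → ℝ} (hf : Measurable f) (d : Π j, Fin (Nd j + 1)) :
    Measurable (mixedF f d) := by
  have h1 : Measurable fun q : W n Nd × X n Nd =>
      f q.2 * ∏ j, pker (Nd j) (d j) (q.1 j).1 (q.1 j).2 (q.2 j) := by
    refine (hf.comp measurable_snd).mul (Finset.measurable_fun_prod _ fun j _ => ?_)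
    unfold pker; fun_prop
  exact h1.stronglyMeasurable.integral_prod_right.measurable

theorem integrable_mul_prod_pker {f : X n Nd → ℝ} (hf : Integrable f) (d : Π j, Fin (Nd j + 1))
    {p : W n Nd} (hp : ∀ j, 0 < (p j).2) :
    Integrable fun w : X n Nd => f w * ∏ j, pker (Nd j) (d j) (p j).1 (p j).2 (w j) := by
  choose C hC0 hC using fun j => exists_abs_pker_le_pow (Nd j)
  exact integrable_mul_prod_of_bdd hf (fun j => measurable_pker _ _ _)
    fun j w => hC j (d j) _ w _ (hp j)

theorem integral_mul_prod_calG {f : X n Nd → ℝ} (hf : Integrable f)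
    (h : Π j, (Fin (Nd j) → ℝ) → ℝ) {p : W n Nd} (hp : ∀ j, 0 < (p j).2) :
    ∫ w, f w * ∏ j, calG (Nd j) (h j) (w j) (p j) =
      (∏ j, (p j).2⁻¹) * ∑ d : Π j, Fin (Nd j + 1),
        (∏ j, pcoef (Nd j) (h j) (d j) (p j)) * mixedF f d p := by
  have h1 : ∀ w : X n Nd, f w * ∏ j, calG (Nd j) (h j) (w j) (p j) =
      (∏ j, (p j).2⁻¹) * ∑ d : Π j, Fin (Nd j + 1), (∏ j, pcoef (Nd j) (h j) (d j) (p j)) *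
        (f w * ∏ j, pker (Nd j) (d j) (p j).1 (p j).2 (w j)) := by
    intro w
    unfold calG
    rw [Finset.prod_mul_distrib, Finset.prod_univ_sum, Fintype.piFinset_univ, mul_left_comm,
      Finset.mul_sum]
    congr 1
    refine Finset.sum_congr rfl fun d _ => ?_
    rw [Finset.prod_mul_distrib]
    ring
  simp only [h1]
  rw [integral_const_mul, integral_finsetSum]
  · simp only [integral_const_mul, mixedF]
  · exact fun d _ => (integrable_mul_prod_pker hf d hp).const_mul _

theorem tendsto_integral_mul_prod_calA (hNd : ∀ j, 0 < Nd j) {f : X n Nd → ℝ} (hf : Integrable f)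
    {h : Π j, (Fin (Nd j) → ℝ) → ℝ} (hm : ∀ j, Measurable (h j)) (hi : ∀ j, Integrable (h j))
    {M R : Fin n → ℝ} (hM : ∀ j x, |h j x| ≤ M j) (hR : ∀ j x, R j < ‖x‖ → h j x = 0)
    (hc : ∀ j, ∀ᵐ w, ContinuousAt (h j) w) :
    Tendsto (fun m => ∫ w, f w * ∏ j, calA (Nd j) m (h j) (w j)) atTop
      (𝓝 ((∏ j, calConst (Nd j)) * ∫ w, f w * ∏ j, h j (w j))) := by
  rw [← integral_const_mul]
  have hmeas : ∀ m j, Measurable (calA (Nd j) m (h j)) := by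
    intro m j
    have : calA (Nd j) m (h j) = fun w => ∫ p, calG (Nd j) (h j) w p ∂slabMeasure (Nd j) m :=
      funext fun w => calA_eq_integral_calG m (h j) w
    rw [this]
    exact (measurable_calG (hm j)).stronglyMeasurable.integral_prod_right.measurable
  refine tendsto_integral_of_dominated_convergence
    (fun w => |f w| * ∏ j, (M j * ∫ u, |greenKernel (Nd j) u|)) (fun m => ?_)
    (hf.abs.mul_const _) (fun m => ae_of_all _ fun w => ?_) ?_
  · exact (integrable_mul_prod_of_bdd hf (hmeas m)
      fun j w => abs_calA_le m (hm j) (hi j) (hM j) w).aestronglyMeasurable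
  · rw [Real.norm_eq_abs, abs_mul, Finset.abs_prod]
    exact mul_le_mul_of_nonneg_left (Finset.prod_le_prod (fun _ _ => abs_nonneg _)
      fun j _ => abs_calA_le m (hm j) (hi j) (hM j) _) (abs_nonneg _)
  · have h1 : ∀ᵐ w : X n Nd, ∀ j, ContinuousAt (h j) (w j) :=
      ae_all_iff.2 fun j => (Measure.quasiMeasurePreserving_eval
        (fun j => (volume : Measure (Fin (Nd j) → ℝ))) j).ae (hc j)
    filter_upwards [h1] with w hw
    have h2 := (tendsto_finsetProd (Finset.univ : Finset (Fin n)) fun j _ =>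
      tendsto_calA (hNd j) (hm j) (hi j) (hM j) (hR j) (hw j)).const_mul (f w)
    rw [Finset.prod_mul_distrib, mul_left_comm] at h2
    exact h2

theorem integral_mul_prod_calA (m : ℕ) {f : X n Nd → ℝ} (hfm : Measurable f) (hf : Integrable f)
    {h : Π j, (Fin (Nd j) → ℝ) → ℝ} (hm : ∀ j, Measurable (h j)) (hi : ∀ j, Integrable (h j))
    {R : Fin n → ℝ} (hR : ∀ j x, R j < ‖x‖ → h j x = 0) :
    ∫ w, f w * ∏ j, calA (Nd j) m (h j) (w j) =
      ∫ p, (∫ w, f w * ∏ j, calG (Nd j) (h j) (w j) (p j))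
        ∂(Measure.pi fun j => slabMeasure (Nd j) m) := by
  choose g hg hgb using fun j => exists_abs_calG_le (N := Nd j) m (hm j) (hi j) (hR j)
  have hmeas : Measurable fun q : X n Nd × W n Nd =>
      f q.1 * ∏ j, calG (Nd j) (h j) (q.1 j) (q.2 j) := by
    refine (hfm.comp measurable_fst).mul (Finset.measurable_fun_prod _ fun j _ => ?_)
    exact (measurable_calG (hm j)).comp (f := fun q : X n Nd × W n Nd => (q.1 j, q.2 j))
      (by fun_prop)
  have hinteg : Integrable (fun q : X n Nd × W n Nd =>
      f q.1 * ∏ j, calG (Nd j) (h j) (q.1 j) (q.2 j))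
      (volume.prod (Measure.pi fun j => slabMeasure (Nd j) m)) := by
    refine (hf.abs.mul_prod (Integrable.fintype_prod_dep hg)).mono'
      hmeas.aestronglyMeasurable ?_
    have hae : ∀ᵐ q ∂((volume : Measure (X n Nd)).prod
        (Measure.pi fun j => slabMeasure (Nd j) m)), ∀ j,
        (q.2 j).2 ∈ Set.Ioc ((m : ℝ) + 1)⁻¹ ((m : ℝ) + 1) :=
      Measure.quasiMeasurePreserving_snd.ae (ae_pi_slabMeasure m)
    filter_upwards [hae] with q hq
    rw [Real.norm_eq_abs, abs_mul, Finset.abs_prod]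
    exact mul_le_mul_of_nonneg_left (Finset.prod_le_prod (fun _ _ => abs_nonneg _)
      fun j _ => hgb j _ _ (hq j)) (abs_nonneg _)
  rw [← integral_integral_swap hinteg]
  refine integral_congr_ae (ae_of_all _ fun w => ?_)
  dsimp only
  rw [integral_const_mul, integral_fintype_prod_eq_prod fun j => calG (Nd j) (h j) (w j)]
  simp only [calA_eq_integral_calG]

theorem pcoef_haar (c : Π j : Fin n, ℤ → Fin (Nd j) → ℝ) (k : Fin n → ℤ) (y : X n Nd)
    (d : Π j, Fin (Nd j + 1)) {p : W n Nd} (hp : ∀ j, 0 < (p j).2) (j : Fin n) :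
    pcoef (Nd j) (haar (c j) (k j) (y j)) (d j) (p j) =
      mdiff (c j) (k j) (pker (Nd j) (d j) (p j).1 (p j).2) (y j) :=
  integral_haar_mul _ _ (integrable_pker (hp j) _ _) _

/-- The martingale differences of `f` are controlled by the mixed derivatives of its Poisson
extension. -/
theorem ofReal_abs_rmdiff_le (hNd : ∀ j, 0 < Nd j) {f : X n Nd → ℝ} (hfm : Measurable f)
    (hf : Integrable f) (c : Π j : Fin n, ℤ → Fin (Nd j) → ℝ) (k : Fin n → ℤ) (y : X n Nd) :
    ENNReal.ofReal |rmdiff n Nd c k f y| ≤ ENNReal.ofReal (∏ j, calConst (Nd j))⁻¹ *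
      ∫⁻ p in {p : W n Nd | ∀ j, 0 < (p j).2}, ∑ d : Π j, Fin (Nd j + 1),
        (∏ j, ENNReal.ofReal |mdiff (c j) (k j) (pker (Nd j) (d j) (p j).1 (p j).2) (y j)|) *
          (ENNReal.ofReal |mixedF f d p| * ∏ j, ENNReal.ofReal (p j).2⁻¹) := by
  have hc0 : 0 < ∏ j, calConst (Nd j) := Finset.prod_pos fun j _ => calConst_pos
  have hR : ∀ j x, ‖y j‖ + (2 : ℝ) ^ k j < ‖x‖ → haar (c j) (k j) (y j) x = 0 :=
    fun j x => haar_eq_zero (c j) (k j) (y j) x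
  have hlim := tendsto_integral_mul_prod_calA hNd hf
    (fun j => measurable_haar (c j) (k j) (y j)) (fun j => integrable_haar (c j) (k j) (y j))
    (fun j => abs_haar_le (c j) (k j) (y j)) hR (fun j => ae_continuousAt_haar (c j) (k j) (y j))
  rw [← rmdiff_eq_integral c k hf y] at hlim
  have hlim' := (ENNReal.continuous_ofReal.tendsto _).comp hlim.abs
  set J := ∫⁻ p in {p : W n Nd | ∀ j, 0 < (p j).2}, ∑ d : Π j, Fin (Nd j + 1),
        (∏ j, ENNReal.ofReal |mdiff (c j) (k j) (pker (Nd j) (d j) (p j).1 (p j).2) (y j)|) *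
          (ENNReal.ofReal |mixedF f d p| * ∏ j, ENNReal.ofReal (p j).2⁻¹) with hJ
  have hle : ENNReal.ofReal |(∏ j, calConst (Nd j)) * rmdiff n Nd c k f y| ≤ J := by
    refine le_of_tendsto hlim' (Eventually.of_forall fun m => ?_)
    rw [Function.comp_apply, integral_mul_prod_calA m hfm hf
      (fun j => measurable_haar (c j) (k j) (y j)) (fun j => integrable_haar (c j) (k j) (y j)) hR]
    have hms : MeasurableSet {p : W n Nd | ∀ j, 0 < (p j).2} := isOpen_halfSpace.measurableSet
    have hpos : ∀ᵐ p ∂(Measure.pi fun j => slabMeasure (Nd j) m), ∀ j, 0 < (p j).2 := by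
      filter_upwards [ae_pi_slabMeasure (Nd := Nd) m] with p hp j
      exact (truncation_pos m).trans (hp j).1
    rw [← Real.enorm_eq_ofReal_abs]
    refine (enorm_integral_le_lintegral_enorm _).trans ?_
    calc _ ≤ ∫⁻ p, ∑ d : Π j, Fin (Nd j + 1),
        (∏ j, ENNReal.ofReal |mdiff (c j) (k j) (pker (Nd j) (d j) (p j).1 (p j).2) (y j)|) *
          (ENNReal.ofReal |mixedF f d p| * ∏ j, ENNReal.ofReal (p j).2⁻¹)
          ∂(Measure.pi fun j => slabMeasure (Nd j) m) := by
          refine lintegral_mono_ae ?_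
          filter_upwards [hpos] with p hp
          rw [integral_mul_prod_calG hf _ hp, enorm_mul, Real.enorm_of_nonneg
            (Finset.prod_nonneg fun j _ => (inv_pos.2 (hp j)).le),
            ENNReal.ofReal_prod_of_nonneg fun j _ => (inv_pos.2 (hp j)).le, mul_comm]
          refine (mul_le_mul_left (enorm_sum_le _ _) _).trans ?_
          rw [Finset.sum_mul]
          refine Finset.sum_le_sum fun d _ => ?_
          rw [enorm_mul, Real.enorm_eq_ofReal_abs, Finset.abs_prod,
            ENNReal.ofReal_prod_of_nonneg fun j _ => abs_nonneg _, Real.enorm_eq_ofReal_abs,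
            mul_assoc]
          simp only [pcoef_haar c k y d hp, le_refl]
      _ ≤ J := lintegral_mono' (pi_slabMeasure_le m) le_rfl
  rw [abs_mul, abs_of_pos hc0, ENNReal.ofReal_mul hc0.le] at hle
  calc ENNReal.ofReal |rmdiff n Nd c k f y|
      = ENNReal.ofReal (∏ j, calConst (Nd j))⁻¹ * (ENNReal.ofReal (∏ j, calConst (Nd j)) *
        ENNReal.ofReal |rmdiff n Nd c k f y|) := by
        rw [← mul_assoc, ← ENNReal.ofReal_mul (inv_nonneg.2 hc0.le), inv_mul_cancel₀ hc0.ne',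
          ENNReal.ofReal_one, one_mul]
    _ ≤ _ := mul_le_mul_right hle _

end ReproducingProduct

/-! ### Reproducing the Poisson extension from the martingale differences -/
section Averages

variable {N : ℕ} (c : ℤ → Fin N → ℝ)

theorem measurable_avgKer_uncurry (k : ℤ) :
    Measurable fun q : (Fin N → ℝ) × (Fin N → ℝ) => avgKer c k q.1 q.2 :=
  measurable_const.indicator (measurableSet_mem_dcube (c k) k)

theorem measurable_haar_uncurry (k : ℤ) :
    Measurable fun q : (Fin N → ℝ) × (Fin N → ℝ) => haar c k q.1 q.2 :=
  (measurable_avgKer_uncurry c _).sub (measurable_avgKer_uncurry c _)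

theorem measurable_avg (k : ℤ) {K : (Fin N → ℝ) → ℝ} (hK : Measurable K) :
    Measurable (avg c k K) := by
  have h1 : avg c k K = fun y => ∫ w, avgKer c k y w * K w :=
    funext fun y => (integral_avgKer_mul c k K y).symm
  have h2 : Measurable fun q : (Fin N → ℝ) × (Fin N → ℝ) => avgKer c k q.1 q.2 * K q.2 :=
    (measurable_avgKer_uncurry c k).mul (hK.comp measurable_snd)
  rw [h1]
  exact h2.stronglyMeasurable.integral_prod_right.measurable

theorem measurable_mdiff (k : ℤ) {K : (Fin N → ℝ) → ℝ} (hK : Measurable K) :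
    Measurable (mdiff c k K) :=
  (measurable_avg c _ hK).sub (measurable_avg c _ hK)

theorem avg_of_dconst (k : ℤ) {K : (Fin N → ℝ) → ℝ} (hK : DConst (c k) k K) :
    avg c k K = K := by
  funext x
  unfold avg
  rw [setIntegral_congr_fun (measurableSet_dcube _ _ _) fun y hy => hK x y hy, setIntegral_const,
    measureReal_dcube, smul_eq_mul, mul_div_cancel_left₀ _ (by positivity)]

theorem dconst_avg (k : ℤ) (K : (Fin N → ℝ) → ℝ) : DConst (c k) k (avg c k K) := by
  intro x y hy
  unfold avg
  rw [dcube_eq_of_mem hy]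

theorem dconst_avgKer (k : ℤ) (x : Fin N → ℝ) : DConst (c k) k (avgKer c k x) := by
  intro w y hy
  rw [avgKer_comm c k x, avgKer_comm c k x, avgKer, avgKer, dcube_eq_of_mem hy]

theorem integral_avgKer (k : ℤ) (y : Fin N → ℝ) : ∫ w, avgKer c k y w = 1 := by
  have h := integral_avgKer_mul c k (fun _ => 1) y
  rw [avg_of_dconst c k fun x y _ => rfl] at h
  simpa using h

theorem integrable_avgKer_mul (k : ℤ) {K : (Fin N → ℝ) → ℝ} (hK : Measurable K)
    (hi : Integrable K) :
    Integrable (fun q : (Fin N → ℝ) × (Fin N → ℝ) => avgKer c k q.1 q.2 * K q.2)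
      (volume.prod volume) := by
  have hm : Measurable fun q : (Fin N → ℝ) × (Fin N → ℝ) => avgKer c k q.1 q.2 * K q.2 :=
    (measurable_avgKer_uncurry c k).mul (hK.comp measurable_snd)
  rw [integrable_prod_iff' hm.aestronglyMeasurable]
  constructor
  · refine ae_of_all _ fun w => ?_
    simp only [avgKer_comm c k _ w]
    exact (integrable_avgKer c k w).mul_const _
  · refine hi.norm.congr (ae_of_all _ fun w => ?_)
    simp only [norm_mul, avgKer_comm c k _ w, Real.norm_of_nonneg (avgKer_nonneg c k w _)]
    rw [integral_mul_const, integral_avgKer, one_mul]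

theorem integrable_avg (k : ℤ) {K : (Fin N → ℝ) → ℝ} (hK : Measurable K) (hi : Integrable K) :
    Integrable (avg c k K) := by
  refine (integrable_avgKer_mul c k hK hi).integral_prod_left.congr (ae_of_all _ fun y => ?_)
  exact integral_avgKer_mul c k K y

theorem integrable_mdiff (k : ℤ) {K : (Fin N → ℝ) → ℝ} (hK : Measurable K) (hi : Integrable K) :
    Integrable (mdiff c k K) :=
  (integrable_avg c _ hK hi).sub (integrable_avg c _ hK hi)

variable {c}

theorem avg_avg_of_le (hc : Nested c) {l k : ℤ} (hlk : l ≤ k) {K : (Fin N → ℝ) → ℝ}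
    (hK : Measurable K) (hi : Integrable K) : avg c k (avg c l K) = avg c k K := by
  funext x
  rw [← integral_avgKer_mul, ← integral_avgKer_mul]
  simp only [← integral_avgKer_mul c l K, ← integral_const_mul]
  have hinteg : Integrable (Function.uncurry fun y w => avgKer c k x y * (avgKer c l y w * K w))
      (volume.prod volume) := by
    refine (integrable_avgKer_mul c l hK hi).bdd_mul (c := (((2 : ℝ) ^ k) ^ N)⁻¹)
        (f := fun q : (Fin N → ℝ) × (Fin N → ℝ) => avgKer c k x q.1)
      ((measurable_avgKer c k x).comp measurable_fst).aestronglyMeasurable (ae_of_all _ fun q => ?_)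
    rw [Real.norm_of_nonneg (avgKer_nonneg c k x _)]
    exact avgKer_le c k x _
  rw [integral_integral_swap hinteg]
  refine integral_congr_ae (ae_of_all _ fun w => ?_)
  dsimp only
  have h1 : ∀ y, avgKer c k x y * (avgKer c l y w * K w) =
      (avgKer c l w y * avgKer c k x y) * K w := by
    intro y; rw [avgKer_comm c l y w]; ring
  simp only [h1]
  rw [integral_mul_const, integral_avgKer_mul,
    avg_of_dconst c l ((dconst_avgKer c k x).mono hc hlk)]

theorem avg_avg_of_ge (hc : Nested c) {l k : ℤ} (hlk : l ≤ k) (K : (Fin N → ℝ) → ℝ) :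
    avg c l (avg c k K) = avg c k K :=
  avg_of_dconst c l ((dconst_avg c k K).mono hc hlk)

theorem avg_sub (l : ℤ) {K L : (Fin N → ℝ) → ℝ} (hK : Integrable K) (hL : Integrable L)
    (y : Fin N → ℝ) : avg c l (fun w => K w - L w) y = avg c l K y - avg c l L y := by
  unfold avg
  rw [integral_sub hK.integrableOn hL.integrableOn, sub_div]

theorem mdiff_mdiff (hc : Nested c) (k : ℤ) {K : (Fin N → ℝ) → ℝ}
    (hK : Measurable K) (hi : Integrable K) : mdiff c k (mdiff c k K) = mdiff c k K := by
  have h1 := integrable_avg c (k - 1) hK hi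
  have h2 := integrable_avg c k hK hi
  have e : mdiff c k K = fun w => avg c (k - 1) K w - avg c k K w := rfl
  funext x
  rw [e]
  unfold mdiff
  rw [avg_sub _ h1 h2, avg_sub _ h1 h2, avg_avg_of_le hc le_rfl hK hi,
    avg_avg_of_ge hc (by lia : k - 1 ≤ k), avg_avg_of_le hc (by lia : k - 1 ≤ k) hK hi,
    avg_avg_of_le hc le_rfl hK hi]
  ring

variable (c)

theorem sum_mdiff (K : (Fin N → ℝ) → ℝ) (w : Fin N → ℝ) (M : ℕ) :
    ∑ k ∈ Finset.Ioc (-(M : ℤ)) M, mdiff c k K w = avg c (-(M : ℤ)) K w - avg c M K w := by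
  induction M with
  | zero => simp
  | succ M ih =>
    have h1 : Finset.Ioc (-((M + 1 : ℕ) : ℤ)) ((M + 1 : ℕ) : ℤ) =
        insert (-(M : ℤ)) (insert ((M : ℤ) + 1) (Finset.Ioc (-(M : ℤ)) M)) := by
      ext k
      simp only [Finset.mem_Ioc, Finset.mem_insert]
      push_cast
      lia
    rw [h1, Finset.sum_insert (by simp; lia), Finset.sum_insert (by simp), ih]
    unfold mdiff
    push_cast
    rw [show -(M : ℤ) - 1 = -1 + -(M : ℤ) by ring]
    simp

theorem tendsto_avg_atTop (hN : 0 < N) {K : (Fin N → ℝ) → ℝ} (hi : Integrable K)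
    (w : Fin N → ℝ) :
    Tendsto (fun M : ℕ => avg c M K w) atTop (𝓝 0) := by
  have h1 : Tendsto (fun M : ℕ => (∫ x, |K x|) * ((2 : ℝ) ^ N)⁻¹ ^ M) atTop (𝓝 0) := by
    have := tendsto_pow_atTop_nhds_zero_of_lt_one (r := ((2 : ℝ) ^ N)⁻¹) (by positivity)
      (inv_lt_one_of_one_lt₀ (one_lt_pow₀ one_lt_two hN.ne'))
    simpa using this.const_mul (∫ x, |K x|)
  refine squeeze_zero_norm (fun M => ?_) h1
  unfold avg
  rw [Real.norm_eq_abs, abs_div, abs_of_pos (by positivity : (0 : ℝ) < ((2 : ℝ) ^ (M : ℤ)) ^ N),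
    div_eq_mul_inv]
  refine mul_le_mul ?_ (le_of_eq ?_) (by positivity) (by positivity)
  · exact (abs_integral_le_integral_abs).trans
      (setIntegral_le_integral hi.abs (ae_of_all _ fun x => abs_nonneg _))
  · rw [zpow_natCast, inv_pow, ← pow_mul, ← pow_mul, mul_comm]

theorem tendsto_avg_atBot {K : (Fin N → ℝ) → ℝ} (hi : Integrable K) {w : Fin N → ℝ}
    (hw : ContinuousAt K w) : Tendsto (fun M : ℕ => avg c (-(M : ℤ)) K w) atTop (𝓝 (K w)) := by
  rw [Metric.tendsto_atTop]
  intro ε hε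
  obtain ⟨δ, hδ, h⟩ := Metric.continuousAt_iff.1 hw (ε / 2) (half_pos hε)
  obtain ⟨M₀, hM₀⟩ := exists_pow_lt_of_lt_one hδ (by norm_num : (2⁻¹ : ℝ) < 1)
  refine ⟨M₀, fun M hM => ?_⟩
  rw [Real.dist_eq, ← avg_sub_const c _ hi]
  refine (abs_avg_le c _ fun v hv => ?_).trans_lt (half_lt_self hε)
  have h1 := norm_sub_le_of_mem_dcube hv
  have h2 : dist v w < δ := by
    rw [dist_eq_norm]
    refine h1.trans_lt (lt_of_le_of_lt ?_ hM₀)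
    rw [zpow_neg, zpow_natCast, ← inv_pow]
    exact pow_le_pow_of_le_one (by norm_num) (by norm_num) hM
  exact (h h2).le

theorem tendsto_sum_mdiff (hN : 0 < N) {K : (Fin N → ℝ) → ℝ} (hi : Integrable K) {w : Fin N → ℝ}
    (hw : ContinuousAt K w) :
    Tendsto (fun M : ℕ => ∑ k ∈ Finset.Ioc (-(M : ℤ)) M, mdiff c k K w) atTop (𝓝 (K w)) := by
  simp only [sum_mdiff]
  simpa using (tendsto_avg_atBot c hi hw).sub (tendsto_avg_atTop c hN hi w)

theorem abs_sum_mdiff_le {K : (Fin N → ℝ) → ℝ} {B : ℝ} (hB : ∀ w, |K w| ≤ B) (w : Fin N → ℝ)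
    (M : ℕ) : |∑ k ∈ Finset.Ioc (-(M : ℤ)) M, mdiff c k K w| ≤ B + B := by
  rw [sum_mdiff]
  exact (abs_sub _ _).trans (add_le_add (abs_avg_le c _ fun w _ => hB w)
    (abs_avg_le c _ fun w _ => hB w))

theorem continuous_pker {t : ℝ} (ht : 0 < t) (d : Fin (N + 1)) (z : Fin N → ℝ) :
    Continuous (pker N d z t) := by
  unfold pker
  refine continuous_const.mul (continuous_iff_continuousAt.2 fun w => ?_)
  exact ContinuousAt.comp (g := dpk N d) (f := fun w : Fin N → ℝ => (z - w, t))
    (contDiffAt_dpk d (mk_ne_zero ht (z - w)) 0).continuousAt (by fun_prop)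

end Averages

section LowerReproducing

variable {n : ℕ} {Nd : Fin n → ℕ}

theorem abs_mdiff_le {N : ℕ} (c : ℤ → Fin N → ℝ) (k : ℤ) {K : (Fin N → ℝ) → ℝ} {B : ℝ}
    (hB : ∀ w, |K w| ≤ B) (w : Fin N → ℝ) : |mdiff c k K w| ≤ B + B :=
  (abs_sub _ _).trans (add_le_add (abs_avg_le c _ fun w _ => hB w)
    (abs_avg_le c _ fun w _ => hB w))

theorem measurable_rmdiff (c : Π j : Fin n, ℤ → Fin (Nd j) → ℝ) (k : Fin n → ℤ)
    {f : X n Nd → ℝ} (hfm : Measurable f) (hf : Integrable f) :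
    Measurable (rmdiff n Nd c k f) := by
  have h1 : rmdiff n Nd c k f = fun y => ∫ w, f w * ∏ j, haar (c j) (k j) (y j) (w j) :=
    funext fun y => rmdiff_eq_integral c k hf y
  have h2 : Measurable fun q : X n Nd × X n Nd =>
      f q.2 * ∏ j, haar (c j) (k j) (q.1 j) (q.2 j) := by
    refine (hfm.comp measurable_snd).mul (Finset.measurable_fun_prod _ fun j _ => ?_)
    exact (measurable_haar_uncurry (c j) (k j)).comp
      (f := fun q : X n Nd × X n Nd => (q.1 j, q.2 j)) (by fun_prop)
  rw [h1]
  exact h2.stronglyMeasurable.integral_prod_right.measurable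

theorem integral_mul_prod_mdiff {f : X n Nd → ℝ} (hfm : Measurable f) (hf : Integrable f)
    {c : Π j : Fin n, ℤ → Fin (Nd j) → ℝ} (hc : ∀ j, Nested (c j)) (k : Fin n → ℤ)
    {K : Π j, (Fin (Nd j) → ℝ) → ℝ} (hm : ∀ j, Measurable (K j)) (hi : ∀ j, Integrable (K j)) :
    ∫ w, f w * ∏ j, mdiff (c j) (k j) (K j) (w j) =
      ∫ y, rmdiff n Nd c k f y * ∏ j, mdiff (c j) (k j) (K j) (y j) := by
  have h1 : ∀ w : X n Nd, f w * ∏ j, mdiff (c j) (k j) (K j) (w j) =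
      ∫ y : X n Nd, f w * ∏ j, (haar (c j) (k j) (y j) (w j) *
        mdiff (c j) (k j) (K j) (y j)) := by
    intro w
    rw [integral_const_mul, integral_fintype_prod_volume_eq_prod fun j y =>
      haar (c j) (k j) y (w j) * mdiff (c j) (k j) (K j) y]
    congr 1
    refine Finset.prod_congr rfl fun j _ => ?_
    simp only [haar_comm (c j) (k j) _ (w j)]
    rw [integral_haar_mul _ _ (integrable_mdiff (c j) (k j) (hm j) (hi j)),
      mdiff_mdiff (hc j) _ (hm j) (hi j)]
  have hmeas : Measurable fun q : X n Nd × X n Nd =>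
      f q.1 * ∏ j, (haar (c j) (k j) (q.2 j) (q.1 j) * mdiff (c j) (k j) (K j) (q.2 j)) := by
    refine (hfm.comp measurable_fst).mul (Finset.measurable_fun_prod _ fun j _ => ?_)
    refine ((measurable_haar_uncurry (c j) (k j)).comp
      (f := fun q : X n Nd × X n Nd => (q.2 j, q.1 j)) (by fun_prop)).mul ?_
    exact (measurable_mdiff (c j) (k j) (hm j)).comp
      ((measurable_pi_apply j).comp measurable_snd)
  have hinteg : Integrable (Function.uncurry fun (w y : X n Nd) =>
      f w * ∏ j, (haar (c j) (k j) (y j) (w j) * mdiff (c j) (k j) (K j) (y j)))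
      (volume.prod volume) := by
    have hD : Integrable fun y : X n Nd => ∏ j,
        ((((2 : ℝ) ^ (k j - 1)) ^ Nd j)⁻¹ + (((2 : ℝ) ^ k j) ^ Nd j)⁻¹) *
          |mdiff (c j) (k j) (K j) (y j)| :=
      Integrable.fintype_prod_dep (f := fun j y => ((((2 : ℝ) ^ (k j - 1)) ^ Nd j)⁻¹ +
        (((2 : ℝ) ^ k j) ^ Nd j)⁻¹) * |mdiff (c j) (k j) (K j) y|)
        fun j => (integrable_mdiff (c j) (k j) (hm j) (hi j)).abs.const_mul _
    refine (hf.abs.mul_prod hD).mono' hmeas.aestronglyMeasurable (ae_of_all _ fun q => ?_)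
    simp only [Function.uncurry]
    rw [Real.norm_eq_abs, abs_mul, Finset.abs_prod]
    refine mul_le_mul_of_nonneg_left (Finset.prod_le_prod (fun _ _ => abs_nonneg _)
      fun j _ => ?_) (abs_nonneg _)
    rw [abs_mul]
    exact mul_le_mul_of_nonneg_right (abs_haar_le _ _ _ _) (abs_nonneg _)
  simp only [h1]
  rw [integral_integral_swap hinteg]
  refine integral_congr_ae (ae_of_all _ fun y => ?_)
  dsimp only
  rw [rmdiff_eq_integral c k hf, ← integral_mul_const]
  refine integral_congr_ae (ae_of_all _ fun w => ?_)
  dsimp only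
  rw [Finset.prod_mul_distrib, mul_assoc]

/-- The mixed derivatives of the Poisson extension of `f` are controlled by the martingale
differences of `f`. -/
theorem ofReal_abs_mixedF_le (hNd : ∀ j, 0 < Nd j) {f : X n Nd → ℝ} (hfm : Measurable f)
    (hf : Integrable f) {c : Π j : Fin n, ℤ → Fin (Nd j) → ℝ} (hc : ∀ j, Nested (c j))
    (d : Π j, Fin (Nd j + 1)) {p : W n Nd} (hp : ∀ j, 0 < (p j).2) :
    ENNReal.ofReal |mixedF f d p| ≤ ∑' k : Fin n → ℤ, ∫⁻ y,
      (∏ j, ENNReal.ofReal |mdiff (c j) (k j) (pker (Nd j) (d j) (p j).1 (p j).2) (y j)|) *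
        ENNReal.ofReal |rmdiff n Nd c k f y| := by
  choose C hC0 hC using fun j => exists_abs_pker_le_pow (Nd j)
  set K : Π j, (Fin (Nd j) → ℝ) → ℝ := fun j => pker (Nd j) (d j) (p j).1 (p j).2 with hK
  have hm : ∀ j, Measurable (K j) := fun j => measurable_pker _ _ _
  have hi : ∀ j, Integrable (K j) := fun j => integrable_pker (hp j) _ _
  set B : Fin n → ℝ := fun j => C j * ((p j).2 ^ Nd j)⁻¹
  have hB : ∀ j w, |K j w| ≤ B j := fun j w => hC j (d j) _ w _ (hp j)
  have hlim : Tendsto (fun M : ℕ => ∫ w, f w * ∏ j,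
      ∑ k ∈ Finset.Ioc (-(M : ℤ)) M, mdiff (c j) k (K j) (w j)) atTop (𝓝 (mixedF f d p)) := by
    refine tendsto_integral_of_dominated_convergence (fun w => |f w| * ∏ j, (B j + B j))
      (fun M => ?_) (hf.abs.mul_const _) (fun M => ae_of_all _ fun w => ?_)
      (ae_of_all _ fun w => ?_)
    · exact (integrable_mul_prod_of_bdd hf
        (g := fun j w => ∑ k ∈ Finset.Ioc (-(M : ℤ)) M, mdiff (c j) k (K j) w)
        (fun j => Finset.measurable_fun_sum _ fun k _ => measurable_mdiff (c j) k (hm j))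
        fun j w => abs_sum_mdiff_le (c j) (hB j) w M).aestronglyMeasurable
    · rw [Real.norm_eq_abs, abs_mul, Finset.abs_prod]
      exact mul_le_mul_of_nonneg_left (Finset.prod_le_prod (fun _ _ => abs_nonneg _)
        fun j _ => abs_sum_mdiff_le (c j) (hB j) (w j) M) (abs_nonneg _)
    · exact (tendsto_finsetProd (Finset.univ : Finset (Fin n)) fun j _ =>
        tendsto_sum_mdiff (c j) (hNd j) (hi j)
          (continuous_pker (hp j) _ _).continuousAt).const_mul (f w)
  refine le_of_tendsto ((ENNReal.continuous_ofReal.tendsto _).comp hlim.abs)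
    (Eventually.of_forall fun M => ?_)
  have hinteg : ∀ k : Fin n → ℤ, Integrable fun w : X n Nd =>
      f w * ∏ j, mdiff (c j) (k j) (K j) (w j) := fun k =>
    integrable_mul_prod_of_bdd hf (fun j => measurable_mdiff (c j) (k j) (hm j))
      fun j w => abs_mdiff_le (c j) (k j) (hB j) w
  rw [Function.comp_apply]
  simp only [Finset.prod_univ_sum, Finset.mul_sum]
  rw [integral_finsetSum _ fun k _ => hinteg k, ← Real.enorm_eq_ofReal_abs]
  refine (enorm_sum_le _ _).trans ?_
  refine le_trans (Finset.sum_le_sum fun k _ => ?_)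
    (ENNReal.sum_le_tsum (Fintype.piFinset fun _ => Finset.Ioc (-(M : ℤ)) M))
  rw [integral_mul_prod_mdiff hfm hf hc k hm hi]
  refine (enorm_integral_le_lintegral_enorm _).trans (lintegral_mono fun y => ?_)
  rw [enorm_mul, Real.enorm_eq_ofReal_abs, mul_comm, Real.enorm_eq_ofReal_abs, Finset.abs_prod,
    ENNReal.ofReal_prod_of_nonneg fun _ _ => abs_nonneg _]

end LowerReproducing

section Slabs

variable {n : ℕ} {Nd : Fin n → ℕ}

theorem tsum_pi_prod_ennreal {ι : Type*} : ∀ {n : ℕ} (a : Fin n → ι → ℝ≥0∞),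
    ∑' m : Fin n → ι, ∏ j, a j (m j) = ∏ j, ∑' i, a j i := by
  intro n
  induction n with
  | zero => intro a; simp
  | succ n ih =>
    intro a
    rw [← (Fin.consEquiv fun _ => ι).tsum_eq, ENNReal.tsum_prod', Fin.prod_univ_succ, ← ih,
      ← ENNReal.tsum_mul_right]
    refine tsum_congr fun i => ?_
    rw [← ENNReal.tsum_mul_left]
    refine tsum_congr fun m => ?_
    simp [Fin.prod_univ_succ, Fin.consEquiv]

theorem tsum_two_rpow_neg_abs_ne_top {b : ℝ} (hb : 0 < b) :
    ∑' m : ℤ, (2 : ℝ≥0∞) ^ (-(|m| : ℝ) * b) ≠ ⊤ := by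
  have h1 : Summable fun m : ℕ => ((2 : ℝ) ^ (-b)) ^ m :=
    summable_geometric_of_lt_one (by positivity)
      (Real.rpow_lt_one_of_one_lt_of_neg (by norm_num) (by linarith))
  have h2 : Summable fun m : ℤ => (2 : ℝ) ^ (-(|m| : ℝ) * b) := by
    refine Summable.of_nat_of_neg ?_ ?_
    all_goals
      refine h1.congr fun m => ?_
      rw [← Real.rpow_natCast, ← Real.rpow_mul (by norm_num)]
      congr 1
      push_cast
      simp
      ring
  have h3 : ∀ m : ℤ, (2 : ℝ≥0∞) ^ (-(|m| : ℝ) * b) =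
      ENNReal.ofReal ((2 : ℝ) ^ (-(|m| : ℝ) * b)) := by
    intro m
    rw [← ENNReal.ofReal_rpow_of_pos (by norm_num)]
    simp
  simp_rw [h3]
  exact h2.tsum_ofReal_ne_top

theorem tsum_pi_two_rpow_ne_top (n : ℕ) {b : ℝ} (hb : 0 < b) :
    ∑' m : Fin n → ℤ, ∏ j, (2 : ℝ≥0∞) ^ (-(|m j| : ℝ) * b) ≠ ⊤ := by
  rw [tsum_pi_prod_ennreal fun _ (i : ℤ) => (2 : ℝ≥0∞) ^ (-(|i| : ℝ) * b)]
  exact ENNReal.prod_ne_top fun j _ => tsum_two_rpow_neg_abs_ne_top hb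

/-- The region of the product of upper half-spaces in which `t_j` is comparable to `2^(i_j)`. -/
def slab (i : Fin n → ℤ) : Set (W n Nd) :=
  {p | ∀ j, 2 ^ i j ≤ (p j).2 ∧ (p j).2 < 2 * 2 ^ i j}

theorem measurableSet_slab (i : Fin n → ℤ) : MeasurableSet (slab i : Set (W n Nd)) := by
  unfold slab
  simp only [Set.ofPred_forall]
  refine MeasurableSet.iInter fun j => ?_
  have h1 : MeasurableSet {p : W n Nd | 2 ^ i j ≤ (p j).2} :=
    measurableSet_le (by fun_prop) (by fun_prop)
  have h2 : MeasurableSet {p : W n Nd | (p j).2 < 2 * 2 ^ i j} :=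
    measurableSet_lt (by fun_prop) (by fun_prop)
  exact h1.inter h2

theorem pos_of_mem_slab {i : Fin n → ℤ} {p : W n Nd} (hp : p ∈ (slab i : Set (W n Nd)))
    (j : Fin n) : 0 < (p j).2 :=
  lt_of_lt_of_le (by positivity) (hp j).1

theorem lintegral_eq_tsum_slab {S : Set (W n Nd)} (hS : MeasurableSet S)
    (hpos : ∀ p ∈ S, ∀ j, 0 < (p j).2) (g : W n Nd → ℝ≥0∞) :
    ∫⁻ p in S, g p = ∑' i : Fin n → ℤ, ∫⁻ p in S ∩ slab i, g p := by
  rw [← lintegral_iUnion (fun i => hS.inter (measurableSet_slab i))]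
  · congr 2
    rw [← Set.inter_iUnion, eq_comm, Set.inter_eq_left]
    intro p hp
    choose i hi using fun j => exists_mem_Ico_zpow (hpos p hp j) (one_lt_two)
    refine Set.mem_iUnion.2 ⟨i, fun j => ⟨(hi j).1, (hi j).2.trans_eq ?_⟩⟩
    rw [zpow_add_one₀ two_ne_zero, mul_comm]
  · intro i i' hii
    refine Set.disjoint_left.2 fun p hp hp' => hii (funext fun j => ?_)
    have h1 := (hp.2 j)
    have h2 := (hp'.2 j)
    have h3 : (2 : ℝ) ^ i j < 2 ^ (i' j + 1) := by
      rw [zpow_add_one₀ two_ne_zero, mul_comm]; exact h1.1.trans_lt h2.2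
    have h4 : (2 : ℝ) ^ i' j < 2 ^ (i j + 1) := by
      rw [zpow_add_one₀ two_ne_zero, mul_comm]; exact h2.1.trans_lt h1.2
    have h5 := (zpow_lt_zpow_iff_right₀ (one_lt_two (α := ℝ))).1 h3
    have h6 := (zpow_lt_zpow_iff_right₀ (one_lt_two (α := ℝ))).1 h4
    omega

theorem measurableSet_prodCone (x : X n Nd) : MeasurableSet (prodCone n Nd x) := by
  unfold prodCone
  simp only [Set.ofPred_forall]
  exact MeasurableSet.iInter fun j => measurableSet_lt (by fun_prop) (by fun_prop)

theorem norm_sub_le_of_mem_prodCone {x : X n Nd} {p : W n Nd} (hp : p ∈ prodCone n Nd x)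
    (j : Fin n) : ‖x j - (p j).1‖ ≤ (p j).2 := by
  have h := hp j
  have ht : 0 ≤ (p j).2 := (Real.sqrt_nonneg _).trans h.le
  refine (pi_norm_le_iff_of_nonneg ht).2 fun i => ?_
  refine le_trans ?_ h.le
  rw [Real.norm_eq_abs, ← Real.sqrt_sq_eq_abs]
  refine Real.sqrt_le_sqrt ?_
  rw [Pi.sub_apply, ← neg_sub, neg_sq]
  exact Finset.single_le_sum (f := fun i => ((p j).1 i - x j i) ^ 2)
    (fun _ _ => sq_nonneg _) (Finset.mem_univ i)

theorem pos_of_mem_prodCone {x : X n Nd} {p : W n Nd} (hp : p ∈ prodCone n Nd x)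
    (j : Fin n) : 0 < (p j).2 := (Real.sqrt_nonneg _).trans_lt (hp j)

theorem volume_prodCone_inter_slab_le (x : X n Nd) (i : Fin n → ℤ) :
    volume (prodCone n Nd x ∩ slab i) ≤
      ∏ j, ENNReal.ofReal ((4 * 2 ^ i j) ^ Nd j * 2 ^ i j) := by
  calc volume (prodCone n Nd x ∩ slab i)
      ≤ volume (Set.univ.pi fun j => Metric.closedBall (x j) (2 * 2 ^ i j) ×ˢ
          Set.Ico ((2 : ℝ) ^ i j) (2 * 2 ^ i j)) := by
        refine measure_mono fun p hp j _ => ⟨?_, (hp.2 j).1, (hp.2 j).2⟩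
        rw [Metric.mem_closedBall, dist_comm, dist_eq_norm]
        exact (norm_sub_le_of_mem_prodCone hp.1 j).trans (hp.2 j).2.le
    _ = ∏ j, ENNReal.ofReal ((4 * 2 ^ i j) ^ Nd j * 2 ^ i j) := by
        rw [volume_pi_pi]
        refine Finset.prod_congr rfl fun j _ => ?_
        rw [Measure.volume_eq_prod, Measure.prod_prod, Real.volume_pi_closedBall _ (by positivity),
          Real.volume_Ico, ← ENNReal.ofReal_mul (by positivity)]
        congr 1
        simp
        ring

end Slabs

section RectangleAverages

variable {n : ℕ} {Nd : Fin n → ℕ}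

/-- The rectangle of sidelengths `2^(k_j)` which contains `x`. -/
def rect (c : Π j : Fin n, ℤ → Fin (Nd j) → ℝ) (k : Fin n → ℤ) (x : X n Nd) : Set (X n Nd) :=
  Set.univ.pi fun j => dcube (c j (k j)) (k j) (x j)

theorem measurableSet_rect (c : Π j : Fin n, ℤ → Fin (Nd j) → ℝ) (k : Fin n → ℤ) (x : X n Nd) :
    MeasurableSet (rect c k x) :=
  MeasurableSet.univ_pi fun _ => measurableSet_dcube _ _ _

theorem volume_rect_ne_top (c : Π j : Fin n, ℤ → Fin (Nd j) → ℝ) (k : Fin n → ℤ) (x : X n Nd) :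
    volume (rect c k x) ≠ ⊤ := by
  unfold rect
  rw [volume_pi_pi]
  exact ENNReal.prod_ne_top fun j _ => (volume_dcube_lt_top _ _ _).ne

theorem measureReal_rect (c : Π j : Fin n, ℤ → Fin (Nd j) → ℝ) (k : Fin n → ℤ) (x : X n Nd) :
    volume.real (rect c k x) = ∏ j, ((2 : ℝ) ^ k j) ^ Nd j := by
  unfold rect
  rw [measureReal_def, volume_pi_pi, ENNReal.toReal_prod]
  exact Finset.prod_congr rfl fun j _ => measureReal_dcube _ _ _

theorem rect_eq_of_mem {c : Π j : Fin n, ℤ → Fin (Nd j) → ℝ} (hc : ∀ j, Nested (c j))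
    {k l : Fin n → ℤ} (hkl : ∀ j, k j ≤ l j) {x y : X n Nd} (h : y ∈ rect c k x) :
    rect c l y = rect c l x := by
  unfold rect
  congr 1
  funext j
  exact dcube_eq_of_mem (hc j _ _ (hkl j) _ (h j trivial))

theorem ravg_eq_of_mem {c : Π j : Fin n, ℤ → Fin (Nd j) → ℝ} (hc : ∀ j, Nested (c j))
    {k l : Fin n → ℤ} (hkl : ∀ j, k j ≤ l j) {x y : X n Nd} (h : y ∈ rect c k x)
    (f : X n Nd → ℝ) : ravg n Nd c l f y = ravg n Nd c l f x := by
  unfold ravg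
  have := rect_eq_of_mem hc hkl h
  unfold rect at this
  rw [this]

theorem rmdiff_eq_of_mem {c : Π j : Fin n, ℤ → Fin (Nd j) → ℝ} (hc : ∀ j, Nested (c j))
    (k : Fin n → ℤ) {x y : X n Nd} (h : y ∈ rect c (fun j => k j - 1) x)
    (f : X n Nd → ℝ) : rmdiff n Nd c k f y = rmdiff n Nd c k f x := by
  unfold rmdiff
  refine Finset.sum_congr rfl fun ε _ => ?_
  rw [ravg_eq_of_mem hc (fun j => ?_) h]
  split_ifs <;> omega

theorem exists_abs_rmdiff_le (c : Π j : Fin n, ℤ → Fin (Nd j) → ℝ) (k : Fin n → ℤ)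
    {f : X n Nd → ℝ} (hf : Integrable f) : ∃ B, ∀ y, |rmdiff n Nd c k f y| ≤ B := by
  refine ⟨∫ w, |f w| * ∏ j, ((((2 : ℝ) ^ (k j - 1)) ^ Nd j)⁻¹ + (((2 : ℝ) ^ k j) ^ Nd j)⁻¹),
    fun y => ?_⟩
  rw [rmdiff_eq_integral c k hf, ← Real.norm_eq_abs]
  refine norm_integral_le_of_norm_le (G := ℝ) (hf.abs.mul_const _) (ae_of_all _ fun w => ?_)
  rw [norm_mul, norm_prod, Real.norm_eq_abs]
  exact mul_le_mul_of_nonneg_left (Finset.prod_le_prod (fun _ _ => norm_nonneg _)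
    fun j _ => abs_haar_le (c j) (k j) (y j) (w j)) (abs_nonneg _)

theorem integrableOn_rmdiff_sq (c : Π j : Fin n, ℤ → Fin (Nd j) → ℝ) (k : Fin n → ℤ)
    {f : X n Nd → ℝ} (hfm : Measurable f) (hf : Integrable f) (x : X n Nd) :
    IntegrableOn (fun y => rmdiff n Nd c k f y ^ 2) (rect c k x) := by
  obtain ⟨B, hB⟩ := exists_abs_rmdiff_le c k hf
  refine IntegrableOn.of_bound (volume_rect_ne_top c k x).lt_top
    ((measurable_rmdiff c k hfm hf).pow_const 2).aestronglyMeasurable (B ^ 2)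
    (ae_of_all _ fun y => ?_)
  rw [norm_pow, Real.norm_eq_abs]
  exact pow_le_pow_left₀ (abs_nonneg _) (hB y) 2

theorem rmdiff_sq_le {c : Π j : Fin n, ℤ → Fin (Nd j) → ℝ} (hc : ∀ j, Nested (c j))
    (k : Fin n → ℤ) {f : X n Nd → ℝ} (hfm : Measurable f) (hf : Integrable f) (x : X n Nd) :
    rmdiff n Nd c k f x ^ 2 ≤
      (∏ j, (2 : ℝ) ^ Nd j) * ravg n Nd c k (fun y => rmdiff n Nd c k f y ^ 2) x := by
  have hsub : rect c (fun j => k j - 1) x ⊆ rect c k x :=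
    Set.pi_mono fun j _ => hc j _ _ (sub_le_self _ zero_le_one) _
  have h1 : ∫ y in rect c (fun j => k j - 1) x, rmdiff n Nd c k f y ^ 2 =
      (∏ j, ((2 : ℝ) ^ (k j - 1)) ^ Nd j) * rmdiff n Nd c k f x ^ 2 := by
    rw [setIntegral_congr_fun (measurableSet_rect _ _ _) (g := fun _ => rmdiff n Nd c k f x ^ 2)
      fun y hy => by simp only [rmdiff_eq_of_mem hc k hy f]]
    rw [setIntegral_const, measureReal_rect, smul_eq_mul]
  have h2 : ∫ y in rect c (fun j => k j - 1) x, rmdiff n Nd c k f y ^ 2 ≤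
      ∫ y in rect c k x, rmdiff n Nd c k f y ^ 2 :=
    setIntegral_mono_set (integrableOn_rmdiff_sq c k hfm hf x)
      (ae_of_all _ fun _ => sq_nonneg _) (LE.le.eventuallyLE hsub)
  have h3 : (∏ j, ((2 : ℝ) ^ k j) ^ Nd j) =
      (∏ j, (2 : ℝ) ^ Nd j) * ∏ j, ((2 : ℝ) ^ (k j - 1)) ^ Nd j := by
    rw [← Finset.prod_mul_distrib]
    refine Finset.prod_congr rfl fun j _ => ?_
    rw [← mul_pow, zpow_sub_one₀ two_ne_zero]
    congr 1
    ring
  have h4 : 0 < ∏ j, ((2 : ℝ) ^ k j) ^ Nd j := Finset.prod_pos fun j _ => by positivity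
  unfold ravg
  rw [← mul_div_assoc, le_div_iff₀ h4, h3]
  rw [h1] at h2
  have h5 : 0 ≤ ∏ j, (2 : ℝ) ^ Nd j := Finset.prod_nonneg fun j _ => by positivity
  unfold rect at h2
  nlinarith [mul_le_mul_of_nonneg_left h2 h5]

/-- The `ℓ²` component of the square function `S̃`. -/
def stildeTerm (c : Π j : Fin n, ℤ → Fin (Nd j) → ℝ) (k : Fin n → ℤ) (f : X n Nd → ℝ)
    (x : X n Nd) : ℝ≥0∞ :=
  ENNReal.ofReal (ravg n Nd c k (fun y => rmdiff n Nd c k f y ^ 2) x) ^ (1 / 2 : ℝ)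

theorem tsum_stildeTerm_sq (c : Π j : Fin n, ℤ → Fin (Nd j) → ℝ) (f : X n Nd → ℝ) (x : X n Nd) :
    ∑' k, stildeTerm c k f x ^ 2 = rStildeSq n Nd c f x :=
  tsum_congr fun _ => sq_sqrt_ennreal _

theorem ofReal_abs_rmdiff_le_stildeTerm {c : Π j : Fin n, ℤ → Fin (Nd j) → ℝ}
    (hc : ∀ j, Nested (c j)) (k : Fin n → ℤ) {f : X n Nd → ℝ} (hfm : Measurable f)
    (hf : Integrable f) (x : X n Nd) :
    ENNReal.ofReal |rmdiff n Nd c k f x| ≤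
      ENNReal.ofReal (∏ j, (2 : ℝ) ^ Nd j) ^ (1 / 2 : ℝ) * stildeTerm c k f x := by
  unfold stildeTerm
  rw [← ENNReal.mul_rpow_of_nonneg _ _ (by norm_num), ← sqrt_sq_ennreal (ENNReal.ofReal _),
    ← ENNReal.ofReal_pow (abs_nonneg _), sq_abs,
    ← ENNReal.ofReal_mul (Finset.prod_nonneg fun j _ => by positivity)]
  exact ENNReal.rpow_le_rpow (ENNReal.ofReal_le_ofReal (rmdiff_sq_le hc k hfm hf x)) (by norm_num)

theorem measurable_ravg (c : Π j : Fin n, ℤ → Fin (Nd j) → ℝ) (k : Fin n → ℤ)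
    {g : X n Nd → ℝ} (hg : Measurable g) : Measurable (ravg n Nd c k g) := by
  have h1 : ravg n Nd c k g = fun y => ∫ w, g w * ∏ j, avgKer (c j) (k j) (y j) (w j) :=
    funext fun y => ravg_eq_integral c k g y
  have h2 : Measurable fun q : X n Nd × X n Nd =>
      g q.2 * ∏ j, avgKer (c j) (k j) (q.1 j) (q.2 j) := by
    refine (hg.comp measurable_snd).mul (Finset.measurable_fun_prod _ fun j _ => ?_)
    exact (measurable_avgKer_uncurry (c j) (k j)).comp
      (f := fun q : X n Nd × X n Nd => (q.1 j, q.2 j)) (by fun_prop)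
  rw [h1]
  exact h2.stronglyMeasurable.integral_prod_right.measurable

theorem measurable_stildeTerm (c : Π j : Fin n, ℤ → Fin (Nd j) → ℝ) (k : Fin n → ℤ)
    {f : X n Nd → ℝ} (hfm : Measurable f) (hf : Integrable f) :
    Measurable (stildeTerm c k f) :=
  (measurable_ravg c k ((measurable_rmdiff c k hfm hf).pow_const 2)).ennreal_ofReal.pow_const _

theorem dconst_stildeTerm (c : Π j : Fin n, ℤ → Fin (Nd j) → ℝ) (k : Fin n → ℤ)
    (f : X n Nd → ℝ) (j : Fin n) (x : X n Nd) :
    DConst (c j (k j)) (k j) fun y => stildeTerm c k f (Function.update x j y) := by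
  intro y y' hy
  unfold stildeTerm ravg
  have : (Set.univ.pi fun i => dcube (c i (k i)) (k i) (Function.update x j y' i)) =
      Set.univ.pi fun i => dcube (c i (k i)) (k i) (Function.update x j y i) := by
    congr 1
    funext i
    rcases eq_or_ne i j with rfl | h
    · simpa using dcube_eq_of_mem hy
    · simp [h]
  simp only [this]

end RectangleAverages

section LowerFixedLattice

variable {n : ℕ} {Nd : Fin n → ℕ}

/-- The kernel which dominates the contribution of `Δ_k` at scale `2^i`. -/
def lowerKer {N : ℕ} (c : ℤ → Fin N → ℝ) (k i : ℤ) (x y : Fin N → ℝ) : ℝ≥0∞ :=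
  kr N (N + 1) (max k i) (x - y) * wt c k i x

/-- The contribution of `Δ_k f` to the scales `2^i` of the Lusin function. -/
def lowerPiece (c : Π j : Fin n, ℤ → Fin (Nd j) → ℝ) (f : X n Nd → ℝ) (k i : Fin n → ℤ)
    (x : X n Nd) : ℝ≥0∞ :=
  ∫⁻ y : X n Nd, (∏ j, lowerKer (c j) (k j) (i j) (x j) (y j)) *
    ENNReal.ofReal |rmdiff n Nd c k f y|

theorem ofReal_mixedF_sq_mul (f : X n Nd → ℝ) {p : W n Nd} (hp : ∀ j, 0 < (p j).2) :
    ENNReal.ofReal ((∑ d, mixedF f d p ^ 2) * ∏ j, (p j).2 ^ (-1 - (Nd j : ℝ))) =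
      (∑ d, ENNReal.ofReal |mixedF f d p| ^ 2) *
        ∏ j, ENNReal.ofReal ((p j).2 ^ (-1 - (Nd j : ℝ))) := by
  rw [ENNReal.ofReal_mul (Finset.sum_nonneg fun _ _ => sq_nonneg _),
    ENNReal.ofReal_sum_of_nonneg fun _ _ => sq_nonneg _,
    ENNReal.ofReal_prod_of_nonneg fun j _ => Real.rpow_nonneg (hp j).le _]
  congr 1
  refine Finset.sum_congr rfl fun d _ => ?_
  rw [← ENNReal.ofReal_pow (abs_nonneg _), sq_abs]

theorem exists_lusinSq_le (hNd : ∀ j, 0 < Nd j) : ∃ C : ℝ≥0∞, C ≠ ⊤ ∧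
    ∀ (f : X n Nd → ℝ), Measurable f → Integrable f →
      ∀ c : Π j : Fin n, ℤ → Fin (Nd j) → ℝ, (∀ j, Nested (c j)) → ∀ x,
        lusinSq n Nd f x ≤ C * ∑' i : Fin n → ℤ, (∑' k : Fin n → ℤ, lowerPiece c f k i x) ^ 2 := by
  choose C hC h using fun j => exists_mdiff_pker_le (Nd j) (hNd j)
  refine ⟨Fintype.card (Π j, Fin (Nd j + 1)) * (∏ j, C j) ^ 2 * ∏ j, (4 : ℝ≥0∞) ^ Nd j,
    ENNReal.mul_ne_top (ENNReal.mul_ne_top (ENNReal.natCast_ne_top _)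
      (ENNReal.pow_ne_top (ENNReal.prod_ne_top fun j _ => hC j)))
      (ENNReal.prod_ne_top fun j _ => ENNReal.pow_ne_top (by simp)), fun f hfm hf c hc x => ?_⟩
  rw [lusinSq_eq hf, lintegral_eq_tsum_slab (measurableSet_prodCone x)
    (fun p hp => pos_of_mem_prodCone hp), ← ENNReal.tsum_mul_left]
  refine ENNReal.tsum_le_tsum fun i => ?_
  set G := ∑' k : Fin n → ℤ, lowerPiece c f k i x with hG
  have hF : ∀ d, ∀ p ∈ prodCone n Nd x ∩ slab i,
      ENNReal.ofReal |mixedF f d p| ≤ (∏ j, C j) * G := by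
    intro d p hp
    refine (ofReal_abs_mixedF_le hNd hfm hf hc d (pos_of_mem_prodCone hp.1)).trans ?_
    rw [hG, ← ENNReal.tsum_mul_left]
    refine ENNReal.tsum_le_tsum fun k => ?_
    unfold lowerPiece
    rw [← lintegral_const_mul' _ _ (ENNReal.prod_ne_top fun j _ => hC j)]
    refine lintegral_mono fun y => ?_
    rw [← mul_assoc, ← Finset.prod_mul_distrib]
    refine mul_le_mul_left (Finset.prod_le_prod' fun j _ => ?_) _
    exact h j (d j) (c j) (k j) (i j) (x j) (y j) (p j).1 (p j).2 (hp.2 j).1 (hp.2 j).2.le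
      (norm_sub_le_of_mem_prodCone hp.1 j)
  calc ∫⁻ p in prodCone n Nd x ∩ slab i,
        ENNReal.ofReal ((∑ d, mixedF f d p ^ 2) * ∏ j, (p j).2 ^ (-1 - (Nd j : ℝ)))
      ≤ ∫⁻ _ in prodCone n Nd x ∩ slab i,
          (Fintype.card (Π j, Fin (Nd j + 1)) * ((∏ j, C j) * G) ^ 2) *
            ∏ j, ENNReal.ofReal (((2 : ℝ) ^ i j) ^ (-1 - (Nd j : ℝ))) := by
        refine setLIntegral_mono' ((measurableSet_prodCone x).inter (measurableSet_slab i))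
          fun p hp => ?_
        rw [ofReal_mixedF_sq_mul f (pos_of_mem_prodCone hp.1)]
        refine mul_le_mul' ?_ (Finset.prod_le_prod' fun j _ => ENNReal.ofReal_le_ofReal
          (Real.rpow_le_rpow_of_nonpos (by positivity) (hp.2 j).1 ?_))
        · refine (Finset.sum_le_sum fun d _ => pow_le_pow_left' (hF d p hp) 2).trans_eq ?_
          simp
        · have : (0 : ℝ) ≤ Nd j := Nat.cast_nonneg _
          linarith
    _ ≤ _ := by
        rw [setLIntegral_const]
        refine (mul_le_mul_right (volume_prodCone_inter_slab_le x i) _).trans_eq ?_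
        rw [mul_assoc, ← Finset.prod_mul_distrib]
        have : ∀ j, ENNReal.ofReal (((2 : ℝ) ^ i j) ^ (-1 - (Nd j : ℝ))) *
            ENNReal.ofReal ((4 * 2 ^ i j) ^ Nd j * 2 ^ i j) = 4 ^ Nd j := by
          intro j
          have hpos : (0 : ℝ) < 2 ^ i j := by positivity
          rw [← ENNReal.ofReal_mul (by positivity), Real.rpow_sub hpos, Real.rpow_neg_one,
            Real.rpow_natCast]
          have : ((2 : ℝ) ^ i j)⁻¹ / (2 ^ i j) ^ Nd j * ((4 * 2 ^ i j) ^ Nd j * 2 ^ i j) =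
              4 ^ Nd j := by
            rw [mul_pow]
            field_simp
          rw [this, ENNReal.ofReal_pow (by norm_num)]
          simp
        simp_rw [this]
        ring

theorem exists_lintegral_lowerPiece_le (hNd : ∀ j, 0 < Nd j) : ∃ C : ℝ≥0∞, C ≠ ⊤ ∧
    ∀ (f : X n Nd → ℝ), Measurable f → Integrable f →
      ∀ c : Π j : Fin n, ℤ → Fin (Nd j) → ℝ, (∀ j, Nested (c j)) → ∀ m : Fin n → ℤ,
        ∫⁻ x, (∑' k : Fin n → ℤ, lowerPiece c f k (k - m) x ^ 2) ^ (1 / 2 : ℝ) ≤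
          C * (∏ j, (2 : ℝ≥0∞) ^ (-(|m j| : ℝ) / 4)) *
            ∫⁻ x, rStildeSq n Nd c f x ^ (1 / 2 : ℝ) := by
  choose C hC h using fun j => lintegral_wt_conv_le (hNd j)
  set K : ℝ≥0∞ := ENNReal.ofReal (∏ j, (2 : ℝ) ^ Nd j) ^ (1 / 2 : ℝ) with hK
  have hKt : K ≠ ⊤ := ENNReal.rpow_ne_top_of_nonneg (by norm_num) ENNReal.ofReal_ne_top
  refine ⟨(∏ j, C j) * K, ENNReal.mul_ne_top (ENNReal.prod_ne_top fun j _ => hC j) hKt,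
    fun f hfm hf c hc m => ?_⟩
  have h1 := lintegral_iterate_le (ι := Fin n → ℤ) (cc := fun j k => c j (k j))
    (ll := fun j k => k j)
    (τ := fun j k x y => lowerKer (c j) (k j) (k j - m j) x y) (fun j k => ?_)
    (fun j => C j * 2 ^ (-(|m j| : ℝ) / 4))
    (fun j β hβ hd => h j (c j) (hc j) (Fin n → ℤ) (fun k => k j) (m j) β hβ hd)
    (β := fun k y => K * stildeTerm c k f y)
    (fun k => (measurable_stildeTerm c k hfm hf).const_mul _)
    (fun j k x y y' hy => by
      have := dconst_stildeTerm c k f j x y y' hy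
      simp only at this ⊢
      rw [this])
  · refine (lintegral_mono fun x => ?_).trans (h1.trans_eq ?_)
    · refine ENNReal.rpow_le_rpow (ENNReal.tsum_le_tsum fun k => pow_le_pow_left' ?_ 2)
        (by norm_num)
      exact lintegral_mono fun y => mul_le_mul_right
        (ofReal_abs_rmdiff_le_stildeTerm hc k hfm hf y) _
    · rw [Finset.prod_mul_distrib, mul_right_comm (∏ j, C j) K, mul_assoc (_ * _) K]
      congr 1
      rw [← lintegral_const_mul' _ _ hKt]
      refine lintegral_congr fun x => ?_
      simp_rw [mul_pow]
      rw [ENNReal.tsum_mul_left, tsum_stildeTerm_sq, ENNReal.mul_rpow_of_nonneg _ _ (by norm_num),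
        sqrt_sq_ennreal]
  · unfold Function.uncurry lowerKer
    exact ((measurable_kr _ _ _).comp (measurable_fst.sub measurable_snd)).mul
      ((measurable_wt _ _ _).comp measurable_fst)

theorem tsum_sq_tsum_lowerPiece_le (c : Π j : Fin n, ℤ → Fin (Nd j) → ℝ) (f : X n Nd → ℝ)
    (x : X n Nd) :
    (∑' i : Fin n → ℤ, (∑' k : Fin n → ℤ, lowerPiece c f k i x) ^ 2) ^ (1 / 2 : ℝ) ≤
      ∑' m : Fin n → ℤ, (∑' k : Fin n → ℤ, lowerPiece c f k (k - m) x ^ 2) ^ (1 / 2 : ℝ) := by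
  have h1 : ∀ i : Fin n → ℤ, ∑' k : Fin n → ℤ, lowerPiece c f k i x =
      ∑' m : Fin n → ℤ, lowerPiece c f (i + m) i x := fun i =>
    ((Equiv.addLeft i).tsum_eq fun k => lowerPiece c f k i x).symm
  simp_rw [h1]
  refine (minkowski_sq_tsum _).trans_eq (tsum_congr fun m => ?_)
  congr 1
  rw [← (Equiv.subRight m).tsum_eq]
  simp

/-- The lower bound for a fixed nested lattice. -/
theorem exists_H1prodNorm_le_lintegral_rStildeSq (hNd : ∀ j, 0 < Nd j) : ∃ C : ℝ≥0∞, C ≠ ⊤ ∧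
    ∀ (f : X n Nd → ℝ), Measurable f → Integrable f →
      ∀ c : Π j : Fin n, ℤ → Fin (Nd j) → ℝ, (∀ j, Nested (c j)) →
        H1prodNorm n Nd f ≤ C * ∫⁻ x, rStildeSq n Nd c f x ^ (1 / 2 : ℝ) := by
  obtain ⟨C1, hC1, h1⟩ := exists_lusinSq_le hNd
  obtain ⟨C2, hC2, h2⟩ := exists_lintegral_lowerPiece_le hNd
  have hS : ∑' m : Fin n → ℤ, ∏ j, (2 : ℝ≥0∞) ^ (-(|m j| : ℝ) / 4) ≠ ⊤ := by
    simpa only [div_eq_mul_inv] using tsum_pi_two_rpow_ne_top n (b := 4⁻¹) (by norm_num)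
  have hC1' : C1 ^ (1 / 2 : ℝ) ≠ ⊤ := ENNReal.rpow_ne_top_of_nonneg (by norm_num) hC1
  refine ⟨C1 ^ (1 / 2 : ℝ) * (C2 * ∑' m : Fin n → ℤ, ∏ j, (2 : ℝ≥0∞) ^ (-(|m j| : ℝ) / 4)),
    ENNReal.mul_ne_top hC1' (ENNReal.mul_ne_top hC2 hS), fun f hfm hf c hc => ?_⟩
  have hmeas : ∀ k i : Fin n → ℤ, Measurable (lowerPiece c f k i) := by
    intro k i
    have h3 : Measurable fun q : X n Nd × X n Nd =>
        (∏ j, lowerKer (c j) (k j) (i j) (q.1 j) (q.2 j)) *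
          ENNReal.ofReal |rmdiff n Nd c k f q.2| := by
      refine (Finset.measurable_fun_prod _ fun j _ => ?_).mul
        (((measurable_rmdiff c k hfm hf).comp measurable_snd).abs.ennreal_ofReal)
      unfold lowerKer
      exact ((measurable_kr _ _ _).comp (by fun_prop)).mul ((measurable_wt _ _ _).comp
        (by fun_prop))
    exact h3.lintegral_prod_right'
  calc H1prodNorm n Nd f
      ≤ ∫⁻ x, C1 ^ (1 / 2 : ℝ) * ∑' m : Fin n → ℤ,
          (∑' k : Fin n → ℤ, lowerPiece c f k (k - m) x ^ 2) ^ (1 / 2 : ℝ) := by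
        refine lintegral_mono fun x => ?_
        refine (ENNReal.rpow_le_rpow (h1 f hfm hf c hc x) (by norm_num)).trans ?_
        rw [ENNReal.mul_rpow_of_nonneg _ _ (by norm_num)]
        exact mul_le_mul_right (tsum_sq_tsum_lowerPiece_le c f x) _
    _ = C1 ^ (1 / 2 : ℝ) * ∑' m : Fin n → ℤ, ∫⁻ x,
          (∑' k : Fin n → ℤ, lowerPiece c f k (k - m) x ^ 2) ^ (1 / 2 : ℝ) := by
        rw [lintegral_const_mul' _ _ hC1', lintegral_tsum fun m => ?_]
        exact ((Measurable.tsum fun k => (hmeas _ _).pow_const 2).pow_const _).aemeasurable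
    _ ≤ C1 ^ (1 / 2 : ℝ) * ∑' m : Fin n → ℤ, C2 * (∏ j, (2 : ℝ≥0∞) ^ (-(|m j| : ℝ) / 4)) *
            ∫⁻ x, rStildeSq n Nd c f x ^ (1 / 2 : ℝ) :=
        mul_le_mul_right (ENNReal.tsum_le_tsum fun m => h2 f hfm hf c hc m) _
    _ = _ := by
        rw [ENNReal.tsum_mul_right, ENNReal.tsum_mul_left]
        simp only [mul_assoc]

end LowerFixedLattice

section Randomization

variable {n : ℕ} {Nd : Fin n → ℕ}

instance : IsProbabilityMeasure (prodRandMeasure n Nd) := by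
  unfold prodRandMeasure
  infer_instance

theorem measurable_avgKer_randOffset {N : ℕ} (k : ℤ) :
    Measurable fun q : RSpace N × (Fin N → ℝ) × (Fin N → ℝ) =>
      avgKer (randOffset q.1) k q.2.1 q.2.2 := by
  have h1 : MeasurableSet {q : RSpace N × (Fin N → ℝ) × (Fin N → ℝ) |
      q.2.2 ∈ dcube (randOffset q.1 k) k q.2.1} := by
    have : {q : RSpace N × (Fin N → ℝ) × (Fin N → ℝ) |
        q.2.2 ∈ dcube (randOffset q.1 k) k q.2.1} =
        ⋂ i, {q | ⌊(q.2.2 i - randOffset q.1 k i) / (2 : ℝ) ^ k⌋ =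
          ⌊(q.2.1 i - randOffset q.1 k i) / (2 : ℝ) ^ k⌋} := by
      ext p
      simp [dcube]
    rw [this]
    refine MeasurableSet.iInter fun i => ?_
    have h2 : Measurable fun q : RSpace N × (Fin N → ℝ) × (Fin N → ℝ) => randOffset q.1 k i :=
      (measurable_pi_iff.1 (measurable_randOffset k) i).comp measurable_fst
    exact measurableSet_eq_fun
      ((Measurable.sub (by fun_prop) h2).div_const _).floor
      ((Measurable.sub (by fun_prop) h2).div_const _).floor
  exact measurable_const.indicator h1

theorem measurable_rmdiff_randOffset (k : Fin n → ℤ) {f : X n Nd → ℝ} (hfm : Measurable f)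
    (hf : Integrable f) :
    Measurable fun q : PSpace n Nd × X n Nd =>
      rmdiff n Nd (fun j => randOffset (q.1 j)) k f q.2 := by
  have h2 : Measurable fun q : (PSpace n Nd × X n Nd) × X n Nd =>
      f q.2 * ∏ j, haar (randOffset (q.1.1 j)) (k j) (q.1.2 j) (q.2 j) := by
    refine (hfm.comp measurable_snd).mul (Finset.measurable_fun_prod _ fun j _ => ?_)
    unfold haar
    exact ((measurable_avgKer_randOffset (k j - 1)).comp
      (f := fun q : (PSpace n Nd × X n Nd) × X n Nd => (q.1.1 j, q.1.2 j, q.2 j))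
        (by fun_prop)).sub ((measurable_avgKer_randOffset (k j)).comp
      (f := fun q : (PSpace n Nd × X n Nd) × X n Nd => (q.1.1 j, q.1.2 j, q.2 j)) (by fun_prop))
  simp_rw [rmdiff_eq_integral _ k hf]
  exact h2.stronglyMeasurable.integral_prod_right.measurable

theorem measurable_ravg_rmdiff_randOffset (k : Fin n → ℤ) {f : X n Nd → ℝ} (hfm : Measurable f)
    (hf : Integrable f) :
    Measurable fun q : PSpace n Nd × X n Nd => ravg n Nd (fun j => randOffset (q.1 j)) k
      (fun y => rmdiff n Nd (fun j => randOffset (q.1 j)) k f y ^ 2) q.2 := by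
  have h2 : Measurable fun q : (PSpace n Nd × X n Nd) × X n Nd =>
      rmdiff n Nd (fun j => randOffset (q.1.1 j)) k f q.2 ^ 2 *
        ∏ j, avgKer (randOffset (q.1.1 j)) (k j) (q.1.2 j) (q.2 j) := by
    refine (((measurable_rmdiff_randOffset k hfm hf).comp
      (f := fun q : (PSpace n Nd × X n Nd) × X n Nd => (q.1.1, q.2)) (by fun_prop)).pow_const
        2).mul (Finset.measurable_fun_prod _ fun j _ => ?_)
    exact (measurable_avgKer_randOffset (k j)).comp
      (f := fun q : (PSpace n Nd × X n Nd) × X n Nd => (q.1.1 j, q.1.2 j, q.2 j)) (by fun_prop)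
  simp_rw [ravg_eq_integral]
  exact h2.stronglyMeasurable.integral_prod_right.measurable

theorem measurable_rStildeSq_randOffset {f : X n Nd → ℝ} (hfm : Measurable f)
    (hf : Integrable f) :
    Measurable fun q : PSpace n Nd × X n Nd =>
      rStildeSq n Nd (fun j => randOffset (q.1 j)) f q.2 :=
  Measurable.tsum fun k => (measurable_ravg_rmdiff_randOffset k hfm hf).ennreal_ofReal

/-- The lower bound for measurable functions. -/
theorem exists_H1prodNorm_le (hNd : ∀ j, 0 < Nd j) : ∃ C : ℝ≥0∞, C ≠ ⊤ ∧
    ∀ (f : X n Nd → ℝ), Measurable f → Integrable f →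
      H1prodNorm n Nd f ≤ C * randProdStildeNorm n Nd f := by
  obtain ⟨C, hC, h⟩ := exists_H1prodNorm_le_lintegral_rStildeSq hNd
  refine ⟨C, hC, fun f hfm hf => ?_⟩
  have hm := measurable_rStildeSq_randOffset hfm hf
  have h1 : H1prodNorm n Nd f ≤ ∫⁻ ω, C * (∫⁻ x, rStildeSq n Nd (fun j => randOffset (ω j)) f x ^
      (1 / 2 : ℝ)) ∂prodRandMeasure n Nd := by
    refine le_trans (le_of_eq ?_) (lintegral_mono fun ω => h f hfm hf _ fun j =>
      nested_randOffset (ω j))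
    rw [lintegral_const, measure_univ, mul_one]
  rw [lintegral_const_mul' _ _ hC, lintegral_lintegral_swap
    (f := fun (ω : PSpace n Nd) x => rStildeSq n Nd (fun j => randOffset (ω j)) f x ^ (1 / 2 : ℝ))
    (hm.pow_const _).aemeasurable] at h1
  refine h1.trans (mul_le_mul_right (lintegral_mono fun x => ?_) _)
  have hx : Measurable fun ω : PSpace n Nd => rStildeSq n Nd (fun j => randOffset (ω j)) f x :=
    hm.comp (f := fun ω : PSpace n Nd => (ω, x)) (by fun_prop)
  have h2 := lintegral_mul_le_sqrt (prodRandMeasure n Nd) (hx.pow_const (1 / 2 : ℝ)).aemeasurable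
    (g := fun _ => 1) aemeasurable_const
  simpa only [sq_sqrt_ennreal, mul_one, one_pow, lintegral_const, measure_univ,
    ENNReal.one_rpow] using h2

end Randomization

section UpperDensity

variable {n : ℕ} {Nd : Fin n → ℕ}

/-- The part of the slab of height `2^i` over a dyadic rectangle containing `x`, small enough to
lie inside the product cone at `x`. -/
def coneCell (i : Fin n → ℤ) (x : X n Nd) : Set (W n Nd) :=
  {p | ∀ j, (p j).1 ∈ dcube 0 (i j - Nd j) (x j) ∧ (2 ^ i j ≤ (p j).2 ∧ (p j).2 < 2 * 2 ^ i j)}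

theorem measurableSet_mem_coneCell (i : Fin n → ℤ) :
    MeasurableSet {q : X n Nd × W n Nd | q.2 ∈ coneCell i q.1} := by
  have h1 : {q : X n Nd × W n Nd | q.2 ∈ coneCell i q.1} =
      (⋂ j, (fun q : X n Nd × W n Nd => (q.1 j, (q.2 j).1)) ⁻¹'
        {p | p.2 ∈ dcube 0 (i j - Nd j) p.1}) ∩ Prod.snd ⁻¹' slab i := by
    ext q
    simp only [coneCell, slab, Set.mem_ofPred_eq, Set.mem_inter_iff, Set.mem_iInter,
      Set.mem_preimage]
    exact ⟨fun h => ⟨fun j => (h j).1, fun j => (h j).2⟩, fun h j => ⟨h.1 j, h.2 j⟩⟩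
  rw [h1]
  refine (MeasurableSet.iInter fun j => ?_).inter (measurable_snd (measurableSet_slab i))
  exact (measurableSet_mem_dcube 0 (i j - Nd j)).preimage (by fun_prop)

theorem measurableSet_coneCell (i : Fin n → ℤ) (x : X n Nd) : MeasurableSet (coneCell i x) :=
  (measurableSet_mem_coneCell i).preimage measurable_prodMk_left

theorem coneCell_subset (i : Fin n → ℤ) (x : X n Nd) :
    coneCell i x ⊆ prodCone n Nd x ∩ slab i := by
  refine fun p hp => ⟨fun j => ?_, fun j => (hp j).2⟩
  refine lt_of_lt_of_le ?_ (hp j).2.1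
  rw [Real.sqrt_lt' (by positivity)]
  have h1 : ∀ a, ((p j).1 a - x j a) ^ 2 ≤ ((2 : ℝ) ^ (i j - Nd j : ℤ)) ^ 2 := fun a => by
    rw [← sq_abs]
    exact pow_le_pow_left₀ (abs_nonneg _)
      ((norm_le_pi_norm ((p j).1 - x j) a).trans (norm_sub_le_of_mem_dcube (hp j).1)) 2
  refine (Finset.sum_le_sum fun a _ => h1 a).trans_lt ?_
  rw [Finset.sum_const, Finset.card_univ, Fintype.card_fin, nsmul_eq_mul,
    zpow_sub₀ two_ne_zero, zpow_natCast, div_pow]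
  have h2 : (Nd j : ℝ) < (2 ^ Nd j) ^ 2 := by
    have : Nd j < 2 ^ Nd j := Nat.lt_two_pow_self
    have h3 : (Nd j : ℝ) < 2 ^ Nd j := by exact_mod_cast this
    have h4 : (1 : ℝ) ≤ 2 ^ Nd j := one_le_pow₀ (by norm_num)
    nlinarith
  rw [mul_div_assoc', div_lt_iff₀ (by positivity), mul_comm]
  exact mul_lt_mul_of_pos_left h2 (by positivity)

theorem volume_coneCell (i : Fin n → ℤ) (x : X n Nd) : volume (coneCell i x) =
    ∏ j, (2 : ℝ≥0∞) ^ ((i j - Nd j : ℝ) * Nd j + i j) := by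
  have h1 : coneCell i x = Set.univ.pi fun j => dcube 0 (i j - Nd j) (x j) ×ˢ
      Set.Ico ((2 : ℝ) ^ i j) (2 * 2 ^ i j) := by
    ext p
    simp [coneCell, Set.mem_pi]
  rw [h1, volume_pi_pi]
  refine Finset.prod_congr rfl fun j _ => ?_
  rw [Measure.volume_eq_prod, Measure.prod_prod, volume_dcube, Real.volume_Ico, two_rpow_add,
    two_mul, add_sub_cancel_right, ofReal_two_zpow]
  push_cast
  rfl

/-- The density of all the mixed derivatives of the Poisson extension. -/
def gradDensity (f : X n Nd → ℝ) (p : W n Nd) : ℝ≥0∞ :=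
  (∑ d : Π j, Fin (Nd j + 1), ENNReal.ofReal |mixedF f d p|) * ∏ j, ENNReal.ofReal (p j).2⁻¹

theorem measurable_gradDensity {f : X n Nd → ℝ} (hf : Measurable f) :
    Measurable (gradDensity f) := by
  unfold gradDensity
  refine (Finset.measurable_fun_sum _ fun d _ => (measurable_mixedF hf d).abs.ennreal_ofReal).mul
    (Finset.measurable_fun_prod _ fun j _ => ?_)
  exact Measurable.ennreal_ofReal (by fun_prop)

/-- The inverse of the volume of the base of `coneCell`. -/
def cellWeight (Nd : Fin n → ℕ) (i : Fin n → ℤ) : ℝ≥0∞ :=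
  ∏ j, (2 : ℝ≥0∞) ^ (-((i j - Nd j : ℝ) * Nd j))

theorem cellWeight_ne_top (i : Fin n → ℤ) : cellWeight Nd i ≠ ⊤ :=
  ENNReal.prod_ne_top fun _ _ => two_rpow_ne_top _

/-- The average of the mixed derivatives over `coneCell`. -/
def cellGrad (f : X n Nd → ℝ) (i : Fin n → ℤ) (x : X n Nd) : ℝ≥0∞ :=
  cellWeight Nd i * ∫⁻ p in coneCell i x, gradDensity f p

theorem measurable_cellGrad {f : X n Nd → ℝ} (hf : Measurable f) (i : Fin n → ℤ) :
    Measurable (cellGrad f i) := by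
  unfold cellGrad
  have h1 : Measurable fun q : X n Nd × W n Nd =>
      {q : X n Nd × W n Nd | q.2 ∈ coneCell i q.1}.indicator (fun q => gradDensity f q.2) q :=
    ((measurable_gradDensity hf).comp measurable_snd).indicator (measurableSet_mem_coneCell i)
  have h2 := h1.lintegral_prod_right' (ν := volume)
  have h3 : (fun x => ∫⁻ p in coneCell i x, gradDensity f p) = fun x => ∫⁻ p,
      {q : X n Nd × W n Nd | q.2 ∈ coneCell i q.1}.indicator (fun q => gradDensity f q.2) (x, p) :=
    funext fun x => (lintegral_indicator (measurableSet_coneCell i x) _).symm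
  exact Measurable.const_mul (h3 ▸ h2) _

theorem dconst_cellGrad (f : X n Nd → ℝ) (i : Fin n → ℤ) (j : Fin n) (x : X n Nd) :
    DConst 0 (i j - Nd j) fun y => cellGrad f i (Function.update x j y) := by
  intro y y' hy
  have : coneCell i (Function.update x j y') = coneCell i (Function.update x j y) := by
    unfold coneCell
    ext p
    refine forall_congr' fun a => ?_
    rcases eq_or_ne a j with rfl | h
    · simp only [Function.update_self, dcube_eq_of_mem hy]
    · simp only [Function.update_of_ne h]
  simp only [cellGrad, this]

theorem lintegral_cellWeight (i : Fin n → ℤ) {p : W n Nd} (hp : p ∈ (slab i : Set (W n Nd))) :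
    ∫⁻ x : X n Nd, {x | p ∈ coneCell i x}.indicator (fun _ => cellWeight Nd i) x = 1 := by
  have h1 : {x : X n Nd | p ∈ coneCell i x} =
      Set.univ.pi fun j => dcube 0 (i j - Nd j) (p j).1 := by
    ext x
    simp only [coneCell, Set.mem_ofPred_eq, Set.mem_pi, Set.mem_univ, true_imp_iff]
    exact forall_congr' fun j => ⟨fun h => mem_dcube_comm.1 h.1, fun h =>
      ⟨mem_dcube_comm.1 h, hp j⟩⟩
  rw [h1, lintegral_indicator (MeasurableSet.univ_pi fun j => measurableSet_dcube _ _ _),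
    setLIntegral_const, volume_pi_pi, cellWeight, ← Finset.prod_mul_distrib]
  refine Finset.prod_eq_one fun j _ => ?_
  rw [volume_dcube, ← two_rpow_add]
  simp

theorem lintegral_slab_le {f : X n Nd → ℝ} (hf : Measurable f) (i : Fin n → ℤ)
    {g : W n Nd → ℝ≥0∞} {H : X n Nd → ℝ≥0∞} (hH : Measurable H)
    (h : ∀ x, ∀ p ∈ coneCell i x, g p ≤ H x * gradDensity f p) :
    ∫⁻ p in slab i, g p ≤ ∫⁻ x, H x * cellGrad f i x := by
  have hm : Measurable fun q : W n Nd × X n Nd =>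
      {q : W n Nd × X n Nd | q.1 ∈ coneCell i q.2}.indicator
        (fun q => cellWeight Nd i * (H q.2 * gradDensity f q.1)) q := by
    refine Measurable.indicator ?_ ((measurableSet_mem_coneCell i).preimage measurable_swap)
    exact ((hH.comp measurable_snd).mul ((measurable_gradDensity hf).comp
      measurable_fst)).const_mul _
  calc ∫⁻ p in slab i, g p
      = ∫⁻ p in slab i, ∫⁻ x : X n Nd,
          {x | p ∈ coneCell i x}.indicator (fun _ => cellWeight Nd i) x * g p := by
        refine setLIntegral_congr_fun (measurableSet_slab i) fun p hp => ?_
        have hms : Measurable fun x : X n Nd =>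
            {x | p ∈ coneCell i x}.indicator (fun _ => cellWeight Nd i) x :=
          measurable_const.indicator
            ((measurableSet_mem_coneCell i).preimage measurable_prodMk_right)
        rw [lintegral_mul_const _ hms, lintegral_cellWeight i hp, one_mul]
    _ ≤ ∫⁻ p, ∫⁻ x : X n Nd, {q : W n Nd × X n Nd | q.1 ∈ coneCell i q.2}.indicator
          (fun q => cellWeight Nd i * (H q.2 * gradDensity f q.1)) (p, x) := by
        refine (setLIntegral_le_lintegral _ _).trans (lintegral_mono fun p => lintegral_mono
          fun x => ?_)
        by_cases hp : p ∈ coneCell i x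
        · rw [Set.indicator_of_mem (show x ∈ {x | p ∈ coneCell i x} from hp),
            Set.indicator_of_mem (show (p, x) ∈ {q : W n Nd × X n Nd | q.1 ∈ coneCell i q.2}
              from hp)]
          exact mul_le_mul_right (h x p hp) _
        · rw [Set.indicator_of_notMem (show x ∉ {x | p ∈ coneCell i x} from hp), zero_mul]
          exact zero_le
    _ = ∫⁻ x, ∫⁻ p, {q : W n Nd × X n Nd | q.1 ∈ coneCell i q.2}.indicator
          (fun q => cellWeight Nd i * (H q.2 * gradDensity f q.1)) (p, x) :=
        lintegral_lintegral_swap hm.aemeasurable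
    _ = ∫⁻ x, H x * cellGrad f i x := by
        refine lintegral_congr fun x => ?_
        have h2 : ∀ p, {q : W n Nd × X n Nd | q.1 ∈ coneCell i q.2}.indicator
            (fun q => cellWeight Nd i * (H q.2 * gradDensity f q.1)) (p, x) =
            (coneCell i x).indicator (fun p => cellWeight Nd i * (H x * gradDensity f p)) p :=
          fun _ => rfl
        simp_rw [h2]
        rw [lintegral_indicator (measurableSet_coneCell i x),
          lintegral_const_mul' _ _ (cellWeight_ne_top i),
          lintegral_const_mul _ (measurable_gradDensity hf), cellGrad]
        ring

theorem gradDensity_sq_le (f : X n Nd → ℝ) (hNd : ∀ j, 0 < Nd j) (i : Fin n → ℤ) {p : W n Nd}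
    (hp : p ∈ (slab i : Set (W n Nd))) :
    gradDensity f p ^ 2 ≤
      (Fintype.card (Π j, Fin (Nd j + 1)) * ∏ j, (2 : ℝ≥0∞) ^ ((i j + 1 : ℝ) * (Nd j - 1))) *
        ENNReal.ofReal ((∑ d, mixedF f d p ^ 2) * ∏ j, (p j).2 ^ (-1 - (Nd j : ℝ))) := by
  have h1 : (∑ d : Π j, Fin (Nd j + 1), ENNReal.ofReal |mixedF f d p|) ^ 2 ≤
      Fintype.card (Π j, Fin (Nd j + 1)) * ∑ d, ENNReal.ofReal |mixedF f d p| ^ 2 := by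
    have h := ENNReal.rpow_sum_le_const_mul_sum_rpow Finset.univ
      (fun d : Π j, Fin (Nd j + 1) => ENNReal.ofReal |mixedF f d p|) (p := 2) (by norm_num)
    norm_num at h
    simpa using h
  have h2 : (∏ j, ENNReal.ofReal (p j).2⁻¹) ^ 2 ≤
      (∏ j, (2 : ℝ≥0∞) ^ ((i j + 1 : ℝ) * (Nd j - 1))) *
        ∏ j, ENNReal.ofReal ((p j).2 ^ (-1 - (Nd j : ℝ))) := by
    rw [← Finset.prod_pow, ← Finset.prod_mul_distrib]
    refine Finset.prod_le_prod' fun j _ => ?_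
    have ht := pos_of_mem_slab hp j
    have hN : (1 : ℝ) ≤ Nd j := by exact_mod_cast hNd j
    have h3 : (2 : ℝ≥0∞) ^ ((i j + 1 : ℝ) * (Nd j - 1)) =
        ENNReal.ofReal ((2 * 2 ^ i j) ^ (Nd j - 1 : ℝ)) := by
      rw [← ENNReal.ofReal_rpow_of_pos (by positivity), ENNReal.rpow_mul,
        ENNReal.ofReal_mul (by norm_num), ofReal_two_zpow, two_rpow_add, ENNReal.rpow_one, mul_comm]
      simp
    rw [h3, ← ENNReal.ofReal_pow (by positivity), ← ENNReal.ofReal_mul (by positivity)]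
    refine ENNReal.ofReal_le_ofReal ?_
    have h4 : ((p j).2⁻¹) ^ 2 = (p j).2 ^ (Nd j - 1 : ℝ) * (p j).2 ^ (-1 - (Nd j : ℝ)) := by
      rw [← Real.rpow_add ht, ← Real.rpow_neg_one, ← Real.rpow_natCast, ← Real.rpow_mul ht.le]
      congr 1
      push_cast
      ring
    rw [h4]
    refine mul_le_mul_of_nonneg_right ?_ (Real.rpow_nonneg ht.le _)
    exact Real.rpow_le_rpow ht.le (hp j).2.le (by linarith)
  unfold gradDensity
  rw [ofReal_mixedF_sq_mul f (pos_of_mem_slab hp), mul_pow]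
  exact (mul_le_mul' h1 h2).trans_eq (by ring)

theorem tsum_cellGrad_sq_le (hNd : ∀ j, 0 < Nd j) {f : X n Nd → ℝ} (hfm : Measurable f)
    (hf : Integrable f) (x : X n Nd) :
    ∑' i, cellGrad f i x ^ 2 ≤ (Fintype.card (Π j, Fin (Nd j + 1)) *
      ∏ j, (2 : ℝ≥0∞) ^ ((Nd j : ℝ) ^ 2 + Nd j - 1)) * lusinSq n Nd f x := by
  rw [lusinSq_eq hf, lintegral_eq_tsum_slab (measurableSet_prodCone x)
    (fun p hp => pos_of_mem_prodCone hp), ← ENNReal.tsum_mul_left]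
  refine ENNReal.tsum_le_tsum fun i => ?_
  have h1 : (∫⁻ p in coneCell i x, gradDensity f p) ^ 2 ≤
      (∫⁻ p in coneCell i x, gradDensity f p ^ 2) * volume (coneCell i x) := by
    have h := lintegral_mul_le_sqrt (volume.restrict (coneCell i x))
      (measurable_gradDensity hfm).aemeasurable (g := fun _ => 1) aemeasurable_const
    simp only [mul_one, one_pow, lintegral_const, Measure.restrict_apply_univ, one_mul] at h
    refine (pow_le_pow_left' h 2).trans_eq ?_
    rw [mul_pow, sq_sqrt_ennreal, sq_sqrt_ennreal]
  have h2 : ∫⁻ p in coneCell i x, gradDensity f p ^ 2 ≤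
      (Fintype.card (Π j, Fin (Nd j + 1)) * ∏ j, (2 : ℝ≥0∞) ^ ((i j + 1 : ℝ) * (Nd j - 1))) *
        ∫⁻ p in prodCone n Nd x ∩ slab i,
          ENNReal.ofReal ((∑ d, mixedF f d p ^ 2) * ∏ j, (p j).2 ^ (-1 - (Nd j : ℝ))) := by
    rw [← lintegral_const_mul' _ _ (ENNReal.mul_ne_top (ENNReal.natCast_ne_top _)
      (ENNReal.prod_ne_top fun j _ => two_rpow_ne_top _))]
    refine (setLIntegral_mono' (measurableSet_coneCell i x) fun p hp =>
      gradDensity_sq_le f hNd i fun j => (hp j).2).trans ?_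
    exact lintegral_mono_set (coneCell_subset i x)
  unfold cellGrad
  rw [mul_pow]
  refine (mul_le_mul_right (h1.trans (mul_le_mul_left h2 _)) _).trans_eq ?_
  rw [volume_coneCell, cellWeight]
  have h3 : (∏ j, (2 : ℝ≥0∞) ^ (-((i j - Nd j : ℝ) * Nd j))) ^ 2 *
      (∏ j, (2 : ℝ≥0∞) ^ ((i j + 1 : ℝ) * (Nd j - 1))) *
        (∏ j, (2 : ℝ≥0∞) ^ ((i j - Nd j : ℝ) * Nd j + i j)) =
      ∏ j, (2 : ℝ≥0∞) ^ ((Nd j : ℝ) ^ 2 + Nd j - 1) := by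
    rw [sq, ← Finset.prod_mul_distrib, ← Finset.prod_mul_distrib, ← Finset.prod_mul_distrib]
    refine Finset.prod_congr rfl fun j _ => ?_
    rw [← two_rpow_add, ← two_rpow_add, ← two_rpow_add]
    congr 1
    ring
  rw [← h3]
  ring

end UpperDensity

section UpperBound

variable {n : ℕ} {Nd : Fin n → ℕ}

/-- The contribution of the scales `2^i` of the Lusin function to `Δ_k f`. -/
def upperPiece (c : Π j : Fin n, ℤ → Fin (Nd j) → ℝ) (f : X n Nd → ℝ) (k i : Fin n → ℤ)
    (x : X n Nd) : ℝ≥0∞ :=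
  ∫⁻ y : X n Nd, (∏ j, kr (Nd j) (Nd j + 1) (max (k j) (i j)) (x j - y j)) *
    (∏ j, wt (c j) (k j) (i j) (y j)) * cellGrad f i y

theorem exists_abs_rmdiff_le_upperPiece (hNd : ∀ j, 0 < Nd j) : ∃ C : ℝ≥0∞, C ≠ ⊤ ∧
    ∀ (f : X n Nd → ℝ), Measurable f → Integrable f →
      ∀ (c : Π j : Fin n, ℤ → Fin (Nd j) → ℝ) (k : Fin n → ℤ) (x y : X n Nd), y ∈ rect c k x →
        ENNReal.ofReal |rmdiff n Nd c k f y| ≤ C * ∑' i, upperPiece c f k i x := by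
  choose C hC h using fun j => exists_mdiff_pker_le (Nd j) (hNd j)
  set K : ℝ≥0∞ := ∏ j, C j * 2 ^ ((Nd j : ℝ) + 1) with hK
  have hKt : K ≠ ⊤ :=
    ENNReal.prod_ne_top fun j _ => ENNReal.mul_ne_top (hC j) (two_rpow_ne_top _)
  refine ⟨ENNReal.ofReal (∏ j, calConst (Nd j))⁻¹ * K, ENNReal.mul_ne_top ENNReal.ofReal_ne_top hKt,
    fun f hfm hf c k x y hy => ?_⟩
  have hms : MeasurableSet {p : W n Nd | ∀ j, 0 < (p j).2} := by
    rw [Set.ofPred_forall]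
    exact MeasurableSet.iInter fun j => measurableSet_lt measurable_const (by fun_prop)
  refine (ofReal_abs_rmdiff_le hNd hfm hf c k y).trans ?_
  rw [lintegral_eq_tsum_slab hms fun p hp => hp, mul_assoc, ← ENNReal.tsum_mul_left (a := K)]
  refine mul_le_mul_right (ENNReal.tsum_le_tsum fun i => ?_) _
  refine (lintegral_mono_set Set.inter_subset_right).trans ?_
  refine (lintegral_slab_le hfm i (H := fun x' => K * ((∏ j, kr (Nd j) (Nd j + 1)
    (max (k j) (i j)) (x j - x' j)) * ∏ j, wt (c j) (k j) (i j) (x' j))) ?_ ?_).trans_eq ?_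
  · refine ((Finset.measurable_fun_prod _ fun j _ => ?_).mul
      (Finset.measurable_fun_prod _ fun j _ => ?_)).const_mul _
    · exact (measurable_kr _ _ _).comp (by fun_prop)
    · exact (measurable_wt _ _ _).comp (by fun_prop)
  · intro x' p hp
    unfold gradDensity
    rw [Finset.sum_mul, Finset.mul_sum]
    refine Finset.sum_le_sum fun d _ => mul_le_mul_left ?_ _
    rw [hK, ← Finset.prod_mul_distrib, ← Finset.prod_mul_distrib]
    refine Finset.prod_le_prod' fun j _ => ?_
    have hN : (2 : ℝ) ^ (i j - Nd j) ≤ 2 ^ i j :=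
      zpow_le_zpow_right₀ (by norm_num) (by omega)
    have h1 := h j (d j) (c j) (k j) (i j) (x' j) (y j) (p j).1 (p j).2 (hp j).2.1 (hp j).2.2.le
      (by
        rw [norm_sub_rev]
        exact (norm_sub_le_of_mem_dcube (hp j).1).trans (hN.trans (hp j).2.1))
    have h2 : kr (Nd j) (Nd j + 1) (max (k j) (i j)) (x' j - y j) ≤ 2 ^ ((Nd j : ℝ) + 1) *
        kr (Nd j) (Nd j + 1) (max (k j) (i j)) (x j - x' j) := by
      rw [kr_sub_comm]
      refine kr_shift (by positivity) ?_
      rw [sub_sub_sub_cancel_right]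
      exact (norm_sub_le_of_mem_dcube (hy j trivial)).trans
        (zpow_le_zpow_right₀ (by norm_num) (le_max_left _ _))
    refine h1.trans ?_
    rw [mul_assoc (C j)]
    refine mul_le_mul_right ?_ _
    rw [← mul_assoc]
    exact mul_le_mul_left h2 _
  · unfold upperPiece
    rw [← lintegral_const_mul' _ _ hKt]
    simp only [mul_assoc]

theorem exists_rStildeSq_le_upperPiece (hNd : ∀ j, 0 < Nd j) : ∃ C : ℝ≥0∞, C ≠ ⊤ ∧
    ∀ (f : X n Nd → ℝ), Measurable f → Integrable f →
      ∀ (c : Π j : Fin n, ℤ → Fin (Nd j) → ℝ) (x : X n Nd),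
        rStildeSq n Nd c f x ≤ C ^ 2 * ∑' k, (∑' i, upperPiece c f k i x) ^ 2 := by
  obtain ⟨C, hC, h⟩ := exists_abs_rmdiff_le_upperPiece hNd
  refine ⟨C, hC, fun f hfm hf c x => ?_⟩
  rw [← ENNReal.tsum_mul_left]
  refine ENNReal.tsum_le_tsum fun k => ?_
  rw [← mul_pow]
  have h1 := h f hfm hf c k x
  generalize C * ∑' i, upperPiece c f k i x = U at h1
  rcases eq_or_ne U ⊤ with rfl | hU
  · simp
  have h2 : ∀ y ∈ rect c k x, ‖rmdiff n Nd c k f y ^ 2‖ ≤ U.toReal ^ 2 := fun y hy => by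
    rw [norm_pow, Real.norm_eq_abs]
    exact pow_le_pow_left₀ (abs_nonneg _) ((ENNReal.ofReal_le_iff_le_toReal hU).1 (h1 y hy)) 2
  have h3 := norm_setIntegral_le_of_norm_le_const (volume_rect_ne_top c k x).lt_top h2
  rw [measureReal_rect] at h3
  have h4 : 0 < ∏ j, ((2 : ℝ) ^ k j) ^ Nd j := Finset.prod_pos fun j _ => by positivity
  rw [ENNReal.ofReal_le_iff_le_toReal (ENNReal.pow_ne_top hU), ENNReal.toReal_pow]
  unfold ravg
  rw [div_le_iff₀ h4]
  exact (le_abs_self _).trans h3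

/-- The average of `upperPiece` over the random lattices, up to a constant. -/
def meanPiece (f : X n Nd → ℝ) (k i : Fin n → ℤ) (x : X n Nd) : ℝ≥0∞ :=
  ∫⁻ y : X n Nd, (∏ j, kr (Nd j) (Nd j + 1) (max (k j) (i j)) (x j - y j)) * cellGrad f i y

theorem measurable_meanPiece {f : X n Nd → ℝ} (hf : Measurable f) (k i : Fin n → ℤ) :
    Measurable (meanPiece f k i) := by
  have h3 : Measurable fun q : X n Nd × X n Nd =>
      (∏ j, kr (Nd j) (Nd j + 1) (max (k j) (i j)) (q.1 j - q.2 j)) * cellGrad f i q.2 := by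
    refine (Finset.measurable_fun_prod _ fun j _ => ?_).mul
      ((measurable_cellGrad hf i).comp measurable_snd)
    exact (measurable_kr _ _ _).comp (by fun_prop)
  exact h3.lintegral_prod_right'

theorem measurable_prod_wt_randOffset (k i : Fin n → ℤ) :
    Measurable fun q : PSpace n Nd × X n Nd =>
      ∏ j, wt (randOffset (q.1 j)) (k j) (i j) (q.2 j) := by
  refine Finset.measurable_fun_prod _ fun j _ => measurable_wt_comp (k j) (i j) (fun l => ?_)
    (by fun_prop)
  exact (measurable_randOffset l).comp (f := fun q : PSpace n Nd × X n Nd => q.1 j) (by fun_prop)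

theorem measurable_upperPiece_randOffset {f : X n Nd → ℝ} (hf : Measurable f) (k i : Fin n → ℤ) :
    Measurable fun q : PSpace n Nd × X n Nd =>
      upperPiece (fun j => randOffset (q.1 j)) f k i q.2 := by
  have h3 : Measurable fun q : (PSpace n Nd × X n Nd) × X n Nd =>
      (∏ j, kr (Nd j) (Nd j + 1) (max (k j) (i j)) (q.1.2 j - q.2 j)) *
        (∏ j, wt (randOffset (q.1.1 j)) (k j) (i j) (q.2 j)) * cellGrad f i q.2 := by
    refine ((Finset.measurable_fun_prod _ fun j _ => ?_).mul ?_).mul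
      ((measurable_cellGrad hf i).comp measurable_snd)
    · exact (measurable_kr _ _ _).comp (by fun_prop)
    · exact (measurable_prod_wt_randOffset k i).comp
        (f := fun q : (PSpace n Nd × X n Nd) × X n Nd => (q.1.1, q.2)) (by fun_prop)
  exact h3.lintegral_prod_right'

theorem lintegral_prod_wt_sq_le (hNd : ∀ j, 0 < Nd j) (k i : Fin n → ℤ) (y : X n Nd) :
    ∫⁻ ω : PSpace n Nd, (∏ j, wt (randOffset (ω j)) (k j) (i j) (y j)) ^ 2
        ∂prodRandMeasure n Nd ≤
      ∏ j, (12 * (Nd j : ℝ≥0∞) ^ 2 * 2 ^ (-(|k j - i j| : ℝ))) := by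
  have hm : ∀ j, Measurable fun ω : RSpace (Nd j) =>
      wt (randOffset ω) (k j) (i j) (y j) ^ 2 := fun j =>
    (measurable_wt_comp (k j) (i j) measurable_randOffset measurable_const).pow_const 2
  have hind : ProbabilityTheory.iIndepFun (fun (j : Fin n) (ω : PSpace n Nd) =>
      wt (randOffset (ω j)) (k j) (i j) (y j) ^ 2) (prodRandMeasure n Nd) :=
    ProbabilityTheory.iIndepFun_pi fun j => (hm j).aemeasurable
  simp_rw [← Finset.prod_pow]
  rw [ProbabilityTheory.lintegral_prod_eq_prod_lintegral_of_indepFun Finset.univ _ hind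
    fun j => (hm j).comp (measurable_pi_apply j)]
  refine Finset.prod_le_prod' fun j _ => ?_
  refine le_trans (le_of_eq ?_) (lintegral_wt_randOffset_sq_le (hNd j) (k j) (i j) (y j))
  exact (measurePreserving_eval (fun j => randMeasure (Nd j)) j).lintegral_comp (hm j)

/-- The random decay factor of `upperPiece`. -/
def decay (Nd : Fin n → ℕ) (m : Fin n → ℤ) : ℝ≥0∞ :=
  (∏ j, (12 * (Nd j : ℝ≥0∞) ^ 2 * 2 ^ (-(|m j| : ℝ)))) ^ (1 / 2 : ℝ)

theorem lintegral_upperPiece_sq_le (hNd : ∀ j, 0 < Nd j) {f : X n Nd → ℝ} (hf : Measurable f)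
    (k m : Fin n → ℤ) (x : X n Nd) :
    ∫⁻ ω, upperPiece (fun j => randOffset (ω j)) f k (k - m) x ^ 2 ∂prodRandMeasure n Nd ≤
      (decay Nd m * meanPiece f k (k - m) x) ^ 2 := by
  have hm : Measurable (Function.uncurry fun (ω : PSpace n Nd) (y : X n Nd) =>
      (∏ j, kr (Nd j) (Nd j + 1) (max (k j) ((k - m) j)) (x j - y j)) *
        (∏ j, wt (randOffset (ω j)) (k j) ((k - m) j) (y j)) * cellGrad f (k - m) y) := by
    refine ((Finset.measurable_fun_prod _ fun j _ => ?_).mul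
      (measurable_prod_wt_randOffset k (k - m))).mul
      ((measurable_cellGrad hf (k - m)).comp measurable_snd)
    exact (measurable_kr _ _ _).comp (by fun_prop)
  have h1 := minkowski_sq (prodRandMeasure n Nd) (volume : Measure (X n Nd)) hm
  rw [← sq_sqrt_ennreal (∫⁻ ω, _ ∂_)]
  refine pow_le_pow_left' (h1.trans ?_) 2
  have hdt : decay Nd m ≠ ⊤ := by
    refine ENNReal.rpow_ne_top_of_nonneg (by norm_num) (ENNReal.prod_ne_top fun j _ => ?_)
    exact ENNReal.mul_ne_top (ENNReal.mul_ne_top (by simp)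
      (ENNReal.pow_ne_top (ENNReal.natCast_ne_top _))) (two_rpow_ne_top _)
  unfold meanPiece
  rw [← lintegral_const_mul' _ _ hdt]
  refine lintegral_mono fun y => ?_
  have h2 := lintegral_prod_wt_sq_le hNd k (k - m) y
  have h3 : Measurable fun ω : PSpace n Nd =>
      ∏ j, wt (randOffset (ω j)) (k j) ((k - m) j) (y j) :=
    (measurable_prod_wt_randOffset k (k - m)).comp
      (f := fun ω : PSpace n Nd => (ω, y)) (by fun_prop)
  simp_rw [mul_right_comm _ (∏ j, wt _ _ _ _), mul_pow _ (∏ j, wt _ _ _ _)]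
  rw [lintegral_const_mul _ (h3.pow_const 2), ENNReal.mul_rpow_of_nonneg _ _ (by norm_num),
    sqrt_sq_ennreal, mul_comm (decay _ _)]
  refine mul_le_mul_right (ENNReal.rpow_le_rpow (h2.trans_eq ?_) (by norm_num)) _
  simp

end UpperBound

section UpperAssembly

variable {n : ℕ} {Nd : Fin n → ℕ}

theorem minkowski_sq_tsum_right {α κ : Type*} [MeasurableSpace α] [Countable κ] (μ : Measure α)
    [SFinite μ] {g : κ → α → ℝ≥0∞} (hg : ∀ m, Measurable (g m)) :
    (∫⁻ a, (∑' m, g m a) ^ 2 ∂μ) ^ (1 / 2 : ℝ) ≤ ∑' m, (∫⁻ a, g m a ^ 2 ∂μ) ^ (1 / 2 : ℝ) := by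
  let _ : MeasurableSpace κ := ⊤
  have : DiscreteMeasurableSpace κ := ⟨fun _ => trivial⟩
  have h := minkowski_sq μ (Measure.count : Measure κ) (g := fun a m => g m a)
    (measurable_from_prod_countable_left fun m => hg m)
  simpa only [lintegral_count] using h

theorem tsum_sq_tsum_upperPiece_le (c : Π j : Fin n, ℤ → Fin (Nd j) → ℝ) (f : X n Nd → ℝ)
    (x : X n Nd) :
    ∑' k : Fin n → ℤ, (∑' i : Fin n → ℤ, upperPiece c f k i x) ^ 2 ≤
      (∑' m : Fin n → ℤ, (∑' k : Fin n → ℤ, upperPiece c f k (k - m) x ^ 2) ^ (1 / 2 : ℝ)) ^ 2 := by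
  rw [← sq_sqrt_ennreal (∑' k : Fin n → ℤ, (∑' i : Fin n → ℤ, upperPiece c f k i x) ^ 2)]
  refine pow_le_pow_left' ?_ 2
  have h1 : ∀ k : Fin n → ℤ, ∑' i : Fin n → ℤ, upperPiece c f k i x =
      ∑' m : Fin n → ℤ, upperPiece c f k (k - m) x := fun k =>
    ((Equiv.subLeft k).tsum_eq fun i => upperPiece c f k i x).symm
  simp_rw [h1]
  exact minkowski_sq_tsum _

theorem lintegral_upper_le (hNd : ∀ j, 0 < Nd j) {f : X n Nd → ℝ} (hf : Measurable f)
    (x : X n Nd) :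
    (∫⁻ ω, ∑' k : Fin n → ℤ, (∑' i : Fin n → ℤ,
      upperPiece (fun j => randOffset (ω j)) f k i x) ^ 2 ∂prodRandMeasure n Nd) ^ (1 / 2 : ℝ) ≤
      ∑' m : Fin n → ℤ, decay Nd m *
        (∑' k : Fin n → ℤ, meanPiece f k (k - m) x ^ 2) ^ (1 / 2 : ℝ) := by
  have hm : ∀ k i, Measurable fun ω : PSpace n Nd =>
      upperPiece (fun j => randOffset (ω j)) f k i x := fun k i =>
    (measurable_upperPiece_randOffset hf k i).comp (f := fun ω : PSpace n Nd => (ω, x))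
      (by fun_prop)
  refine (ENNReal.rpow_le_rpow (lintegral_mono fun ω => tsum_sq_tsum_upperPiece_le _ f x)
    (by norm_num)).trans ?_
  refine (minkowski_sq_tsum_right _ fun m => (Measurable.tsum fun k =>
    (hm k (k - m)).pow_const 2).pow_const _).trans (ENNReal.tsum_le_tsum fun m => ?_)
  simp_rw [sq_sqrt_ennreal]
  rw [lintegral_tsum fun k => ((hm k (k - m)).pow_const 2).aemeasurable,
    ← sqrt_sq_ennreal (decay Nd m), ← ENNReal.mul_rpow_of_nonneg _ _ (by norm_num),
    ← ENNReal.tsum_mul_left]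
  refine ENNReal.rpow_le_rpow (ENNReal.tsum_le_tsum fun k => ?_) (by norm_num)
  rw [← mul_pow]
  exact lintegral_upperPiece_sq_le hNd hf k m x

theorem exists_lintegral_meanPiece_le (hNd : ∀ j, 0 < Nd j) : ∃ C : ℝ≥0∞, C ≠ ⊤ ∧
    ∀ (f : X n Nd → ℝ), Measurable f → ∀ m : Fin n → ℤ,
      ∫⁻ x, (∑' k : Fin n → ℤ, meanPiece f k (k - m) x ^ 2) ^ (1 / 2 : ℝ) ≤
        C * (∏ j, (2 : ℝ≥0∞) ^ ((|m j| : ℝ) / 4)) *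
          ∫⁻ x, (∑' i, cellGrad f i x ^ 2) ^ (1 / 2 : ℝ) := by
  choose C hC h using fun j => lintegral_conv_le (hNd j)
  refine ⟨∏ j, C j * 2 ^ ((Nd j : ℝ) / 4), ENNReal.prod_ne_top fun j _ =>
    ENNReal.mul_ne_top (hC j) (two_rpow_ne_top _), fun f hfm m => ?_⟩
  have h1 := lintegral_iterate_le (ι := Fin n → ℤ) (cc := fun _ _ => 0)
    (ll := fun j i => i j - Nd j)
    (τ := fun j i x y => kr (Nd j) (Nd j + 1) (i j - Nd j + ((Nd j + (m j).toNat : ℕ) : ℤ))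
      (x - y)) (fun j k => ?_)
    (fun j => C j * 2 ^ (((Nd j + (m j).toNat : ℕ) : ℝ) / 4))
    (fun j β hβ hd => h j (Fin n → ℤ) (fun _ => 0) (fun i => i j - Nd j) (Nd j + (m j).toNat)
      β hβ hd)
    (β := fun i y => cellGrad f i y) (fun i => measurable_cellGrad hfm i)
    (fun j i x => dconst_cellGrad f i j x)
  · refine le_trans (le_of_eq ?_) (h1.trans (mul_le_mul_left ?_ _))
    · refine lintegral_congr fun x => ?_
      congr 1
      rw [← (Equiv.addRight m).tsum_eq]
      refine tsum_congr fun i => ?_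
      congr 1
      refine lintegral_congr fun y => ?_
      rw [Equiv.coe_addRight, add_sub_cancel_right]
      congr 1
      refine Finset.prod_congr rfl fun j _ => ?_
      congr 1
      simp only [Pi.add_apply]
      omega
    · rw [← Finset.prod_mul_distrib]
      refine Finset.prod_le_prod' fun j _ => ?_
      rw [mul_assoc, ← two_rpow_add]
      refine mul_le_mul_right (ENNReal.rpow_le_rpow_of_exponent_le (by norm_num) ?_) _
      have : (((m j).toNat : ℕ) : ℤ) ≤ |m j| := by
        rw [Int.toNat_eq_max]
        exact max_le (le_abs_self _) (abs_nonneg _)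
      have h2 : ((m j).toNat : ℝ) ≤ |(m j : ℝ)| := by exact_mod_cast this
      push_cast
      linarith
  · exact (measurable_kr _ _ _).comp (measurable_fst.sub measurable_snd)

theorem decay_mul_prod (m : Fin n → ℤ) :
    decay Nd m * ∏ j, (2 : ℝ≥0∞) ^ ((|m j| : ℝ) / 4) =
      (∏ j, 12 * (Nd j : ℝ≥0∞) ^ 2) ^ (1 / 2 : ℝ) * ∏ j, (2 : ℝ≥0∞) ^ (-(|m j| : ℝ) / 4) := by
  unfold decay
  rw [Finset.prod_mul_distrib, ENNReal.mul_rpow_of_nonneg _ _ (by norm_num), mul_assoc,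
    ← ENNReal.prod_rpow_of_nonneg (s := Finset.univ)
      (f := fun j => (2 : ℝ≥0∞) ^ (-(|m j| : ℝ))) (by norm_num), ← Finset.prod_mul_distrib]
  congr 1
  refine Finset.prod_congr rfl fun j _ => ?_
  rw [← ENNReal.rpow_mul, ← two_rpow_add]
  congr 1
  ring

/-- The upper bound for measurable functions. -/
theorem exists_randProdStildeNorm_le (hNd : ∀ j, 0 < Nd j) : ∃ C : ℝ≥0∞, C ≠ ⊤ ∧
    ∀ (f : X n Nd → ℝ), Measurable f → Integrable f →
      randProdStildeNorm n Nd f ≤ C * H1prodNorm n Nd f := by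
  obtain ⟨C1, hC1, h1⟩ := exists_rStildeSq_le_upperPiece hNd
  obtain ⟨C2, hC2, h2⟩ := exists_lintegral_meanPiece_le hNd
  have hS : ∑' m : Fin n → ℤ, ∏ j, (2 : ℝ≥0∞) ^ (-(|m j| : ℝ) / 4) ≠ ⊤ := by
    simpa only [div_eq_mul_inv] using tsum_pi_two_rpow_ne_top n (b := 4⁻¹) (by norm_num)
  set S := ∑' m : Fin n → ℤ, ∏ j, (2 : ℝ≥0∞) ^ (-(|m j| : ℝ) / 4) with hSdef
  set D : ℝ≥0∞ := (∏ j, 12 * (Nd j : ℝ≥0∞) ^ 2) ^ (1 / 2 : ℝ) with hD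
  have hDt : D ≠ ⊤ := ENNReal.rpow_ne_top_of_nonneg (by norm_num) (ENNReal.prod_ne_top fun j _ =>
    ENNReal.mul_ne_top (by simp) (ENNReal.pow_ne_top (ENNReal.natCast_ne_top _)))
  set C3 : ℝ≥0∞ := Fintype.card (Π j, Fin (Nd j + 1)) *
    ∏ j, (2 : ℝ≥0∞) ^ ((Nd j : ℝ) ^ 2 + Nd j - 1) with hC3
  have hC3t : C3 ^ (1 / 2 : ℝ) ≠ ⊤ := ENNReal.rpow_ne_top_of_nonneg (by norm_num)
    (ENNReal.mul_ne_top (ENNReal.natCast_ne_top _) (ENNReal.prod_ne_top fun j _ =>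
      two_rpow_ne_top _))
  refine ⟨C1 * (C2 * D * S * C3 ^ (1 / 2 : ℝ)), ENNReal.mul_ne_top hC1 (ENNReal.mul_ne_top
    (ENNReal.mul_ne_top (ENNReal.mul_ne_top hC2 hDt) hS) hC3t), fun f hfm hf => ?_⟩
  have hcell : ∫⁻ x, (∑' i, cellGrad f i x ^ 2) ^ (1 / 2 : ℝ) ≤
      C3 ^ (1 / 2 : ℝ) * H1prodNorm n Nd f := by
    unfold H1prodNorm
    rw [← lintegral_const_mul' _ _ hC3t]
    refine lintegral_mono fun x => ?_
    rw [← ENNReal.mul_rpow_of_nonneg _ _ (by norm_num)]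
    exact ENNReal.rpow_le_rpow (tsum_cellGrad_sq_le hNd hfm hf x) (by norm_num)
  calc randProdStildeNorm n Nd f
      ≤ ∫⁻ x, C1 * ∑' m : Fin n → ℤ, decay Nd m *
          (∑' k : Fin n → ℤ, meanPiece f k (k - m) x ^ 2) ^ (1 / 2 : ℝ) := by
        refine lintegral_mono fun x => ?_
        refine (ENNReal.rpow_le_rpow (lintegral_mono fun ω => h1 f hfm hf _ x)
          (by norm_num)).trans ?_
        rw [lintegral_const_mul' _ _ (ENNReal.pow_ne_top hC1),
          ENNReal.mul_rpow_of_nonneg _ _ (by norm_num), sqrt_sq_ennreal]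
        exact mul_le_mul_right (lintegral_upper_le hNd hfm x) _
    _ = C1 * ∑' m : Fin n → ℤ, decay Nd m *
          ∫⁻ x, (∑' k : Fin n → ℤ, meanPiece f k (k - m) x ^ 2) ^ (1 / 2 : ℝ) := by
        have hmeas : ∀ m : Fin n → ℤ, Measurable fun x : X n Nd =>
            (∑' k : Fin n → ℤ, meanPiece f k (k - m) x ^ 2) ^ (1 / 2 : ℝ) := fun m =>
          (Measurable.tsum fun k => (measurable_meanPiece hfm _ _).pow_const 2).pow_const _
        rw [lintegral_const_mul' _ _ hC1, lintegral_tsum fun m =>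
          ((hmeas m).const_mul _).aemeasurable]
        exact congrArg _ (tsum_congr fun m => lintegral_const_mul _ (hmeas m))
    _ ≤ C1 * ∑' m : Fin n → ℤ, decay Nd m * (C2 * (∏ j, (2 : ℝ≥0∞) ^ ((|m j| : ℝ) / 4)) *
          (C3 ^ (1 / 2 : ℝ) * H1prodNorm n Nd f)) :=
        mul_le_mul_right (ENNReal.tsum_le_tsum fun m => mul_le_mul_right
          ((h2 f hfm m).trans (mul_le_mul_right hcell _)) _) _
    _ = C1 * ∑' m : Fin n → ℤ, (C2 * D * (C3 ^ (1 / 2 : ℝ) * H1prodNorm n Nd f)) *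
          ∏ j, (2 : ℝ≥0∞) ^ (-(|m j| : ℝ) / 4) := by
        congr 1
        refine tsum_congr fun m => ?_
        calc _ = (decay Nd m * ∏ j, (2 : ℝ≥0∞) ^ ((|m j| : ℝ) / 4)) *
              (C2 * (C3 ^ (1 / 2 : ℝ) * H1prodNorm n Nd f)) := by ring
          _ = _ := by rw [decay_mul_prod]; ring
    _ = _ := by
        rw [ENNReal.tsum_mul_left]
        ring

theorem lusinSq_congr {f g : X n Nd → ℝ} (h : f =ᵐ[volume] g) (x : X n Nd) :
    lusinSq n Nd f x = lusinSq n Nd g x := by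
  have : prodPoisson n Nd f = prodPoisson n Nd g := by
    funext p
    refine integral_congr_ae ?_
    filter_upwards [h] with z hz
    rw [hz]
  simp only [lusinSq, this]

theorem rmdiff_congr {f g : X n Nd → ℝ} (h : f =ᵐ[volume] g)
    (c : Π j : Fin n, ℤ → Fin (Nd j) → ℝ) (k : Fin n → ℤ) :
    rmdiff n Nd c k f = rmdiff n Nd c k g := by
  have h1 : ∀ k, ravg n Nd c k f = ravg n Nd c k g := fun k => by
    funext x
    unfold ravg
    rw [integral_congr_ae (ae_restrict_of_ae h)]
  funext x
  simp only [rmdiff, h1]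

theorem H1prodNorm_congr {f g : X n Nd → ℝ} (h : f =ᵐ[volume] g) :
    H1prodNorm n Nd f = H1prodNorm n Nd g := by
  simp only [H1prodNorm, lusinSq_congr h]

theorem randProdStildeNorm_congr {f g : X n Nd → ℝ} (h : f =ᵐ[volume] g) :
    randProdStildeNorm n Nd f = randProdStildeNorm n Nd g := by
  simp only [randProdStildeNorm, rStildeSq, rmdiff_congr h]

end UpperAssembly

/-- **Theorem 0.4** (multi-parameter case, square function `S̃`): a function `f ∈ L¹(X)`
belongs to `H¹(X₁ × ⋯ × Xₙ)` iff `∫_X [𝔼_ω |S̃_{𝒟(ω)} f(x)|²]^{1/2} dx < ∞`, and this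
quantity is an equivalent norm on `H¹(X)`, with constants depending only on `N₁, …, Nₙ`. -/
theorem theorem04_Stilde (n : ℕ) (hn : 0 < n) (Nd : Fin n → ℕ) (hNd : ∀ j, 0 < Nd j) :
    ∃ c C : ℝ, 0 < c ∧ c ≤ C ∧
      ∀ f : X n Nd → ℝ, Integrable f volume →
        ((H1prodNorm n Nd f < ⊤ ↔ randProdStildeNorm n Nd f < ⊤) ∧
          (H1prodNorm n Nd f < ⊤ →
            ENNReal.ofReal c * H1prodNorm n Nd f ≤ randProdStildeNorm n Nd f ∧
              randProdStildeNorm n Nd f ≤ ENNReal.ofReal C * H1prodNorm n Nd f)) := by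
  obtain ⟨A, hA, hlow⟩ := exists_H1prodNorm_le hNd
  obtain ⟨B, hB, hup⟩ := exists_randProdStildeNorm_le hNd
  have hlow' : ∀ f : X n Nd → ℝ, Integrable f →
      H1prodNorm n Nd f ≤ A * randProdStildeNorm n Nd f := fun f hf => by
    rw [H1prodNorm_congr hf.1.ae_eq_mk, randProdStildeNorm_congr hf.1.ae_eq_mk]
    exact hlow _ hf.1.stronglyMeasurable_mk.measurable (hf.congr hf.1.ae_eq_mk)
  have hup' : ∀ f : X n Nd → ℝ, Integrable f →
      randProdStildeNorm n Nd f ≤ B * H1prodNorm n Nd f := fun f hf => by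
    rw [H1prodNorm_congr hf.1.ae_eq_mk, randProdStildeNorm_congr hf.1.ae_eq_mk]
    exact hup _ hf.1.stronglyMeasurable_mk.measurable (hf.congr hf.1.ae_eq_mk)
  have hA1 : (0 : ℝ) < A.toReal + 1 := by positivity
  have hA2 : (A.toReal + 1)⁻¹ ≤ 1 := inv_le_one_of_one_le₀ (by
    linarith [ENNReal.toReal_nonneg (a := A)])
  refine ⟨(A.toReal + 1)⁻¹, B.toReal + 1, inv_pos.2 hA1, ?_,
      fun f hf => ⟨⟨fun h => ?_, fun h => ?_⟩,
    fun _ => ⟨?_, ?_⟩⟩⟩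
  · linarith [ENNReal.toReal_nonneg (a := B)]
  · exact (hup' f hf).trans_lt (ENNReal.mul_lt_top hB.lt_top h)
  · exact (hlow' f hf).trans_lt (ENNReal.mul_lt_top hA.lt_top h)
  · have h1 : A ≤ ENNReal.ofReal (A.toReal + 1) :=
      (ENNReal.le_ofReal_iff_toReal_le hA hA1.le).2 (by linarith)
    rw [ENNReal.ofReal_inv_of_pos hA1, mul_comm, ← div_eq_mul_inv]
    exact ENNReal.div_le_of_le_mul' ((hlow' f hf).trans (mul_le_mul_left h1 _))
  · have h1 : B ≤ ENNReal.ofReal (B.toReal + 1) :=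
      (ENNReal.le_ofReal_iff_toReal_le hB (by positivity)).2 (by linarith)
    exact (hup' f hf).trans (mul_le_mul_left h1 _)

end Treil
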